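/- Let p ≥ q ≥ 1. An element (x,y,z) ∈ (ℝ^q_{++})^3 belongs to Singular(p,q) if and only if for every r ∈ [q] and every triple I_•, J_•, K_• of polarized subsets of [q], each of cardinal r, satisfying both (λ(I^p_•), λ(J^p_•), λ(K^p_•) − (p+q−r)·1^r) ∈ Horn(r) and (λ(Ĩ^p_•), λ(J̃^p_•), λ(K̃^p_•) − (p+q−2r)·1^r) ∈ Horn(r), the inequality |x|_{I_+} + |y|_{J_+} + |z|_{K_+} ≤ |x|_{I_−} + |y|_{J_−} + |z|_{K_−} holds. -/

import Mathlib

open Matrix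

/-- The eigenvalues of a Hermitian matrix, listed in decreasing order. -/
noncomputable def eigsDesc {n : ℕ} {A : Matrix (Fin n) (Fin n) ℂ} (hA : A.IsHermitian) :
    Fin n → ℝ :=
  fun i => hA.eigenvalues (Tuple.sort hA.eigenvalues i.rev)

/-- The singular values of a complex `p × q` matrix, listed in decreasing order:
the square roots of the eigenvalues of the Hermitian matrix `Aᴴ * A`. -/
noncomputable def singularValues {p q : ℕ} (A : Matrix (Fin p) (Fin q) ℂ) : Fin q → ℝ :=
  fun i => Real.sqrt (eigsDesc (Matrix.isHermitian_conjTranspose_mul_self A) i)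

/-- `sval A k` is the `k`-th singular value `τ_k(A)` of `A`, with 1-based indexing
(junk value `0` out of range). -/
noncomputable def sval {p q : ℕ} (A : Matrix (Fin p) (Fin q) ℂ) (k : ℕ) : ℝ :=
  if h : k - 1 < q then singularValues A ⟨k - 1, h⟩ else 0

/-- `Horn n` is the set of triples `(s(A), s(B), s(C))` of decreasing eigenvalue vectors of
Hermitian `n × n` matrices `A`, `B`, `C` with `A + B + C = 0`. -/
def Horn (n : ℕ) : Set ((Fin n → ℝ) × (Fin n → ℝ) × (Fin n → ℝ)) :=
  {t | ∃ (A B C : Matrix (Fin n) (Fin n) ℂ) (hA : A.IsHermitian) (hB : B.IsHermitian)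
      (hC : C.IsHermitian), A + B + C = 0 ∧
      eigsDesc hA = t.1 ∧ eigsDesc hB = t.2.1 ∧ eigsDesc hC = t.2.2}

/-- `X^p_•` : given a polarized subset `X_• = (X_+, X_−)` of `[q]`, the subset
`X_+ ∪ {p+q+1−x : x ∈ X_−}` of `[p+q]`. -/
def polToSet (p q : ℕ) (Xplus Xminus : Finset ℕ) : Finset ℕ :=
  Xplus ∪ Xminus.image (fun a => p + q + 1 - a)

/-- `λ(X)` for a subset `X = {x_1 < … < x_r}` of `[m]` : the vector with entries
`λ_a = m − r + a − x_a`, viewed in `ℝ^r`. -/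
noncomputable def lambdaOf (m r : ℕ) (S : Finset ℕ) : Fin r → ℝ :=
  fun a => (m : ℝ) - r + (a.val + 1) - ((S.sort (· ≤ ·)).getD a.val 0 : ℝ)

/-- `(X^p_•)'` : writing the complement of `S = X^p_•` in `[p+q]` as
`{u_1 < … < u_{p+q−r}}` and `S^o = {p+q+1−x : x ∈ S}`, this is
`{i ∈ [p+q−r] : u_i ∈ S^o}`. -/
def primeSet (p q r : ℕ) (S : Finset ℕ) : Finset ℕ :=
  (Finset.Icc 1 (p + q - r)).filter
    (fun i => ((Finset.Icc 1 (p + q) \ S).sort (· ≤ ·)).getD (i - 1) 0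
      ∈ S.image (fun a => p + q + 1 - a))

/-- `X̃^p_• = {k ∈ [p+q−r] : p+q−r+1−k ∈ (X^p_•)'}`. -/
def tildeSet (p q r : ℕ) (S : Finset ℕ) : Finset ℕ :=
  (Finset.Icc 1 (p + q - r)).filter (fun k => p + q - r + 1 - k ∈ primeSet p q r S)

/-- `1^r_α ∈ ℝ^r` : the vector with `α` ones followed by `r − α` zeros. -/
def oneVec (r α : ℕ) : Fin r → ℝ := fun i => if i.val < α then 1 else 0

/-- `δ_{X_•}` : the number of pairs `(a,b) ∈ X_+ × X_−` with `a < b`. -/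
def deltaPol (Xplus Xminus : Finset ℕ) : ℕ :=
  ((Xplus ×ˢ Xminus).filter (fun ab => ab.1 < ab.2)).card

/-- The `i`-th coordinate (1-based) of a vector `x ∈ ℝ^q`, junk value `0` out of range. -/
noncomputable def valAt {q : ℕ} (x : Fin q → ℝ) (i : ℕ) : ℝ :=
  if h : i - 1 < q then x ⟨i - 1, h⟩ else 0

/-- `x ∈ ℝ^q_{++}` : the coordinates of `x` are weakly decreasing and nonnegative. -/
def DecrNonneg {q : ℕ} (x : Fin q → ℝ) : Prop :=
  (∀ i j : Fin q, i ≤ j → x j ≤ x i) ∧ ∀ i, 0 ≤ x i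

/-- `SingularCone p q` is the set of triples `(τ(A), τ(B), τ(C))` of singular value vectors
of complex `p × q` matrices `A`, `B`, `C` with `A + B + C = 0`. -/
def SingularCone (p q : ℕ) : Set ((Fin q → ℝ) × (Fin q → ℝ) × (Fin q → ℝ)) :=
  {t | ∃ A B C : Matrix (Fin p) (Fin q) ℂ, A + B + C = 0 ∧
      singularValues A = t.1 ∧ singularValues B = t.2.1 ∧ singularValues C = t.2.2}

set_option linter.unusedSectionVars false

namespace SingHorn

open scoped ComplexOrder
open Module Finset

section Abel

theorem sum_mul_sub_eq (n : ℕ) (w D : ℕ → ℝ) :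
    ∑ i ∈ range (n + 1), w i * (D (i + 1) - D i) =
      ∑ i ∈ range n, (w i - w (i + 1)) * D (i + 1) + w n * D (n + 1) - w 0 * D 0 := by
  induction n with
  | zero => simp; ring
  | succ n ih => rw [sum_range_succ, ih, sum_range_succ]; ring

/-- Abel summation comparison: moving the jumps of `D` to the left increases a sum weighted by an
antitone function. -/
theorem abel_le {n : ℕ} {w D D' : ℕ → ℝ} (hw : Antitone w) (h0 : D 0 = D' 0) (hn : D n = D' n)
    (h : ∀ i ≤ n, D i ≤ D' i) :
    ∑ i ∈ range n, w i * (D (i + 1) - D i) ≤ ∑ i ∈ range n, w i * (D' (i + 1) - D' i) := by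
  cases n with
  | zero => simp
  | succ n =>
    rw [sum_mul_sub_eq, sum_mul_sub_eq, h0, hn]
    gcongr with i hi
    · have := hw (Nat.le_succ i); linarith
    · exact h _ (by have := mem_range.1 hi; omega)

end Abel

section Flags

variable {E : Type*} [AddCommGroup E] [Module ℂ E] [FiniteDimensional ℂ E]

/-- A complete flag of an `n`-dimensional space, indexed by `ℕ`. -/
structure IsFlag (n : ℕ) (F : ℕ → Submodule ℂ E) : Prop where
  mono : Monotone F
  rank : ∀ i ≤ n, finrank ℂ (F i) = i
  top : F n = ⊤

/-- The dimension of `W ⊓ F i`. -/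
noncomputable def capDim (F : ℕ → Submodule ℂ E) (W : Submodule ℂ E) (i : ℕ) : ℕ :=
  finrank ℂ ↥(W ⊓ F i)

/-- The weight of a subspace with respect to a flag. -/
noncomputable def wsum (n : ℕ) (w : ℕ → ℝ) (F : ℕ → Submodule ℂ E) (W : Submodule ℂ E) : ℝ :=
  ∑ i ∈ range n, w i * ((capDim F W (i + 1) : ℝ) - capDim F W i)

/-- The set of jumps of the filtration induced by a flag on a subspace. -/
noncomputable def pos (n : ℕ) (F : ℕ → Submodule ℂ E) (W : Submodule ℂ E) : Finset ℕ :=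
  (range n).filter fun i => capDim F W i < capDim F W (i + 1)

variable {n : ℕ} {F : ℕ → Submodule ℂ E} {W W' : Submodule ℂ E}

theorem IsFlag.bot (hF : IsFlag n F) : F 0 = ⊥ :=
  Submodule.finrank_eq_zero.1 (hF.rank 0 (Nat.zero_le _))

theorem IsFlag.capDim_zero (hF : IsFlag n F) : capDim F W 0 = 0 := by
  rw [capDim, hF.bot, inf_bot_eq, finrank_bot]

theorem IsFlag.capDim_top (hF : IsFlag n F) : capDim F W n = finrank ℂ W := by
  rw [capDim, hF.top, inf_top_eq]

theorem IsFlag.capDim_mono (hF : IsFlag n F) {i j : ℕ} (h : i ≤ j) :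
    capDim F W i ≤ capDim F W j :=
  Submodule.finrank_mono (inf_le_inf le_rfl (hF.mono h))

theorem capDim_mono_right (h : W ≤ W') (i : ℕ) : capDim F W i ≤ capDim F W' i :=
  Submodule.finrank_mono (inf_le_inf h le_rfl)

theorem IsFlag.capDim_univ (hF : IsFlag n F) {i : ℕ} (h : i ≤ n) : capDim F ⊤ i = i := by
  rw [capDim, top_inf_eq, hF.rank i h]

theorem capDim_sup_add_inf_ge (i : ℕ) :
    capDim F W i + capDim F W' i ≤ capDim F (W ⊔ W') i + capDim F (W ⊓ W') i := by
  unfold capDim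
  have h := Submodule.finrank_sup_add_finrank_inf_eq (W ⊓ F i) (W' ⊓ F i)
  have h1 : W ⊓ F i ⊓ (W' ⊓ F i) = W ⊓ W' ⊓ F i := by
    rw [inf_inf_inf_comm, inf_idem]
  rw [h1] at h
  have h2 : finrank ℂ ↥(W ⊓ F i ⊔ W' ⊓ F i) ≤ finrank ℂ ↥((W ⊔ W') ⊓ F i) :=
    Submodule.finrank_mono (sup_le (inf_le_inf le_sup_left le_rfl) (inf_le_inf le_sup_right le_rfl))
  omega

/-- Dimension growth along two nested pairs: `A ⊓ C' / A ⊓ C` embeds in `C'/C`. -/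
theorem finrank_inf_add_le {C C' : Submodule ℂ E} (h : C ≤ C') (A A' : Submodule ℂ E)
    (hA : A ≤ A') :
    finrank ℂ ↥(A ⊓ C') + finrank ℂ ↥(A' ⊓ C) ≤ finrank ℂ ↥(A' ⊓ C') + finrank ℂ ↥(A ⊓ C) := by
  have e := Submodule.finrank_sup_add_finrank_inf_eq (A ⊓ C') (A' ⊓ C)
  have h1 : A ⊓ C' ⊓ (A' ⊓ C) = A ⊓ C := by
    apply le_antisymm
    · exact le_inf (inf_le_left.trans inf_le_left) (inf_le_right.trans inf_le_right)
    · exact le_inf (inf_le_inf le_rfl h) (inf_le_inf hA le_rfl)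
  rw [h1] at e
  have h2 : finrank ℂ ↥(A ⊓ C' ⊔ A' ⊓ C) ≤ finrank ℂ ↥(A' ⊓ C') :=
    Submodule.finrank_mono (sup_le (inf_le_inf hA le_rfl) (inf_le_inf le_rfl h))
  omega

theorem IsFlag.capDim_succ_le (hF : IsFlag n F) {i : ℕ} (hi : i < n) :
    capDim F W (i + 1) ≤ capDim F W i + 1 := by
  have := finrank_inf_add_le (hF.mono (Nat.le_succ i)) W ⊤ le_top
  rw [top_inf_eq, top_inf_eq] at this
  have h1 := hF.rank i hi.le
  have h2 := hF.rank (i + 1) hi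
  simp only [capDim, Nat.succ_eq_add_one] at *
  omega

theorem IsFlag.mem_pos (_hF : IsFlag n F) {i : ℕ} :
    i ∈ pos n F W ↔ i < n ∧ capDim F W i < capDim F W (i + 1) := by
  simp [pos]

theorem IsFlag.mem_pos' (hF : IsFlag n F) {i : ℕ} :
    i ∈ pos n F W ↔ i < n ∧ capDim F W (i + 1) = capDim F W i + 1 := by
  rw [hF.mem_pos]
  constructor <;> rintro ⟨h, h'⟩ <;> refine ⟨h, ?_⟩
  · have := hF.capDim_succ_le (W := W) h; omega
  · omega

theorem IsFlag.pos_mono (hF : IsFlag n F) (h : W ≤ W') : pos n F W ⊆ pos n F W' := by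
  intro i hi
  rw [hF.mem_pos] at hi ⊢
  refine ⟨hi.1, ?_⟩
  have := finrank_inf_add_le (hF.mono (Nat.le_succ i)) W W' h
  have h1 := hi.2
  simp only [capDim, Nat.succ_eq_add_one] at *
  omega

theorem IsFlag.capDim_eq_card (hF : IsFlag n F) {j : ℕ} (hj : j ≤ n) :
    capDim F W j = ((pos n F W).filter (· < j)).card := by
  induction j with
  | zero => simp [hF.capDim_zero]
  | succ j ih =>
    have hj' : j < n := hj
    by_cases h : j ∈ pos n F W
    · have : (pos n F W).filter (· < j + 1) = insert j ((pos n F W).filter (· < j)) := by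
        ext x; simp only [mem_filter, mem_insert]
        constructor
        · rintro ⟨a, b⟩
          rcases Nat.lt_succ_iff_lt_or_eq.1 b with c | c
          · exact Or.inr ⟨a, c⟩
          · exact Or.inl c
        · rintro (rfl | ⟨a, b⟩)
          · exact ⟨h, Nat.lt_succ_self _⟩
          · exact ⟨a, by omega⟩
      rw [this, card_insert_of_notMem (by simp), ← ih hj'.le]
      exact (hF.mem_pos'.1 h).2
    · have : (pos n F W).filter (· < j + 1) = (pos n F W).filter (· < j) := by
        ext x; simp only [mem_filter]
        constructor
        · rintro ⟨a, b⟩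
          refine ⟨a, lt_of_le_of_ne (by omega) ?_⟩
          rintro rfl; exact h a
        · rintro ⟨a, b⟩; exact ⟨a, by omega⟩
      rw [this, ← ih hj'.le]
      have h1 := hF.capDim_mono (W := W) (Nat.le_succ j)
      rw [hF.mem_pos] at h
      push Not at h
      exact le_antisymm (h hj') h1

theorem IsFlag.card_pos (hF : IsFlag n F) : (pos n F W).card = finrank ℂ W := by
  rw [← hF.capDim_top, hF.capDim_eq_card le_rfl, filter_true_of_mem]
  intro i hi; exact (hF.mem_pos.1 hi).1

theorem IsFlag.wsum_eq (hF : IsFlag n F) (w : ℕ → ℝ) :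
    wsum n w F W = ∑ i ∈ pos n F W, w i := by
  rw [wsum, pos, sum_filter]
  refine sum_congr rfl fun i hi => ?_
  have hi := mem_range.1 hi
  have h := hF.mem_pos' (W := W) (i := i)
  split_ifs with h1
  · have : i ∈ pos n F W := hF.mem_pos.2 ⟨hi, h1⟩
    rw [(h.1 this).2]; push_cast; ring
  · have := hF.capDim_mono (W := W) (Nat.le_succ i)
    have : capDim F W (i + 1) = capDim F W i := le_antisymm (not_lt.1 h1) this
    rw [this]; simp

theorem wsum_bot (w : ℕ → ℝ) : wsum n w F ⊥ = 0 := by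
  have h : ∀ i, capDim F (⊥ : Submodule ℂ E) i = 0 := fun i => by
    rw [capDim, bot_inf_eq, finrank_bot]
  simp [wsum, h]

theorem IsFlag.wsum_top (hF : IsFlag n F) (w : ℕ → ℝ) :
    wsum n w F ⊤ = ∑ i ∈ range n, w i := by
  refine sum_congr rfl fun i hi => ?_
  have hi := mem_range.1 hi
  rw [hF.capDim_univ hi, hF.capDim_univ hi.le]; push_cast; ring

theorem IsFlag.wsum_supermodular (hF : IsFlag n F) {w : ℕ → ℝ} (hw : Antitone w) :
    wsum n w F W + wsum n w F W' ≤ wsum n w F (W ⊔ W') + wsum n w F (W ⊓ W') := by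
  have := abel_le (n := n) (D := fun i => (capDim F W i : ℝ) + capDim F W' i)
    (D' := fun i => (capDim F (W ⊔ W') i : ℝ) + capDim F (W ⊓ W') i) hw
    (by simp [hF.capDim_zero])
    (by
      simp only [hF.capDim_top]
      exact_mod_cast (Submodule.finrank_sup_add_finrank_inf_eq W W').symm)
    (fun i _ => by exact_mod_cast capDim_sup_add_inf_ge i)
  unfold wsum
  rw [← sum_add_distrib, ← sum_add_distrib]
  calc _ = _ := sum_congr rfl fun i _ => by ring
    _ ≤ _ := this
    _ = _ := sum_congr rfl fun i _ => by ring

/-- Comparing weights of two subspaces of the same dimension, for possibly different flags. -/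
theorem wsum_le_of_capDim_le {E' : Type*} [AddCommGroup E'] [Module ℂ E'] [FiniteDimensional ℂ E']
    {F' : ℕ → Submodule ℂ E'} {W' : Submodule ℂ E'}
    (hF : IsFlag n F) (hF' : IsFlag n F') {w : ℕ → ℝ} (hw : Antitone w)
    (hd : finrank ℂ W = finrank ℂ W') (h : ∀ i ≤ n, capDim F W i ≤ capDim F' W' i) :
    wsum n w F W ≤ wsum n w F' W' :=
  abel_le (D := fun i => (capDim F W i : ℝ)) (D' := fun i => (capDim F' W' i : ℝ)) hw
    (by simp [hF.capDim_zero, hF'.capDim_zero])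
    (by simp [hF.capDim_top, hF'.capDim_top, hd]) (fun i hi => by exact_mod_cast h i hi)

end Flags

end SingHorn

namespace SingHorn

open scoped ComplexOrder
open Module Finset

section Adapted

variable {E : Type*} [AddCommGroup E] [Module ℂ E] [FiniteDimensional ℂ E]
variable {n : ℕ} {F : ℕ → Submodule ℂ E} {W : Submodule ℂ E}

/-- A family of vectors of `W` adapted to the filtration induced by a flag. -/
def IsAdapted (n : ℕ) (F : ℕ → Submodule ℂ E) (W : Submodule ℂ E) (v : ℕ → E) : Prop :=
  ∀ i ∈ pos n F W, v i ∈ W ⊓ F (i + 1) ∧ v i ∉ F i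

theorem IsAdapted.span_eq (hF : IsFlag n F) {v : ℕ → E} (hv : IsAdapted n F W v) {j : ℕ}
    (hj : j ≤ n) : W ⊓ F j = Submodule.span ℂ (v '' {i | i ∈ pos n F W ∧ i < j}) := by
  induction j with
  | zero => simp [hF.bot]
  | succ j ih =>
    have hjn : j < n := hj
    have hle : W ⊓ F j ≤ W ⊓ F (j + 1) := inf_le_inf le_rfl (hF.mono (Nat.le_succ j))
    by_cases h : j ∈ pos n F W
    · have hs : {i | i ∈ pos n F W ∧ i < j + 1} = insert j {i | i ∈ pos n F W ∧ i < j} := by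
        ext x; simp only [Set.mem_ofPred_eq, Set.mem_insert_iff]
        constructor
        · rintro ⟨a, b⟩
          rcases Nat.lt_succ_iff_lt_or_eq.1 b with c | c
          · exact Or.inr ⟨a, c⟩
          · exact Or.inl c
        · rintro (rfl | ⟨a, b⟩)
          · exact ⟨h, Nat.lt_succ_self _⟩
          · exact ⟨a, by omega⟩
      rw [hs, Set.image_insert_eq, Submodule.span_insert, ← ih hjn.le]
      symm
      apply Submodule.eq_of_le_of_finrank_le
      · refine sup_le ?_ hle
        rw [Submodule.span_singleton_le_iff_mem]
        exact (hv j h).1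
      · have h1 := (hF.mem_pos'.1 h).2
        have h2 : W ⊓ F j < Submodule.span ℂ {v j} ⊔ W ⊓ F j := by
          refine lt_of_le_of_ne le_sup_right fun he => (hv j h).2 ?_
          have : v j ∈ Submodule.span ℂ {v j} ⊔ W ⊓ F j :=
            (le_sup_left : _ ≤ Submodule.span ℂ {v j} ⊔ W ⊓ F j) (Submodule.mem_span_singleton_self _)
          rw [← he] at this
          exact this.2
        have h3 := Submodule.finrank_lt_finrank_of_lt h2
        simp only [capDim] at h1
        omega
    · have hs : {i | i ∈ pos n F W ∧ i < j + 1} = {i | i ∈ pos n F W ∧ i < j} := by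
        ext x; simp only [Set.mem_ofPred_eq]
        constructor
        · rintro ⟨a, b⟩
          refine ⟨a, lt_of_le_of_ne (by omega) ?_⟩
          rintro rfl; exact h a
        · rintro ⟨a, b⟩; exact ⟨a, by omega⟩
      rw [hs, ← ih hjn.le]
      symm
      apply Submodule.eq_of_le_of_finrank_le hle
      rw [hF.mem_pos] at h
      push Not at h
      exact h hjn

theorem IsAdapted.span_top (hF : IsFlag n F) {v : ℕ → E} (hv : IsAdapted n F W v) :
    W = Submodule.span ℂ (v '' (pos n F W)) := by
  have := hv.span_eq hF le_rfl
  rw [hF.top, inf_top_eq] at this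
  conv_lhs => rw [this]
  congr 2
  ext i
  simp only [Set.mem_ofPred_eq, mem_coe, and_iff_left_iff_imp]
  exact fun h => (hF.mem_pos.1 h).1

theorem IsAdapted.linearIndependent (hF : IsFlag n F) {v : ℕ → E} (hv : IsAdapted n F W v) :
    LinearIndependent ℂ (fun i : pos n F W => v i) := by
  rw [linearIndependent_iff_card_eq_finrank_span]
  have h := hv.span_top hF
  have : Set.range (fun i : pos n F W => v i) = v '' (pos n F W) := by
    ext x; simp
  rw [Set.finrank, this, ← h, Fintype.card_coe, hF.card_pos]

theorem IsAdapted.exists (hF : IsFlag n F) (W : Submodule ℂ E) : ∃ v, IsAdapted n F W v := by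
  have : ∀ i, ∃ v, i ∈ pos n F W → v ∈ W ⊓ F (i + 1) ∧ v ∉ F i := by
    intro i
    by_cases h : i ∈ pos n F W
    · have h1 : ¬ (W ⊓ F (i + 1) ≤ W ⊓ F i) := fun hle => by
        have := Submodule.finrank_mono hle
        have h2 := (hF.mem_pos.1 h).2
        simp only [capDim] at h2
        omega
      obtain ⟨v, hv, hv'⟩ := SetLike.not_le_iff_exists.1 h1
      exact ⟨v, fun _ => ⟨hv, fun h' => hv' ⟨hv.1, h'⟩⟩⟩
    · exact ⟨0, fun h' => absurd h' h⟩
  choose v hv using this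
  exact ⟨v, hv⟩

end Adapted

section Concrete

theorem finrank_map_of_injective {V V' : Type*} [AddCommGroup V] [Module ℂ V] [AddCommGroup V']
    [Module ℂ V'] {f : V →ₗ[ℂ] V'} (hf : Function.Injective f) (W : Submodule ℂ V) :
    finrank ℂ (W.map f) = finrank ℂ W :=
  (Submodule.equivMapOfInjective f hf W).finrank_eq.symm

variable {n : ℕ}

/-- The vectors supported on the first `i` coordinates. -/
def coord (n i : ℕ) : Submodule ℂ (Fin n → ℂ) where
  carrier := {c | ∀ a : Fin n, i ≤ a → c a = 0}
  zero_mem' := fun _ _ => rfl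
  add_mem' := fun ha hb a h => by simp [ha a h, hb a h]
  smul_mem' := fun r c hc a h => by simp [hc a h]

theorem mem_coord {i : ℕ} {c : Fin n → ℂ} : c ∈ coord n i ↔ ∀ a : Fin n, i ≤ a → c a = 0 :=
  Iff.rfl

theorem finrank_coord {i : ℕ} (h : i ≤ n) : finrank ℂ (coord n i) = i := by
  let e : coord n i ≃ₗ[ℂ] (Fin i → ℂ) :=
    { toFun := fun c a => c.1 (Fin.castLE h a)
      map_add' := fun _ _ => rfl
      map_smul' := fun _ _ => rfl
      invFun := fun d => ⟨fun a => if h' : (a : ℕ) < i then d ⟨a, h'⟩ else 0, fun a ha => by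
        simp [not_lt.2 ha]⟩
      left_inv := fun c => by
        ext a
        by_cases h' : (a : ℕ) < i
        · simp [h']
        · simp [h', c.2 a (not_lt.1 h')]
      right_inv := fun d => by ext a; simp }
  rw [e.finrank_eq]; simp

theorem isFlag_coord : IsFlag n (coord n) where
  mono := fun i j h c hc a ha => hc a (h.trans ha)
  rank := fun _ h => finrank_coord h
  top := by
    rw [eq_top_iff]; intro c _ a ha; exact absurd a.2 (not_lt.2 ha)

/-- The flag spanned by the columns of a matrix. -/
noncomputable def colFlag (f : Matrix (Fin n) (Fin n) ℂ) (i : ℕ) : Submodule ℂ (Fin n → ℂ) :=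
  (coord n i).map f.mulVecLin

theorem mem_colFlag {f : Matrix (Fin n) (Fin n) ℂ} {i : ℕ} {v : Fin n → ℂ} :
    v ∈ colFlag f i ↔ ∃ c : Fin n → ℂ, (∀ a : Fin n, i ≤ a → c a = 0) ∧ f *ᵥ c = v := Iff.rfl

theorem mulVec_injective_of_isUnit' {f : Matrix (Fin n) (Fin n) ℂ} (hf : IsUnit f) :
    Function.Injective f.mulVecLin :=
  Matrix.mulVec_injective_of_isUnit hf

theorem isFlag_colFlag {f : Matrix (Fin n) (Fin n) ℂ} (hf : IsUnit f) : IsFlag n (colFlag f) where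
  mono := fun _ _ h => Submodule.map_mono (isFlag_coord.mono h)
  rank := fun i h => by
    rw [colFlag, finrank_map_of_injective (mulVec_injective_of_isUnit' hf), finrank_coord h]
  top := by
    apply Submodule.eq_top_of_finrank_eq
    rw [colFlag, finrank_map_of_injective (mulVec_injective_of_isUnit' hf),
      finrank_coord le_rfl]; simp

theorem colFlag_mul (g f : Matrix (Fin n) (Fin n) ℂ) (i : ℕ) :
    colFlag (g * f) i = (colFlag f i).map g.mulVecLin := by
  rw [colFlag, colFlag, Matrix.mulVecLin_mul, Submodule.map_comp]

theorem capDim_map {g : Matrix (Fin n) (Fin n) ℂ} (hg : IsUnit g) (f : Matrix (Fin n) (Fin n) ℂ)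
    (W : Submodule ℂ (Fin n → ℂ)) (i : ℕ) :
    capDim (colFlag (g * f)) (W.map g.mulVecLin) i = capDim (colFlag f) W i := by
  have hi := mulVec_injective_of_isUnit' hg
  rw [capDim, colFlag_mul, ← Submodule.map_inf _ hi, finrank_map_of_injective hi,
    capDim]

/-- Orthonormal adapted frames. -/
def IsONAdapted (n : ℕ) (F : ℕ → Submodule ℂ (Fin n → ℂ)) (W : Submodule ℂ (Fin n → ℂ))
    (v : ℕ → Fin n → ℂ) : Prop :=
  ∀ i ∈ pos n F W, v i ∈ W ⊓ F (i + 1) ∧ star (v i) ⬝ᵥ v i = 1 ∧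
    ∀ u ∈ W ⊓ F i, star u ⬝ᵥ v i = 0

theorem exists_unit_orthogonal {G G' : Submodule ℂ (Fin n → ℂ)} (h : G < G') :
    ∃ v ∈ G', star v ⬝ᵥ v = 1 ∧ ∀ u ∈ G, star u ⬝ᵥ v = 0 := by
  let e := (WithLp.linearEquiv 2 ℂ (Fin n → ℂ))
  have hG : G.comap e.toLinearMap < G'.comap e.toLinearMap := by
    refine lt_of_le_of_ne (Submodule.comap_mono h.le) fun he => h.ne ?_
    exact Submodule.comap_injective_of_surjective e.surjective he
  have hne : (G.comap e.toLinearMap)ᗮ ⊓ G'.comap e.toLinearMap ≠ ⊥ := by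
    intro hb
    have := Submodule.sup_orthogonal_inf_of_hasOrthogonalProjection hG.le
    rw [hb, sup_bot_eq] at this
    exact hG.ne this
  obtain ⟨x, hx, hx0⟩ := Submodule.exists_mem_ne_zero_of_ne_bot hne
  have hn : ‖x‖ ≠ 0 := norm_ne_zero_iff.2 hx0
  have hy : ‖((‖x‖ : ℂ)⁻¹) • x‖ = 1 := by
    rw [norm_smul, norm_inv]; simp [hn]
  set y := ((‖x‖ : ℂ)⁻¹) • x with hyd
  have hyG : y ∈ (G.comap e.toLinearMap)ᗮ ⊓ G'.comap e.toLinearMap := Submodule.smul_mem _ _ hx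
  refine ⟨e y, hyG.2, ?_, fun u hu => ?_⟩
  · have := inner_self_eq_norm_sq_to_K (𝕜 := ℂ) y
    rw [hy] at this
    rw [EuclideanSpace.inner_eq_star_dotProduct] at this
    rw [dotProduct_comm]
    exact this.trans (by simp)
  · have := (Submodule.mem_orthogonal _ _).1 hyG.1 (e.symm u) (by simpa using hu)
    rw [EuclideanSpace.inner_eq_star_dotProduct] at this
    rw [dotProduct_comm]
    exact this

theorem IsONAdapted.exists {F : ℕ → Submodule ℂ (Fin n → ℂ)} (hF : IsFlag n F)
    (W : Submodule ℂ (Fin n → ℂ)) : ∃ v, IsONAdapted n F W v := by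
  have : ∀ i, ∃ v, i ∈ pos n F W → v ∈ W ⊓ F (i + 1) ∧ star v ⬝ᵥ v = 1 ∧
      ∀ u ∈ W ⊓ F i, star u ⬝ᵥ v = 0 := by
    intro i
    by_cases h : i ∈ pos n F W
    · have h1 : W ⊓ F i < W ⊓ F (i + 1) := by
        refine lt_of_le_of_ne (inf_le_inf le_rfl (hF.mono (Nat.le_succ i))) fun he => ?_
        have h2 := (hF.mem_pos.1 h).2
        simp only [capDim] at h2
        rw [he] at h2
        exact lt_irrefl _ h2
      obtain ⟨v, hv, hv'⟩ := exists_unit_orthogonal h1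
      exact ⟨v, fun _ => ⟨hv, hv'⟩⟩
    · exact ⟨0, fun h' => absurd h' h⟩
  choose v hv using this
  exact ⟨v, hv⟩

theorem star_dotProduct_comm (u v : Fin n → ℂ) : star u ⬝ᵥ v = star (star v ⬝ᵥ u) := by
  rw [star_dotProduct]

theorem IsONAdapted.orthonormal {F : ℕ → Submodule ℂ (Fin n → ℂ)} (hF : IsFlag n F)
    {W : Submodule ℂ (Fin n → ℂ)}
    {v : ℕ → Fin n → ℂ} (hv : IsONAdapted n F W v) {i j : ℕ} (hi : i ∈ pos n F W)
    (hj : j ∈ pos n F W) : star (v i) ⬝ᵥ v j = if i = j then 1 else 0 := by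
  rcases lt_trichotomy i j with h | h | h
  · rw [if_neg h.ne, (hv j hj).2.2 _ ?_]
    exact ⟨(hv i hi).1.1, hF.mono h (hv i hi).1.2⟩
  · subst h; simp [(hv i hi).2.1]
  · rw [if_neg h.ne', star_dotProduct_comm, (hv i hi).2.2 _ ?_, star_zero]
    exact ⟨(hv j hj).1.1, hF.mono h (hv j hj).1.2⟩

theorem IsFlag.pos_top {E : Type*} [AddCommGroup E] [Module ℂ E] [FiniteDimensional ℂ E]
    {F : ℕ → Submodule ℂ E} (hF : IsFlag n F) : pos n F ⊤ = range n := by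
  ext i
  rw [hF.mem_pos, mem_range, and_iff_left_iff_imp]
  intro h
  rw [hF.capDim_univ h.le, hF.capDim_univ h]; omega

/-- A matrix whose columns lie in the right steps of a flag spans that flag. -/
theorem colFlag_eq_of_mem {F : ℕ → Submodule ℂ (Fin n → ℂ)} (hF : IsFlag n F)
    {U : Matrix (Fin n) (Fin n) ℂ} (hU : IsUnit U) (h : ∀ a : Fin n, Uᵀ a ∈ F (a + 1)) {i : ℕ}
    (hi : i ≤ n) : colFlag U i = F i := by
  apply Submodule.eq_of_le_of_finrank_eq
  · rintro v ⟨c, hc, rfl⟩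
    rw [Matrix.mulVecLin_apply, Matrix.mulVec_eq_sum]
    refine Submodule.sum_mem _ fun a _ => ?_
    by_cases ha : i ≤ a
    · rw [hc a ha]; simp
    · have := hF.mono (show (a : ℕ) + 1 ≤ i by omega) (h a)
      simpa using Submodule.smul_mem _ (c a) this
  · rw [(isFlag_colFlag hU).rank i hi, hF.rank i hi]

theorem exists_unitary_flag {F : ℕ → Submodule ℂ (Fin n → ℂ)} (hF : IsFlag n F) :
    ∃ U : Matrix (Fin n) (Fin n) ℂ, Uᴴ * U = 1 ∧ ∀ i ≤ n, colFlag U i = F i := by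
  obtain ⟨v, hv⟩ := IsONAdapted.exists hF ⊤
  have hp : ∀ a : Fin n, (a : ℕ) ∈ pos n F ⊤ := fun a => by rw [hF.pos_top]; simp
  let U : Matrix (Fin n) (Fin n) ℂ := Matrix.of fun i a => v a i
  have hU : Uᴴ * U = 1 := by
    ext a b
    have := hv.orthonormal hF (hp a) (hp b)
    rw [Matrix.mul_apply, Matrix.one_apply]
    simp only [dotProduct, Pi.star_apply] at this
    simpa [U, Fin.ext_iff] using this
  refine ⟨U, hU, fun i hi => colFlag_eq_of_mem hF ?_ (fun a => (hv a (hp a)).1.2) hi⟩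
  exact IsUnit.of_mul_eq_one _ (mul_eq_one_comm.1 hU)

end Concrete

end SingHorn

namespace SingHorn

open scoped ComplexOrder
open Module Finset Polynomial

section Sorting

theorem antitone_eq_of_prod_eq {n : ℕ} {w w' : Fin n → ℝ} (hw : Antitone w) (hw' : Antitone w')
    (h : ∏ i, (X - C (w i : ℂ)) = ∏ i, (X - C (w' i : ℂ))) : w = w' := by
  have h1 : Multiset.map (fun i => (w i : ℂ)) univ.val = Multiset.map (fun i => (w' i : ℂ)) univ.val := by
    have := congrArg roots h
    have e : ∀ u : Fin n → ℝ, (∏ i, (X - C (u i : ℂ))).roots = Multiset.map (fun i => (u i : ℂ)) univ.val := by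
      intro u
      have := roots_multiset_prod_X_sub_C (Multiset.map (fun i => (u i : ℂ)) univ.val)
      rw [Multiset.map_map] at this
      exact this
    rwa [e, e] at this
  have h2 : Multiset.map w univ.val = Multiset.map w' univ.val := by
    apply Multiset.map_injective Complex.ofReal_injective
    rw [Multiset.map_map, Multiset.map_map]
    exact h1
  have h3 : (List.ofFn w).Perm (List.ofFn w') := by
    rw [← Multiset.coe_eq_coe]
    have e : ∀ u : Fin n → ℝ, ((List.ofFn u : List ℝ) : Multiset ℝ) = Multiset.map u univ.val := by
      intro u; simp [List.ofFn_eq_map, Fin.univ_def]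
    rw [e, e, h2]
  have s : ∀ u : Fin n → ℝ, Antitone u → (List.ofFn u).Pairwise (· ≥ ·) := by
    intro u hu
    rw [List.pairwise_ofFn]
    intro i j hij
    exact hu hij.le
  exact List.ofFn_injective (h3.eq_of_pairwise (fun a b _ _ h1 h2 => le_antisymm h2 h1) (s w hw) (s w' hw'))

variable {n : ℕ} {A : Matrix (Fin n) (Fin n) ℂ}

theorem eigsDesc_antitone (hA : A.IsHermitian) : Antitone (eigsDesc hA) := by
  intro i j hij
  exact Tuple.monotone_sort hA.eigenvalues (Fin.rev_le_rev.2 hij)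

theorem charpoly_eq_prod_eigsDesc (hA : A.IsHermitian) :
    A.charpoly = ∏ i, (X - C (eigsDesc hA i : ℂ)) := by
  rw [hA.charpoly_eq]
  symm
  exact Fintype.prod_equiv (Fin.revPerm.trans (Tuple.sort hA.eigenvalues)) _ _ (fun i => rfl)

theorem eigsDesc_eq_iff (hA : A.IsHermitian) {w : Fin n → ℝ} (hw : Antitone w) :
    eigsDesc hA = w ↔ A.charpoly = ∏ i, (X - C (w i : ℂ)) := by
  constructor
  · rintro rfl; exact charpoly_eq_prod_eigsDesc hA
  · intro h
    rw [charpoly_eq_prod_eigsDesc hA] at h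
    exact antitone_eq_of_prod_eq (eigsDesc_antitone hA) hw h

theorem charpoly_unitary_conj {U : Matrix (Fin n) (Fin n) ℂ} (hU : Uᴴ * U = 1) (d : Fin n → ℂ) :
    (U * diagonal d * Uᴴ).charpoly = ∏ i, (X - C (d i)) := by
  rw [charpoly_mul_comm, ← mul_assoc, hU, one_mul, charpoly_diagonal]

/-- Spectral theorem with eigenvalues in decreasing order. -/
theorem spectral_desc (hA : A.IsHermitian) :
    ∃ U : Matrix (Fin n) (Fin n) ℂ, Uᴴ * U = 1 ∧
      A = U * diagonal (fun i => (eigsDesc hA i : ℂ)) * Uᴴ := by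
  let σ := Fin.revPerm.trans (Tuple.sort hA.eigenvalues)
  let V : Matrix (Fin n) (Fin n) ℂ := hA.eigenvectorUnitary
  have hV : Vᴴ * V = 1 := by
    have := (Unitary.mem_iff.1 hA.eigenvectorUnitary.2).1
    exact this
  have hd : A = V * diagonal (fun i => (hA.eigenvalues i : ℂ)) * Vᴴ := by
    conv_lhs => rw [hA.spectral_theorem, Unitary.conjStarAlgAut_apply]
    rfl
  refine ⟨V.submatrix id σ, ?_, ?_⟩
  · rw [conjTranspose_submatrix]
    ext a b
    have := congrFun (congrFun hV (σ a)) (σ b)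
    simp only [mul_apply, submatrix_apply, id] at this ⊢
    rw [this]
    simp [one_apply]
  · have e : diagonal (fun i => (eigsDesc hA i : ℂ)) =
        (diagonal (fun i => (hA.eigenvalues i : ℂ))).submatrix σ σ := by
      rw [submatrix_diagonal_equiv]; rfl
    rw [e, conjTranspose_submatrix, submatrix_mul_equiv, submatrix_mul_equiv, ← hd]
    rfl

end Sorting

section Block

variable {p q : ℕ}

theorem charpoly_block (B : Matrix (Fin p) (Fin q) ℂ) :
    (fromBlocks 0 B Bᴴ 0).charpoly * X ^ q = X ^ p * (Bᴴ * B).charpoly.comp (X ^ 2) := by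
  have e1 : (fromBlocks 0 B Bᴴ 0).charmatrix =
      fromBlocks (scalar (Fin p) X) (-(B.map C)) (-(Bᴴ.map C)) (scalar (Fin q) X) := by
    ext i j : 1
    rcases i with i | i <;> rcases j with j | j <;> simp [charmatrix, diagonal_apply]
  have e2 : fromBlocks (scalar (Fin p) X) (-(B.map C)) (-(Bᴴ.map C)) (scalar (Fin q) X) *
      fromBlocks 1 (B.map C) 0 (scalar (Fin q) (X : ℂ[X])) =
      fromBlocks (scalar (Fin p) X) 0 (-(Bᴴ.map C)) (scalar (Fin q) (X ^ 2) - (Bᴴ * B).map C) := by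
    rw [fromBlocks_multiply]
    congr 1
    · simp
    · ext i j : 1
      simp only [scalar_apply, Matrix.add_apply, diagonal_mul, mul_diagonal, Matrix.neg_apply,
        Matrix.zero_apply, map_apply]
      ring
    · simp
    · rw [Matrix.map_mul, Matrix.neg_mul, ← map_mul, ← pow_two, sub_eq_add_neg, add_comm]
  have e3 : (scalar (Fin q) (X ^ 2) - (Bᴴ * B).map C).det = (Bᴴ * B).charpoly.comp (X ^ 2) := by
    have : (Bᴴ * B).charpoly.comp (X ^ 2) = (compRingHom (X ^ 2 : ℂ[X])) (Bᴴ * B).charpoly := rfl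
    rw [this, charpoly, RingHom.map_det]
    congr 1
    ext i j : 1
    simp only [charmatrix, Matrix.sub_apply, scalar_apply, diagonal_apply, RingHom.mapMatrix_apply,
      map_apply, coe_compRingHom_apply]
    split_ifs <;> simp only [sub_comp, X_comp, C_comp, zero_comp]
  have := congrArg det e2
  rw [det_mul, det_fromBlocks_zero₂₁, det_fromBlocks_zero₁₂, e3, ← e1] at this
  simpa [charpoly] using this

theorem singularValues_eq_iff (B : Matrix (Fin p) (Fin q) ℂ) {x : Fin q → ℝ} (hx : DecrNonneg x) :
    singularValues B = x ↔ (Bᴴ * B).charpoly = ∏ i, (X - C ((x i : ℂ) ^ 2)) := by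
  have hps := posSemidef_conjTranspose_mul_self B
  have h0 : ∀ i, 0 ≤ eigsDesc (isHermitian_conjTranspose_mul_self B) i := fun i =>
    hps.eigenvalues_nonneg _
  have ha : Antitone fun i => x i ^ 2 := fun i j h =>
    pow_le_pow_left₀ (hx.2 j) (hx.1 i j h) 2
  have := eigsDesc_eq_iff (isHermitian_conjTranspose_mul_self B) ha
  push_cast at this
  rw [← this]
  constructor
  · rintro rfl
    funext i
    exact (Real.sq_sqrt (h0 i)).symm
  · intro h
    funext i
    rw [singularValues, h, Real.sqrt_sq (hx.2 i)]

/-- The spectrum of `[[0, B], [Bᴴ, 0]]` in terms of the singular values of `B`. -/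
noncomputable def xhat (p q : ℕ) (x : Fin q → ℝ) (i : ℕ) : ℝ :=
  if i < q then valAt x (i + 1) else if i < p then 0 else -valAt x (p + q - i)

theorem valAt_nonneg {x : Fin q → ℝ} (hx : DecrNonneg x) (i : ℕ) : 0 ≤ valAt x i := by
  unfold valAt; split_ifs
  · exact hx.2 _
  · exact le_rfl

theorem valAt_anti {x : Fin q → ℝ} (hx : DecrNonneg x) {i j : ℕ} (h : i ≤ j) :
    valAt x j ≤ valAt x i := by
  unfold valAt
  split_ifs with h1 h2
  · apply hx.1; simp only [Fin.mk_le_mk]; omega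
  · omega
  · exact hx.2 _
  · exact le_rfl

theorem xhat_antitone {x : Fin q → ℝ} (hx : DecrNonneg x) : Antitone (xhat p q x) := by
  intro i j h
  unfold xhat
  have h1 := valAt_nonneg hx (i + 1)
  have h2 := valAt_nonneg hx (p + q - j)
  split_ifs <;> first | omega | linarith | skip
  · exact valAt_anti hx (by omega)
  · exact neg_le_neg (valAt_anti hx (by omega))

theorem xhat_rev (hpq : q ≤ p) (x : Fin q → ℝ) {i : ℕ} (hi : i < p + q) :
    xhat p q x (p + q - 1 - i) = - xhat p q x i := by
  unfold xhat
  split_ifs <;> first | omega | skip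
  · rw [neg_neg]; congr 1; omega
  · simp
  · congr 2; omega

theorem xhat_mid (x : Fin q → ℝ) {i : ℕ} (h : q ≤ i) (h' : i < p) : xhat p q x i = 0 := by
  simp [xhat, not_lt.2 h, h']

theorem prod_xhat (hpq : q ≤ p) (x : Fin q → ℝ) :
    (∏ i ∈ range (p + q), (X - C (xhat p q x i : ℂ))) * X ^ q =
      X ^ p * (∏ i, (X - C ((x i : ℂ) ^ 2))).comp (X ^ 2) := by
  have h1 : ∏ i ∈ range q, (X - C (xhat p q x i : ℂ)) = ∏ i : Fin q, (X - C (x i : ℂ)) := by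
    rw [prod_range]
    refine prod_congr rfl fun i _ => ?_
    simp [xhat, valAt]
  have h2 : ∏ i ∈ Ico q p, (X - C (xhat p q x i : ℂ)) = X ^ (p - q) := by
    rw [prod_congr rfl (g := fun _ => X), prod_const, Nat.card_Ico]
    intro i hi
    rw [mem_Ico] at hi
    rw [xhat_mid x hi.1 hi.2]; simp
  have h3 : ∏ i ∈ Ico p (p + q), (X - C (xhat p q x i : ℂ)) = ∏ i : Fin q, (X + C (x i : ℂ)) := by
    rw [prod_Ico_eq_prod_range, Nat.add_sub_cancel_left, ← prod_range_reflect, prod_range]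
    refine prod_congr rfl fun i _ => ?_
    have hi := i.2
    have e1 : ¬ (p + (q - 1 - i) < q) := by omega
    have e2 : ¬ (p + (q - 1 - i) < p) := by omega
    have e3 : p + q - (p + (q - 1 - i)) = i + 1 := by omega
    simp [xhat, e1, e2, e3, valAt]
  rw [range_eq_Ico, ← prod_Ico_consecutive _ (Nat.zero_le p) (Nat.le_add_right p q),
    ← prod_Ico_consecutive _ (Nat.zero_le q) hpq, ← range_eq_Ico, h1, h2, h3, Polynomial.prod_comp]
  have h4 : ∏ i : Fin q, (X - C ((x i : ℂ) ^ 2)).comp (X ^ 2) =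
      (∏ i : Fin q, (X - C (x i : ℂ))) * ∏ i : Fin q, (X + C (x i : ℂ)) := by
    rw [← prod_mul_distrib]
    refine prod_congr rfl fun i _ => ?_
    simp; ring
  rw [h4]
  have h5 : (X : ℂ[X]) ^ p = X ^ (p - q) * X ^ q := by rw [← pow_add]; congr 1; omega
  rw [h5]; ring

theorem singularValues_eq_iff_block (hpq : q ≤ p) (B : Matrix (Fin p) (Fin q) ℂ) {x : Fin q → ℝ}
    (hx : DecrNonneg x) : singularValues B = x ↔
      (fromBlocks 0 B Bᴴ 0).charpoly = ∏ i ∈ range (p + q), (X - C (xhat p q x i : ℂ)) := by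
  rw [singularValues_eq_iff B hx]
  have hX : (X : ℂ[X]) ^ q ≠ 0 := pow_ne_zero _ X_ne_zero
  have hX' : (X : ℂ[X]) ^ p ≠ 0 := pow_ne_zero _ X_ne_zero
  constructor
  · intro h
    apply mul_right_cancel₀ hX
    rw [charpoly_block, prod_xhat hpq, h]
  · intro h
    have := charpoly_block B
    rw [h, prod_xhat hpq] at this
    have := mul_left_cancel₀ hX' this
    rw [← expand_eq_comp_X_pow, ← expand_eq_comp_X_pow] at this
    exact (expand_injective two_pos this).symm

end Block

end SingHorn

namespace SingHorn

open scoped ComplexOrder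
open Module Finset

section CauchyBinet

variable {m ι : Type*} [Fintype m] [DecidableEq m] [Fintype ι] [DecidableEq ι]

theorem det_mul_rect (M : Matrix m ι ℂ) (N : Matrix ι m ℂ) :
    (M * N).det = ∑ σ : m → ι, (∏ b, N (σ b) b) * (M.submatrix id σ).det := by
  have h1 : (M * N).det = detRowAlternating (fun b => ∑ j, N j b • Mᵀ j) := by
    rw [← det_transpose]
    congr 1
    ext b a
    simp [mul_apply, mul_comm]
  have h2 := (detRowAlternating (n := m) (R := ℂ)).toMultilinearMap.map_sum
    (fun (b : m) (j : ι) => N j b • Mᵀ j)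
  rw [h1]
  refine h2.trans (sum_congr rfl fun σ _ => ?_)
  have h3 := (detRowAlternating (n := m) (R := ℂ)).toMultilinearMap.map_smul_univ
    (fun b => N (σ b) b) (fun b => Mᵀ (σ b))
  refine h3.trans ?_
  rw [smul_eq_mul, ← det_transpose]
  rfl

/-- Cauchy–Binet for a weighted Gram matrix, as a sum over all maps. -/
theorem gram_det_eq (C : Matrix ι m ℂ) (d : ι → ℂ) :
    ((Fintype.card m).factorial : ℂ) * (Cᴴ * diagonal d * C).det =
      ∑ σ : m → ι, (∏ b, d (σ b)) * ((‖(C.submatrix σ id).det‖ ^ 2 : ℝ) : ℂ) := by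
  rw [Matrix.mul_assoc, det_mul_rect]
  have h (π : Equiv.Perm m) : ∑ σ : m → ι, (∏ b, (diagonal d * C) (σ b) b) *
      ((Cᴴ).submatrix id σ).det = ∑ σ : m → ι, (∏ b, d (σ b)) *
        ((Equiv.Perm.sign π : ℤ) * ∏ b, C (σ (π b)) b) * ((Cᴴ).submatrix id σ).det := by
    rw [← (Equiv.arrowCongr π (Equiv.refl ι)).symm.sum_comp]
    refine sum_congr rfl fun σ _ => ?_
    have e : (Equiv.arrowCongr π (Equiv.refl ι)).symm σ = σ ∘ π := by
      ext b; simp [Equiv.arrowCongr]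
    rw [e]
    have e2 : ((Cᴴ).submatrix id (σ ∘ π)).det =
        (Equiv.Perm.sign π : ℤ) * ((Cᴴ).submatrix id σ).det := by
      rw [← det_permute' π]; rfl
    rw [e2]
    simp only [diagonal_mul, prod_mul_distrib, Function.comp]
    rw [Equiv.prod_comp π (fun b => d (σ b))]
    ring
  have h' : ((Fintype.card m).factorial : ℂ) * ∑ σ : m → ι, (∏ b, (diagonal d * C) (σ b) b) *
      ((Cᴴ).submatrix id σ).det = ∑ π : Equiv.Perm m, ∑ σ : m → ι, (∏ b, d (σ b)) *
        ((Equiv.Perm.sign π : ℤ) * ∏ b, C (σ (π b)) b) * ((Cᴴ).submatrix id σ).det := by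
    rw [sum_congr rfl fun π _ => (h π).symm, sum_const, card_univ, Fintype.card_perm, nsmul_eq_mul]
  rw [h', sum_comm]
  refine sum_congr rfl fun σ _ => ?_
  rw [← sum_mul, ← mul_sum, mul_assoc]
  congr 1
  have e1 : ∑ π : Equiv.Perm m, ((Equiv.Perm.sign π : ℤ) : ℂ) * ∏ b, C (σ (π b)) b =
      (C.submatrix σ id).det := by
    rw [det_apply']; rfl
  have e2 : ((Cᴴ).submatrix id σ).det = star (C.submatrix σ id).det := by
    rw [← det_conjTranspose]; rfl
  rw [e1, e2, Complex.star_def, Complex.mul_conj, Complex.normSq_eq_norm_sq]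

end CauchyBinet

section ExpSum

variable {κ : Type*} [Fintype κ]

/-- Log-convexity of a positive combination of exponentials, along a ray from the origin. -/
theorem log_sum_exp_le {c θ : κ → ℝ} (hc : ∀ σ, 0 ≤ c σ) (hpos : 0 < ∑ σ, c σ) {T t : ℝ}
    (hT : 0 ≤ T) (ht : T ≤ t) (ht0 : 0 < t) :
    Real.log (∑ σ, c σ * Real.exp (T * θ σ)) ≤ (1 - T / t) * Real.log (∑ σ, c σ) +
      T / t * Real.log (∑ σ, c σ * Real.exp (t * θ σ)) := by
  set s := T / t with hs
  have hs0 : 0 ≤ s := div_nonneg hT ht0.le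
  have hs1 : s ≤ 1 := (div_le_one ht0).2 ht
  have hpos' : ∀ u : ℝ, 0 < ∑ σ, c σ * Real.exp (u * θ σ) := by
    intro u
    obtain ⟨σ, _, hσ⟩ := exists_lt_of_sum_lt (s := univ) (f := fun _ : κ => (0 : ℝ)) (g := c)
      (by simpa using hpos)
    exact sum_pos' (fun σ _ => mul_nonneg (hc σ) (Real.exp_pos _).le)
      ⟨σ, mem_univ _, mul_pos hσ (Real.exp_pos _)⟩
  set A := ∑ σ, c σ
  set B := ∑ σ, c σ * Real.exp (t * θ σ)
  have hB : 0 < B := hpos' t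
  rw [← Real.log_rpow hpos, ← Real.log_rpow hB, ← Real.log_mul (Real.rpow_pos_of_pos hpos _).ne'
    (Real.rpow_pos_of_pos hB _).ne']
  apply Real.log_le_log (hpos' T)
  have hAB : 0 < A ^ (1 - s) * B ^ s := by positivity
  rw [← div_le_one hAB, sum_div]
  calc ∑ σ, c σ * Real.exp (T * θ σ) / (A ^ (1 - s) * B ^ s)
      ≤ ∑ σ, ((1 - s) * (c σ / A) + s * (c σ * Real.exp (t * θ σ) / B)) := by
        refine sum_le_sum fun σ _ => ?_
        have hcs := hc σ
        have e : c σ * Real.exp (T * θ σ) / (A ^ (1 - s) * B ^ s) =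
            (c σ / A) ^ (1 - s) * (c σ * Real.exp (t * θ σ) / B) ^ s := by
          rw [Real.div_rpow hcs hpos.le, Real.div_rpow (by positivity) hB.le,
            Real.mul_rpow hcs (Real.exp_pos _).le, ← Real.exp_mul]
          have : T * θ σ = t * θ σ * s := by rw [hs]; field_simp
          rw [this, div_mul_div_comm, ← mul_assoc]
          congr 2
          rcases hcs.eq_or_lt with h | h
          · rw [← h]
            by_cases h1 : s = 0
            · simp [h1]
            · simp [Real.zero_rpow h1]
          · rw [← Real.rpow_add h]; simp
        rw [e]
        exact Real.geom_mean_le_arith_mean2_weighted (by linarith) hs0 (by positivity)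
          (by positivity) (by ring)
    _ = 1 := by
        rw [sum_add_distrib, ← mul_sum, ← mul_sum, ← sum_div, ← sum_div]
        rw [div_self hpos.ne', div_self hB.ne']; ring

end ExpSum

section LogDet

variable {m : Type*} [Fintype m] [DecidableEq m]

theorem log_det_le_trace {M : Matrix m m ℂ} (hM : M.PosDef) :
    Real.log M.det.re ≤ M.trace.re - Fintype.card m := by
  have h1 := hM.isHermitian.det_eq_prod_eigenvalues
  have h2 := hM.isHermitian.trace_eq_sum_eigenvalues
  rw [h1, h2]
  have e1 : (∏ i, ((hM.isHermitian.eigenvalues i : ℝ) : ℂ)) =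
      ((∏ i, hM.isHermitian.eigenvalues i : ℝ) : ℂ) := by push_cast; rfl
  have e2 : (∑ i, ((hM.isHermitian.eigenvalues i : ℝ) : ℂ)) =
      ((∑ i, hM.isHermitian.eigenvalues i : ℝ) : ℂ) := by push_cast; rfl
  change Real.log (∏ i, ((hM.isHermitian.eigenvalues i : ℝ) : ℂ)).re ≤
    (∑ i, ((hM.isHermitian.eigenvalues i : ℝ) : ℂ)).re - _
  rw [e1, e2, Complex.ofReal_re, Complex.ofReal_re,
    Real.log_prod (fun i _ => (hM.eigenvalues_pos i).ne')]
  have : (Fintype.card m : ℝ) = ∑ _i : m, (1 : ℝ) := by simp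
  rw [this, ← sum_sub_distrib]
  exact sum_le_sum fun i _ => Real.log_le_sub_one_of_pos (hM.eigenvalues_pos i)

end LogDet

end SingHorn

namespace SingHorn

open scoped ComplexOrder
open Module Finset

variable {n : ℕ}

/-- The submatrix of the first `i` columns. -/
def firstCols (f : Matrix (Fin n) (Fin n) ℂ) (i : ℕ) : Matrix (Fin n) {j : Fin n // (j : ℕ) < i} ℂ :=
  f.submatrix id Subtype.val

/-- The Gram determinant of the first `i` columns of `f` for the form `H`. -/
noncomputable def gramMinor (f : Matrix (Fin n) (Fin n) ℂ) (i : ℕ) (H : Matrix (Fin n) (Fin n) ℂ) : ℝ :=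
  ((firstCols f i)ᴴ * H * firstCols f i).det.re

/-- The Hermitian matrix with eigenvectors the columns of `U` and eigenvalues `exp ℓ`. -/
noncomputable def expMat (U : Matrix (Fin n) (Fin n) ℂ) (l : Fin n → ℝ) : Matrix (Fin n) (Fin n) ℂ :=
  U * diagonal (fun j => (Real.exp (l j) : ℂ)) * Uᴴ

/-- Extension of a vector to a function on `ℕ`, constant after the last entry. -/
def extNat (hn : 0 < n) (l : Fin n → ℝ) (j : ℕ) : ℝ := l ⟨min j (n - 1), by omega⟩

theorem extNat_mono (hn : 0 < n) {l : Fin n → ℝ} (hl : Monotone l) : Monotone (extNat hn l) := by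
  intro i j h
  apply hl
  simp only [Fin.mk_le_mk]; omega

theorem extNat_apply (hn : 0 < n) (l : Fin n → ℝ) (j : Fin n) : extNat hn l j = l j := by
  unfold extNat; congr 1; ext; simp; omega

theorem card_firstCols {i : ℕ} (hi : i ≤ n) : Fintype.card {j : Fin n // (j : ℕ) < i} = i := by
  rw [Fintype.card_congr (Fin.castLEquiv hi).symm]; simp

theorem gramMinor_expMat (f U : Matrix (Fin n) (Fin n) ℂ) (i : ℕ) (l : Fin n → ℝ) :
    gramMinor f i (expMat U l) = ∑ σ : {j : Fin n // (j : ℕ) < i} → Fin n,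
      ‖((Uᴴ * firstCols f i).submatrix σ id).det‖ ^ 2 /
        ((Fintype.card {j : Fin n // (j : ℕ) < i}).factorial : ℝ) * Real.exp (∑ b, l (σ b)) := by
  have h := gram_det_eq (Uᴴ * firstCols f i) (fun j => (Real.exp (l j) : ℂ))
  have e : (Uᴴ * firstCols f i)ᴴ * diagonal (fun j => (Real.exp (l j) : ℂ)) * (Uᴴ * firstCols f i) =
      (firstCols f i)ᴴ * expMat U l * firstCols f i := by
    simp only [expMat, conjTranspose_mul, conjTranspose_conjTranspose, Matrix.mul_assoc]
  rw [e] at h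
  set N : ℝ := ((Fintype.card {j : Fin n // (j : ℕ) < i}).factorial : ℝ) with hN
  have hN0 : N ≠ 0 := by rw [hN]; exact_mod_cast Nat.factorial_ne_zero _
  have h2 := congrArg Complex.re h
  have h3 : (((Fintype.card {j : Fin n // (j : ℕ) < i}).factorial : ℂ) *
    ((firstCols f i)ᴴ * expMat U l * firstCols f i).det).re = N * gramMinor f i (expMat U l) := by
    rw [gramMinor, hN]
    rw [show ((Fintype.card {j : Fin n // (j : ℕ) < i}).factorial : ℂ) =
      (((Fintype.card {j : Fin n // (j : ℕ) < i}).factorial : ℝ) : ℂ) by push_cast; rfl,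
      Complex.re_ofReal_mul]
  rw [h3] at h2
  have h4 : gramMinor f i (expMat U l) = N⁻¹ * (N * gramMinor f i (expMat U l)) := by
    field_simp
  rw [h4, h2, Complex.re_sum, mul_sum]
  refine sum_congr rfl fun σ _ => ?_
  rw [← Complex.ofReal_prod, ← Complex.ofReal_mul, Complex.ofReal_re, Real.exp_sum]
  field_simp

theorem expMat_zero {U : Matrix (Fin n) (Fin n) ℂ} (hU : Uᴴ * U = 1) : expMat U 0 = 1 := by
  simp [expMat, mul_eq_one_comm.1 hU]

theorem isUnit_of_unitary {U : Matrix (Fin n) (Fin n) ℂ} (hU : Uᴴ * U = 1) : IsUnit U :=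
  IsUnit.of_mul_eq_one _ (mul_eq_one_comm.1 hU)

theorem mem_colFlag_firstCols {f : Matrix (Fin n) (Fin n) ℂ} {i : ℕ} {v : Fin n → ℂ}
    (hv : v ∈ colFlag f i) : ∃ c, firstCols f i *ᵥ c = v := by
  obtain ⟨c, hc, rfl⟩ := hv
  refine ⟨fun j => c j, ?_⟩
  ext a
  simp only [mulVecLin_apply, mulVec, dotProduct, firstCols, submatrix_apply, id]
  rw [← sum_subtype (univ.filter fun j : Fin n => (j : ℕ) < i) (by simp) (fun j => f a j * c j)]
  refine sum_subset (filter_subset _ _) fun j _ hj => ?_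
  simp only [mem_filter, mem_univ, true_and, not_lt] at hj
  rw [hc j hj, mul_zero]

/-- Lower exponential bound for a Gram determinant along a one-parameter family. -/
theorem gramMinor_lower (hn : 0 < n) {f U : Matrix (Fin n) (Fin n) ℂ} (hf : IsUnit f)
    (hU : Uᴴ * U = 1) {i : ℕ} (hi : i ≤ n) (l : Fin n → ℝ) :
    ∃ c > 0, ∀ T : ℝ, c * Real.exp (T * wsum n (extNat hn l) (colFlag U) (colFlag f i)) ≤
      gramMinor f i (expMat U (T • l)) := by
  have hR := isFlag_colFlag (isUnit_of_unitary hU)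
  obtain ⟨v, hv⟩ := IsAdapted.exists hR (colFlag f i)
  set S := pos n (colFlag U) (colFlag f i) with hS
  have hcard : Fintype.card {j : Fin n // (j : ℕ) < i} = Fintype.card S := by
    rw [card_firstCols hi, Fintype.card_coe, hR.card_pos, (isFlag_colFlag hf).rank i hi]
  let e : {j : Fin n // (j : ℕ) < i} ≃ S := Fintype.equivOfCardEq hcard
  have hSn : ∀ s : S, (s : ℕ) < n := fun s => (hR.mem_pos.1 s.2).1
  let σ₀ : {j : Fin n // (j : ℕ) < i} → Fin n := fun b => ⟨e b, hSn _⟩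
  -- the coordinate matrix of the adapted vectors
  have hcoord : ∀ s : S, ∃ c : Fin n → ℂ, (∀ a : Fin n, (s : ℕ) + 1 ≤ a → c a = 0) ∧
      U *ᵥ c = v s ∧ c ⟨s, hSn s⟩ ≠ 0 := by
    intro s
    obtain ⟨⟨_, c, hc, hcv⟩, hnot⟩ := hv s s.2
    refine ⟨c, hc, hcv, fun h0 => hnot ⟨c, fun a ha => ?_, hcv⟩⟩
    rcases ha.eq_or_lt with h | h
    · have : a = ⟨s, hSn s⟩ := by ext; exact h.symm
      rw [this, h0]
    · exact hc a h
  choose c hc hcv hc0 using hcoord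
  have hM : ∀ s : S, ∃ x, firstCols f i *ᵥ x = v s := fun s => mem_colFlag_firstCols (hv s s.2).1.1
  choose x hx using hM
  have hdetS : (Matrix.of fun s t : S => c t ⟨s, hSn s⟩).det ≠ 0 := by
    rw [det_of_isUpperTriangular]
    · exact prod_ne_zero_iff.2 fun s _ => hc0 s
    · intro s t hst
      exact hc t _ hst
  have hmat : ((Uᴴ * firstCols f i).submatrix σ₀ id) * (Matrix.of fun (a b : {j : Fin n // (j : ℕ) < i}) => x (e b) a) =
      (Matrix.of fun s t : S => c t ⟨s, hSn s⟩).submatrix e e := by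
    ext a b
    have h1 : Uᴴ *ᵥ (firstCols f i *ᵥ x (e b)) = c (e b) := by
      rw [hx, ← hcv, mulVec_mulVec, hU, one_mulVec]
    rw [mulVec_mulVec] at h1
    have := congrFun h1 (σ₀ a)
    simpa [mulVec, dotProduct, mul_apply] using this
  have hne : ((Uᴴ * firstCols f i).submatrix σ₀ id).det ≠ 0 := by
    intro h0
    have := congrArg det hmat
    rw [det_mul, h0, zero_mul, det_submatrix_equiv_self] at this
    exact hdetS this.symm
  have hκ : ∑ b, l (σ₀ b) = wsum n (extNat hn l) (colFlag U) (colFlag f i) := by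
    rw [hR.wsum_eq, ← hS, ← sum_coe_sort S, ← e.sum_comp (fun s : S => extNat hn l s)]
    refine sum_congr rfl fun b _ => ?_
    exact (extNat_apply hn l (σ₀ b)).symm
  refine ⟨‖((Uᴴ * firstCols f i).submatrix σ₀ id).det‖ ^ 2 /
        ((Fintype.card {j : Fin n // (j : ℕ) < i}).factorial : ℝ), ?_, fun T => ?_⟩
  · have := Nat.factorial_pos (Fintype.card {j : Fin n // (j : ℕ) < i})
    have h2 : 0 < ‖((Uᴴ * firstCols f i).submatrix σ₀ id).det‖ := norm_pos_iff.2 hne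
    positivity
  · rw [gramMinor_expMat, ← hκ]
    have := single_le_sum (s := univ) (f := fun σ : {j : Fin n // (j : ℕ) < i} → Fin n =>
      ‖((Uᴴ * firstCols f i).submatrix σ id).det‖ ^ 2 /
        ((Fintype.card {j : Fin n // (j : ℕ) < i}).factorial : ℝ) * Real.exp (∑ b, (T • l) (σ b)))
      (fun σ _ => by positivity) (mem_univ σ₀)
    refine le_trans (le_of_eq ?_) this
    simp [mul_sum]

theorem gramMinor_pos (hn : 0 < n) {f U : Matrix (Fin n) (Fin n) ℂ} (hf : IsUnit f)
    (hU : Uᴴ * U = 1) {i : ℕ} (hi : i ≤ n) (l : Fin n → ℝ) : 0 < gramMinor f i (expMat U l) := by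
  obtain ⟨c, hc, h⟩ := gramMinor_lower hn hf hU hi l
  have := h 1
  rw [one_smul] at this
  exact lt_of_lt_of_le (by positivity) this

theorem log_gramMinor_le (hn : 0 < n) {f U : Matrix (Fin n) (Fin n) ℂ} (hf : IsUnit f)
    (hU : Uᴴ * U = 1) {i : ℕ} (hi : i ≤ n) (l : Fin n → ℝ) {T t : ℝ}
    (hT : 0 ≤ T) (ht : T ≤ t) (ht0 : 0 < t) :
    Real.log (gramMinor f i (expMat U (T • l))) ≤ (1 - T / t) * Real.log (gramMinor f i 1) +
      T / t * Real.log (gramMinor f i (expMat U (t • l))) := by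
  have h1 := gramMinor_expMat f U i (0 : Fin n → ℝ)
  have hp := gramMinor_pos hn hf hU hi (0 : Fin n → ℝ)
  have e : ∀ T : ℝ, ∀ σ : {j : Fin n // (j : ℕ) < i} → Fin n,
    ∑ b, (T • l) (σ b) = T * ∑ b, l (σ b) := fun T σ => by simp [mul_sum]
  rw [← expMat_zero hU, gramMinor_expMat, gramMinor_expMat, gramMinor_expMat]
  rw [h1] at hp
  simp only [e]
  simp only [Pi.zero_apply, sum_const_zero, Real.exp_zero, mul_one] at hp ⊢
  exact log_sum_exp_le (fun σ => by positivity) hp hT ht ht0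

end SingHorn

namespace SingHorn

open scoped ComplexOrder
open Module Finset

variable {n : ℕ}

/-- The (regularised) Kempf–Ness function. -/
noncomputable def knF (f : Fin 3 → Matrix (Fin n) (Fin n) ℂ) (w : Fin 3 → ℕ → ℝ) (ε : ℝ)
    (H : Matrix (Fin n) (Fin n) ℂ) : ℝ :=
  ∑ k, ∑ i ∈ range (n - 1), (w k i - w k (i + 1)) * Real.log (gramMinor (f k) (i + 1) H) +
    ε * Real.log H.trace.re

theorem isCompact_unitary : IsCompact {U : Matrix (Fin n) (Fin n) ℂ | Uᴴ * U = 1} := by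
  have hc : IsCompact (Set.pi Set.univ fun _ : Fin n => Set.pi Set.univ fun _ : Fin n =>
      Metric.closedBall (0 : ℂ) 1) :=
    isCompact_univ_pi fun _ => isCompact_univ_pi fun _ => isCompact_closedBall _ _
  refine hc.of_isClosed_subset ?_ ?_
  · exact isClosed_eq (by fun_prop) continuous_const
  · intro (U : Matrix (Fin n) (Fin n) ℂ) (hU : Uᴴ * U = 1) i _ j _
    have h := congrFun (congrFun hU j) j
    rw [mul_apply, one_apply_eq] at h
    have h2 := congrArg Complex.re h
    rw [Complex.re_sum, Complex.one_re] at h2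
    have h3 : ‖U i j‖ ^ 2 ≤ 1 := by
      rw [← h2]
      refine le_trans (le_of_eq ?_) (single_le_sum (f := fun a => (Uᴴ j a * U a j).re) ?_ (mem_univ i))
      · rw [conjTranspose_apply, Complex.star_def, Complex.conj_mul', ← Complex.ofReal_pow,
          Complex.ofReal_re]
      · intro a _
        rw [conjTranspose_apply, Complex.star_def, Complex.conj_mul', ← Complex.ofReal_pow,
          Complex.ofReal_re]
        positivity
    rw [mem_closedBall_zero_iff]
    nlinarith [norm_nonneg (U i j)]

theorem trace_expMat {U : Matrix (Fin n) (Fin n) ℂ} (hU : Uᴴ * U = 1) (l : Fin n → ℝ) :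
    (expMat U l).trace.re = ∑ j, Real.exp (l j) := by
  rw [expMat, trace_mul_comm, ← Matrix.mul_assoc, hU, Matrix.one_mul, trace_diagonal, Complex.re_sum]
  rfl

theorem trace_expMat_pos (hn : 0 < n) {U : Matrix (Fin n) (Fin n) ℂ} (hU : Uᴴ * U = 1)
    (l : Fin n → ℝ) : 0 < (expMat U l).trace.re := by
  rw [trace_expMat hU]
  exact sum_pos (fun _ _ => Real.exp_pos _) ⟨⟨0, hn⟩, mem_univ _⟩

theorem slope_nonneg (hn : 0 < n) {f : Fin 3 → Matrix (Fin n) (Fin n) ℂ} (hf : ∀ k, IsUnit (f k))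
    {w : Fin 3 → ℕ → ℝ}
    (hs : ∀ W, ∑ k, wsum n (w k) (colFlag (f k)) W ≤ 0)
    (ht : ∑ k, wsum n (w k) (colFlag (f k)) ⊤ = 0)
    {U : Matrix (Fin n) (Fin n) ℂ} (hU : Uᴴ * U = 1) {l : Fin n → ℝ} (hl : Monotone l)
    (hl0 : ∑ j, l j = 0) :
    0 ≤ ∑ k, ∑ i ∈ range (n - 1), (w k i - w k (i + 1)) *
      wsum n (extNat hn l) (colFlag U) (colFlag (f k) (i + 1)) := by
  have hR := isFlag_colFlag (isUnit_of_unitary hU)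
  set R := colFlag U
  set L := extNat hn l with hL
  obtain ⟨m, rfl⟩ : ∃ m, n = m + 1 := ⟨n - 1, by omega⟩
  have hL0 : ∑ j ∈ range (m + 1), L j = 0 := by
    rw [← Fin.sum_univ_eq_sum_range, ← hl0]
    exact sum_congr rfl fun j _ => extNat_apply hn l j
  set s : ℕ → ℝ := fun j => ∑ k, wsum (m + 1) (w k) (colFlag (f k)) (R j) with hsdef
  have key : ∀ k, ∀ W, ∑ i ∈ range m, (w k i - w k (i + 1)) * (capDim (colFlag (f k)) W (i + 1) : ℝ) =
      wsum (m + 1) (w k) (colFlag (f k)) W - w k m * finrank ℂ W := by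
    intro k W
    have hF := isFlag_colFlag (hf k)
    have := sum_mul_sub_eq m (w k) (fun i => (capDim (colFlag (f k)) W i : ℝ))
    rw [wsum, this, hF.capDim_top, hF.capDim_zero]
    simp
  have e1 : ∑ k, ∑ i ∈ range m, (w k i - w k (i + 1)) * wsum (m + 1) L R (colFlag (f k) (i + 1)) =
      ∑ j ∈ range (m + 1), L j * (s (j + 1) - s j) - (∑ k, w k m) * ∑ j ∈ range (m + 1), L j := by
    have e2 : ∀ k, ∑ i ∈ range m, (w k i - w k (i + 1)) * wsum (m + 1) L R (colFlag (f k) (i + 1)) =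
        ∑ j ∈ range (m + 1), L j * (wsum (m + 1) (w k) (colFlag (f k)) (R (j + 1)) -
          wsum (m + 1) (w k) (colFlag (f k)) (R j) - w k m) := by
      intro k
      have e3 : ∀ i ∈ range m, (w k i - w k (i + 1)) * wsum (m + 1) L R (colFlag (f k) (i + 1)) =
          ∑ j ∈ range (m + 1), L j * ((w k i - w k (i + 1)) * (capDim (colFlag (f k)) (R (j + 1)) (i + 1) : ℝ)
            - (w k i - w k (i + 1)) * (capDim (colFlag (f k)) (R j) (i + 1) : ℝ)) := by
        intro i _
        rw [wsum, mul_sum]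
        refine sum_congr rfl fun j _ => ?_
        rw [capDim, capDim, capDim, capDim, inf_comm (R (j + 1)), inf_comm (R j)]
        ring
      rw [sum_congr rfl e3, sum_comm]
      refine sum_congr rfl fun j hj => ?_
      have hj := mem_range.1 hj
      rw [← mul_sum, sum_sub_distrib, key, key, hR.rank _ hj, hR.rank _ hj.le]
      push_cast; ring
    rw [sum_congr rfl fun k _ => e2 k, sum_comm, sum_mul_sum, ← sub_eq_zero, sum_comm (s := univ (α := Fin 3)), ← sum_sub_distrib,
      ← sum_sub_distrib]
    refine sum_eq_zero fun j _ => ?_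
    simp only [hsdef, Fin.sum_univ_three]
    ring
  change 0 ≤ ∑ k, ∑ i ∈ range m, _
  rw [e1, hL0, mul_zero, sub_zero]
  have h0 : s 0 = 0 := by
    simp only [hsdef]
    refine sum_eq_zero fun k _ => ?_
    rw [hR.bot, wsum_bot]
  have h1 : s (m + 1) = 0 := by
    simp only [hsdef]; rw [hR.top]; exact ht
  have := abel_le (n := m + 1) (w := fun j => - L j) (D := s) (D' := fun _ => 0)
    (fun i j h => neg_le_neg (extNat_mono hn hl h)) h0 h1 (fun i _ => hs _)
  simp only [neg_mul, sum_neg_distrib, sub_self, mul_zero, sum_const_zero] at this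
  linarith

theorem knF_lower (hn : 0 < n) {f : Fin 3 → Matrix (Fin n) (Fin n) ℂ} (hf : ∀ k, IsUnit (f k))
    {w : Fin 3 → ℕ → ℝ} (hw : ∀ k, Antitone (w k))
    (hs : ∀ W, ∑ k, wsum n (w k) (colFlag (f k)) W ≤ 0)
    (ht : ∑ k, wsum n (w k) (colFlag (f k)) ⊤ = 0) {ε : ℝ} (hε : 0 < ε)
    {U : Matrix (Fin n) (Fin n) ℂ} (hU : Uᴴ * U = 1) {l : Fin n → ℝ} (hl : Monotone l)
    (hl0 : ∑ j, l j = 0) :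
    ∃ C, ∀ T : ℝ, 0 ≤ T → C + ε * (T * l ⟨n - 1, by omega⟩) ≤ knF f w ε (expMat U (T • l)) := by
  have h1 : ∀ k, ∀ i : ℕ, ∃ c > 0, i + 1 ≤ n → ∀ T : ℝ,
      c * Real.exp (T * wsum n (extNat hn l) (colFlag U) (colFlag (f k) (i + 1))) ≤
      gramMinor (f k) (i + 1) (expMat U (T • l)) := by
    intro k i
    by_cases hi : i + 1 ≤ n
    · obtain ⟨c, hc, h⟩ := gramMinor_lower hn (hf k) hU hi l
      exact ⟨c, hc, fun _ => h⟩
    · exact ⟨1, one_pos, fun h => absurd h hi⟩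
  choose c hc h using h1
  refine ⟨∑ k, ∑ i ∈ range (n - 1), (w k i - w k (i + 1)) * Real.log (c k i), fun T hT => ?_⟩
  unfold knF
  refine add_le_add ?_ ?_
  · have h2 : ∑ k, ∑ i ∈ range (n - 1), (w k i - w k (i + 1)) * Real.log (c k i) +
        T * ∑ k, ∑ i ∈ range (n - 1), (w k i - w k (i + 1)) *
          wsum n (extNat hn l) (colFlag U) (colFlag (f k) (i + 1)) ≤
        ∑ k, ∑ i ∈ range (n - 1), (w k i - w k (i + 1)) *
          Real.log (gramMinor (f k) (i + 1) (expMat U (T • l))) := by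
      rw [mul_sum, ← sum_add_distrib]
      refine sum_le_sum fun k _ => ?_
      rw [mul_sum, ← sum_add_distrib]
      refine sum_le_sum fun i hi => ?_
      have hi := mem_range.1 hi
      have h3 := h k i (by omega) T
      have h4 := Real.log_le_log (by have := hc k i; positivity) h3
      rw [Real.log_mul (hc k i).ne' (Real.exp_pos _).ne', Real.log_exp] at h4
      have h5 : 0 ≤ w k i - w k (i + 1) := by have := hw k (Nat.le_succ i); linarith
      nlinarith [mul_le_mul_of_nonneg_left h4 h5]
    have h6 := mul_nonneg hT (slope_nonneg hn hf hs ht hU hl hl0)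
    linarith
  · refine mul_le_mul_of_nonneg_left ?_ hε.le
    rw [trace_expMat hU, Real.le_log_iff_exp_le (sum_pos (fun _ _ => Real.exp_pos _) ⟨⟨0, hn⟩, mem_univ _⟩)]
    exact single_le_sum (f := fun j => Real.exp ((T • l) j)) (fun _ _ => (Real.exp_pos _).le)
      (mem_univ (⟨n - 1, by omega⟩ : Fin n))

theorem knF_convex (hn : 0 < n) {f : Fin 3 → Matrix (Fin n) (Fin n) ℂ} (hf : ∀ k, IsUnit (f k))
    {w : Fin 3 → ℕ → ℝ} (hw : ∀ k, Antitone (w k)) {ε : ℝ} (hε : 0 < ε)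
    {U : Matrix (Fin n) (Fin n) ℂ} (hU : Uᴴ * U = 1) (l : Fin n → ℝ) {T t : ℝ}
    (hT : 0 ≤ T) (hTt : T ≤ t) (ht : 0 < t) :
    knF f w ε (expMat U (T • l)) ≤ (1 - T / t) * knF f w ε 1 +
      T / t * knF f w ε (expMat U (t • l)) := by
  unfold knF
  have h1 : ∑ k, ∑ i ∈ range (n - 1), (w k i - w k (i + 1)) *
        Real.log (gramMinor (f k) (i + 1) (expMat U (T • l))) ≤
      (1 - T / t) * ∑ k, ∑ i ∈ range (n - 1), (w k i - w k (i + 1)) *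
        Real.log (gramMinor (f k) (i + 1) 1) +
      T / t * ∑ k, ∑ i ∈ range (n - 1), (w k i - w k (i + 1)) *
        Real.log (gramMinor (f k) (i + 1) (expMat U (t • l))) := by
    rw [mul_sum, mul_sum, ← sum_add_distrib]
    refine sum_le_sum fun k _ => ?_
    rw [mul_sum, mul_sum, ← sum_add_distrib]
    refine sum_le_sum fun i hi => ?_
    have hi := mem_range.1 hi
    have h3 := log_gramMinor_le hn (hf k) hU (show i + 1 ≤ n by omega) l hT hTt ht
    have h5 : 0 ≤ w k i - w k (i + 1) := by have := hw k (Nat.le_succ i); linarith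
    nlinarith [mul_le_mul_of_nonneg_left h3 h5]
  have h2 : Real.log (expMat U (T • l)).trace.re ≤ (1 - T / t) *
      Real.log (1 : Matrix (Fin n) (Fin n) ℂ).trace.re +
      T / t * Real.log (expMat U (t • l)).trace.re := by
    rw [← expMat_zero hU, trace_expMat hU, trace_expMat hU, trace_expMat hU]
    have := log_sum_exp_le (c := fun _ : Fin n => (1 : ℝ)) (θ := l) (fun _ => zero_le_one)
      (by simpa using hn) hT hTt ht
    simpa using this
  nlinarith [mul_le_mul_of_nonneg_left h2 hε.le]

end SingHorn

namespace SingHorn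

open scoped ComplexOrder
open Module Finset

variable {n : ℕ}

theorem continuous_gramMinor (f : Matrix (Fin n) (Fin n) ℂ) (i : ℕ) : Continuous (gramMinor f i) := by
  unfold gramMinor
  refine Complex.continuous_re.comp (Continuous.matrix_det ?_)
  fun_prop

theorem continuous_trace_re : Continuous fun H : Matrix (Fin n) (Fin n) ℂ => H.trace.re :=
  Complex.continuous_re.comp (continuous_id.matrix_trace)

theorem continuousOn_knF {X : Type*} [TopologicalSpace X] {s : Set X}
    {f : Fin 3 → Matrix (Fin n) (Fin n) ℂ} {w : Fin 3 → ℕ → ℝ} {ε : ℝ}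
    {g : X → Matrix (Fin n) (Fin n) ℂ} (hg : ContinuousOn g s)
    (h1 : ∀ x ∈ s, ∀ k, ∀ i ∈ range (n - 1), gramMinor (f k) (i + 1) (g x) ≠ 0)
    (h2 : ∀ x ∈ s, (g x).trace.re ≠ 0) : ContinuousOn (fun x => knF f w ε (g x)) s := by
  unfold knF
  refine ContinuousOn.add ?_ (continuousOn_const.mul
    (ContinuousOn.log (continuous_trace_re.comp_continuousOn hg) h2))
  refine continuousOn_finsetSum _ fun k _ => continuousOn_finsetSum _ fun i hi => ?_
  exact continuousOn_const.mul
    (ContinuousOn.log ((continuous_gramMinor _ _).comp_continuousOn hg) fun x hx => h1 x hx k i hi)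

theorem continuous_expMat_smul (T : ℝ) :
    Continuous fun x : Matrix (Fin n) (Fin n) ℂ × (Fin n → ℝ) => expMat x.1 (T • x.2) := by
  unfold expMat
  have : Continuous fun x : Matrix (Fin n) (Fin n) ℂ × (Fin n → ℝ) =>
      diagonal fun j => ((Real.exp ((T • x.2) j) : ℝ) : ℂ) :=
    Continuous.matrix_diagonal (by simp only [Pi.smul_apply, smul_eq_mul]; fun_prop)
  exact (continuous_fst.matrix_mul this).matrix_mul continuous_fst.matrix_conjTranspose

/-- Coercivity of the Kempf–Ness function. -/
theorem knF_coercive (hn : 0 < n) {f : Fin 3 → Matrix (Fin n) (Fin n) ℂ} (hf : ∀ k, IsUnit (f k))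
    {w : Fin 3 → ℕ → ℝ} (hw : ∀ k, Antitone (w k))
    (hs : ∀ W, ∑ k, wsum n (w k) (colFlag (f k)) W ≤ 0)
    (ht : ∑ k, wsum n (w k) (colFlag (f k)) ⊤ = 0) {ε : ℝ} (hε : 0 < ε) :
    ∃ R, ∀ U : Matrix (Fin n) (Fin n) ℂ, Uᴴ * U = 1 → ∀ l : Fin n → ℝ, Monotone l →
      ∑ j, l j = 0 → knF f w ε (expMat U l) ≤ knF f w ε 1 → l ⟨n - 1, by omega⟩ ≤ R := by
  by_contra! hcon
  set last : Fin n := ⟨n - 1, by omega⟩ with hlast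
  let K : Set (Matrix (Fin n) (Fin n) ℂ × (Fin n → ℝ)) :=
    {U | Uᴴ * U = 1} ×ˢ ({l | Monotone l ∧ ∑ j, l j = 0 ∧ l last = 1} ∩
      Set.pi Set.univ fun _ => Set.Icc (-(n : ℝ)) 1)
  have hKl : IsClosed {l : Fin n → ℝ | Monotone l ∧ ∑ j, l j = 0 ∧ l last = 1} := by
    refine IsClosed.inter ?_ (IsClosed.inter ?_ ?_)
    · exact isClosed_monotone
    · exact isClosed_eq (by fun_prop) continuous_const
    · exact isClosed_eq (by fun_prop) continuous_const
  have hK : IsCompact K := isCompact_unitary.prod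
    ((isCompact_univ_pi fun _ => isCompact_Icc).inter_left hKl)
  let C : ℕ → Set (Matrix (Fin n) (Fin n) ℂ × (Fin n → ℝ)) := fun N =>
    ⋂ T : Set.Icc (0 : ℝ) N, {x ∈ K | knF f w ε (expMat x.1 ((T : ℝ) • x.2)) ≤ knF f w ε 1}
  have hcont : ∀ T : ℝ, ContinuousOn (fun x : Matrix (Fin n) (Fin n) ℂ × (Fin n → ℝ) =>
      knF f w ε (expMat x.1 (T • x.2))) K := by
    intro T
    refine continuousOn_knF ?_ ?_ ?_
    · exact (continuous_expMat_smul T).continuousOn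
    · intro x hx k i hi
      have hi := mem_range.1 hi
      exact (gramMinor_pos hn (hf k) hx.1 (by omega) _).ne'
    · intro x hx
      exact (trace_expMat_pos hn hx.1 _).ne'
  have hCclosed : ∀ N, IsClosed (C N) := fun N => isClosed_iInter fun T =>
    hK.isClosed.isClosed_le (hcont T) continuousOn_const
  have h0 : ∀ N : ℕ, (0 : ℝ) ∈ Set.Icc (0 : ℝ) N := fun N => ⟨le_rfl, Nat.cast_nonneg _⟩
  have hCK : ∀ N, C N ⊆ K := fun N x hx => (Set.mem_iInter.1 hx ⟨0, h0 N⟩).1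
  have hne : (⋂ N, C N).Nonempty := by
    refine IsCompact.nonempty_iInter_of_sequence_nonempty_isCompact_isClosed C ?_ ?_
      (hK.of_isClosed_subset (hCclosed 0) (hCK 0)) hCclosed
    · intro N x hx
      refine Set.mem_iInter.2 fun T => ?_
      exact Set.mem_iInter.1 hx ⟨T, T.2.1, T.2.2.trans (by push_cast; linarith)⟩
    · intro N
      obtain ⟨U, hU, l, hl, hl0, hF, hR⟩ := hcon N
      set t := l last with htdef
      have ht0 : 0 < t := lt_of_le_of_lt (Nat.cast_nonneg N) hR
      have hle : ∀ j, l j ≤ t := fun j => hl (by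
        rw [hlast, Fin.le_def]; have := j.2; simp only; omega)
      have hge : ∀ j, -(n : ℝ) * t ≤ l j := by
        intro j
        have h1 : ∑ i ∈ univ.erase j, l i ≤ ∑ i ∈ univ.erase j, t := sum_le_sum fun i _ => hle i
        have h2 := add_sum_erase univ l (mem_univ j)
        rw [sum_const, card_erase_of_mem (mem_univ j), card_univ, Fintype.card_fin, nsmul_eq_mul] at h1
        rw [hl0] at h2
        have h3 : ((n - 1 : ℕ) : ℝ) * t ≤ n * t := by
          gcongr; omega
        linarith
      refine ⟨(U, t⁻¹ • l), ?_⟩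
      have hmem : (U, t⁻¹ • l) ∈ K := by
        refine ⟨hU, ⟨?_, ?_, ?_⟩, ?_⟩
        · intro i j hij
          exact mul_le_mul_of_nonneg_left (hl hij) (inv_nonneg.2 ht0.le)
        · simp only [Pi.smul_apply, smul_eq_mul]
          rw [← mul_sum, hl0, mul_zero]
        · simp only [Pi.smul_apply, smul_eq_mul]
          exact inv_mul_cancel₀ ht0.ne'
        · intro j _
          simp only [Pi.smul_apply, smul_eq_mul]
          rw [Set.mem_Icc, inv_mul_eq_div, le_div_iff₀ ht0, div_le_iff₀ ht0]
          exact ⟨hge j, by simpa using hle j⟩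
      refine Set.mem_iInter.2 fun T => ⟨hmem, ?_⟩
      have hTt : (T : ℝ) ≤ t := T.2.2.trans hR.le
      have := knF_convex hn hf hw hε hU (t⁻¹ • l) T.2.1 hTt ht0
      rw [smul_inv_smul₀ ht0.ne'] at this
      refine this.trans ?_
      have h5 : 0 ≤ (T : ℝ) / t := div_nonneg T.2.1 ht0.le
      nlinarith [mul_le_mul_of_nonneg_left hF h5]
  obtain ⟨x, hx⟩ := hne
  have hx' := fun N => Set.mem_iInter.1 hx N
  obtain ⟨hU, ⟨hm, hs0, hl1⟩, -⟩ := hCK 0 (hx' 0)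
  obtain ⟨c, hc⟩ := knF_lower hn hf hw hs ht hε hU hm hs0
  obtain ⟨N, hN⟩ := exists_nat_gt ((knF f w ε 1 - c) / ε)
  have h1 := hc N (Nat.cast_nonneg _)
  have h2 := (Set.mem_iInter.1 (hx' N) ⟨N, Nat.cast_nonneg _, le_rfl⟩).2
  rw [hl1] at h1
  rw [div_lt_iff₀ hε] at hN
  have h2' : knF f w ε (expMat x.1 ((N : ℝ) • x.2)) ≤ knF f w ε 1 := h2
  linarith

theorem polar_expMat (a : Matrix (Fin n) (Fin n) ℂ) (ha : ‖a.det‖ = 1) :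
    ∃ U : Matrix (Fin n) (Fin n) ℂ, ∃ l : Fin n → ℝ, Uᴴ * U = 1 ∧ Monotone l ∧ ∑ j, l j = 0 ∧
      aᴴ * a = expMat U l := by
  have hu : IsUnit a := by
    rw [isUnit_iff_isUnit_det, isUnit_iff_ne_zero]
    intro h; rw [h] at ha; simp at ha
  have hpd : (aᴴ * a).PosDef := Matrix.PosDef.conjTranspose_mul_self _ (mulVec_injective_of_isUnit' hu)
  have hH := hpd.isHermitian
  have hpos : ∀ i, 0 < eigsDesc hH i := fun i => hpd.eigenvalues_pos _
  obtain ⟨U, hU, hd⟩ := spectral_desc hH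
  refine ⟨U.submatrix id Fin.revPerm, fun i => Real.log (eigsDesc hH i.rev), ?_, ?_, ?_, ?_⟩
  · rw [conjTranspose_submatrix]
    have := congrArg (fun M : Matrix (Fin n) (Fin n) ℂ => M.submatrix Fin.revPerm Fin.revPerm) hU
    simp only [submatrix_one_equiv] at this
    rw [← this]
    rfl
  · intro i j hij
    exact Real.log_le_log (hpos _) (eigsDesc_antitone hH (Fin.rev_le_rev.2 hij))
  · have h1 : ∑ j : Fin n, Real.log (eigsDesc hH j.rev) = ∑ j, Real.log (eigsDesc hH j) :=
      Equiv.sum_comp Fin.revPerm (fun j => Real.log (eigsDesc hH j))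
    rw [h1, ← Real.log_prod (fun i _ => (hpos i).ne')]
    have h2 : ((∏ i, eigsDesc hH i : ℝ) : ℂ) = 1 := by
      have h3 := congrArg det hd
      rw [det_mul, det_mul (U * _), det_mul U, mul_right_comm, ← det_mul U, mul_eq_one_comm.1 hU, det_one, one_mul,
        det_diagonal, det_conjTranspose, Complex.star_def, Complex.conj_mul', ha] at h3
      push_cast
      rw [← h3]; simp
    have h4 : ∏ i, eigsDesc hH i = 1 := by exact_mod_cast h2
    rw [h4, Real.log_one]
  · refine hd.trans ?_
    rw [expMat]
    ext i j
    simp only [mul_apply, diagonal_apply, mul_ite, mul_zero, sum_ite_eq', mem_univ, if_true,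
      submatrix_apply, conjTranspose_apply, id]
    rw [← Equiv.sum_comp Fin.revPerm]
    refine sum_congr rfl fun k _ => ?_
    rw [Real.exp_log (hpos _)]
    rfl

theorem knF_exists_min (hn : 0 < n) {f : Fin 3 → Matrix (Fin n) (Fin n) ℂ} (hf : ∀ k, IsUnit (f k))
    {w : Fin 3 → ℕ → ℝ} (hw : ∀ k, Antitone (w k))
    (hs : ∀ W, ∑ k, wsum n (w k) (colFlag (f k)) W ≤ 0)
    (ht : ∑ k, wsum n (w k) (colFlag (f k)) ⊤ = 0) {ε : ℝ} (hε : 0 < ε)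
    {G : Set (Matrix (Fin n) (Fin n) ℂ)} (hG : IsClosed G) (h1 : 1 ∈ G)
    (hdet : ∀ a ∈ G, ‖a.det‖ = 1) :
    ∃ a ∈ G, ∀ b ∈ G, knF f w ε (aᴴ * a) ≤ knF f w ε (bᴴ * b) := by
  obtain ⟨R, hR⟩ := knF_coercive hn hf hw hs ht hε
  have hcont : ContinuousOn (fun a : Matrix (Fin n) (Fin n) ℂ => knF f w ε (aᴴ * a)) G := by
    refine continuousOn_knF (Continuous.continuousOn (by fun_prop)) ?_ ?_
    · intro a ha k i hi
      have hi := mem_range.1 hi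
      obtain ⟨U, l, hU, _, _, h⟩ := polar_expMat a (hdet a ha)
      rw [h]
      exact (gramMinor_pos hn (hf k) hU (by omega) _).ne'
    · intro a ha
      obtain ⟨U, l, hU, _, _, h⟩ := polar_expMat a (hdet a ha)
      rw [h]
      exact (trace_expMat_pos hn hU _).ne'
  let G' := {a ∈ G | knF f w ε (aᴴ * a) ≤ knF f w ε 1}
  have hG' : IsClosed G' := hG.isClosed_le hcont continuousOn_const
  set B := Real.sqrt (n * Real.exp R) with hB
  have hc : IsCompact (Set.pi Set.univ fun _ : Fin n => Set.pi Set.univ fun _ : Fin n =>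
      Metric.closedBall (0 : ℂ) B) :=
    isCompact_univ_pi fun _ => isCompact_univ_pi fun _ => isCompact_closedBall _ _
  have hGc : IsCompact G' := by
    refine hc.of_isClosed_subset hG' ?_
    rintro (a : Matrix (Fin n) (Fin n) ℂ) ⟨haG, haF⟩ i _ j _
    rw [mem_closedBall_zero_iff]
    apply Real.le_sqrt_of_sq_le
    obtain ⟨U, l, hU, hm, hl0, h⟩ := polar_expMat a (hdet a haG)
    rw [h] at haF
    have hlast := hR U hU l hm hl0 haF
    have htr : (aᴴ * a).trace.re ≤ n * Real.exp R := by
      rw [h, trace_expMat hU]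
      calc ∑ j, Real.exp (l j) ≤ ∑ _j : Fin n, Real.exp R := by
            refine sum_le_sum fun j _ => Real.exp_le_exp.2 (le_trans (hm ?_) hlast)
            rw [Fin.le_def]; have := j.2; simp only; omega
        _ = n * Real.exp R := by simp
    refine le_trans ?_ htr
    have e : (aᴴ * a).trace.re = ∑ j, ∑ i, ‖a i j‖ ^ 2 := by
      rw [trace, Complex.re_sum]
      refine sum_congr rfl fun j _ => ?_
      rw [diag_apply, mul_apply, Complex.re_sum]
      refine sum_congr rfl fun i _ => ?_
      rw [conjTranspose_apply, Complex.star_def, Complex.conj_mul', ← Complex.ofReal_pow,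
        Complex.ofReal_re]
    rw [e]
    refine le_trans ?_ (single_le_sum (f := fun j => ∑ i, ‖a i j‖ ^ 2)
      (fun j _ => sum_nonneg fun i _ => by positivity) (mem_univ j))
    exact single_le_sum (f := fun i => ‖a i j‖ ^ 2) (fun i _ => by positivity) (mem_univ i)
  have h1' : (1 : Matrix (Fin n) (Fin n) ℂ) ∈ G' := ⟨h1, by simp⟩
  obtain ⟨a, ha, hmin⟩ := hGc.exists_isMinOn ⟨1, h1'⟩ (hcont.mono fun a ha => ha.1)
  refine ⟨a, ha.1, fun b hb => ?_⟩
  by_cases hbF : knF f w ε (bᴴ * b) ≤ knF f w ε 1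
  · exact hmin ⟨hb, hbF⟩
  · exact ha.2.trans (not_le.1 hbF).le

end SingHorn

namespace SingHorn

open scoped ComplexOrder
open Module Finset

variable {n : ℕ}

theorem posDef_expMat {V : Matrix (Fin n) (Fin n) ℂ} (hV : Vᴴ * V = 1) (l : Fin n → ℝ) :
    (expMat V l).PosDef := by
  unfold expMat
  refine PosDef.mul_mul_conjTranspose_same ?_ ?_
  · rw [posDef_diagonal_iff]
    intro i
    exact_mod_cast Real.exp_pos (l i)
  · have := (isUnit_of_unitary hV)
    exact Matrix.vecMul_injective_of_isUnit this

theorem isUnit_of_norm_det {a : Matrix (Fin n) (Fin n) ℂ} (ha : ‖a.det‖ = 1) : IsUnit a := by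
  rw [isUnit_iff_isUnit_det, isUnit_iff_ne_zero]
  intro h; rw [h] at ha; simp at ha

theorem firstCols_conj_one {U : Matrix (Fin n) (Fin n) ℂ} (hU : Uᴴ * U = 1) (i : ℕ) :
    (firstCols U i)ᴴ * firstCols U i = 1 := by
  rw [firstCols, conjTranspose_submatrix]
  ext x y
  have := congrFun (congrFun hU x) y
  simp only [mul_apply, submatrix_apply, id, one_apply, Subtype.ext_iff] at this ⊢
  rw [this]

theorem firstCols_injective {U : Matrix (Fin n) (Fin n) ℂ} (hU : Uᴴ * U = 1) (i : ℕ) :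
    Function.Injective (firstCols U i).mulVec := by
  intro x y h
  have := congrArg (fun v => (firstCols U i)ᴴ *ᵥ v) h
  simpa [mulVec_mulVec, firstCols_conj_one hU] using this

theorem gramMinor_one {U : Matrix (Fin n) (Fin n) ℂ} (hU : Uᴴ * U = 1) (i : ℕ) :
    gramMinor U i 1 = 1 := by
  rw [gramMinor, Matrix.mul_one, firstCols_conj_one hU, det_one, Complex.one_re]

theorem gramMinor_conj_eq (hn : 0 < n) {f a U : Matrix (Fin n) (Fin n) ℂ} (hf : IsUnit f)
    (ha : ‖a.det‖ = 1) (hU : Uᴴ * U = 1) {i : ℕ} (hi : i ≤ n) (h : colFlag U i = colFlag (a * f) i) :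
    0 < gramMinor f i (aᴴ * a) ∧
    ∀ M, gramMinor f i (aᴴ * M * a) = gramMinor f i (aᴴ * a) * gramMinor U i M := by
  have hpos : 0 < gramMinor f i (aᴴ * a) := by
    obtain ⟨V, l, hV, _, _, e⟩ := polar_expMat a ha
    rw [e]; exact gramMinor_pos hn hf hV hi l
  refine ⟨hpos, ?_⟩
  have h1 : ∀ j : {j : Fin n // (j : ℕ) < i}, ∃ c, firstCols U i *ᵥ c = fun b => (a * f) b j := by
    intro j
    apply mem_colFlag_firstCols
    rw [h, mem_colFlag]
    refine ⟨Pi.single j.1 1, fun b hb => ?_, ?_⟩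
    · rw [Pi.single_apply, if_neg]
      rintro rfl
      exact absurd j.2 (not_lt.2 hb)
    · ext b; simp
  choose c hc using h1
  let T : Matrix {j : Fin n // (j : ℕ) < i} {j : Fin n // (j : ℕ) < i} ℂ := Matrix.of fun x y => c y x
  have hT : a * firstCols f i = firstCols U i * T := by
    ext b j
    have := congrFun (hc j) b
    simp only [mulVec, dotProduct, mul_apply] at this ⊢
    exact this.symm
  have h2 : ∀ M, gramMinor f i (aᴴ * M * a) = ‖T.det‖ ^ 2 * gramMinor U i M := by
    intro M
    have : (firstCols f i)ᴴ * (aᴴ * M * a) * firstCols f i =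
        Tᴴ * ((firstCols U i)ᴴ * M * firstCols U i) * T := by
      calc _ = (a * firstCols f i)ᴴ * M * (a * firstCols f i) := by
            simp only [conjTranspose_mul, Matrix.mul_assoc]
        _ = _ := by rw [hT]; simp only [conjTranspose_mul, Matrix.mul_assoc]
    rw [gramMinor, this, det_mul, det_mul, mul_right_comm, det_conjTranspose, Complex.star_def,
      Complex.conj_mul', gramMinor, ← Complex.ofReal_pow, Complex.re_ofReal_mul]
  have h3 := h2 1
  rw [Matrix.mul_one, gramMinor_one hU, mul_one] at h3
  intro M
  rw [h3, h2]

/-- Upper bound for the increment of one term of the Kempf–Ness function. -/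
theorem log_gramMinor_conj_le (hn : 0 < n) {f a U V : Matrix (Fin n) (Fin n) ℂ} (hf : IsUnit f)
    (ha : ‖a.det‖ = 1) (hU : Uᴴ * U = 1) (hV : Vᴴ * V = 1) (l : Fin n → ℝ) {i : ℕ} (hi : i ≤ n)
    (h : colFlag U i = colFlag (a * f) i) :
    Real.log (gramMinor f i (aᴴ * expMat V l * a)) ≤ Real.log (gramMinor f i (aᴴ * a)) +
      ∑ j : {j : Fin n // (j : ℕ) < i}, (((Uᴴ * expMat V l * U) j j).re - 1) := by
  obtain ⟨hp, hM⟩ := gramMinor_conj_eq hn hf ha hU hi h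
  have hpd : ((firstCols U i)ᴴ * expMat V l * firstCols U i).PosDef :=
    (posDef_expMat hV l).conjTranspose_mul_mul_same (firstCols_injective hU i)
  have hp2 : 0 < gramMinor U i (expMat V l) := by
    have := hpd.det_pos
    exact (Complex.pos_iff.1 this).1
  rw [hM, Real.log_mul hp.ne' hp2.ne']
  have h4 := log_det_le_trace hpd
  have e : ((firstCols U i)ᴴ * expMat V l * firstCols U i).trace.re - Fintype.card {j : Fin n // (j : ℕ) < i}
      = ∑ j : {j : Fin n // (j : ℕ) < i}, (((Uᴴ * expMat V l * U) j j).re - 1) := by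
    rw [sum_sub_distrib, sum_const, card_univ, nsmul_eq_mul, mul_one, trace, Complex.re_sum]
    rfl
  rw [e] at h4
  have h5 : Real.log (gramMinor U i (expMat V l)) ≤ _ := h4
  linarith

theorem log_knF_sum_le (hn : 0 < n) {f a U V : Matrix (Fin n) (Fin n) ℂ} (hf : IsUnit f)
    (ha : ‖a.det‖ = 1) (hU : Uᴴ * U = 1) (hV : Vᴴ * V = 1) (l : Fin n → ℝ)
    (h : ∀ i ≤ n, colFlag U i = colFlag (a * f) i) {w : ℕ → ℝ} (hw : Antitone w) :
    ∑ i ∈ range (n - 1), (w i - w (i + 1)) * Real.log (gramMinor f (i + 1) (aᴴ * expMat V l * a)) ≤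
      ∑ i ∈ range (n - 1), (w i - w (i + 1)) * Real.log (gramMinor f (i + 1) (aᴴ * a)) +
      ((U * diagonal (fun j : Fin n => (w j : ℂ)) * Uᴴ * expMat V l).trace.re - ∑ j : Fin n, w j
        - w (n - 1) * ((expMat V l).trace.re - n)) := by
  set g : Fin n → ℝ := fun j => ((Uᴴ * expMat V l * U) j j).re - 1 with hg
  let D : ℕ → ℝ := fun i => ∑ j : Fin n, if (j : ℕ) < i then g j else 0
  have hD : ∀ i, D i = ∑ j : {j : Fin n // (j : ℕ) < i}, g j := by
    intro i
    simp only [D]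
    rw [← sum_filter]
    exact sum_subtype _ (by simp) g
  obtain ⟨m, rfl⟩ : ∃ m, n = m + 1 := ⟨n - 1, by omega⟩
  have h1 : ∀ i ∈ range m, (w i - w (i + 1)) * Real.log (gramMinor f (i + 1) (aᴴ * expMat V l * a)) ≤
      (w i - w (i + 1)) * Real.log (gramMinor f (i + 1) (aᴴ * a)) + (w i - w (i + 1)) * D (i + 1) := by
    intro i hi
    have hi := mem_range.1 hi
    rw [← mul_add, hD]
    refine mul_le_mul_of_nonneg_left ?_ (by have := hw (Nat.le_succ i); linarith)
    exact log_gramMinor_conj_le hn hf ha hU hV l (by omega) (h _ (by omega))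
  have h2 := sum_le_sum h1
  rw [sum_add_distrib] at h2
  have h3 := sum_mul_sub_eq m w D
  have h4 : ∑ i ∈ range (m + 1), w i * (D (i + 1) - D i) = ∑ j : Fin (m + 1), w j * g j := by
    rw [← Fin.sum_univ_eq_sum_range (fun i => w i * (D (i + 1) - D i))]
    refine sum_congr rfl fun j _ => ?_
    congr 1
    simp only [D]
    rw [← sum_sub_distrib, sum_eq_single j]
    · simp
    · intro b _ hb
      have : (b : ℕ) ≠ j := fun h => hb (Fin.ext h)
      by_cases hbj : (b : ℕ) < j
      · rw [if_pos (by omega), if_pos hbj, sub_self]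
      · rw [if_neg (by omega), if_neg hbj, sub_self]
    · simp
  have h5 : D 0 = 0 := by simp [D]
  have h6 : D (m + 1) = (expMat V l).trace.re - (m + 1 : ℕ) := by
    have : D (m + 1) = ∑ j, g j := sum_congr rfl fun j _ => if_pos j.2
    rw [this]
    simp only [hg]
    rw [sum_sub_distrib, ← Complex.re_sum]
    have e : ∑ j, (Uᴴ * expMat V l * U) j j = (Uᴴ * expMat V l * U).trace := rfl
    rw [e, trace_mul_comm, ← Matrix.mul_assoc, mul_eq_one_comm.1 hU, Matrix.one_mul]
    simp
  have h7 : ∑ j : Fin (m + 1), w j * g j =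
      (U * diagonal (fun j : Fin (m + 1) => (w j : ℂ)) * Uᴴ * expMat V l).trace.re
        - ∑ j : Fin (m + 1), w j := by
    have e : (U * diagonal (fun j : Fin (m + 1) => (w j : ℂ)) * Uᴴ * expMat V l).trace =
        (diagonal (fun j : Fin (m + 1) => (w j : ℂ)) * (Uᴴ * expMat V l * U)).trace := by
      rw [Matrix.mul_assoc, Matrix.mul_assoc, trace_mul_comm]
      simp only [Matrix.mul_assoc]
    rw [e, trace, Complex.re_sum, ← sum_sub_distrib]
    refine sum_congr rfl fun j _ => ?_
    rw [diag_apply, diagonal_mul, Complex.re_ofReal_mul]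
    simp only [hg]; ring
  rw [h4, h7, h5, h6] at h3
  simp only [Nat.add_sub_cancel] at h2 ⊢
  linarith

end SingHorn

namespace SingHorn

open scoped ComplexOrder
open Module Finset

variable {n : ℕ}

/-- The Hermitian matrix with eigenvector matrix `U` and eigenvalues `w`. -/
noncomputable def diagConj (U : Matrix (Fin n) (Fin n) ℂ) (w : ℕ → ℝ) : Matrix (Fin n) (Fin n) ℂ :=
  U * diagonal (fun j : Fin n => (w j : ℂ)) * Uᴴ

theorem isHermitian_diagConj (U : Matrix (Fin n) (Fin n) ℂ) (w : ℕ → ℝ) :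
    (diagConj U w).IsHermitian := by
  unfold diagConj
  rw [IsHermitian, conjTranspose_mul, conjTranspose_mul, conjTranspose_conjTranspose,
    diagonal_conjTranspose, Matrix.mul_assoc]
  congr 3
  ext j; simp

theorem conj_diagonal_mul {V : Matrix (Fin n) (Fin n) ℂ} (hV : Vᴴ * V = 1) (d e : Fin n → ℂ) :
    V * diagonal d * Vᴴ * (V * diagonal e * Vᴴ) = V * diagonal (fun j => d j * e j) * Vᴴ := by
  calc _ = V * diagonal d * (Vᴴ * V) * diagonal e * Vᴴ := by simp only [Matrix.mul_assoc]
    _ = V * (diagonal d * diagonal e) * Vᴴ := by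
      rw [hV, Matrix.mul_one]; simp only [Matrix.mul_assoc]
    _ = _ := by rw [diagonal_mul_diagonal]

theorem trace_conj_diagonal {V : Matrix (Fin n) (Fin n) ℂ} (hV : Vᴴ * V = 1) (d e : Fin n → ℂ) :
    (V * diagonal d * Vᴴ * (V * diagonal e * Vᴴ)).trace = ∑ j, d j * e j := by
  rw [conj_diagonal_mul hV, trace_mul_comm, ← Matrix.mul_assoc, hV, Matrix.one_mul, trace_diagonal]

theorem trace_conj_expMat (a V : Matrix (Fin n) (Fin n) ℂ) (l : Fin n → ℝ) :
    (aᴴ * expMat V l * a).trace.re = ∑ j, Real.exp (l j) * ∑ i, ‖(Vᴴ * a) j i‖ ^ 2 := by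
  have e : aᴴ * expMat V l * a = (Vᴴ * a)ᴴ * (diagonal (fun j => (Real.exp (l j) : ℂ)) * (Vᴴ * a)) := by
    simp only [expMat, conjTranspose_mul, conjTranspose_conjTranspose, Matrix.mul_assoc]
  rw [e, trace, Complex.re_sum]
  simp_rw [mul_sum]
  rw [sum_comm]
  refine sum_congr rfl fun i _ => ?_
  rw [diag_apply, mul_apply, Complex.re_sum]
  refine sum_congr rfl fun j _ => ?_
  rw [diagonal_mul, conjTranspose_apply, Complex.star_def, mul_left_comm, Complex.conj_mul',
    ← Complex.ofReal_pow, ← Complex.ofReal_mul, Complex.ofReal_re]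

/-- A family of exponentials minimised at the origin is critical there. -/
theorem sum_mul_eq_zero_of_exp_nonneg {β d : Fin n → ℝ}
    (h : ∀ s : ℝ, 0 ≤ ∑ j, β j * (Real.exp (s * d j) - 1)) : ∑ j, β j * d j = 0 := by
  have hd : HasDerivAt (fun s : ℝ => ∑ j, β j * (Real.exp (s * d j) - 1)) (∑ j, β j * d j) 0 := by
    refine HasDerivAt.fun_sum fun j _ => ?_
    have h1 : HasDerivAt (fun s : ℝ => Real.exp (s * d j)) (Real.exp (0 * d j) * (1 * d j)) 0 :=
      ((hasDerivAt_id (0 : ℝ)).mul_const (d j)).exp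
    have h2 := (h1.sub_const 1).const_mul (β j)
    simpa using h2
  refine IsLocalMin.hasDerivAt_eq_zero (Filter.Eventually.of_forall fun s => ?_) hd
  simpa using h s

theorem knF_crit (hn : 0 < n) {f : Fin 3 → Matrix (Fin n) (Fin n) ℂ} (hf : ∀ k, IsUnit (f k))
    {w : Fin 3 → ℕ → ℝ} (hw : ∀ k, Antitone (w k)) {ε : ℝ} (hε : 0 < ε)
    (hw0 : ∑ k, ∑ j : Fin n, w k j = 0)
    {a V : Matrix (Fin n) (Fin n) ℂ} (ha : ‖a.det‖ = 1) {U : Fin 3 → Matrix (Fin n) (Fin n) ℂ}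
    (hU : ∀ k, (U k)ᴴ * U k = 1) (hV : Vᴴ * V = 1) {d : Fin n → ℝ}
    (h : ∀ k, ∀ i ≤ n, colFlag (U k) i = colFlag (a * f k) i)
    (hA : ∑ k, diagConj (U k) (w k) = V * diagonal (fun j => (d j : ℂ)) * Vᴴ)
    (hmin : ∀ s : ℝ, knF f w ε (aᴴ * a) ≤ knF f w ε (aᴴ * expMat V (s • d) * a)) :
    ∑ j, d j ^ 2 ≤ ε ^ 2 := by
  set τ := (aᴴ * a).trace.re with hτ
  set ν : Fin n → ℝ := fun j => ∑ i, ‖(Vᴴ * a) j i‖ ^ 2 with hν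
  have hτν : τ = ∑ j, ν j := by
    have := trace_conj_expMat a V 0
    rw [expMat_zero hV, Matrix.mul_one] at this
    simpa using this
  have hτpos : 0 < τ := by
    obtain ⟨V', l, hV', _, _, e⟩ := polar_expMat a ha
    rw [hτ, e]; exact trace_expMat_pos hn hV' l
  have hν0 : ∀ j, 0 ≤ ν j := fun j => sum_nonneg fun i _ => by positivity
  set κ := ∑ k, w k (n - 1) with hκ
  have hd0 : ∑ j, d j = 0 := by
    have h1 := congrArg (fun M => (Matrix.trace M).re) hA
    simp only [trace_sum, diagConj] at h1
    have h2 : ∀ k, (U k * diagonal (fun j : Fin n => (w k j : ℂ)) * (U k)ᴴ).trace =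
        ((∑ j : Fin n, w k j : ℝ) : ℂ) := fun k => by
      rw [trace_mul_comm, ← Matrix.mul_assoc, hU k, Matrix.one_mul, trace_diagonal]; push_cast; rfl
    simp only [h2] at h1
    rw [trace_mul_comm, ← Matrix.mul_assoc, hV, Matrix.one_mul, trace_diagonal, ← Complex.ofReal_sum,
      ← Complex.ofReal_sum, Complex.ofReal_re, Complex.ofReal_re, hw0] at h1
    exact h1.symm
  have key : ∀ s : ℝ, 0 ≤ ∑ j, (d j - κ + ε * ν j / τ) * (Real.exp (s * d j) - 1) := by
    intro s
    have h1 := hmin s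
    unfold knF at h1
    have h2 : ∀ k, _ := fun k => log_knF_sum_le hn (hf k) ha (hU k) hV (s • d) (h k) (hw k)
    have h3 := sum_le_sum (s := univ) fun k _ => h2 k
    rw [sum_add_distrib, sum_sub_distrib, sum_sub_distrib, hw0, ← sum_mul, ← hκ, ← Complex.re_sum,
      ← trace_sum, ← Matrix.sum_mul] at h3
    have hA' : ∑ k, U k * diagonal (fun j : Fin n => (w k j : ℂ)) * (U k)ᴴ = _ := hA
    rw [hA', expMat, trace_conj_diagonal hV, ← expMat, trace_expMat hV] at h3
    have h4 : (aᴴ * expMat V (s • d) * a).trace.re = ∑ j, Real.exp (s * d j) * ν j :=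
      trace_conj_expMat a V (s • d)
    have h5 : 0 < (aᴴ * expMat V (s • d) * a).trace.re := by
      rw [h4]
      by_contra hcon
      have hz : ∀ j ∈ univ, Real.exp (s * d j) * ν j = 0 :=
        (sum_eq_zero_iff_of_nonneg fun j _ => mul_nonneg (Real.exp_pos _).le (hν0 j)).1
          (le_antisymm (not_lt.1 hcon) (sum_nonneg fun j _ => mul_nonneg (Real.exp_pos _).le (hν0 j)))
      have : τ = 0 := by
        rw [hτν]
        exact sum_eq_zero fun j hj => (mul_eq_zero.1 (hz j hj)).resolve_left (Real.exp_pos _).ne'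
      exact hτpos.ne' this
    have h6 : Real.log (aᴴ * expMat V (s • d) * a).trace.re ≤ Real.log τ +
        ((aᴴ * expMat V (s • d) * a).trace.re / τ - 1) := by
      have := Real.log_le_sub_one_of_pos (div_pos h5 hτpos)
      rw [Real.log_div h5.ne' hτpos.ne'] at this
      linarith
    have h7 := mul_le_mul_of_nonneg_left h6 hε.le
    rw [h4] at h7
    have h8 : (∑ j, (d j : ℂ) * (Real.exp ((s • d) j) : ℂ)).re = ∑ j, d j * Real.exp (s * d j) := by
      rw [Complex.re_sum]
      refine sum_congr rfl fun j _ => ?_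
      rw [← Complex.ofReal_mul, Complex.ofReal_re]; rfl
    rw [h8] at h3
    have h9 : ∑ j, (d j - κ + ε * ν j / τ) * (Real.exp (s * d j) - 1) =
        ∑ j, d j * Real.exp (s * d j) - ∑ j, d j - κ * (∑ j, Real.exp (s * d j) - n) +
        ε * ((∑ j, Real.exp (s * d j) * ν j) / τ - 1) := by
      have : (1 : ℝ) = (∑ j, ν j) / τ := by rw [← hτν, div_self hτpos.ne']
      conv_rhs => rw [this]
      have hn' : (n : ℝ) = ∑ _j : Fin n, (1 : ℝ) := by simp
      rw [hn', sum_div, sum_div, ← sum_sub_distrib, ← sum_sub_distrib, ← sum_sub_distrib, mul_sum,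
        mul_sum, ← sum_sub_distrib, ← sum_add_distrib]
      refine sum_congr rfl fun j _ => ?_
      ring
    rw [h9, hd0]
    simp only [Pi.smul_apply, smul_eq_mul] at h3
    rw [h4] at h1
    linarith
  have h1 := sum_mul_eq_zero_of_exp_nonneg key
  have h2 : ∑ j, d j ^ 2 + ε / τ * ∑ j, ν j * d j = 0 := by
    rw [← h1]
    have : ∑ j, (d j - κ + ε * ν j / τ) * d j =
        ∑ j, d j ^ 2 - κ * ∑ j, d j + ε / τ * ∑ j, ν j * d j := by
      rw [mul_sum, mul_sum, ← sum_sub_distrib, ← sum_add_distrib]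
      exact sum_congr rfl fun j _ => by ring
    rw [this, hd0]; ring
  set D := Real.sqrt (∑ j, d j ^ 2) with hD
  have hDs : D ^ 2 = ∑ j, d j ^ 2 := Real.sq_sqrt (sum_nonneg fun j _ => sq_nonneg _)
  have hD0 : 0 ≤ D := Real.sqrt_nonneg _
  have hdj : ∀ j, -d j ≤ D := by
    intro j
    refine (neg_le_abs _).trans (Real.abs_le_sqrt ?_)
    exact single_le_sum (f := fun j => d j ^ 2) (fun j _ => sq_nonneg _) (mem_univ j)
  have h3 : -∑ j, ν j * d j ≤ τ * D := by
    rw [hτν, sum_mul, ← sum_neg_distrib]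
    refine sum_le_sum fun j _ => ?_
    nlinarith [mul_le_mul_of_nonneg_left (hdj j) (hν0 j)]
  have h4 : D ^ 2 ≤ ε * D := by
    rw [hDs]
    have h5 : ε / τ * (-∑ j, ν j * d j) ≤ ε / τ * (τ * D) :=
      mul_le_mul_of_nonneg_left h3 (by positivity)
    have h6 : ε / τ * (τ * D) = ε * D := by field_simp
    linarith
  rw [← hDs]
  nlinarith

theorem expMat_mul {V : Matrix (Fin n) (Fin n) ℂ} (hV : Vᴴ * V = 1) (l l' : Fin n → ℝ) :
    expMat V l * expMat V l' = expMat V (l + l') := by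
  unfold expMat
  rw [conj_diagonal_mul hV]
  congr 3
  ext j
  rw [← Complex.ofReal_mul, ← Real.exp_add]
  rfl

/-- Kempf–Ness: a semistable configuration of three weighted flags is equivalent, up to a limit in
a closed set of transformations, to one whose weighted spectral projections add up to zero. -/
theorem kempf_ness (hn : 0 < n) {f : Fin 3 → Matrix (Fin n) (Fin n) ℂ} (hf : ∀ k, IsUnit (f k))
    {w : Fin 3 → ℕ → ℝ} (hw : ∀ k, Antitone (w k))
    (hs : ∀ W, ∑ k, wsum n (w k) (colFlag (f k)) W ≤ 0)
    (ht : ∑ k, wsum n (w k) (colFlag (f k)) ⊤ = 0)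
    {G : Set (Matrix (Fin n) (Fin n) ℂ)} (hG : IsClosed G) (h1 : 1 ∈ G)
    (hdet : ∀ a ∈ G, ‖a.det‖ = 1) {Z : Set (Fin 3 → Matrix (Fin n) (Fin n) ℂ)} (hZ : IsClosed Z)
    (hGZ : ∀ a ∈ G, ∀ U : Fin 3 → Matrix (Fin n) (Fin n) ℂ, (∀ k, (U k)ᴴ * U k = 1) →
      (∀ k, ∀ i ≤ n, colFlag (U k) i = colFlag (a * f k) i) → U ∈ Z)
    (hGe : ∀ a ∈ G, ∀ U ∈ Z, ∀ V : Matrix (Fin n) (Fin n) ℂ, ∀ d : Fin n → ℝ, (∀ k, (U k)ᴴ * U k = 1) →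
      Vᴴ * V = 1 → ∑ k, diagConj (U k) (w k) = V * diagonal (fun j => (d j : ℂ)) * Vᴴ →
      ∀ s : ℝ, expMat V (s • d) * a ∈ G) :
    ∃ U ∈ Z, (∀ k, (U k)ᴴ * U k = 1) ∧ ∑ k, diagConj (U k) (w k) = 0 := by
  have hw0 : ∑ k, ∑ j : Fin n, w k j = 0 := by
    rw [← ht]
    refine sum_congr rfl fun k _ => ?_
    rw [(isFlag_colFlag (hf k)).wsum_top, ← Fin.sum_univ_eq_sum_range]
  let φ : (Fin 3 → Matrix (Fin n) (Fin n) ℂ) → ℝ := fun U =>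
    ((∑ k, diagConj (U k) (w k))ᴴ * ∑ k, diagConj (U k) (w k)).trace.re
  have hφ : Continuous φ := by
    refine continuous_trace_re.comp ?_
    unfold diagConj
    fun_prop
  have hsmall : ∀ ε : ℝ, 0 < ε → ∃ U ∈ Z, (∀ k, (U k)ᴴ * U k = 1) ∧ φ U ≤ ε ^ 2 := by
    intro ε hε
    obtain ⟨a, ha, hmin⟩ := knF_exists_min hn hf hw hs ht hε hG h1 hdet
    have haf : ∀ k, ∃ U : Matrix (Fin n) (Fin n) ℂ, Uᴴ * U = 1 ∧ ∀ i ≤ n, colFlag U i = colFlag (a * f k) i := by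
      intro k
      have := exists_unitary_flag (isFlag_colFlag ((isUnit_of_norm_det (hdet a ha)).mul (hf k)))
      exact this
    choose U hU hUf using haf
    have hUZ := hGZ a ha U hU hUf
    have hH : (∑ k, diagConj (U k) (w k)).IsHermitian := by
      rw [IsHermitian, conjTranspose_sum]
      exact sum_congr rfl fun k _ => isHermitian_diagConj _ _
    obtain ⟨V, hV, hd⟩ := spectral_desc hH
    refine ⟨U, hUZ, hU, ?_⟩
    have := knF_crit hn hf hw hε hw0 (hdet a ha) hU hV (d := eigsDesc hH) hUf hd (fun s => ?_)
    · refine le_trans (le_of_eq ?_) this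
      have e : ((∑ k, diagConj (U k) (w k))ᴴ * ∑ k, diagConj (U k) (w k)) =
        V * diagonal (fun j => (eigsDesc hH j : ℂ)) * Vᴴ * (V * diagonal (fun j => (eigsDesc hH j : ℂ)) * Vᴴ) := by
        rw [hH, ← hd]
      simp only [φ]
      rw [e, trace_conj_diagonal hV, Complex.re_sum]
      refine sum_congr rfl fun j _ => ?_
      rw [← Complex.ofReal_mul, Complex.ofReal_re, sq]
    · have h2 := hmin _ (hGe a ha U hUZ V (eigsDesc hH) hU hV hd (s / 2))
      have e : (expMat V ((s / 2) • eigsDesc hH) * a)ᴴ * (expMat V ((s / 2) • eigsDesc hH) * a) =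
          aᴴ * expMat V (s • eigsDesc hH) * a := by
        have h3 : (expMat V ((s / 2) • eigsDesc hH))ᴴ * expMat V ((s / 2) • eigsDesc hH) =
            expMat V (s • eigsDesc hH) := by
          rw [(posDef_expMat hV _).isHermitian]
          rw [expMat_mul hV, ← add_smul, add_halves]
        rw [conjTranspose_mul, ← h3]
        simp only [Matrix.mul_assoc]
      rw [e] at h2
      exact h2
  let K : Set (Fin 3 → Matrix (Fin n) (Fin n) ℂ) := Set.pi Set.univ (fun _ => {U | Uᴴ * U = 1}) ∩ Z
  have hK : IsCompact K := (isCompact_univ_pi fun _ => isCompact_unitary).inter_right hZ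
  obtain ⟨U₀, hU₀Z, hU₀, _⟩ := hsmall 1 one_pos
  obtain ⟨U, hUK, hmin⟩ := hK.exists_isMinOn ⟨U₀, fun k _ => hU₀ k, hU₀Z⟩ hφ.continuousOn
  refine ⟨U, hUK.2, fun k => hUK.1 k (Set.mem_univ k), ?_⟩
  have hle : ∀ ε : ℝ, 0 < ε → φ U ≤ ε ^ 2 := fun ε hε => by
    obtain ⟨U', hZ', hU', hφ'⟩ := hsmall ε hε
    exact (hmin ⟨fun k _ => hU' k, hZ'⟩ : φ U ≤ φ U').trans hφ'
  have hφ0 : φ U ≤ 0 := by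
    by_contra hcon
    push Not at hcon
    have h3 := hle (Real.sqrt (φ U / 2)) (by positivity)
    rw [Real.sq_sqrt (by positivity)] at h3
    linarith
  set A := ∑ k, diagConj (U k) (w k) with hA
  have hps : (Aᴴ * A).PosSemidef := posSemidef_conjTranspose_mul_self A
  have h4 : (Aᴴ * A).trace = 0 := by
    have h5 := hps.trace_nonneg
    rw [Complex.nonneg_iff] at h5
    apply Complex.ext
    · exact le_antisymm hφ0 h5.1
    · exact h5.2.symm
  exact trace_conjTranspose_mul_self_eq_zero_iff.1 h4

end SingHorn

namespace SingHorn

open scoped ComplexOrder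
open Module Finset

section Restrict

variable {E : Type*} [AddCommGroup E] [Module ℂ E] [FiniteDimensional ℂ E]
variable {N r : ℕ} {F : ℕ → Submodule ℂ E} {V : Submodule ℂ E} {e : ℕ → ℕ}

/-- The cutting points of a list of jumps. -/
def cutPt (e : ℕ → ℕ) : ℕ → ℕ
  | 0 => 0
  | j + 1 => e j + 1

theorem cutPt_mono (he : StrictMono e) : Monotone (cutPt e) := by
  refine monotone_nat_of_le_succ fun j => ?_
  cases j with
  | zero => simp [cutPt]
  | succ j => simp only [cutPt]; have := he (Nat.lt_add_one j); omega

theorem lt_cutPt (he : StrictMono e) {i j : ℕ} : e i < cutPt e j ↔ i < j := by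
  cases j with
  | zero => simp [cutPt]
  | succ j => simp only [cutPt, Nat.lt_succ_iff]; exact he.le_iff_le

theorem cutPt_le (hF : IsFlag N F) (hp : pos N F V = (range r).image e) {j : ℕ}
    (hj : j ≤ r) : cutPt e j ≤ N := by
  cases j with
  | zero => simp [cutPt]
  | succ j =>
    have : e j ∈ pos N F V := by rw [hp]; exact mem_image_of_mem _ (mem_range.2 hj)
    exact (hF.mem_pos.1 this).1

/-- The flag induced on a subspace, in coordinates. -/
def restrictFlag (φ : (Fin r → ℂ) →ₗ[ℂ] E) (F : ℕ → Submodule ℂ E) (e : ℕ → ℕ) (j : ℕ) :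
    Submodule ℂ (Fin r → ℂ) := (F (cutPt e j)).comap φ

variable {φ : (Fin r → ℂ) →ₗ[ℂ] E}

theorem capDim_restrictFlag (hφ : Function.Injective φ) (W : Submodule ℂ (Fin r → ℂ)) (j : ℕ) :
    capDim (restrictFlag φ F e) W j = capDim F (W.map φ) (cutPt e j) := by
  have : (W ⊓ (F (cutPt e j)).comap φ).map φ = W.map φ ⊓ F (cutPt e j) := by
    ext v
    constructor
    · rintro ⟨u, ⟨h1, h2⟩, rfl⟩; exact ⟨⟨u, h1, rfl⟩, h2⟩
    · rintro ⟨⟨u, h1, rfl⟩, h2⟩; exact ⟨u, ⟨h1, h2⟩, rfl⟩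
  rw [capDim, restrictFlag, capDim, ← this, finrank_map_of_injective hφ]

theorem isFlag_restrictFlag (hF : IsFlag N F) (he : StrictMono e)
    (hp : pos N F V = (range r).image e) (hφ : Function.Injective φ) (hr : LinearMap.range φ = V) :
    IsFlag r (restrictFlag φ F e) := by
  have hrank : ∀ j ≤ r, finrank ℂ (restrictFlag φ F e j) = j := by
    intro j hj
    have h := capDim_restrictFlag (F := F) (e := e) hφ ⊤ j
    rw [capDim, top_inf_eq] at h
    rw [h, Submodule.map_top, hr, hF.capDim_eq_card (cutPt_le hF hp hj), hp]
    have : ((range r).image e).filter (· < cutPt e j) = (range j).image e := by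
      ext i
      simp only [mem_filter, mem_image, mem_range]
      constructor
      · rintro ⟨⟨a, ha, rfl⟩, h⟩; exact ⟨a, (lt_cutPt he).1 h, rfl⟩
      · rintro ⟨a, ha, rfl⟩; exact ⟨⟨a, ha.trans_le hj, rfl⟩, (lt_cutPt he).2 ha⟩
    rw [this, card_image_of_injective _ he.injective, card_range]
  refine ⟨fun i j h => Submodule.comap_mono (hF.mono (cutPt_mono he h)), hrank, ?_⟩
  apply Submodule.eq_top_of_finrank_eq
  rw [hrank r le_rfl, finrank_fin_fun]

theorem wsum_restrictFlag (hF : IsFlag N F) (he : StrictMono e)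
    (hp : pos N F V = (range r).image e) (hφ : Function.Injective φ) (hr : LinearMap.range φ = V)
    (w : ℕ → ℝ) (W : Submodule ℂ (Fin r → ℂ)) :
    wsum r (fun j => w (e j)) (restrictFlag φ F e) W = wsum N w F (W.map φ) := by
  have hF' := isFlag_restrictFlag hF he hp hφ hr
  have hsub : pos N F (W.map φ) ⊆ (range r).image e := by
    rw [← hp]; exact hF.pos_mono (by rw [← hr]; exact LinearMap.map_le_range)
  rw [hF'.wsum_eq, hF.wsum_eq]
  have : pos N F (W.map φ) = (pos r (restrictFlag φ F e) W).image e := by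
    have key : ∀ j < r, (e j ∈ pos N F (W.map φ) ↔ j ∈ pos r (restrictFlag φ F e) W) := by
      intro j hj
      rw [hF'.mem_pos, capDim_restrictFlag hφ, capDim_restrictFlag hφ,
        hF.capDim_eq_card (cutPt_le hF hp hj.le), hF.capDim_eq_card (cutPt_le hF hp hj)]
      constructor
      · intro h
        refine ⟨hj, card_lt_card ?_⟩
        refine ⟨fun i hi => ?_, fun h' => ?_⟩
        · rw [mem_filter] at hi ⊢
          exact ⟨hi.1, hi.2.trans_le (cutPt_mono he (Nat.le_succ j))⟩
        · have : e j ∈ (pos N F (W.map φ)).filter (· < cutPt e (j + 1)) :=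
            mem_filter.2 ⟨h, (lt_cutPt he).2 (Nat.lt_succ_self j)⟩
          exact lt_irrefl _ ((lt_cutPt he).1 (mem_filter.1 (h' this)).2)
      · rintro ⟨-, h⟩
        by_contra hc
        refine h.not_ge (card_le_card fun i hi => ?_)
        rw [mem_filter] at hi ⊢
        refine ⟨hi.1, ?_⟩
        obtain ⟨a, -, rfl⟩ := mem_image.1 (hsub hi.1)
        rw [lt_cutPt he] at hi ⊢
        have : a ≠ j := by rintro rfl; exact hc hi.1
        omega
    ext i
    constructor
    · intro hi
      obtain ⟨a, ha, rfl⟩ := mem_image.1 (hsub hi)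
      exact mem_image_of_mem _ ((key a (mem_range.1 ha)).1 hi)
    · intro hi
      obtain ⟨a, ha, rfl⟩ := mem_image.1 hi
      exact (key a (hF'.mem_pos.1 ha).1).2 ha
  rw [this, sum_image he.injective.injOn]

end Restrict

theorem det_expMat {n : ℕ} {U : Matrix (Fin n) (Fin n) ℂ} (hU : Uᴴ * U = 1) (l : Fin n → ℝ) :
    (expMat U l).det = Real.exp (∑ j, l j) := by
  rw [expMat, det_mul_comm, ← Matrix.mul_assoc, hU, Matrix.one_mul, det_diagonal, Real.exp_sum]
  push_cast; rfl

/-- Semistability of flags on a space yields Hermitian matrices of zero sum with prescribed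
eigenvalues. -/
theorem exists_hermitian_of_semistable {r : ℕ} (hr : 0 < r) {f : Fin 3 → Matrix (Fin r) (Fin r) ℂ}
    (hf : ∀ k, IsUnit (f k)) {w : Fin 3 → ℕ → ℝ} (hw : ∀ k, Antitone (w k))
    (hs : ∀ W, ∑ k, wsum r (w k) (colFlag (f k)) W ≤ 0)
    (ht : ∑ k, wsum r (w k) (colFlag (f k)) ⊤ = 0) :
    ∃ U : Fin 3 → Matrix (Fin r) (Fin r) ℂ, (∀ k, (U k)ᴴ * U k = 1) ∧
      ∑ k, diagConj (U k) (w k) = 0 := by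
  have hG : IsClosed {a : Matrix (Fin r) (Fin r) ℂ | ‖a.det‖ = 1} :=
    isClosed_eq (by fun_prop) continuous_const
  obtain ⟨U, -, h1, h2⟩ := kempf_ness hr hf hw hs ht hG (by simp) (fun a ha => ha) isClosed_univ
    (fun _ _ _ _ _ => Set.mem_univ _) (by
      intro a ha U _ V d hU hV hsum s
      have ha : ‖a.det‖ = 1 := ha
      change ‖(expMat V (s • d) * a).det‖ = 1
      have hd : ∑ j, d j = 0 := by
        have h := congrArg trace hsum
        rw [trace_mul_comm, ← Matrix.mul_assoc, hV, Matrix.one_mul, trace_diagonal, trace_sum] at h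
        have h' : ∀ k, (diagConj (U k) (w k)).trace = ((∑ j ∈ range r, w k j : ℝ) : ℂ) := by
          intro k
          rw [diagConj, trace_mul_comm, ← Matrix.mul_assoc, hU, Matrix.one_mul, trace_diagonal,
            ← Fin.sum_univ_eq_sum_range]
          push_cast; rfl
        simp only [h'] at h
        have ht' : ∑ k, ∑ j ∈ range r, w k j = 0 := by
          rw [← ht]
          exact sum_congr rfl fun k _ => ((isFlag_colFlag (hf k)).wsum_top _).symm
        have : ((∑ k, ∑ j ∈ range r, w k j : ℝ) : ℂ) = ((∑ j, d j : ℝ) : ℂ) := by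
          push_cast at h ⊢; exact h
        rw [← Complex.ofReal_inj, ← this, ht']
      rw [det_mul, det_expMat hV, norm_mul, ha, mul_one]
      have : ∑ j, (s • d) j = 0 := by
        simp only [Pi.smul_apply, smul_eq_mul, ← mul_sum, hd, mul_zero]
      rw [this]; simp)
  exact ⟨U, h1, h2⟩

theorem eigsDesc_diagConj {r : ℕ} {U : Matrix (Fin r) (Fin r) ℂ} (hU : Uᴴ * U = 1) {w : ℕ → ℝ}
    (hw : Antitone w) : eigsDesc (isHermitian_diagConj U w) = fun a : Fin r => w a := by
  rw [eigsDesc_eq_iff _ (fun i j h => hw h)]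
  exact charpoly_unitary_conj hU _

/-- Semistability of the flags induced on a subspace `V` gives a point of the Horn cone. -/
theorem horn_of_semistable {E : Type*} [AddCommGroup E] [Module ℂ E] [FiniteDimensional ℂ E]
    {N r : ℕ} (hr : 0 < r) {F : Fin 3 → ℕ → Submodule ℂ E} (hF : ∀ k, IsFlag N (F k))
    {V : Submodule ℂ E} (hV : finrank ℂ V = r) {w : Fin 3 → ℕ → ℝ} (hw : ∀ k, Antitone (w k))
    (hs : ∀ W ≤ V, ∑ k, wsum N (w k) (F k) W ≤ 0) (ht : ∑ k, wsum N (w k) (F k) V = 0)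
    {e : Fin 3 → ℕ → ℕ} (he : ∀ k, StrictMono (e k))
    (hp : ∀ k, pos N (F k) V = (range r).image (e k)) :
    ((fun a : Fin r => w 0 (e 0 a), fun a : Fin r => w 1 (e 1 a), fun a : Fin r => w 2 (e 2 a)) :
      (Fin r → ℝ) × (Fin r → ℝ) × (Fin r → ℝ)) ∈ Horn r := by
  obtain ⟨φ, hφ, hφr⟩ : ∃ φ : (Fin r → ℂ) →ₗ[ℂ] E, Function.Injective φ ∧ LinearMap.range φ = V := by
    let ε : (Fin r → ℂ) ≃ₗ[ℂ] V := LinearEquiv.ofFinrankEq _ _ (by rw [finrank_fin_fun, hV])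
    refine ⟨V.subtype ∘ₗ ε.toLinearMap, V.injective_subtype.comp ε.injective, ?_⟩
    rw [LinearMap.range_comp, LinearEquiv.range, Submodule.map_top, Submodule.range_subtype]
  have hfl : ∀ k, IsFlag r (restrictFlag φ (F k) (e k)) := fun k =>
    isFlag_restrictFlag (hF k) (he k) (hp k) hφ hφr
  choose f hf hfF using fun k => exists_unitary_flag (hfl k)
  have hcap : ∀ k W, wsum r (fun j => w k (e k j)) (colFlag (f k)) W = wsum N (w k) (F k) (W.map φ) := by
    intro k W
    rw [← wsum_restrictFlag (hF k) (he k) (hp k) hφ hφr]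
    refine sum_congr rfl fun i hi => ?_
    have hi := mem_range.1 hi
    rw [capDim, capDim, hfF k _ hi, hfF k _ hi.le]; rfl
  have hwe : ∀ k, Antitone fun j => w k (e k j) := fun k => (hw k).comp_monotone (he k).monotone
  obtain ⟨U, hU, hsum⟩ := exists_hermitian_of_semistable hr (fun k => isUnit_of_unitary (hf k)) hwe
    (fun W => by
      simp only [hcap]
      exact hs _ (by rw [← hφr]; exact LinearMap.map_le_range))
    (by simp only [hcap]; rw [Submodule.map_top, hφr]; exact ht)
  refine ⟨_, _, _, isHermitian_diagConj (U 0) fun j => w 0 (e 0 j),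
    isHermitian_diagConj (U 1) fun j => w 1 (e 1 j),
    isHermitian_diagConj (U 2) fun j => w 2 (e 2 j), ?_, eigsDesc_diagConj (hU 0) (hwe 0),
    eigsDesc_diagConj (hU 1) (hwe 1), eigsDesc_diagConj (hU 2) (hwe 2)⟩
  rw [← hsum, Fin.sum_univ_three]

end SingHorn

namespace SingHorn

open scoped ComplexOrder
open Module Finset

/-- The involution reversing the first and last `q` indices of `0, …, p + q - 1`. -/
def revIdx (p q i : ℕ) : ℕ := if i < q ∨ p ≤ i then p + q - 1 - i else i

theorem revIdx_lt {p q i : ℕ} (hi : i < p + q) : revIdx p q i < p + q := by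
  unfold revIdx; split_ifs <;> omega

theorem revIdx_revIdx {p q i : ℕ} (hi : i < p + q) :
    revIdx p q (revIdx p q i) = i := by
  unfold revIdx; split_ifs <;> omega

variable {p q : ℕ}

/-- The matrix of a Hermitian form of signature `(p, q)` adapted to the standard flag. -/
def J0 (p q : ℕ) : Matrix (Fin (p + q)) (Fin (p + q)) ℂ :=
  Matrix.of fun i j => if revIdx p q i = j then 1 else 0

theorem J0_mulVec (v : Fin (p + q) → ℂ) (i : Fin (p + q)) :
    (J0 p q *ᵥ v) i = v ⟨revIdx p q i, revIdx_lt i.2⟩ := by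
  simp only [J0, mulVec, dotProduct, of_apply, ite_mul, one_mul, zero_mul]
  rw [sum_eq_single ⟨revIdx p q i, revIdx_lt i.2⟩]
  · simp
  · intro b _ hb; rw [if_neg]; intro h; exact hb (Fin.ext h.symm)
  · simp

theorem J0_mul_self : J0 p q * J0 p q = 1 := by
  apply Matrix.ext_of_mulVec_single
  intro i
  rw [← mulVec_mulVec]
  ext j
  rw [J0_mulVec, J0_mulVec, one_mulVec]
  congr 1
  exact Fin.ext (revIdx_revIdx j.2)

theorem J0_conjTranspose : (J0 p q)ᴴ = J0 p q := by
  ext i j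
  simp only [J0, conjTranspose_apply, of_apply]
  have : revIdx p q j = i ↔ revIdx p q i = j := by
    constructor <;> intro h <;> rw [← h] <;> exact revIdx_revIdx (Fin.is_lt _)
  simp only [this]
  split_ifs <;> simp

theorem trace_J0 (hpq : q ≤ p) : (J0 p q).trace = (p : ℂ) - q := by
  simp only [trace, Matrix.diag, J0, of_apply]
  rw [Fin.sum_univ_eq_sum_range (fun i => if revIdx p q i = i then (1 : ℂ) else 0), ← sum_filter,
    sum_const, nsmul_eq_mul, mul_one]
  have : (range (p + q)).filter (fun i => revIdx p q i = i) = Ico q p := by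
    ext i
    rw [Finset.mem_filter, Finset.mem_range, Finset.mem_Ico, revIdx]
    split_ifs <;> omega
  rw [this, Nat.card_Ico, Nat.cast_sub hpq]

/-- A unitary matrix diagonalising `J0`. -/
theorem exists_diag_J0 (hpq : q ≤ p) : ∃ Q : Matrix (Fin (p + q)) (Fin (p + q)) ℂ, Qᴴ * Q = 1 ∧
    J0 p q * Q = Q * diagonal (fun i : Fin (p + q) => if (i : ℕ) < p then (1 : ℂ) else -1) := by
  have hJ : (J0 p q).IsHermitian := J0_conjTranspose
  obtain ⟨U, hU, hJU⟩ := spectral_desc hJ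
  set d := eigsDesc hJ with hd
  have hanti : Antitone d := eigsDesc_antitone hJ
  have hJU' : J0 p q * U = U * diagonal (fun i => (d i : ℂ)) := by
    conv_lhs => rw [hJU, Matrix.mul_assoc, hU, Matrix.mul_one]
  have hsq : ∀ i, d i = 1 ∨ d i = -1 := by
    intro i
    have h1 : diagonal (fun i => (d i : ℂ)) * diagonal (fun i => (d i : ℂ)) = 1 := by
      calc _ = Uᴴ * U * (diagonal (fun i => (d i : ℂ)) * diagonal (fun i => (d i : ℂ))) := by
            rw [hU, Matrix.one_mul]
        _ = Uᴴ * (U * diagonal (fun i => (d i : ℂ)) * diagonal (fun i => (d i : ℂ))) := by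
            simp only [Matrix.mul_assoc]
        _ = Uᴴ * (J0 p q * (J0 p q * U)) := by rw [← hJU', Matrix.mul_assoc, ← hJU']
        _ = Uᴴ * (J0 p q * J0 p q * U) := by simp only [Matrix.mul_assoc]
        _ = 1 := by rw [J0_mul_self, Matrix.one_mul, hU]
    have h2 := congrFun (congrFun h1 i) i
    rw [diagonal_mul_diagonal, diagonal_apply_eq, one_apply_eq] at h2
    have h3 : d i * d i = 1 := by exact_mod_cast h2
    exact mul_self_eq_one_iff.1 h3
  have hsum : ∑ i, d i = (p : ℝ) - q := by
    have h := trace_J0 hpq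
    rw [hJU, trace_mul_comm, ← Matrix.mul_assoc, hU, Matrix.one_mul, trace_diagonal] at h
    exact_mod_cast h
  refine ⟨U, hU, ?_⟩
  rw [hJU']
  congr 2
  ext i
  let S := univ.filter fun i => d i = 1
  have hS : (S.card : ℝ) = p := by
    have h1 : ∑ i, (d i + 1) = 2 * S.card := by
      have : ∀ i, d i + 1 = if d i = 1 then 2 else 0 := by
        intro i
        rcases hsq i with h | h
        · rw [if_pos h, h]; norm_num
        · rw [if_neg (by rw [h]; norm_num), h]; norm_num
      simp only [this]
      rw [← sum_filter, sum_const, nsmul_eq_mul, mul_comm]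
    rw [sum_add_distrib, hsum] at h1
    simp at h1
    linarith
  have hS : S.card = p := by exact_mod_cast hS
  split_ifs with hi
  · rcases hsq i with h | h
    · simp [h]
    · exfalso
      have : S ⊆ Finset.Iio i := by
        intro j hj
        rw [Finset.mem_Iio]
        by_contra hc
        have h1 := hanti (not_lt.1 hc)
        have h2 : d j = 1 := (mem_filter.1 hj).2
        rw [h, h2] at h1; norm_num at h1
      have := card_le_card this
      rw [Fin.card_Iio] at this
      omega
  · rcases hsq i with h | h
    · exfalso
      have : Finset.Iic i ⊆ S := by
        intro j hj
        have h1 := hanti (Finset.mem_Iic.1 hj)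
        refine mem_filter.2 ⟨mem_univ _, ?_⟩
        rcases hsq j with h2 | h2
        · exact h2
        · rw [h, h2] at h1; norm_num at h1
      have := card_le_card this
      rw [Fin.card_Iic] at this
      omega
    · simp [h]

end SingHorn

namespace SingHorn

open scoped ComplexOrder
open Module Finset

variable {p q : ℕ}

theorem J0_coord_orth {i : ℕ} (h : i ≤ q ∨ p ≤ i) (hi : i ≤ p + q)
    {c c' : Fin (p + q) → ℂ}
    (hc : c ∈ coord (p + q) i) (hc' : c' ∈ coord (p + q) (p + q - i)) :
    star c ⬝ᵥ (J0 p q *ᵥ c') = 0 := by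
  refine sum_eq_zero fun a _ => ?_
  rw [J0_mulVec]
  by_cases ha : i ≤ a
  · simp [hc a ha]
  · rw [hc' ⟨revIdx p q a, revIdx_lt a.2⟩, mul_zero]
    simp only [revIdx]
    have := a.2
    split_ifs <;> omega

/-- The unitary group of the form `J0`. -/
def formGroup (p q : ℕ) : Set (Matrix (Fin (p + q)) (Fin (p + q)) ℂ) :=
  {g | gᴴ * J0 p q * g = J0 p q}

theorem mem_formGroup {g : Matrix (Fin (p + q)) (Fin (p + q)) ℂ} :
    g ∈ formGroup p q ↔ gᴴ * J0 p q * g = J0 p q := Iff.rfl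

theorem form_mulVec {g : Matrix (Fin (p + q)) (Fin (p + q)) ℂ} (hg : g ∈ formGroup p q)
    (u v : Fin (p + q) → ℂ) :
    star (g *ᵥ u) ⬝ᵥ (J0 p q *ᵥ (g *ᵥ v)) = star u ⬝ᵥ (J0 p q *ᵥ v) := by
  rw [star_mulVec, ← dotProduct_mulVec, mulVec_mulVec, mulVec_mulVec,
    mem_formGroup.1 hg]

theorem isUnit_J0 : IsUnit (J0 p q) := IsUnit.of_mul_eq_one _ J0_mul_self

theorem formGroup_mul {g g' : Matrix (Fin (p + q)) (Fin (p + q)) ℂ} (hg : g ∈ formGroup p q)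
    (hg' : g' ∈ formGroup p q) : g * g' ∈ formGroup p q := by
  rw [mem_formGroup] at *
  calc (g * g')ᴴ * J0 p q * (g * g') = g'ᴴ * (gᴴ * J0 p q * g) * g' := by
        rw [conjTranspose_mul]; simp only [Matrix.mul_assoc]
    _ = _ := by rw [hg, hg']

theorem formGroup_one : (1 : Matrix (Fin (p + q)) (Fin (p + q)) ℂ) ∈ formGroup p q := by
  simp [mem_formGroup]

theorem norm_det_formGroup {g : Matrix (Fin (p + q)) (Fin (p + q)) ℂ} (hg : g ∈ formGroup p q) :
    ‖g.det‖ = 1 := by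
  have h := congrArg det (mem_formGroup.1 hg)
  have hJ : (J0 p q).det ≠ 0 := by
    have := isUnit_J0 (p := p) (q := q)
    rw [isUnit_iff_isUnit_det, isUnit_iff_ne_zero] at this; exact this
  rw [det_mul, det_mul, det_conjTranspose, mul_right_comm] at h
  have h1 : star g.det * g.det = 1 := mul_right_cancel₀ hJ (by rw [h, one_mul])
  have h2 := congrArg norm h1
  rw [norm_mul, norm_star, norm_one] at h2
  nlinarith [norm_nonneg g.det]

theorem isClosed_formGroup : IsClosed (formGroup p q) := by
  refine isClosed_eq ?_ continuous_const
  fun_prop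

/-- A unitary matrix mapping coordinate subspaces to orthogonals of coordinate subspaces. -/
theorem unitary_block_zero {n : ℕ} {M : Matrix (Fin n) (Fin n) ℂ} (hM : Mᴴ * M = 1)
    (hM' : Mᴴ = M) {i : ℕ} (hi : i ≤ n)
    (h : ∀ a b : Fin n, (a : ℕ) < i → (b : ℕ) < n - i → M a b = 0) {a b : Fin n}
    (hab : M a b ≠ 0) : i ≤ a ↔ (b : ℕ) < n - i := by
  let P : ℕ → Matrix (Fin n) (Fin n) ℂ := fun j => diagonal fun a => if (a : ℕ) < j then 1 else 0
  have hP : ∀ j, P j * P j = P j := by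
    intro j; simp only [P, diagonal_mul_diagonal]; congr 1; ext a; split_ifs <;> simp
  have hPt : ∀ j ≤ n, (P j).trace = (j : ℂ) := by
    intro j hj
    simp only [P, trace_diagonal]
    rw [Fin.sum_univ_eq_sum_range (fun a => if a < j then (1 : ℂ) else 0), ← sum_filter, sum_const,
      nsmul_eq_mul, mul_one]
    congr 1
    rw [show (range n).filter (· < j) = range j by ext a; simp; omega, card_range]
  have hPs : ∀ j, (P j)ᴴ = P j := by
    intro j
    simp only [P, diagonal_conjTranspose]
    congr 1; ext a; simp only [Pi.star_apply]; split_ifs <;> simp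
  have hMM : M * M = 1 := by rw [hM'] at hM; exact hM
  have h0 : P i * M * P (n - i) = 0 := by
    ext a b
    simp only [P, mul_diagonal, diagonal_mul, Matrix.zero_apply]
    by_cases h1 : (a : ℕ) < i <;> by_cases h2 : (b : ℕ) < n - i <;> simp [h1, h2]
    exact h a b h1 h2
  have h0' : P (n - i) * M * P i = 0 := by
    have := congrArg conjTranspose h0
    rwa [conjTranspose_mul, conjTranspose_mul, hPs, hPs, hM', conjTranspose_zero,
      ← Matrix.mul_assoc] at this
  let R := 1 - P i - M * P (n - i) * M
  have hRs : Rᴴ = R := by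
    simp only [R, conjTranspose_sub, conjTranspose_mul, hPs, hM', conjTranspose_one,
      Matrix.mul_assoc]
  have e1 : P i * (M * P (n - i) * M) = 0 := by
    rw [← Matrix.mul_assoc, ← Matrix.mul_assoc, h0, Matrix.zero_mul]
  have e2 : M * P (n - i) * M * P i = 0 := by
    rw [Matrix.mul_assoc, Matrix.mul_assoc, ← Matrix.mul_assoc _ M, h0', Matrix.mul_zero]
  have e3 : M * P (n - i) * M * (M * P (n - i) * M) = M * P (n - i) * M := by
    calc _ = M * P (n - i) * (M * M) * P (n - i) * M := by simp only [Matrix.mul_assoc]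
      _ = M * (P (n - i) * P (n - i)) * M := by rw [hMM, Matrix.mul_one]; simp only [Matrix.mul_assoc]
      _ = _ := by rw [hP]
  have hRR : R * R = R := by
    simp only [R, Matrix.sub_mul, Matrix.mul_sub, Matrix.one_mul, Matrix.mul_one, hP, e1, e2, e3]
    abel
  have htr : (Rᴴ * R).trace = 0 := by
    rw [hRs, hRR]
    simp only [R, trace_sub, trace_one, Fintype.card_fin]
    rw [trace_mul_comm, ← Matrix.mul_assoc, hMM, Matrix.one_mul, hPt _ hi, hPt _ (Nat.sub_le _ _),
      Nat.cast_sub hi]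
    ring
  have hR : R = 0 := trace_conjTranspose_mul_self_eq_zero_iff.1 htr
  have key : M * P (n - i) = (1 - P i) * M := by
    have : 1 - P i = M * P (n - i) * M := by
      rw [← sub_eq_zero]; exact hR
    rw [this, Matrix.mul_assoc, hMM, Matrix.mul_one]
  have := congrFun (congrFun key a) b
  simp only [P, mul_diagonal, Matrix.sub_mul, Matrix.one_mul, Matrix.sub_apply, diagonal_mul] at this
  by_cases h1 : (b : ℕ) < n - i <;> by_cases h2 : (a : ℕ) < i <;> simp [h1, h2, hab] at this ⊢
  · omega
  · exact hab this.symm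

end SingHorn

namespace SingHorn

open scoped ComplexOrder
open Module Finset

variable {p q : ℕ}

theorem col_mem_colFlag {n : ℕ} (U : Matrix (Fin n) (Fin n) ℂ) {a : Fin n} {i : ℕ}
    (h : (a : ℕ) < i) : U *ᵥ Pi.single a 1 ∈ colFlag U i :=
  ⟨Pi.single a 1, fun b hb => by rw [Pi.single_apply, if_neg]; rintro rfl; omega, rfl⟩

theorem form_entry (U J : Matrix (Fin (p + q)) (Fin (p + q)) ℂ) (a b : Fin (p + q)) :
    (Uᴴ * J * U) a b = star (U *ᵥ Pi.single a 1) ⬝ᵥ (J *ᵥ (U *ᵥ Pi.single b 1)) := by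
  rw [star_mulVec, ← dotProduct_mulVec, mulVec_mulVec, mulVec_mulVec]
  simp [Pi.star_single, Matrix.mul_assoc]

theorem unitary_mul_self {n : ℕ} {U : Matrix (Fin n) (Fin n) ℂ} (hU : Uᴴ * U = 1) : U * Uᴴ = 1 :=
  mul_eq_one_comm.1 hU

theorem diagConj_anticomm (hpq : q ≤ p) {g U : Matrix (Fin (p + q)) (Fin (p + q)) ℂ}
    (hg : g ∈ formGroup p q) (hU : Uᴴ * U = 1)
    (h : ∀ i ≤ p + q, colFlag U i = colFlag g i) (x : Fin q → ℝ) :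
    J0 p q * diagConj U (xhat p q x) + diagConj U (xhat p q x) * J0 p q = 0 := by
  let M := Uᴴ * J0 p q * U
  have hUU := unitary_mul_self hU
  have hM' : Mᴴ = M := by
    simp only [M, conjTranspose_mul, conjTranspose_conjTranspose, J0_conjTranspose,
      Matrix.mul_assoc]
  have hM : Mᴴ * M = 1 := by
    rw [hM']
    calc M * M = Uᴴ * J0 p q * (U * Uᴴ) * J0 p q * U := by simp only [M, Matrix.mul_assoc]
      _ = Uᴴ * (J0 p q * J0 p q) * U := by rw [hUU, Matrix.mul_one]; simp only [Matrix.mul_assoc]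
      _ = 1 := by rw [J0_mul_self, Matrix.mul_one, hU]
  have hz : ∀ i ≤ p + q, i ≤ q ∨ p ≤ i → ∀ a b : Fin (p + q), M a b ≠ 0 →
      (i ≤ a ↔ (b : ℕ) < p + q - i) := by
    intro i hi hi' a b hab
    refine unitary_block_zero hM hM' hi (fun a b ha hb => ?_) hab
    have h1 := col_mem_colFlag U ha
    have h2 := col_mem_colFlag U hb
    rw [h i hi] at h1
    rw [h _ (Nat.sub_le _ _)] at h2
    obtain ⟨c, hc, hc1⟩ := h1
    obtain ⟨c', hc', hc1'⟩ := h2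
    change g *ᵥ c = _ at hc1
    change g *ᵥ c' = _ at hc1'
    change (Uᴴ * J0 p q * U) a b = 0
    rw [form_entry, ← hc1, ← hc1', form_mulVec hg]
    exact J0_coord_orth hi' hi hc hc'
  have key : ∀ a b : Fin (p + q), M a b * ((xhat p q x b + xhat p q x a : ℝ) : ℂ) = 0 := by
    intro a b
    by_cases hab : M a b = 0
    · rw [hab, zero_mul]
    have hlt := a.2
    have : xhat p q x b + xhat p q x a = 0 := by
      by_cases ha : (a : ℕ) < q ∨ p ≤ a
      · have h1 := hz a (by omega) (by omega) a b hab
        have h2 := hz (a + 1) (by omega) (by omega) a b hab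
        have : (b : ℕ) = p + q - 1 - a := by omega
        rw [this, xhat_rev hpq x a.2]; ring
      · have h1 := hz q (by omega) (by omega) a b hab
        have h2 := hz p (by omega) (by omega) a b hab
        rw [xhat_mid x (by omega) (by omega), xhat_mid x (by omega) (by omega)]; ring
    rw [this]; simp
  let D : Matrix (Fin (p + q)) (Fin (p + q)) ℂ := diagonal fun j => (xhat p q x j : ℂ)
  have hMD : M * D + D * M = 0 := by
    ext a b
    have := key a b
    simp only [D, Matrix.add_apply, mul_diagonal, diagonal_mul, Matrix.zero_apply]
    rw [← this]; push_cast; ring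
  have hJ : J0 p q = U * M * Uᴴ := by
    calc J0 p q = (U * Uᴴ) * J0 p q * (U * Uᴴ) := by rw [hUU, Matrix.one_mul, Matrix.mul_one]
      _ = _ := by simp only [M, Matrix.mul_assoc]
  calc J0 p q * diagConj U (xhat p q x) + diagConj U (xhat p q x) * J0 p q
      = U * (M * (Uᴴ * U) * D) * Uᴴ + U * (D * (Uᴴ * U) * M) * Uᴴ := by
        rw [hJ]; simp only [diagConj, D, Matrix.mul_assoc]
    _ = U * (M * D + D * M) * Uᴴ := by
        rw [hU, Matrix.mul_one, Matrix.mul_one, Matrix.mul_add, Matrix.add_mul]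
    _ = 0 := by rw [hMD, Matrix.mul_zero, Matrix.zero_mul]

theorem expMat_mem_formGroup {V : Matrix (Fin (p + q)) (Fin (p + q)) ℂ} (hV : Vᴴ * V = 1)
    {d : Fin (p + q) → ℝ}
    (h : J0 p q * (V * diagonal (fun j => (d j : ℂ)) * Vᴴ) +
      V * diagonal (fun j => (d j : ℂ)) * Vᴴ * J0 p q = 0) (s : ℝ) :
    expMat V (s • d) ∈ formGroup p q := by
  have hVV := unitary_mul_self hV
  let W := Vᴴ * J0 p q * V
  have hW : W * diagonal (fun j => (d j : ℂ)) + diagonal (fun j => (d j : ℂ)) * W = 0 := by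
    calc _ = Vᴴ * J0 p q * V * diagonal (fun j => (d j : ℂ)) * (Vᴴ * V) +
          (Vᴴ * V) * diagonal (fun j => (d j : ℂ)) * (Vᴴ * J0 p q * V) := by
          rw [hV, Matrix.mul_one, Matrix.one_mul]
      _ = Vᴴ * (J0 p q * (V * diagonal (fun j => (d j : ℂ)) * Vᴴ) +
          V * diagonal (fun j => (d j : ℂ)) * Vᴴ * J0 p q) * V := by
          rw [Matrix.mul_add, Matrix.add_mul]; simp only [Matrix.mul_assoc]
      _ = 0 := by rw [h, Matrix.mul_zero, Matrix.zero_mul]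
  have hent : ∀ a b, W a b = 0 ∨ d b = - d a := by
    intro a b
    have := congrFun (congrFun hW a) b
    simp only [Matrix.add_apply, mul_diagonal, diagonal_mul, Matrix.zero_apply] at this
    have h2 : W a b * ((d b + d a : ℝ) : ℂ) = 0 := by rw [← this]; push_cast; ring
    rcases mul_eq_zero.1 h2 with h3 | h3
    · exact Or.inl h3
    · right
      have : d b + d a = 0 := by exact_mod_cast h3
      linarith
  have hexp : W * diagonal (fun j => (Real.exp ((s • d) j) : ℂ)) =
      diagonal (fun j => (Real.exp ((-(s • d)) j) : ℂ)) * W := by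
    ext a b
    simp only [mul_diagonal, diagonal_mul]
    rcases hent a b with h3 | h3
    · rw [h3]; ring
    · simp only [Pi.smul_apply, Pi.neg_apply, h3, smul_neg]; ring
  have hcomm : J0 p q * expMat V (s • d) = expMat V (-(s • d)) * J0 p q := by
    calc J0 p q * expMat V (s • d) = (V * Vᴴ) * (J0 p q * expMat V (s • d)) := by
          rw [hVV, Matrix.one_mul]
      _ = V * (W * diagonal (fun j => (Real.exp ((s • d) j) : ℂ))) * Vᴴ := by
          simp only [W, expMat, Matrix.mul_assoc]
      _ = V * diagonal (fun j => (Real.exp ((-(s • d)) j) : ℂ)) * Vᴴ * J0 p q * (V * Vᴴ) := by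
          rw [hexp]; simp only [W, Matrix.mul_assoc]
      _ = _ := by rw [hVV, Matrix.mul_one]; rfl
  have hherm : (expMat V (s • d))ᴴ = expMat V (s • d) := by
    simp only [expMat, conjTranspose_mul, conjTranspose_conjTranspose, diagonal_conjTranspose,
      Matrix.mul_assoc]
    congr 3; ext j
    simp only [Pi.star_apply, Complex.star_def, Complex.conj_ofReal]
  rw [mem_formGroup, hherm, Matrix.mul_assoc, hcomm, ← Matrix.mul_assoc, expMat_mul hV,
    add_neg_cancel, expMat_zero hV, Matrix.one_mul]

theorem sum_xhat (hpq : q ≤ p) (x : Fin q → ℝ) : ∑ i ∈ range (p + q), xhat p q x i = 0 := by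
  have h := sum_range_reflect (xhat p q x) (p + q)
  have : ∑ i ∈ range (p + q), xhat p q x (p + q - 1 - i) = - ∑ i ∈ range (p + q), xhat p q x i := by
    rw [← sum_neg_distrib]
    exact sum_congr rfl fun i hi => xhat_rev hpq x (mem_range.1 hi)
  linarith

theorem exists_block_of_anticomm {Q : Matrix (Fin (p + q)) (Fin (p + q)) ℂ}
    (hJQ : J0 p q * Q = Q * diagonal (fun i : Fin (p + q) => if (i : ℕ) < p then (1 : ℂ) else -1))
    {A : Matrix (Fin (p + q)) (Fin (p + q)) ℂ} (hA : A.IsHermitian)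
    (h : J0 p q * A + A * J0 p q = 0) :
    (Qᴴ * A * Q).submatrix finSumFinEquiv finSumFinEquiv =
      fromBlocks 0 ((Qᴴ * A * Q).submatrix finSumFinEquiv finSumFinEquiv).toBlocks₁₂
        ((Qᴴ * A * Q).submatrix finSumFinEquiv finSumFinEquiv).toBlocks₁₂ᴴ 0 := by
  set B := Qᴴ * A * Q with hB
  set ε : Fin (p + q) → ℂ := fun i => if (i : ℕ) < p then (1 : ℂ) else -1 with hε
  have hQJ : Qᴴ * J0 p q = diagonal ε * Qᴴ := by
    have := congrArg conjTranspose hJQ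
    rw [conjTranspose_mul, conjTranspose_mul, J0_conjTranspose, diagonal_conjTranspose] at this
    rw [this]; congr 2
    ext i; simp only [Pi.star_apply, hε]; split_ifs <;> simp
  have hBe : diagonal ε * B + B * diagonal ε = 0 := by
    calc _ = (diagonal ε * Qᴴ) * A * Q + Qᴴ * A * (Q * diagonal ε) := by
          simp only [hB, Matrix.mul_assoc]
      _ = Qᴴ * (J0 p q * A + A * J0 p q) * Q := by
          rw [← hQJ, ← hJQ, Matrix.mul_add, Matrix.add_mul]; simp only [Matrix.mul_assoc]
      _ = 0 := by rw [h, Matrix.mul_zero, Matrix.zero_mul]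
  have hBh : Bᴴ = B := by
    simp only [hB, conjTranspose_mul, conjTranspose_conjTranspose, hA.eq, Matrix.mul_assoc]
  have hent : ∀ i j, ε i * B i j + B i j * ε j = 0 := by
    intro i j
    have := congrFun (congrFun hBe i) j
    simpa only [Matrix.add_apply, mul_diagonal, diagonal_mul, Matrix.zero_apply] using this
  ext i j
  rcases i with i | i <;> rcases j with j | j
  · have := hent (Fin.castAdd q i) (Fin.castAdd q j)
    simp [hε] at this ⊢
    exact this
  · simp [toBlocks₁₂]
  · simp only [submatrix_apply, fromBlocks_apply₂₁, conjTranspose_apply, toBlocks₁₂, of_apply]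
    rw [← conjTranspose_apply, hBh]
  · have := hent (Fin.natAdd p i) (Fin.natAdd p j)
    simp [hε] at this ⊢
    exact this

/-- If the flags of a triple of elements of the form group are semistable for the weights
`xhat`, then the triple lies in the singular cone. -/
theorem singular_of_semistable (hq : 1 ≤ q) (hpq : q ≤ p) {x : Fin 3 → Fin q → ℝ}
    (hx : ∀ k, DecrNonneg (x k)) {g : Fin 3 → Matrix (Fin (p + q)) (Fin (p + q)) ℂ}
    (hg : ∀ k, g k ∈ formGroup p q)
    (hs : ∀ W, ∑ k, wsum (p + q) (xhat p q (x k)) (colFlag (g k)) W ≤ 0) :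
    (x 0, x 1, x 2) ∈ SingularCone p q := by
  have hgu : ∀ k, IsUnit (g k) := fun k => isUnit_of_norm_det (norm_det_formGroup (hg k))
  have hZ : IsClosed {U : Fin 3 → Matrix (Fin (p + q)) (Fin (p + q)) ℂ | ∀ k,
      J0 p q * diagConj (U k) (xhat p q (x k)) + diagConj (U k) (xhat p q (x k)) * J0 p q = 0} := by
    simp only [Set.ofPred_forall]
    refine isClosed_iInter fun k => isClosed_eq ?_ continuous_const
    unfold diagConj
    fun_prop
  obtain ⟨U, hUZ, hU, hsum⟩ := kempf_ness (by omega) hgu (fun k => xhat_antitone (hx k)) hs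
    (by
      refine sum_eq_zero fun k _ => ?_
      rw [(isFlag_colFlag (hgu k)).wsum_top, sum_xhat hpq])
    (isClosed_formGroup (p := p) (q := q)) formGroup_one (fun a ha => norm_det_formGroup ha) hZ
    (fun a ha U hU h k => diagConj_anticomm hpq (formGroup_mul ha (hg k)) (hU k) (h k) (x k))
    (by
      intro a ha U hUZ V d hU hV hsum s
      refine formGroup_mul (expMat_mem_formGroup hV ?_ s) ha
      rw [← hsum, mul_sum, sum_mul, ← sum_add_distrib]
      exact sum_eq_zero fun k _ => hUZ k)
  obtain ⟨Q, hQ, hJQ⟩ := exists_diag_J0 hpq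
  let B : Fin 3 → Matrix (Fin p ⊕ Fin q) (Fin p ⊕ Fin q) ℂ := fun k =>
    (Qᴴ * diagConj (U k) (xhat p q (x k)) * Q).submatrix finSumFinEquiv finSumFinEquiv
  have hB : ∀ k, B k = fromBlocks 0 (B k).toBlocks₁₂ (B k).toBlocks₁₂ᴴ 0 := fun k =>
    exists_block_of_anticomm hJQ (isHermitian_diagConj _ _) (hUZ k)
  have hch : ∀ k, singularValues (B k).toBlocks₁₂ = x k := by
    intro k
    rw [singularValues_eq_iff_block hpq _ (hx k), ← hB k]
    have : B k = reindex finSumFinEquiv.symm finSumFinEquiv.symm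
      (Qᴴ * diagConj (U k) (xhat p q (x k)) * Q) := rfl
    rw [this, charpoly_reindex, Matrix.mul_assoc, charpoly_mul_comm, Matrix.mul_assoc,
      unitary_mul_self hQ, Matrix.mul_one, diagConj, charpoly_unitary_conj (hU k),
      Fin.prod_univ_eq_prod_range
        (fun i => (Polynomial.X - Polynomial.C ((xhat p q (x k) i : ℝ) : ℂ)))]
  refine ⟨_, _, _, ?_, hch 0, hch 1, hch 2⟩
  have hs3 : B 0 + B 1 + B 2 = 0 := by
    rw [← Fin.sum_univ_three]
    simp only [B]
    ext i j
    rw [Matrix.sum_apply]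
    simp only [submatrix_apply]
    rw [← Matrix.sum_apply, ← sum_mul, ← mul_sum, hsum]
    simp
  ext i j
  exact congrFun (congrFun hs3 (Sum.inl i)) (Sum.inr j)

end SingHorn

namespace SingHorn

open scoped ComplexOrder
open Module Finset

section HN

variable {E : Type*} [AddCommGroup E] [Module ℂ E] [FiniteDimensional ℂ E]
variable {N : ℕ} {w : Fin 3 → ℕ → ℝ} {F : Fin 3 → ℕ → Submodule ℂ E}

/-- The total weight of a subspace with respect to three flags. -/
noncomputable def tot (N : ℕ) (w : Fin 3 → ℕ → ℝ) (F : Fin 3 → ℕ → Submodule ℂ E)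
    (W : Submodule ℂ E) : ℝ := ∑ k, wsum N (w k) (F k) W

theorem tot_bot : tot N w F ⊥ = 0 :=
  sum_eq_zero fun _ _ => wsum_bot _

theorem tot_supermodular (hF : ∀ k, IsFlag N (F k)) (hw : ∀ k, Antitone (w k))
    (W W' : Submodule ℂ E) : tot N w F W + tot N w F W' ≤ tot N w F (W ⊔ W') + tot N w F (W ⊓ W') := by
  unfold tot
  rw [← sum_add_distrib, ← sum_add_distrib]
  exact sum_le_sum fun k _ => (hF k).wsum_supermodular (hw k)

/-- The maximal destabilizing subspace, with its slope. -/
structure IsHN (N : ℕ) (w : Fin 3 → ℕ → ℝ) (F : Fin 3 → ℕ → Submodule ℂ E)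
    (V : Submodule ℂ E) (μ : ℝ) : Prop where
  slope_pos : 0 < μ
  ne_bot : V ≠ ⊥
  eq : tot N w F V = μ * finrank ℂ V
  le : ∀ W, tot N w F W ≤ μ * finrank ℂ W
  max : ∀ W, tot N w F W = μ * finrank ℂ W → W ≤ V

theorem tot_eq_pos (hF : ∀ k, IsFlag N (F k)) (W : Submodule ℂ E) :
    tot N w F W = ∑ k, ∑ i ∈ pos N (F k) W, w k i :=
  sum_congr rfl fun k _ => (hF k).wsum_eq _

theorem finite_pos_range (N : ℕ) : {P : Fin 3 → Finset ℕ | ∀ k, P k ⊆ range N}.Finite := by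
  refine (Set.Finite.pi' (ι := Fin 3) fun _ => Finset.finite_toSet (range N).powerset).subset ?_
  intro P hP k
  exact Finset.mem_coe.2 (mem_powerset.2 (hP k))

theorem pos_subset_range (F : ℕ → Submodule ℂ E) (W : Submodule ℂ E) : pos N F W ⊆ range N :=
  filter_subset _ _

theorem exists_isHN (hF : ∀ k, IsFlag N (F k)) (hw : ∀ k, Antitone (w k))
    (h : ∃ W, 0 < tot N w F W) : ∃ V μ, IsHN N w F V μ := by
  obtain ⟨W₁, hW₁⟩ := h
  have hne : W₁ ≠ ⊥ := by rintro rfl; rw [tot_bot] at hW₁; exact lt_irrefl _ hW₁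
  have hpos : ∀ W : Submodule ℂ E, W ≠ ⊥ → 0 < (finrank ℂ W : ℝ) := by
    intro W hW
    rw [Nat.cast_pos, finrank_pos_iff]
    exact Submodule.nontrivial_iff_ne_bot.2 hW
  have hfin : ∀ S : Set (Submodule ℂ E), ((fun W k => pos N (F k) W) '' S).Finite := fun S =>
    (finite_pos_range N).subset (by rintro _ ⟨W, -, rfl⟩ k; exact pos_subset_range _ _)
  let σ : (Fin 3 → Finset ℕ) → ℝ := fun P => (∑ k, ∑ i ∈ P k, w k i) / (P 0).card
  have hσ : ∀ W, σ (fun k => pos N (F k) W) = tot N w F W / finrank ℂ W := fun W => by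
    simp only [σ, tot_eq_pos hF, (hF 0).card_pos]
  obtain ⟨_, ⟨W₀, hW₀, rfl⟩, hmax⟩ := Set.exists_max_image _ σ (hfin {W | W ≠ ⊥})
    ⟨_, ⟨W₁, hne, rfl⟩⟩
  have hmax' : ∀ W, W ≠ ⊥ → tot N w F W / finrank ℂ W ≤ tot N w F W₀ / finrank ℂ W₀ := by
    intro W hW
    have := hmax _ ⟨W, hW, rfl⟩
    rwa [hσ, hσ] at this
  set μ := tot N w F W₀ / finrank ℂ W₀ with hμ
  have hμ0 : 0 < μ := (div_pos hW₁ (hpos _ hne)).trans_le (hmax' _ hne)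
  have hle : ∀ W, tot N w F W ≤ μ * finrank ℂ W := by
    intro W
    by_cases hW : W = ⊥
    · rw [hW, tot_bot]; simp
    · exact (div_le_iff₀ (hpos W hW)).1 (hmax' W hW)
  have heq₀ : tot N w F W₀ = μ * finrank ℂ W₀ := by
    rw [hμ, div_mul_cancel₀ _ (hpos W₀ hW₀).ne']
  obtain ⟨_, ⟨V, hV, rfl⟩, hVmax⟩ := Set.exists_max_image _ (fun P : Fin 3 → Finset ℕ => (P 0).card)
    (hfin {W | W ≠ ⊥ ∧ tot N w F W = μ * finrank ℂ W}) ⟨_, ⟨W₀, ⟨hW₀, heq₀⟩, rfl⟩⟩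
  refine ⟨V, μ, hμ0, hV.1, hV.2, hle, fun W hW => ?_⟩
  have h1 := tot_supermodular hF hw V W
  have h2 := hle (V ⊔ W)
  have h3 := hle (V ⊓ W)
  have h4 : (finrank ℂ ↥(V ⊔ W) : ℝ) + finrank ℂ ↥(V ⊓ W) = finrank ℂ V + finrank ℂ W := by
    exact_mod_cast Submodule.finrank_sup_add_finrank_inf_eq V W
  have h5 : tot N w F (V ⊔ W) = μ * finrank ℂ ↥(V ⊔ W) := by
    rw [hV.2, hW] at h1
    nlinarith
  have hne' : V ⊔ W ≠ ⊥ := fun h => hV.1 (le_bot_iff.1 (le_sup_left.trans h.le))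
  have h6 := hVmax _ ⟨V ⊔ W, ⟨hne', h5⟩, rfl⟩
  simp only [(hF 0).card_pos] at h6
  have h7 : V = V ⊔ W := Submodule.eq_of_le_of_finrank_le le_sup_left h6
  rw [h7]; exact le_sup_right

theorem finrank_map_add_inf_ker {E' : Type*} [AddCommGroup E'] [Module ℂ E']
    (f : E →ₗ[ℂ] E') (W : Submodule ℂ E) :
    finrank ℂ (W.map f) + finrank ℂ ↥(W ⊓ LinearMap.ker f) = finrank ℂ W := by
  have := (f.domRestrict W).finrank_range_add_finrank_ker
  rw [LinearMap.range_domRestrict, LinearMap.ker_domRestrict] at this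
  rw [← this, ← finrank_map_of_injective W.injective_subtype, Submodule.map_comap_subtype]

/-- There are no nonzero filtered maps from the maximal destabilizing subspace to the quotient. -/
theorem IsHN.map_le (hF : ∀ k, IsFlag N (F k)) (hw : ∀ k, Antitone (w k)) {V : Submodule ℂ E}
    {μ : ℝ} (h : IsHN N w F V μ) {φ : E →ₗ[ℂ] E}
    (hφ : ∀ k, ∀ i ≤ N, (V ⊓ F k i).map φ ≤ V ⊔ F k i) : V.map φ ≤ V := by
  set ψ := V.mkQ ∘ₗ φ with hψ
  set V' := V ⊔ V.map φ with hV'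
  set K := V ⊓ LinearMap.ker ψ with hK
  have hker : LinearMap.ker V.mkQ = V := Submodule.ker_mkQ V
  have hVV' : V ≤ V' := le_sup_left
  have e1 : ∀ A : Submodule ℂ E, A ≤ V → finrank ℂ (A.map ψ) + finrank ℂ ↥(K ⊓ A) = finrank ℂ A := by
    intro A hA
    have hKA : K ⊓ A = A ⊓ LinearMap.ker ψ := by rw [hK, inf_right_comm, inf_eq_right.2 hA]
    rw [hKA]
    exact finrank_map_add_inf_ker ψ A
  have e2 : ∀ A : Submodule ℂ E, finrank ℂ (A.map V.mkQ) + finrank ℂ ↥(A ⊓ V) = finrank ℂ A := by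
    intro A
    have := finrank_map_add_inf_ker V.mkQ A
    rwa [hker] at this
  have hmap : V'.map V.mkQ = V.map ψ := by
    rw [hV', Submodule.map_sup, hψ, Submodule.map_comp]
    rw [LinearMap.le_ker_iff_map.1 hker.ge, bot_sup_eq]
  have hi : ∀ k, ∀ i ≤ N, (capDim (F k) V i : ℝ) - capDim (F k) K i ≤
      (capDim (F k) V' i : ℝ) - capDim (F k) V i := by
    intro k i hi
    have h1 := e1 (V ⊓ F k i) inf_le_left
    have h2 := e2 (V' ⊓ F k i)
    have h3 : (V ⊓ F k i).map ψ ≤ (V' ⊓ F k i).map V.mkQ := by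
      rw [hψ, Submodule.map_comp]
      rintro _ ⟨_, ⟨v, hv, rfl⟩, rfl⟩
      obtain ⟨a, ha, f, hf, hfa⟩ := Submodule.mem_sup.1 (hφ k i hi ⟨v, hv, rfl⟩)
      refine ⟨f, ⟨?_, hf⟩, ?_⟩
      · have : f = φ v - a := by rw [← hfa]; abel
        rw [this]
        exact V'.sub_mem (le_sup_right (a := V) ⟨v, hv.1, rfl⟩) (hVV' ha)
      · rw [← hfa, map_add]
        have : V.mkQ a = 0 := by rw [← LinearMap.mem_ker, hker]; exact ha
        rw [this, zero_add]
    have h4 := Submodule.finrank_mono h3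
    have h5 : K ⊓ (V ⊓ F k i) = K ⊓ F k i := by rw [← inf_assoc, inf_eq_left.2 (inf_le_left : K ≤ V)]
    have h6 : V' ⊓ F k i ⊓ V = V ⊓ F k i := by rw [inf_right_comm, inf_eq_right.2 hVV']
    rw [h5] at h1
    rw [h6] at h2
    simp only [capDim]
    have : finrank ℂ ↥(V ⊓ F k i) + finrank ℂ ↥(V ⊓ F k i) ≤ finrank ℂ ↥(V' ⊓ F k i) + finrank ℂ ↥(K ⊓ F k i) := by
      omega
    have : (finrank ℂ ↥(V ⊓ F k i) : ℝ) + finrank ℂ ↥(V ⊓ F k i) ≤ finrank ℂ ↥(V' ⊓ F k i) + finrank ℂ ↥(K ⊓ F k i) := by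
      exact_mod_cast this
    linarith
  have hdim : finrank ℂ V + finrank ℂ V = finrank ℂ V' + finrank ℂ K := by
    have h1 := e1 V le_rfl
    have h2 := e2 V'
    rw [hmap, inf_eq_right.2 hVV'] at h2
    have h3 : K ⊓ V = K := inf_eq_left.2 inf_le_left
    rw [h3] at h1
    omega
  have hdim' : (finrank ℂ V : ℝ) + finrank ℂ V = finrank ℂ V' + finrank ℂ K := by exact_mod_cast hdim
  have hs : tot N w F V - tot N w F K ≤ tot N w F V' - tot N w F V := by
    unfold tot
    rw [← sum_sub_distrib, ← sum_sub_distrib]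
    refine sum_le_sum fun k _ => ?_
    have := abel_le (n := N) (D := fun i => (capDim (F k) V i : ℝ) - capDim (F k) K i)
      (D' := fun i => (capDim (F k) V' i : ℝ) - capDim (F k) V i) (hw k)
      (by simp [(hF k).capDim_zero]) (by
        simp only [(hF k).capDim_top]; linarith) (hi k)
    unfold wsum
    rw [← sum_sub_distrib, ← sum_sub_distrib]
    calc _ = _ := sum_congr rfl fun i _ => by ring
      _ ≤ _ := this
      _ = _ := sum_congr rfl fun i _ => by ring
  have h1 := h.le K
  have h2 := h.le V'
  have h3 := h.eq
  have hμ : μ * (finrank ℂ V + finrank ℂ V) = μ * (finrank ℂ V' + finrank ℂ K) := by rw [hdim']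
  have h4 : tot N w F V' = μ * finrank ℂ V' := by linarith
  exact le_sup_right.trans (h.max V' h4)

end HN

end SingHorn

namespace SingHorn

open scoped ComplexOrder
open Module Finset

/-- Counting lemma: a space on which finitely many linear maps have no common kernel. -/
theorem finrank_le_sum_of_ker {K L ι : Type*} [Field K] [AddCommGroup L] [Module K L]
    [FiniteDimensional K L] {Q : ι → Type*} [∀ j, AddCommGroup (Q j)] [∀ j, Module K (Q j)]
    (s : Finset ι) (Φ : ∀ j, L →ₗ[K] Q j) (c : ι → ℕ)
    (hc : ∀ j ∈ s, finrank K (LinearMap.range (Φ j)) ≤ c j) (M : Submodule K L)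
    (h : ∀ f, (∀ j ∈ s, Φ j f = 0) → f ∈ M) : finrank K L ≤ ∑ j ∈ s, c j + finrank K M := by
  classical
  have key : ∀ t ⊆ s, finrank K L ≤ ∑ j ∈ t, c j + finrank K ↥(t.inf fun j => LinearMap.ker (Φ j)) := by
    intro t
    induction t using Finset.induction_on with
    | empty => intro _; rw [inf_empty, finrank_top]; simp
    | insert j t hj ih =>
      intro ht
      have h1 := ih ((subset_insert _ _).trans ht)
      have h2 := hc j (ht (mem_insert_self _ _))
      have h3 := (Φ j).finrank_range_add_finrank_ker
      have h4 := Submodule.finrank_sup_add_finrank_inf_eq (LinearMap.ker (Φ j))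
        (t.inf fun j => LinearMap.ker (Φ j))
      have h5 := Submodule.finrank_le (LinearMap.ker (Φ j) ⊔ t.inf fun j => LinearMap.ker (Φ j))
      rw [sum_insert hj, inf_insert]
      omega
  refine (key s subset_rfl).trans (Nat.add_le_add_left (Submodule.finrank_mono fun f hf => h f ?_) _)
  intro j hj
  exact (Finset.inf_le hj : (s.inf fun j => LinearMap.ker (Φ j)) ≤ _) hf

section HomCount

variable {E : Type*} [AddCommGroup E] [Module ℂ E] [FiniteDimensional ℂ E]
variable {N : ℕ} {F : Fin 3 → ℕ → Submodule ℂ E}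

theorem IsAdapted.exists_pair {G : ℕ → Submodule ℂ E} (hG : IsFlag N G) {W V : Submodule ℂ E}
    (hWV : W ≤ V) : ∃ v : ℕ → E, IsAdapted N G V v ∧ IsAdapted N G W v := by
  obtain ⟨v, hv⟩ := IsAdapted.exists hG V
  obtain ⟨u, hu⟩ := IsAdapted.exists hG W
  classical
  refine ⟨fun i => if i ∈ pos N G W then u i else v i, fun i hi => ?_, fun i hi => ?_⟩
  · by_cases h : i ∈ pos N G W
    · simp only [h, if_true]
      exact ⟨⟨hWV (hu i h).1.1, (hu i h).1.2⟩, (hu i h).2⟩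
    · simp only [h, if_false]
      exact hv i hi
  · simp only [hi, if_true]
    exact hu i hi

theorem hom_count (hF : ∀ k, IsFlag N (F k)) {W V T : Submodule ℂ E} (hWV : W ≤ V) (hVT : V ≤ T)
    (H : ∀ φ : E →ₗ[ℂ] E, V.map φ ≤ T → (∀ k, ∀ i ≤ N, (V ⊓ F k i).map φ ≤ V ⊔ (T ⊓ F k i)) →
      V.map φ ≤ V) :
    (finrank ℂ V - finrank ℂ W) * (finrank ℂ T - finrank ℂ V) ≤
      ∑ k, ∑ a ∈ pos N (F k) V \ pos N (F k) W,
        (finrank ℂ T + capDim (F k) V (a + 1) - finrank ℂ V - capDim (F k) T (a + 1)) := by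
  classical
  obtain ⟨V₁, hV₁⟩ := Submodule.exists_isCompl (W.submoduleOf V)
  obtain ⟨T₁, hT₁⟩ := Submodule.exists_isCompl (V.submoduleOf T)
  obtain ⟨Y, hY⟩ := Submodule.exists_isCompl V
  set V' := V₁.map V.subtype
  set T' := T₁.map T.subtype
  have hV'V : V' ≤ V := Submodule.map_subtype_le _ _
  have hT'T : T' ≤ T := Submodule.map_subtype_le _ _
  have hTV : T' ⊓ V = ⊥ := by
    rw [eq_bot_iff]
    rintro _ ⟨⟨⟨t, ht⟩, ht1, rfl⟩, htV⟩
    have : (⟨t, ht⟩ : T) ∈ V.submoduleOf T ⊓ T₁ := ⟨htV, ht1⟩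
    rw [hT₁.inf_eq_bot] at this
    simpa using congrArg Subtype.val ((Submodule.mem_bot ℂ).1 this)
  have hsup : W ⊔ V' = V := by
    apply le_antisymm (sup_le hWV hV'V)
    intro x hx
    have : (⟨x, hx⟩ : V) ∈ W.submoduleOf V ⊔ V₁ := by rw [hV₁.sup_eq_top]; trivial
    obtain ⟨y, hy, z, hz, hyz⟩ := Submodule.mem_sup.1 this
    exact Submodule.mem_sup.2 ⟨y, hy, z, ⟨z, hz, rfl⟩, by simpa using congrArg Subtype.val hyz⟩
  have hinf : W ⊓ V' = ⊥ := by
    rw [eq_bot_iff]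
    rintro _ ⟨htV, ⟨⟨t, ht⟩, ht1, rfl⟩⟩
    have : (⟨t, ht⟩ : V) ∈ W.submoduleOf V ⊓ V₁ := ⟨htV, ht1⟩
    rw [hV₁.inf_eq_bot] at this
    simpa using congrArg Subtype.val ((Submodule.mem_bot ℂ).1 this)
  have hdV : finrank ℂ V' = finrank ℂ V - finrank ℂ W := by
    have := Submodule.finrank_sup_add_finrank_inf_eq W V'
    rw [hsup, hinf, finrank_bot] at this
    omega
  have hdT : finrank ℂ T' = finrank ℂ T - finrank ℂ V := by
    have h1 := Submodule.finrank_add_eq_of_isCompl hT₁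
    have h2 : finrank ℂ T' = finrank ℂ T₁ := finrank_map_of_injective T.injective_subtype T₁
    have h3 : finrank ℂ (V.submoduleOf T) = finrank ℂ V :=
      (Submodule.submoduleOfEquivOfLe hVT).finrank_eq
    omega
  have hcompl : IsCompl V' (W ⊔ Y) := by
    constructor
    · rw [Submodule.disjoint_def]
      intro x hx hx'
      obtain ⟨a, ha, b, hb, hab⟩ := Submodule.mem_sup.1 hx'
      have hbV : b ∈ V ⊓ Y := ⟨by
        have : b = x - a := by rw [← hab]; abel
        rw [this]; exact V.sub_mem (hV'V hx) (hWV ha), hb⟩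
      rw [hY.inf_eq_bot, Submodule.mem_bot] at hbV
      have : x ∈ W ⊓ V' := ⟨by rw [← hab, hbV, add_zero]; exact ha, hx⟩
      rw [hinf] at this
      simpa using this
    · rw [codisjoint_iff, ← sup_assoc, sup_comm V' W, hsup, hY.sup_eq_top]
  set π := V'.projectionOnto (W ⊔ Y) hcompl with hπ
  have hπV : ∀ x (hx : x ∈ V'), π x = ⟨x, hx⟩ := fun x hx =>
    Submodule.projectionOnto_apply_left hcompl ⟨x, hx⟩
  have hπW : ∀ x ∈ W, π x = 0 := fun x hx =>
    (Submodule.projectionOnto_apply_eq_zero_iff hcompl).2 (le_sup_left (a := W) hx)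
  choose v hvV hvW using fun k => IsAdapted.exists_pair (hF k) hWV
  let ext : (V' →ₗ[ℂ] T') → (E →ₗ[ℂ] E) := fun f => T'.subtype ∘ₗ f ∘ₗ π
  let Q : (Σ _ : Fin 3, ℕ) → Submodule ℂ E := fun j => V ⊔ (T ⊓ F j.1 (j.2 + 1))
  let Φ : ∀ j : (Σ _ : Fin 3, ℕ), (V' →ₗ[ℂ] T') →ₗ[ℂ] (E ⧸ Q j) := fun j =>
    { toFun := fun f => (Q j).mkQ (ext f (v j.1 j.2))
      map_add' := fun f g => by simp [ext]
      map_smul' := fun c f => by simp [ext] }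
  have main := finrank_le_sum_of_ker
    ((univ : Finset (Fin 3)).sigma fun k => pos N (F k) V \ pos N (F k) W) Φ
    (fun j => finrank ℂ T + capDim (F j.1) V (j.2 + 1) - finrank ℂ V - capDim (F j.1) T (j.2 + 1))
    ?_ ⊥ ?_
  · rwa [finrank_linearMap, finrank_bot, add_zero, hdV, hdT, sum_sigma] at main
  · rintro ⟨k, a⟩ -
    have h1 : LinearMap.range (Φ ⟨k, a⟩) ≤ T.map (Q ⟨k, a⟩).mkQ := by
      rintro _ ⟨f, rfl⟩
      exact ⟨ext f (v k a), hT'T (f _).2, rfl⟩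
    have h2 := finrank_map_add_inf_ker (Q ⟨k, a⟩).mkQ T
    rw [Submodule.ker_mkQ] at h2
    have h3 : T ⊓ Q ⟨k, a⟩ = V ⊔ (T ⊓ F k (a + 1)) := inf_eq_right.2 (sup_le hVT inf_le_left)
    rw [h3] at h2
    have h4 := Submodule.finrank_sup_add_finrank_inf_eq V (T ⊓ F k (a + 1))
    have h5 : V ⊓ (T ⊓ F k (a + 1)) = V ⊓ F k (a + 1) := by rw [← inf_assoc, inf_eq_left.2 hVT]
    rw [h5] at h4
    have h6 := Submodule.finrank_mono h1
    simp only [capDim]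
    omega
  · intro f hf
    have hv0 : ∀ k, ∀ a ∈ pos N (F k) V, ext f (v k a) ∈ V ⊔ (T ⊓ F k (a + 1)) := by
      intro k a ha
      by_cases haW : a ∈ pos N (F k) W
      · have : ext f (v k a) = 0 := by
          simp only [ext, LinearMap.comp_apply, hπW _ (hvW k a haW).1.1, map_zero]
        rw [this]; exact Submodule.zero_mem _
      · have := hf ⟨k, a⟩ (mem_sigma.2 ⟨mem_univ _, mem_sdiff.2 ⟨ha, haW⟩⟩)
        exact (Submodule.Quotient.mk_eq_zero _).1 this
    have hfV : V.map (ext f) ≤ V := by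
      refine H _ ?_ fun k i hi => ?_
      · rintro _ ⟨x, -, rfl⟩
        exact hT'T (f _).2
      · rw [(hvV k).span_eq (hF k) hi, Submodule.map_span, Submodule.span_le]
        rintro _ ⟨_, ⟨a, ⟨ha, hai⟩, rfl⟩, rfl⟩
        exact sup_le_sup_left (inf_le_inf le_rfl ((hF k).mono hai)) V (hv0 k a ha)
    rw [Submodule.mem_bot]
    ext x
    have h1 : ext f x ∈ T' ⊓ V := ⟨(f _).2, hfV ⟨x, hV'V x.2, rfl⟩⟩
    rw [hTV, Submodule.mem_bot] at h1
    simpa [ext, hπV] using h1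

end HomCount

end SingHorn

namespace SingHorn

open scoped ComplexOrder
open Module Finset

section Orth

variable {n : ℕ}

/-- The standard orthogonal complement. -/
def orth (W : Submodule ℂ (Fin n → ℂ)) : Submodule ℂ (Fin n → ℂ) where
  carrier := {v | ∀ u ∈ W, star u ⬝ᵥ v = 0}
  zero_mem' := fun u _ => dotProduct_zero _
  add_mem' := fun ha hb u hu => by rw [dotProduct_add, ha u hu, hb u hu, add_zero]
  smul_mem' := fun c v hv u hu => by rw [dotProduct_smul, hv u hu, smul_zero]

theorem inf_orth (W : Submodule ℂ (Fin n → ℂ)) : W ⊓ orth W = ⊥ := by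
  rw [eq_bot_iff]
  rintro v ⟨h, h'⟩
  rw [Submodule.mem_bot]
  exact dotProduct_star_self_eq_zero.1 (h' v h)

theorem finrank_orth (W : Submodule ℂ (Fin n → ℂ)) : finrank ℂ (orth W) + finrank ℂ W = n := by
  have hE : finrank ℂ (Fin n → ℂ) = n := by simp
  apply le_antisymm
  · have h := Submodule.finrank_sup_add_finrank_inf_eq W (orth W)
    rw [inf_orth, finrank_bot] at h
    have := Submodule.finrank_le (W ⊔ orth W)
    omega
  · obtain ⟨v, hv⟩ := IsAdapted.exists (isFlag_coord (n := n)) W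
    let Φ : ℕ → (Fin n → ℂ) →ₗ[ℂ] ℂ := fun a =>
      { toFun := fun x => star (v a) ⬝ᵥ x
        map_add' := fun x y => dotProduct_add _ _ _
        map_smul' := fun c x => dotProduct_smul _ _ _ }
    have := finrank_le_sum_of_ker (pos n (coord n) W) Φ (fun _ => 1)
      (fun j _ => (Submodule.finrank_le _).trans (by simp)) (orth W) (fun f hf => by
        intro u hu
        rw [hv.span_top isFlag_coord] at hu
        induction hu using Submodule.span_induction with
        | mem x hx => obtain ⟨a, ha, rfl⟩ := hx; exact hf a ha
        | zero => simp
        | add x y _ _ hx hy => rw [star_add, add_dotProduct, hx, hy, add_zero]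
        | smul c x _ hx => rw [star_smul, smul_dotProduct, hx, smul_zero])
    rw [hE, sum_const, smul_eq_mul, mul_one, isFlag_coord.card_pos] at this
    omega

end Orth

section Perp

variable {p q : ℕ}

/-- The orthogonal complement with respect to the form `J0`. -/
def perp (p q : ℕ) (W : Submodule ℂ (Fin (p + q) → ℂ)) : Submodule ℂ (Fin (p + q) → ℂ) :=
  (orth W).comap (J0 p q).mulVecLin

theorem mem_perp {W : Submodule ℂ (Fin (p + q) → ℂ)} {v : Fin (p + q) → ℂ} :
    v ∈ perp p q W ↔ ∀ u ∈ W, star u ⬝ᵥ (J0 p q *ᵥ v) = 0 := Iff.rfl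

theorem J0_form_symm (u v : Fin (p + q) → ℂ) :
    star u ⬝ᵥ (J0 p q *ᵥ v) = star (star v ⬝ᵥ (J0 p q *ᵥ u)) := by
  rw [← star_dotProduct_comm, star_mulVec, J0_conjTranspose, dotProduct_mulVec]

theorem perp_eq_map (W : Submodule ℂ (Fin (p + q) → ℂ)) :
    perp p q W = (orth W).map (J0 p q).mulVecLin := by
  ext v
  constructor
  · intro hv
    refine ⟨J0 p q *ᵥ v, hv, ?_⟩
    rw [mulVecLin_apply, mulVec_mulVec, J0_mul_self, one_mulVec]
  · rintro ⟨u, hu, rfl⟩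
    change J0 p q *ᵥ (J0 p q *ᵥ u) ∈ orth W
    rwa [mulVec_mulVec, J0_mul_self, one_mulVec]

theorem finrank_perp (W : Submodule ℂ (Fin (p + q) → ℂ)) :
    finrank ℂ (perp p q W) + finrank ℂ W = p + q := by
  rw [perp_eq_map, finrank_map_of_injective (mulVec_injective_of_isUnit' isUnit_J0)]
  exact finrank_orth W

theorem perp_anti {W W' : Submodule ℂ (Fin (p + q) → ℂ)} (h : W ≤ W') :
    perp p q W' ≤ perp p q W := fun _ hv u hu => hv u (h hu)

theorem perp_perp (W : Submodule ℂ (Fin (p + q) → ℂ)) : perp p q (perp p q W) = W := by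
  symm
  apply Submodule.eq_of_le_of_finrank_le
  · intro v hv
    rw [mem_perp]
    intro u hu
    rw [J0_form_symm, mem_perp.1 hu v hv, star_zero]
  · have := finrank_perp W
    have := finrank_perp (perp p q W)
    omega

theorem perp_sup (W W' : Submodule ℂ (Fin (p + q) → ℂ)) :
    perp p q (W ⊔ W') = perp p q W ⊓ perp p q W' := by
  apply le_antisymm (le_inf (perp_anti le_sup_left) (perp_anti le_sup_right))
  rintro v ⟨h, h'⟩ u hu
  obtain ⟨a, ha, b, hb, rfl⟩ := Submodule.mem_sup.1 hu
  rw [star_add, add_dotProduct, h a ha, h' b hb, add_zero]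

theorem perp_inf (W W' : Submodule ℂ (Fin (p + q) → ℂ)) :
    perp p q (W ⊓ W') = perp p q W ⊔ perp p q W' := by
  rw [← perp_perp (perp p q W ⊔ perp p q W'), perp_sup, perp_perp, perp_perp]

theorem isUnit_formGroup {g : Matrix (Fin (p + q)) (Fin (p + q)) ℂ} (hg : g ∈ formGroup p q) :
    IsUnit g := isUnit_of_norm_det (norm_det_formGroup hg)

variable {g : Matrix (Fin (p + q)) (Fin (p + q)) ℂ} {W : Submodule ℂ (Fin (p + q) → ℂ)}

theorem perp_colFlag (hg : g ∈ formGroup p q) {i : ℕ} (h : i ≤ q ∨ p ≤ i) (hi : i ≤ p + q) :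
    perp p q (colFlag g i) = colFlag g (p + q - i) := by
  have hF := isFlag_colFlag (isUnit_formGroup hg)
  symm
  apply Submodule.eq_of_le_of_finrank_le
  · rintro _ ⟨c', hc', rfl⟩ _ ⟨c, hc, rfl⟩
    change star (g *ᵥ c) ⬝ᵥ (J0 p q *ᵥ (g *ᵥ c')) = 0
    rw [form_mulVec hg]
    exact J0_coord_orth h hi hc hc'
  · have := finrank_perp (colFlag g i)
    rw [hF.rank i hi] at this
    rw [hF.rank _ (Nat.sub_le _ _)]
    omega

theorem capDim_perp (hg : g ∈ formGroup p q) {i : ℕ} (h : i ≤ q ∨ p ≤ i) (hi : i ≤ p + q) :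
    capDim (colFlag g) (perp p q W) i + finrank ℂ W = i + capDim (colFlag g) W (p + q - i) := by
  have hF := isFlag_colFlag (isUnit_formGroup hg)
  have h1 : colFlag g i = perp p q (colFlag g (p + q - i)) := by
    rw [← perp_colFlag hg h hi, perp_perp]
  rw [capDim, h1, ← perp_sup]
  have h2 := finrank_perp (W ⊔ colFlag g (p + q - i))
  have h3 := Submodule.finrank_sup_add_finrank_inf_eq W (colFlag g (p + q - i))
  rw [hF.rank _ (Nat.sub_le _ _)] at h3
  rw [capDim]
  omega

theorem mem_pos_perp (hg : g ∈ formGroup p q) {i : ℕ} (h : i < q ∨ p ≤ i) (hi : i < p + q) :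
    i ∈ pos (p + q) (colFlag g) (perp p q W) ↔ p + q - 1 - i ∉ pos (p + q) (colFlag g) W := by
  have hF := isFlag_colFlag (isUnit_formGroup hg)
  have h1 := capDim_perp (W := W) hg (i := i) (by omega) hi.le
  have h2 := capDim_perp (W := W) hg (i := i + 1) (by omega) hi
  rw [hF.mem_pos, hF.mem_pos']
  have h3 : p + q - (i + 1) = p + q - 1 - i := by omega
  have h4 : p + q - i = p + q - 1 - i + 1 := by omega
  rw [h3] at h2
  rw [h4] at h1
  have h5 := hF.capDim_succ_le (W := W) (i := p + q - 1 - i) (by omega)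
  have h6 := hF.capDim_mono (W := W) (Nat.le_succ (p + q - 1 - i))
  rw [Nat.succ_eq_add_one] at h6
  constructor
  · rintro ⟨-, h⟩ ⟨-, h'⟩; omega
  · intro h
    refine ⟨hi, ?_⟩
    have : ¬ (capDim (colFlag g) W (p + q - 1 - i + 1) = capDim (colFlag g) W (p + q - 1 - i) + 1) :=
      fun h' => h ⟨by omega, h'⟩
    omega

theorem wsum_perp (hpq : q ≤ p) (hg : g ∈ formGroup p q) (x : Fin q → ℝ) :
    wsum (p + q) (xhat p q x) (colFlag g) (perp p q W) =
      wsum (p + q) (xhat p q x) (colFlag g) W := by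
  have hF := isFlag_colFlag (isUnit_formGroup hg)
  rw [hF.wsum_eq, hF.wsum_eq]
  have h0 := sum_xhat hpq x
  have key : ∀ i ∈ range (p + q),
      (if i ∈ pos (p + q) (colFlag g) (perp p q W) then xhat p q x i else 0) =
      xhat p q x i - if p + q - 1 - i ∈ pos (p + q) (colFlag g) W then xhat p q x i else 0 := by
    intro i hi
    rw [mem_range] at hi
    by_cases h : i < q ∨ p ≤ i
    · rw [if_congr (mem_pos_perp hg h hi) rfl rfl]
      by_cases h' : p + q - 1 - i ∈ pos (p + q) (colFlag g) W <;> simp [h']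
    · rw [xhat_mid x (by omega) (by omega)]; simp
  have e : ∀ S : Finset ℕ, S ⊆ range (p + q) → ∑ i ∈ S, xhat p q x i =
      ∑ i ∈ range (p + q), if i ∈ S then xhat p q x i else 0 := by
    intro S hS
    rw [← sum_filter, filter_mem_eq_inter, inter_eq_right.2 hS]
  rw [e _ (pos_subset_range _ _), e _ (pos_subset_range _ _), sum_congr rfl key, sum_sub_distrib, h0,
    zero_sub, ← sum_range_reflect, ← sum_neg_distrib]
  refine sum_congr rfl fun i hi => ?_
  rw [mem_range] at hi
  have h1 : p + q - 1 - (p + q - 1 - i) = i := by omega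
  rw [h1, xhat_rev hpq x hi]
  split_ifs <;> simp

/-- An isotropic subspace has no jumps in the definite part of an isotropic flag. -/
theorem pos_isotropic_mid (hg : g ∈ formGroup p q) (hW : W ≤ perp p q W) {i : ℕ} (h : q ≤ i)
    (h' : i < p) : i ∉ pos (p + q) (colFlag g) W := by
  have hF := isFlag_colFlag (isUnit_formGroup hg)
  have hle : W ⊓ colFlag g p ≤ W ⊓ colFlag g q := by
    rintro _ ⟨hv, ⟨c, hc, rfl⟩⟩
    refine ⟨hv, c, ?_, rfl⟩
    have h0 := hW hv _ hv
    change star (g *ᵥ c) ⬝ᵥ (J0 p q *ᵥ (g *ᵥ c)) = 0 at h0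
    rw [form_mulVec hg] at h0
    have h1 : star c ⬝ᵥ (J0 p q *ᵥ c) =
        ((∑ a : Fin (p + q), if q ≤ (a : ℕ) ∧ (a : ℕ) < p then ‖c a‖ ^ 2 else 0 : ℝ) : ℂ) := by
      rw [Complex.ofReal_sum]
      refine sum_congr rfl fun a _ => ?_
      rw [J0_mulVec]
      have ha := a.2
      split_ifs with h2
      · have : (⟨revIdx p q a, revIdx_lt a.2⟩ : Fin (p + q)) = a := by
          ext; simp only [revIdx]; split_ifs <;> omega
        rw [this, Pi.star_apply, Complex.ofReal_pow, ← Complex.conj_mul']; rfl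
      · by_cases h3 : p ≤ (a : ℕ)
        · rw [Pi.star_apply, hc a h3]; simp
        · rw [hc ⟨revIdx p q a, revIdx_lt a.2⟩]
          · simp
          · simp only [revIdx]; split_ifs <;> omega
    rw [h1, Complex.ofReal_eq_zero, sum_eq_zero_iff_of_nonneg] at h0
    · intro a ha
      by_cases h3 : p ≤ (a : ℕ)
      · exact hc a h3
      · have := h0 a (mem_univ _)
        rw [if_pos ⟨ha, by omega⟩] at this
        simpa using this
    · intro a _; split_ifs <;> positivity
  have h1 := Submodule.finrank_mono hle
  have h2 := hF.capDim_mono (W := W) h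
  have h3 := hF.capDim_mono (W := W) (Nat.succ_le_of_lt h')
  rw [hF.mem_pos]
  rintro ⟨-, h4⟩
  simp only [capDim] at h1 h2 h3 h4
  simp only [Nat.succ_eq_add_one] at h3
  omega

theorem pos_isotropic_rev (hg : g ∈ formGroup p q) (hW : W ≤ perp p q W) {i : ℕ}
    (hi : i ∈ pos (p + q) (colFlag g) W) : p + q - 1 - i ∉ pos (p + q) (colFlag g) W := by
  have hF := isFlag_colFlag (isUnit_formGroup hg)
  have hiN := mem_range.1 (pos_subset_range _ _ hi)
  have h : i < q ∨ p ≤ i := by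
    by_contra hcon
    push Not at hcon
    exact pos_isotropic_mid hg hW hcon.1 hcon.2 hi
  exact (mem_pos_perp hg h hiN).1 (hF.pos_mono hW hi)

theorem pos_perp_eq (hg : g ∈ formGroup p q) (hW : W ≤ perp p q W) :
    pos (p + q) (colFlag g) (perp p q W) =
      (range (p + q)).filter fun i => p + q - 1 - i ∉ pos (p + q) (colFlag g) W := by
  have hF := isFlag_colFlag (isUnit_formGroup hg)
  apply eq_of_subset_of_card_le
  · intro i hi
    have hiN := mem_range.1 (pos_subset_range _ _ hi)
    rw [Finset.mem_filter]
    refine ⟨mem_range.2 hiN, ?_⟩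
    by_cases h : i < q ∨ p ≤ i
    · exact (mem_pos_perp hg h hiN).1 hi
    · exact pos_isotropic_mid hg hW (by omega) (by omega)
  · have h1 := finrank_perp W
    rw [hF.card_pos]
    have h2 := card_filter_add_card_filter_not (s := range (p + q))
      (fun i => p + q - 1 - i ∉ pos (p + q) (colFlag g) W)
    have h3 : ((range (p + q)).filter fun i => ¬ p + q - 1 - i ∉ pos (p + q) (colFlag g) W).card =
        finrank ℂ W := by
      rw [← hF.card_pos]
      refine card_bij (fun i _ => p + q - 1 - i) ?_ ?_ ?_
      · intro i hi; exact not_not.1 (Finset.mem_filter.1 hi).2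
      · intro i hi j hj hij
        have := mem_range.1 (Finset.mem_filter.1 hi).1
        have := mem_range.1 (Finset.mem_filter.1 hj).1
        omega
      · intro j hj
        have hjN := mem_range.1 (pos_subset_range _ _ hj)
        have e : p + q - 1 - (p + q - 1 - j) = j := by omega
        exact ⟨p + q - 1 - j, Finset.mem_filter.2 ⟨mem_range.2 (by omega), by rw [e]; simpa using hj⟩, e⟩
    rw [h3, card_range] at h2
    omega

/-- The maximal destabilizing subspace of isotropic flags is isotropic. -/
theorem IsHN.isotropic (hpq : q ≤ p) {x : Fin 3 → Fin q → ℝ} (hx : ∀ k, DecrNonneg (x k))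
    {g : Fin 3 → Matrix (Fin (p + q)) (Fin (p + q)) ℂ} (hg : ∀ k, g k ∈ formGroup p q)
    {V : Submodule ℂ (Fin (p + q) → ℂ)} {μ : ℝ}
    (h : IsHN (p + q) (fun k => xhat p q (x k)) (fun k => colFlag (g k)) V μ) :
    V ≤ perp p q V := by
  set w := fun k => xhat p q (x k)
  set F := fun k => colFlag (g k)
  have hF : ∀ k, IsFlag (p + q) (F k) := fun k => isFlag_colFlag (isUnit_formGroup (hg k))
  have hperp : ∀ W, tot (p + q) w F (perp p q W) = tot (p + q) w F W := fun W =>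
    sum_congr rfl fun k _ => wsum_perp hpq (hg k) (x k)
  have h1 := tot_supermodular (w := w) hF (fun k => xhat_antitone (hx k)) V (perp p q V)
  have h2 : V ⊔ perp p q V = perp p q (V ⊓ perp p q V) := by rw [perp_inf, perp_perp, sup_comm]
  rw [h2, hperp, hperp] at h1
  have h3 := h.le (V ⊓ perp p q V)
  have h4 := h.eq
  have h5 : (finrank ℂ V : ℝ) ≤ finrank ℂ ↥(V ⊓ perp p q V) := by
    have h6 : μ * finrank ℂ V ≤ μ * finrank ℂ ↥(V ⊓ perp p q V) := by linarith
    exact le_of_mul_le_mul_left h6 h.slope_pos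
  have h6 := Submodule.eq_of_le_of_finrank_le (inf_le_left : V ⊓ perp p q V ≤ V) (by exact_mod_cast h5)
  exact inf_eq_left.1 h6

end Perp

end SingHorn

namespace SingHorn

open scoped ComplexOrder
open Module Finset Filter Topology

section Orthonormal

variable {n : ℕ}

/-- A finite family of vectors, orthonormal for the standard Hermitian product. -/
def ONOn (s : Finset ℕ) (v : ℕ → Fin n → ℂ) : Prop :=
  ∀ a ∈ s, ∀ b ∈ s, star (v a) ⬝ᵥ v b = if a = b then 1 else 0

theorem ONOn.mono {s t : Finset ℕ} {v : ℕ → Fin n → ℂ} (h : ONOn t v) (hst : s ⊆ t) : ONOn s v :=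
  fun a ha b hb => h a (hst ha) b (hst hb)

theorem ONOn.linearIndependent {s : Finset ℕ} {v : ℕ → Fin n → ℂ} (h : ONOn s v) :
    LinearIndependent ℂ (fun i : s => v i) := by
  rw [Fintype.linearIndependent_iff]
  intro c hc i
  have h1 := congrArg (fun u => star (v i) ⬝ᵥ u) hc
  simp only [dotProduct_sum, dotProduct_smul, dotProduct_zero] at h1
  rw [sum_eq_single i] at h1
  · rw [h i i.2 i i.2] at h1; simpa using h1
  · intro j _ hj
    rw [h i i.2 j j.2, if_neg (fun e => hj (Subtype.ext e.symm)), smul_zero]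
  · simp

theorem ONOn.card_le {s : Finset ℕ} {v : ℕ → Fin n → ℂ} (h : ONOn s v)
    {W : Submodule ℂ (Fin n → ℂ)} (hW : ∀ a ∈ s, v a ∈ W) : s.card ≤ finrank ℂ W := by
  have h1 := finrank_span_eq_card h.linearIndependent
  rw [Fintype.card_coe] at h1
  rw [← h1]
  refine Submodule.finrank_mono (Submodule.span_le.2 ?_)
  rintro _ ⟨i, rfl⟩
  exact hW i i.2

theorem ONOn.span_eq {s : Finset ℕ} {v : ℕ → Fin n → ℂ} (h : ONOn s v)
    {W : Submodule ℂ (Fin n → ℂ)} (hW : ∀ a ∈ s, v a ∈ W) (hd : finrank ℂ W ≤ s.card) :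
    W = Submodule.span ℂ (v '' s) := by
  have h1 := finrank_span_eq_card h.linearIndependent
  rw [Fintype.card_coe] at h1
  have h2 : Set.range (fun i : s => v i) = v '' s := by ext x; simp
  rw [h2] at h1
  symm
  apply Submodule.eq_of_le_of_finrank_le
  · rw [Submodule.span_le]
    rintro _ ⟨i, hi, rfl⟩
    exact hW i hi
  · rw [h1]; exact hd

theorem ONOn.expand {s : Finset ℕ} {v : ℕ → Fin n → ℂ} (h : ONOn s v) {u : Fin n → ℂ}
    (hu : u ∈ Submodule.span ℂ (v '' s)) : u = ∑ b ∈ s, (star (v b) ⬝ᵥ u) • v b := by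
  induction hu using Submodule.span_induction with
  | mem x hx =>
    obtain ⟨a, ha, rfl⟩ := hx
    rw [sum_eq_single a]
    · rw [h a ha a ha]; simp
    · intro b hb hba; rw [h b hb a ha, if_neg hba, zero_smul]
    · exact fun h' => absurd ha h'
  | zero => simp
  | add x y _ _ hx hy =>
    conv_lhs => rw [hx, hy]
    rw [← sum_add_distrib]
    exact sum_congr rfl fun b _ => by rw [dotProduct_add, add_smul]
  | smul c x _ hx =>
    conv_lhs => rw [hx]
    rw [smul_sum]
    exact sum_congr rfl fun b _ => by rw [dotProduct_smul, smul_smul, smul_eq_mul]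

theorem norm_le_one_of_unit {v : Fin n → ℂ} (h : star v ⬝ᵥ v = 1) :
    v ∈ Metric.closedBall (0 : Fin n → ℂ) 1 := by
  rw [mem_closedBall_zero_iff, pi_norm_le_iff_of_nonneg zero_le_one]
  intro a
  have h1 : (∑ i, ‖v i‖ ^ 2 : ℝ) = 1 := by
    have : ((∑ i, ‖v i‖ ^ 2 : ℝ) : ℂ) = 1 := by
      rw [← h, Complex.ofReal_sum]
      refine sum_congr rfl fun i _ => ?_
      rw [Complex.ofReal_pow, ← Complex.conj_mul']; rfl
    exact_mod_cast this
  have h2 := single_le_sum (f := fun i => ‖v i‖ ^ 2) (fun i _ => by positivity) (mem_univ a)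
  simp only [h1] at h2
  nlinarith [norm_nonneg (v a)]

theorem tendsto_star_dotProduct {X : Type*} {l : Filter X} {f f' : X → Fin n → ℂ}
    {y y' : Fin n → ℂ} (hf : Tendsto f l (𝓝 y)) (hf' : Tendsto f' l (𝓝 y')) :
    Tendsto (fun n => star (f n) ⬝ᵥ f' n) l (𝓝 (star y ⬝ᵥ y')) := by
  refine tendsto_finsetSum _ fun i _ => ?_
  exact ((continuous_star.tendsto _).comp (tendsto_pi_nhds.1 hf i)).mul (tendsto_pi_nhds.1 hf' i)

theorem tendsto_of_ultrafilter {X : Type*} [TopologicalSpace X] {K : Set X} (hK : IsCompact K)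
    (U : Ultrafilter ℕ) {f : ℕ → X} (h : ∀ n, f n ∈ K) : ∃ x ∈ K, Tendsto f U (𝓝 x) :=
  hK.ultrafilter_le_nhds' (U.map f) (Ultrafilter.mem_map.2 (Filter.univ_mem' h))

theorem eventually_eq_of_finite {X : Type*} {S : Set X} (hS : S.Finite)
    (U : Ultrafilter ℕ) {f : ℕ → X} (h : ∀ n, f n ∈ S) : ∃ x ∈ S, ∀ᶠ n in U, f n = x := by
  obtain ⟨x, hx, e⟩ := Ultrafilter.eq_pure_of_finite_mem hS
    (f := U.map f) (Ultrafilter.mem_map.2 (Filter.univ_mem' h))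
  refine ⟨x, hx, ?_⟩
  have : {x} ∈ U.map f := by rw [e]; exact Set.mem_singleton x
  exact this

end Orthonormal

section Perturbation

variable {p q : ℕ}

theorem formGroup_inv_mul {g : Matrix (Fin (p + q)) (Fin (p + q)) ℂ} (hg : g ∈ formGroup p q) :
    J0 p q * gᴴ * J0 p q * g = 1 := by
  rw [Matrix.mul_assoc, Matrix.mul_assoc, ← Matrix.mul_assoc gᴴ, mem_formGroup.1 hg, J0_mul_self]

theorem mem_colFlag_iff {g : Matrix (Fin (p + q)) (Fin (p + q)) ℂ} (hg : g ∈ formGroup p q)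
    {i : ℕ} {v : Fin (p + q) → ℂ} :
    v ∈ colFlag g i ↔ (J0 p q * gᴴ * J0 p q) *ᵥ v ∈ coord (p + q) i := by
  have h := formGroup_inv_mul hg
  constructor
  · rintro ⟨c, hc, rfl⟩
    rw [mulVecLin_apply, mulVec_mulVec, h, one_mulVec]; exact hc
  · intro hv
    refine ⟨_, hv, ?_⟩
    rw [mulVecLin_apply, mulVec_mulVec, mul_eq_one_comm.1 h, one_mulVec]

theorem mem_colFlag_of_tendsto {U : Filter ℕ} [U.NeBot]
    {γ : ℕ → Matrix (Fin (p + q)) (Fin (p + q)) ℂ}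
    {g : Matrix (Fin (p + q)) (Fin (p + q)) ℂ} (hγ : ∀ n, γ n ∈ formGroup p q)
    (hg : g ∈ formGroup p q) (hlim : Tendsto γ U (𝓝 g)) {v : ℕ → Fin (p + q) → ℂ}
    {u : Fin (p + q) → ℂ} (hv : Tendsto v U (𝓝 u)) {i : ℕ} (h : ∀ᶠ n in U, v n ∈ colFlag (γ n) i) :
    u ∈ colFlag g i := by
  rw [mem_colFlag_iff hg]
  have hc : Continuous fun x : Matrix (Fin (p + q)) (Fin (p + q)) ℂ × (Fin (p + q) → ℂ) =>
      (J0 p q * x.1ᴴ * J0 p q) *ᵥ x.2 := by fun_prop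
  have h1 := (hc.tendsto (g, u)).comp (hlim.prodMk_nhds hv)
  intro a ha
  have h2 := ((continuous_apply a).tendsto _).comp h1
  refine tendsto_nhds_unique h2 (tendsto_const_nhds.congr' ?_)
  filter_upwards [h] with n hn
  rw [mem_colFlag_iff (hγ n)] at hn
  exact (hn a ha).symm

/-- The maximal destabilizing subspace of a triple of isotropic flags. -/
structure HNData (p q : ℕ) (x : Fin 3 → Fin q → ℝ)
    (g : Fin 3 → Matrix (Fin (p + q)) (Fin (p + q)) ℂ) (V : Submodule ℂ (Fin (p + q) → ℂ))
    (μ : ℝ) : Prop where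
  mem : ∀ k, g k ∈ formGroup p q
  hn : IsHN (p + q) (fun k => xhat p q (x k)) (fun k => colFlag (g k)) V μ

/-- The sum of the dimensions of the intersections with all steps of three flags. -/
noncomputable def totCap (n : ℕ) (g : Fin 3 → Matrix (Fin n) (Fin n) ℂ)
    (V : Submodule ℂ (Fin n → ℂ)) : ℕ := ∑ k, ∑ i ∈ range (n + 1), capDim (colFlag (g k)) V i

/-- A triple of isotropic flags as close to semistability as possible. -/
structure MinHN (p q : ℕ) (x : Fin 3 → Fin q → ℝ)
    (g : Fin 3 → Matrix (Fin (p + q)) (Fin (p + q)) ℂ) (V : Submodule ℂ (Fin (p + q) → ℂ))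
    (μ : ℝ) : Prop extends HNData p q x g V μ where
  slope_le : ∀ g' V' μ', HNData p q x g' V' μ' → μ ≤ μ'
  rank_le : ∀ g' V', HNData p q x g' V' μ → finrank ℂ V ≤ finrank ℂ V'
  cap_le : ∀ g' V', HNData p q x g' V' μ → finrank ℂ V' = finrank ℂ V →
    totCap (p + q) g V ≤ totCap (p + q) g' V'

theorem HNData.isFlag {x : Fin 3 → Fin q → ℝ}
    {g : Fin 3 → Matrix (Fin (p + q)) (Fin (p + q)) ℂ} {V : Submodule ℂ (Fin (p + q) → ℂ)}
    {μ : ℝ} (h : HNData p q x g V μ) (k : Fin 3) : IsFlag (p + q) (colFlag (g k)) :=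
  isFlag_colFlag (isUnit_formGroup (h.mem k))

theorem exists_minHN {x : Fin 3 → Fin q → ℝ} (h : ∃ g V μ, HNData p q x g V μ) :
    ∃ g V μ, MinHN p q x g V μ := by
  classical
  have hfin : {μ | ∃ g V, HNData p q x g V μ}.Finite := by
    refine ((finite_pos_range (p + q)).image
      (fun P => (∑ k, ∑ i ∈ P k, xhat p q (x k) i) / (P 0).card)).subset ?_
    rintro μ ⟨g, V, hd⟩
    refine ⟨fun k => pos (p + q) (colFlag (g k)) V, fun k => pos_subset_range _ _, ?_⟩
    have h1 := hd.hn.eq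
    rw [tot_eq_pos hd.isFlag] at h1
    have h2 : (finrank ℂ V : ℝ) ≠ 0 := by
      rw [Nat.cast_ne_zero]
      exact fun h0 => hd.hn.ne_bot (Submodule.finrank_eq_zero.1 h0)
    simp only [h1, (hd.isFlag 0).card_pos]
    rw [mul_div_assoc, div_self h2, mul_one]
  obtain ⟨g₀, V₀, μ₀, h₀⟩ := h
  obtain ⟨μ, ⟨g₁, V₁, h₁⟩, hμ⟩ := Set.exists_min_image _ id hfin ⟨μ₀, g₀, V₀, h₀⟩
  have hr : ∃ r, ∃ g V, HNData p q x g V μ ∧ finrank ℂ V = r := ⟨_, g₁, V₁, h₁, rfl⟩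
  obtain ⟨g₂, V₂, h₂, hr₂⟩ := Nat.find_spec hr
  have hD : ∃ D, ∃ g V, HNData p q x g V μ ∧ finrank ℂ V = Nat.find hr ∧ totCap (p + q) g V = D :=
    ⟨_, g₂, V₂, h₂, hr₂, rfl⟩
  obtain ⟨g, V, h₃, hr₃, hD₃⟩ := Nat.find_spec hD
  refine ⟨g, V, μ, h₃, fun g' V' μ' h' => hμ μ' ⟨g', V', h'⟩, fun g' V' h' => ?_,
    fun g' V' h' e => ?_⟩
  · rw [hr₃]; exact Nat.find_min' hr ⟨g', V', h', rfl⟩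
  · rw [hD₃]; exact Nat.find_min' hD ⟨g', V', h', e.trans hr₃, rfl⟩

set_option maxHeartbeats 800000 in
/-- Limits of maximal destabilizing subspaces at a minimal triple. -/
theorem MinHN.perturb (hpq : q ≤ p) {x : Fin 3 → Fin q → ℝ} (hx : ∀ k, DecrNonneg (x k))
    (hun : ∀ g : Fin 3 → Matrix (Fin (p + q)) (Fin (p + q)) ℂ, (∀ k, g k ∈ formGroup p q) →
      ∃ V μ, HNData p q x g V μ)
    {g : Fin 3 → Matrix (Fin (p + q)) (Fin (p + q)) ℂ} {V : Submodule ℂ (Fin (p + q) → ℂ)}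
    {μ : ℝ} (hm : MinHN p q x g V μ) (U : Ultrafilter ℕ)
    {γ : ℕ → Fin 3 → Matrix (Fin (p + q)) (Fin (p + q)) ℂ} (hγ : ∀ n k, γ n k ∈ formGroup p q)
    (hlim : ∀ k, Tendsto (fun n => γ n k) U (𝓝 (g k))) :
    ∃ (Vn : ℕ → Submodule ℂ (Fin (p + q) → ℂ)) (v : ℕ → Fin 3 → ℕ → Fin (p + q) → ℂ)
      (u : Fin 3 → ℕ → Fin (p + q) → ℂ),
      (∀ n, Vn n ≤ perp p q (Vn n)) ∧
      (∀ᶠ n in U, ∀ k, ∀ a ∈ pos (p + q) (colFlag (g k)) V,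
        v n k a ∈ Vn n ⊓ colFlag (γ n k) (a + 1)) ∧
      (∀ᶠ n in U, Vn n = Submodule.span ℂ (v n 0 '' pos (p + q) (colFlag (g 0)) V) ∧
        ONOn (pos (p + q) (colFlag (g 0)) V) (v n 0)) ∧
      (∀ k a, Tendsto (fun n => v n k a) U (𝓝 (u k a))) ∧
      (∀ k, ONOn (pos (p + q) (colFlag (g k)) V) (u k)) ∧
      (∀ k, ∀ i ≤ p + q, V ⊓ colFlag (g k) i =
        Submodule.span ℂ (u k '' ((pos (p + q) (colFlag (g k)) V).filter (· < i)))) := by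
  classical
  choose Vn μn hn using fun n => hun (γ n) (hγ n)
  have hFn : ∀ n k, IsFlag (p + q) (colFlag (γ n k)) := fun n => (hn n).isFlag
  have hF := hm.isFlag
  choose v₀ hv₀ using fun n k => IsONAdapted.exists (hFn n k) (Vn n)
  let P : ℕ → Fin 3 → Finset ℕ := fun n k => pos (p + q) (colFlag (γ n k)) (Vn n)
  obtain ⟨P', -, hP'⟩ := eventually_eq_of_finite (finite_pos_range (p + q)) U (f := P)
    (fun n k => pos_subset_range _ _)
  let v : ℕ → Fin 3 → ℕ → Fin (p + q) → ℂ := fun n k a => if a ∈ P n k then v₀ n k a else 0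
  have hvball : ∀ n k a, v n k a ∈ Metric.closedBall (0 : Fin (p + q) → ℂ) 1 := by
    intro n k a
    by_cases ha : a ∈ P n k
    · simp only [v, ha, if_true]
      exact norm_le_one_of_unit (hv₀ n k a ha).2.1
    · simp only [v, ha, if_false]
      exact Metric.mem_closedBall_self zero_le_one
  choose u _ hu using fun k a =>
    tendsto_of_ultrafilter (isCompact_closedBall (0 : Fin (p + q) → ℂ) 1) U (fun n => hvball n k a)
  have hmem : ∀ n k, ∀ a ∈ P n k, v n k a ∈ Vn n ⊓ colFlag (γ n k) (a + 1) := by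
    intro n k a ha
    simp only [v, ha, if_true]
    exact (hv₀ n k a ha).1
  have hon : ∀ n k, ONOn (P n k) (v n k) := by
    intro n k a ha b hb
    simp only [v, ha, hb, if_true]
    exact (hv₀ n k).orthonormal (hFn n k) ha hb
  have hspan : ∀ n, Vn n = Submodule.span ℂ (v n 0 '' P n 0) := fun n =>
    (hon n 0).span_eq (fun a ha => (hmem n 0 a ha).1) (by rw [← (hFn n 0).card_pos])
  have hon' : ∀ k, ONOn (P' k) (u k) := by
    intro k a ha b hb
    refine tendsto_nhds_unique (tendsto_star_dotProduct (hu k a) (hu k b)) (tendsto_const_nhds.congr' ?_)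
    filter_upwards [hP'] with n hn
    rw [hon n k a (by rw [hn]; exact ha) b (by rw [hn]; exact hb)]
  set V' := Submodule.span ℂ (u 0 '' P' 0) with hV'
  have huV' : ∀ k, ∀ a ∈ P' k, u k a ∈ V' := by
    intro k a ha
    have h1 : Tendsto (fun n => ∑ b ∈ P' 0, (star (v n 0 b) ⬝ᵥ v n k a) • v n 0 b) U
        (𝓝 (∑ b ∈ P' 0, (star (u 0 b) ⬝ᵥ u k a) • u 0 b)) :=
      tendsto_finsetSum _ fun b _ => (tendsto_star_dotProduct (hu 0 b) (hu k a)).smul (hu 0 b)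
    have h2 : u k a = ∑ b ∈ P' 0, (star (u 0 b) ⬝ᵥ u k a) • u 0 b := by
      refine tendsto_nhds_unique (hu k a) (h1.congr' ?_)
      filter_upwards [hP'] with n hn
      rw [← hn]
      refine ((hon n 0).expand ?_).symm
      rw [← hspan]
      exact (hmem n k a (by rw [hn]; exact ha)).1
    rw [h2]
    exact Submodule.sum_mem _ fun b hb => Submodule.smul_mem _ _ (Submodule.subset_span ⟨b, hb, rfl⟩)
  have huF : ∀ k, ∀ a ∈ P' k, u k a ∈ colFlag (g k) (a + 1) := by
    intro k a ha
    refine mem_colFlag_of_tendsto (fun n => hγ n k) (hm.mem k) (hlim k) (hu k a) ?_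
    filter_upwards [hP'] with n hn
    exact (hmem n k a (by rw [hn]; exact ha)).2
  obtain ⟨n₀, hn₀⟩ := hP'.exists
  have hcap : ∀ k, ∀ i ≤ p + q, capDim (colFlag (γ n₀ k)) (Vn n₀) i ≤ capDim (colFlag (g k)) V' i := by
    intro k i hi
    rw [(hFn n₀ k).capDim_eq_card hi]
    change ((P n₀ k).filter (· < i)).card ≤ _
    rw [hn₀]
    refine ((hon' k).mono (filter_subset _ _)).card_le fun a ha => ?_
    rw [Finset.mem_filter] at ha
    exact ⟨huV' k a ha.1, (hF k).mono ha.2 (huF k a ha.1)⟩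
  have hd' : finrank ℂ V' = finrank ℂ (Vn n₀) := by
    apply le_antisymm
    · rw [← (hFn n₀ 0).card_pos (W := Vn n₀)]
      change _ ≤ (P n₀ 0).card
      rw [hn₀]
      have h1 : u 0 '' P' 0 = ((P' 0).image (u 0) : Finset (Fin (p + q) → ℂ)) := by simp
      rw [hV', h1]
      exact (finrank_span_finset_le_card _).trans card_image_le
    · rw [← (hFn n₀ 0).capDim_top, ← (hF 0).capDim_top]
      exact hcap 0 _ le_rfl
  have htot : tot (p + q) (fun k => xhat p q (x k)) (fun k => colFlag (γ n₀ k)) (Vn n₀) ≤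
      tot (p + q) (fun k => xhat p q (x k)) (fun k => colFlag (g k)) V' :=
    sum_le_sum fun k _ => wsum_le_of_capDim_le (hFn n₀ k) (hF k) (xhat_antitone (hx k)) hd'.symm
      (hcap k)
  have hpos : (0 : ℝ) < finrank ℂ (Vn n₀) := by
    rw [Nat.cast_pos, finrank_pos_iff]
    exact Submodule.nontrivial_iff_ne_bot.2 (hn n₀).hn.ne_bot
  have h1 := hm.hn.le V'
  have h2 := (hn n₀).hn.eq
  have hμle : μn n₀ ≤ μ := by
    rw [h2] at htot
    rw [hd'] at h1
    exact le_of_mul_le_mul_right (htot.trans h1) hpos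
  have hμe : μn n₀ = μ := le_antisymm hμle (hm.slope_le _ _ _ (hn n₀))
  have hdn : HNData p q x (γ n₀) (Vn n₀) μ := hμe ▸ hn n₀
  have hV'V : V' ≤ V := by
    apply hm.hn.max
    apply le_antisymm h1
    rw [hd', ← hμe, ← h2]; exact htot
  have hrank := hm.rank_le _ _ hdn
  have hVe : V' = V := Submodule.eq_of_le_of_finrank_le hV'V (by rw [hd']; exact hrank)
  rw [hVe] at hcap hd' huV'
  have hcape : ∀ k, ∀ i ≤ p + q, capDim (colFlag (γ n₀ k)) (Vn n₀) i = capDim (colFlag (g k)) V i := by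
    have h3 := hm.cap_le _ _ hdn hd'.symm
    have h4 : totCap (p + q) (γ n₀) (Vn n₀) = totCap (p + q) g V := le_antisymm
      (sum_le_sum fun k _ => sum_le_sum fun i hi => hcap k i (Nat.lt_succ_iff.1 (mem_range.1 hi))) h3
    intro k i hi
    have h5 := (sum_eq_sum_iff_of_le fun k _ => sum_le_sum fun i hi =>
      hcap k i (Nat.lt_succ_iff.1 (mem_range.1 hi))).1 h4 k (mem_univ _)
    exact (sum_eq_sum_iff_of_le fun i hi => hcap k i (Nat.lt_succ_iff.1 (mem_range.1 hi))).1 h5 i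
      (mem_range.2 (Nat.lt_succ_iff.2 hi))
  have hPe : ∀ k, P' k = pos (p + q) (colFlag (g k)) V := by
    intro k
    rw [← hn₀]
    refine filter_congr fun i hi => ?_
    rw [mem_range] at hi
    rw [hcape k i hi.le, hcape k (i + 1) hi]
  refine ⟨Vn, v, u, fun n => (hn n).hn.isotropic hpq hx (hγ n), ?_, ?_, hu, ?_, ?_⟩
  · filter_upwards [hP'] with n hn k a ha
    exact hmem n k a (by rw [hn, hPe]; exact ha)
  · filter_upwards [hP'] with n hn
    rw [← hPe, ← hn]
    exact ⟨hspan n, hon n 0⟩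
  · intro k; rw [← hPe]; exact hon' k
  · intro k i hi
    rw [← hPe]
    refine ((hon' k).mono (filter_subset _ _)).span_eq (fun a ha => ?_) ?_
    · rw [Finset.mem_filter] at ha
      exact ⟨huV' k a ha.1, (hF k).mono ha.2 (huF k a ha.1)⟩
    · have := (hF k).capDim_eq_card (W := V) hi
      rw [← hPe] at this
      exact this.le

end Perturbation

end SingHorn

namespace SingHorn

open scoped ComplexOrder
open Module Finset Filter Topology

section

variable {n : ℕ}

/-- The orthogonal projector onto the span of an orthonormal family. -/
noncomputable def projMat (s : Finset ℕ) (v : ℕ → Fin n → ℂ) : Matrix (Fin n) (Fin n) ℂ :=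
  ∑ a ∈ s, vecMulVec (v a) (star (v a))

theorem projMat_mulVec (s : Finset ℕ) (v : ℕ → Fin n → ℂ) (y : Fin n → ℂ) :
    projMat s v *ᵥ y = ∑ a ∈ s, (star (v a) ⬝ᵥ y) • v a := by
  rw [projMat, sum_mulVec]
  refine sum_congr rfl fun a _ => ?_
  rw [vecMulVec_mulVec, op_smul_eq_smul]

theorem projMat_mulVec_mem (s : Finset ℕ) (v : ℕ → Fin n → ℂ) (y : Fin n → ℂ) :
    projMat s v *ᵥ y ∈ Submodule.span ℂ (v '' s) := by
  rw [projMat_mulVec]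
  exact Submodule.sum_mem _ fun b hb => Submodule.smul_mem _ _ (Submodule.subset_span ⟨b, hb, rfl⟩)

theorem ONOn.projMat_mulVec_eq {s : Finset ℕ} {v : ℕ → Fin n → ℂ} (h : ONOn s v) {y : Fin n → ℂ}
    (hy : y ∈ Submodule.span ℂ (v '' s)) : projMat s v *ᵥ y = y := by
  rw [projMat_mulVec]; exact (h.expand hy).symm

theorem projMat_conjTranspose (s : Finset ℕ) (v : ℕ → Fin n → ℂ) :
    (projMat s v)ᴴ = projMat s v := by
  rw [projMat, conjTranspose_sum]
  refine sum_congr rfl fun a _ => ?_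
  rw [conjTranspose_vecMulVec, star_star]

theorem ONOn.projMat_mul_self {s : Finset ℕ} {v : ℕ → Fin n → ℂ} (h : ONOn s v) :
    projMat s v * projMat s v = projMat s v := by
  apply ext_of_mulVec_single
  intro i
  rw [← mulVec_mulVec, h.projMat_mulVec_eq (projMat_mulVec_mem s v _)]

theorem sub_projMat_mulVec_mem_orth {s : Finset ℕ} {v : ℕ → Fin n → ℂ} (h : ONOn s v)
    (y : Fin n → ℂ) : (1 - projMat s v) *ᵥ y ∈ orth (Submodule.span ℂ (v '' s)) := by
  intro u hu
  rw [← h.projMat_mulVec_eq hu, star_mulVec, projMat_conjTranspose, ← dotProduct_mulVec,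
    mulVec_mulVec, Matrix.mul_sub, Matrix.mul_one, h.projMat_mul_self, sub_self, zero_mulVec,
    dotProduct_zero]

theorem tendsto_projMat {X : Type*} {l : Filter X} (s : Finset ℕ) {v : X → ℕ → Fin n → ℂ}
    {u : ℕ → Fin n → ℂ} (h : ∀ a ∈ s, Tendsto (fun x => v x a) l (𝓝 (u a))) :
    Tendsto (fun x => projMat s (v x)) l (𝓝 (projMat s u)) := by
  refine tendsto_finsetSum _ fun a ha => ?_
  refine tendsto_pi_nhds.2 fun i => tendsto_pi_nhds.2 fun j => ?_
  exact (tendsto_pi_nhds.1 (h a ha) i).mul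
    ((continuous_star.tendsto _).comp (tendsto_pi_nhds.1 (h a ha) j))

theorem tendsto_matrix_inv {X : Type*} {l : Filter X} {B : X → Matrix (Fin n) (Fin n) ℂ}
    (h : Tendsto B l (𝓝 1)) : Tendsto (fun x => (B x)⁻¹) l (𝓝 1) ∧ ∀ᶠ x in l, IsUnit (B x).det := by
  have h1 : Tendsto (fun x => (B x).det) l (𝓝 1) := by
    have := (Continuous.matrix_det continuous_id (X := Matrix (Fin n) (Fin n) ℂ)).tendsto 1
    rw [id, det_one] at this
    exact this.comp h
  have h2 : Tendsto (fun x => (B x).adjugate) l (𝓝 1) := by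
    have := (Continuous.matrix_adjugate continuous_id (X := Matrix (Fin n) (Fin n) ℂ)).tendsto 1
    rw [id, adjugate_one] at this
    exact this.comp h
  constructor
  · have h3 := (h1.inv₀ one_ne_zero).smul h2
    rw [inv_one, one_smul] at h3
    refine h3.congr fun x => ?_
    rw [Matrix.inv_def, Ring.inverse_eq_inv']
  · filter_upwards [h1.eventually_ne one_ne_zero] with x hx
    exact isUnit_iff_ne_zero.2 hx

/-- Normalization of a sequence of matrices against a positive sequence. -/
theorem exists_normalized_limit (U : Ultrafilter ℕ) (φ : ℕ → Matrix (Fin n) (Fin n) ℂ) {t : ℕ → ℝ}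
    (ht : ∀ m, 0 < t m) : ∃ (e : ℕ → ℝ) (φ' : Matrix (Fin n) (Fin n) ℂ) (τ : ℝ),
      Tendsto (fun m => (e m : ℂ) • φ m) U (𝓝 φ') ∧ Tendsto (fun m => e m * t m) U (𝓝 τ) ∧
      (τ = 0 → φ' ≠ 0) := by
  let N : ℕ → ℝ := fun m => ∑ i, ∑ j, ‖φ m i j‖
  have hN : ∀ m, 0 ≤ N m := fun m => sum_nonneg fun i _ => sum_nonneg fun j _ => norm_nonneg _
  have hε : ∀ m, 0 < N m + t m := fun m => add_pos_of_nonneg_of_pos (hN m) (ht m)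
  let e : ℕ → ℝ := fun m => (N m + t m)⁻¹
  have he : ∀ m, 0 < e m := fun m => inv_pos.2 (hε m)
  have hle : ∀ m i j, ‖φ m i j‖ ≤ N m := fun m i j =>
    (single_le_sum (f := fun j => ‖φ m i j‖) (fun j _ => norm_nonneg _) (mem_univ j)).trans
      (single_le_sum (f := fun i => ∑ j, ‖φ m i j‖)
        (fun i _ => sum_nonneg fun j _ => norm_nonneg _) (mem_univ i))
  have h1 : ∀ m i j, (e m : ℂ) * φ m i j ∈ Metric.closedBall (0 : ℂ) 1 := by
    intro m i j
    rw [mem_closedBall_zero_iff, norm_mul, Complex.norm_real, Real.norm_of_nonneg (he m).le]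
    calc e m * ‖φ m i j‖ ≤ e m * (N m + t m) :=
          mul_le_mul_of_nonneg_left ((hle m i j).trans (by linarith [ht m])) (he m).le
      _ = 1 := inv_mul_cancel₀ (hε m).ne'
  choose φ' _ hφ' using fun i j =>
    tendsto_of_ultrafilter (isCompact_closedBall (0 : ℂ) 1) U (fun m => h1 m i j)
  have h2 : ∀ m, e m * t m ∈ Set.Icc (0 : ℝ) 1 := fun m =>
    ⟨(mul_pos (he m) (ht m)).le, by
      rw [← inv_mul_cancel₀ (hε m).ne']
      exact mul_le_mul_of_nonneg_left (by linarith [hN m]) (he m).le⟩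
  obtain ⟨τ, _, hτ⟩ := tendsto_of_ultrafilter isCompact_Icc U h2
  refine ⟨e, Matrix.of φ', τ, tendsto_pi_nhds.2 fun i => tendsto_pi_nhds.2 fun j => hφ' i j, hτ, ?_⟩
  rintro rfl h0
  have h3 : Tendsto (fun m => (∑ i, ∑ j, ‖(e m : ℂ) * φ m i j‖) + e m * t m) U
      (𝓝 ((∑ i, ∑ j, ‖φ' i j‖) + 0)) :=
    (tendsto_finsetSum _ fun i _ => tendsto_finsetSum _ fun j _ => (hφ' i j).norm).add hτ
  have h4 : ∀ m, (∑ i, ∑ j, ‖(e m : ℂ) * φ m i j‖) + e m * t m = 1 := by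
    intro m
    simp only [norm_mul, Complex.norm_real, Real.norm_of_nonneg (he m).le, ← mul_sum]
    rw [← mul_add]
    exact inv_mul_cancel₀ (hε m).ne'
  have h5 : ∀ i j, φ' i j = 0 := fun i j => congrFun (congrFun h0 i) j
  simp only [h4, h5, norm_zero, sum_const_zero, add_zero] at h3
  exact one_ne_zero (tendsto_nhds_unique tendsto_const_nhds h3)

end

section Cayley

variable {p q : ℕ}

/-- The Cayley transform provides curves in the group of the form. -/
theorem exists_cayley {X : Matrix (Fin (p + q)) (Fin (p + q)) ℂ}
    (hX : Xᴴ * J0 p q = -(J0 p q * X)) {t : ℕ → ℝ} (ht : Tendsto t atTop (𝓝 0)) :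
    ∃ c : ℕ → Matrix (Fin (p + q)) (Fin (p + q)) ℂ, (∀ n, c n ∈ formGroup p q) ∧
      Tendsto c atTop (𝓝 1) ∧ ∀ᶠ n in atTop, (1 - (t n : ℂ) • X) * c n = 1 + (t n : ℂ) • X := by
  classical
  have ht' : Tendsto (fun n => (t n : ℂ) • X) atTop (𝓝 0) := by
    have h := ((Complex.continuous_ofReal.tendsto _).comp ht).smul_const X
    rwa [Complex.ofReal_zero, zero_smul] at h
  have h1 : Tendsto (fun n => 1 - (t n : ℂ) • X) atTop (𝓝 1) := by
    simpa using (tendsto_const_nhds (x := (1 : Matrix (Fin (p + q)) (Fin (p + q)) ℂ))).sub ht'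
  have h2 : Tendsto (fun n => 1 + (t n : ℂ) • X) atTop (𝓝 1) := by
    simpa using (tendsto_const_nhds (x := (1 : Matrix (Fin (p + q)) (Fin (p + q)) ℂ))).add ht'
  obtain ⟨h3, h4⟩ := tendsto_matrix_inv h1
  obtain ⟨-, h5⟩ := tendsto_matrix_inv h2
  let c : ℕ → Matrix (Fin (p + q)) (Fin (p + q)) ℂ := fun n =>
    if IsUnit (1 - (t n : ℂ) • X).det ∧ IsUnit (1 + (t n : ℂ) • X).det then
      (1 - (t n : ℂ) • X)⁻¹ * (1 + (t n : ℂ) • X) else 1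
  have hc : ∀ᶠ n in atTop, c n = (1 - (t n : ℂ) • X)⁻¹ * (1 + (t n : ℂ) • X) := by
    filter_upwards [h4, h5] with n ha hb
    exact if_pos ⟨ha, hb⟩
  refine ⟨c, fun n => ?_, ?_, ?_⟩
  · by_cases h : IsUnit (1 - (t n : ℂ) • X).det ∧ IsUnit (1 + (t n : ℂ) • X).det
    · simp only [c, if_pos h]
      set A := 1 - (t n : ℂ) • X with hA
      set B := 1 + (t n : ℂ) • X with hB
      have hAB : A * B = B * A := by
        rw [hA, hB]; generalize (t n : ℂ) • X = Y; noncomm_ring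
      have hAJ : Aᴴ * J0 p q = J0 p q * B := by
        rw [hA, hB, conjTranspose_sub, conjTranspose_smul, conjTranspose_one, Matrix.sub_mul,
          Matrix.smul_mul, hX, Matrix.mul_add, Matrix.mul_smul, Complex.star_def,
          Complex.conj_ofReal, Matrix.one_mul, Matrix.mul_one, smul_neg, sub_neg_eq_add]
      have hBJ : Bᴴ * J0 p q = J0 p q * A := by
        rw [hA, hB, conjTranspose_add, conjTranspose_smul, conjTranspose_one, Matrix.add_mul,
          Matrix.smul_mul, hX, Matrix.mul_sub, Matrix.mul_smul, Complex.star_def,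
          Complex.conj_ofReal, Matrix.one_mul, Matrix.mul_one, smul_neg, sub_eq_add_neg]
      have hA' : A⁻¹ᴴ * J0 p q = J0 p q * B⁻¹ := by
        have e1 : A⁻¹ᴴ * Aᴴ = 1 := by
          rw [← conjTranspose_mul, mul_nonsing_inv _ h.1, conjTranspose_one]
        calc A⁻¹ᴴ * J0 p q = A⁻¹ᴴ * (J0 p q * B) * B⁻¹ := by
              rw [Matrix.mul_assoc, Matrix.mul_assoc, mul_nonsing_inv _ h.2, Matrix.mul_one]
          _ = J0 p q * B⁻¹ := by
              rw [← hAJ, ← Matrix.mul_assoc, e1, Matrix.one_mul]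
      have hc2 : B⁻¹ * A⁻¹ * B = A⁻¹ := by
        rw [← Matrix.mul_inv_rev, hAB, Matrix.mul_inv_rev, Matrix.mul_assoc, nonsing_inv_mul _ h.2,
          Matrix.mul_one]
      rw [mem_formGroup]
      calc (A⁻¹ * B)ᴴ * J0 p q * (A⁻¹ * B) = Bᴴ * (A⁻¹ᴴ * J0 p q) * (A⁻¹ * B) := by
            rw [conjTranspose_mul, Matrix.mul_assoc Bᴴ]
        _ = (Bᴴ * J0 p q) * (B⁻¹ * A⁻¹ * B) := by
            rw [hA']; simp only [Matrix.mul_assoc]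
        _ = J0 p q := by
            rw [hBJ, hc2, Matrix.mul_assoc, mul_nonsing_inv _ h.1, Matrix.mul_one]
    · simp only [c, if_neg h]; exact formGroup_one
  · have h6 := h3.mul h2
    rw [Matrix.mul_one] at h6
    exact h6.congr' (hc.mono fun n hn => hn.symm)
  · filter_upwards [hc, h4] with n hn ha
    rw [hn, ← Matrix.mul_assoc, mul_nonsing_inv _ ha, Matrix.one_mul]

end Cayley

end SingHorn

namespace SingHorn

open scoped ComplexOrder
open Module Finset Filter Topology

variable {p q : ℕ}

theorem tendsto_mulVec {n : ℕ} {X : Type*} {l : Filter X} {A : X → Matrix (Fin n) (Fin n) ℂ}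
    {A' : Matrix (Fin n) (Fin n) ℂ} {v : X → Fin n → ℂ} {v' : Fin n → ℂ}
    (hA : Tendsto A l (𝓝 A')) (hv : Tendsto v l (𝓝 v')) :
    Tendsto (fun x => A x *ᵥ v x) l (𝓝 (A' *ᵥ v')) := by
  refine tendsto_pi_nhds.2 fun i => ?_
  change Tendsto (fun x => ∑ j, A x i j * v x j) l (𝓝 (∑ j, A' i j * v' j))
  refine tendsto_finsetSum _ fun j _ => ?_
  exact (tendsto_pi_nhds.1 (tendsto_pi_nhds.1 hA i) j).mul (tendsto_pi_nhds.1 hv j)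

/-- The limit of the normalized graph maps of a converging sequence of isotropic subspaces is
infinitesimally isotropic. -/
theorem isotropic_limit {U : Filter ℕ} [U.NeBot] {V : Submodule ℂ (Fin (p + q) → ℂ)}
    (hV : V ≤ perp p q V) {φ : ℕ → Matrix (Fin (p + q)) (Fin (p + q)) ℂ} {e : ℕ → ℝ}
    {φ' : Matrix (Fin (p + q)) (Fin (p + q)) ℂ} (hφ : Tendsto φ U (𝓝 0))
    (hφ' : Tendsto (fun m => (e m : ℂ) • φ m) U (𝓝 φ')) {w w' : ℕ → Fin (p + q) → ℂ}
    {v v' : Fin (p + q) → ℂ} (hw : Tendsto w U (𝓝 v)) (hw' : Tendsto w' U (𝓝 v'))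
    (hwV : ∀ n, w n ∈ V) (hwV' : ∀ n, w' n ∈ V)
    (h : ∀ᶠ n in U, star (w n + φ n *ᵥ w n) ⬝ᵥ (J0 p q *ᵥ (w' n + φ n *ᵥ w' n)) = 0) :
    star (φ' *ᵥ v) ⬝ᵥ (J0 p q *ᵥ v') + star v ⬝ᵥ (J0 p q *ᵥ (φ' *ᵥ v')) = 0 := by
  have hJ : Tendsto (fun _ : ℕ => J0 p q) U (𝓝 (J0 p q)) := tendsto_const_nhds
  have h1 := tendsto_star_dotProduct (tendsto_mulVec hφ' hw) (tendsto_mulVec hJ hw')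
  have h2 := tendsto_star_dotProduct hw (tendsto_mulVec hJ (tendsto_mulVec hφ' hw'))
  have h3 := tendsto_star_dotProduct (tendsto_mulVec hφ' hw)
    (tendsto_mulVec hJ (tendsto_mulVec hφ hw'))
  have h4 := (h1.add h2).add h3
  rw [zero_mulVec, mulVec_zero, dotProduct_zero, add_zero] at h4
  refine tendsto_nhds_unique h4 (tendsto_const_nhds.congr' ?_)
  filter_upwards [h] with n hn
  have h5 : star (w n) ⬝ᵥ (J0 p q *ᵥ w' n) = 0 := hV (hwV' n) _ (hwV n)
  rw [star_add, add_dotProduct, mulVec_add, dotProduct_add, dotProduct_add, h5, zero_add] at hn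
  have h6 : star (((e n : ℂ) • φ n) *ᵥ w n) = (e n : ℂ) • star (φ n *ᵥ w n) := by
    rw [smul_mulVec, star_smul, Complex.star_def, Complex.conj_ofReal]
  rw [h6, smul_mulVec, mulVec_smul, smul_dotProduct, dotProduct_smul, smul_dotProduct, ← smul_add,
    ← smul_add]
  rw [show star (φ n *ᵥ w n) ⬝ᵥ (J0 p q *ᵥ w' n) + star (w n) ⬝ᵥ (J0 p q *ᵥ (φ n *ᵥ w' n)) +
    star (φ n *ᵥ w n) ⬝ᵥ (J0 p q *ᵥ (φ n *ᵥ w' n)) = 0 by rw [← hn]; ring, smul_zero]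

set_option maxHeartbeats 800000 in
/-- Every infinitesimal motion of a minimal triple of flags is compensated, up to filtered maps,
by an infinitesimal motion of the maximal destabilizing subspace. -/
theorem MinHN.first_order (hpq : q ≤ p) {x : Fin 3 → Fin q → ℝ} (hx : ∀ k, DecrNonneg (x k))
    (hun : ∀ g : Fin 3 → Matrix (Fin (p + q)) (Fin (p + q)) ℂ, (∀ k, g k ∈ formGroup p q) →
      ∃ V μ, HNData p q x g V μ)
    {g : Fin 3 → Matrix (Fin (p + q)) (Fin (p + q)) ℂ} {V : Submodule ℂ (Fin (p + q) → ℂ)}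
    {μ : ℝ} (hm : MinHN p q x g V μ) {X : Fin 3 → Matrix (Fin (p + q)) (Fin (p + q)) ℂ}
    (hX : ∀ k, (X k)ᴴ * J0 p q = -(J0 p q * X k)) :
    ∃ ψ : Matrix (Fin (p + q)) (Fin (p + q)) ℂ, (∀ v ∈ V, ψ *ᵥ v ∈ orth V) ∧
      (∀ v ∈ V, ∀ v' ∈ V,
        star (ψ *ᵥ v) ⬝ᵥ (J0 p q *ᵥ v') + star v ⬝ᵥ (J0 p q *ᵥ (ψ *ᵥ v')) = 0) ∧
      ∀ k, ∀ i ≤ p + q, ∀ v ∈ V ⊓ colFlag (g k) i, (ψ - X k) *ᵥ v ∈ V ⊔ colFlag (g k) i := by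
  classical
  set t : ℕ → ℝ := fun n => 1 / ((n : ℝ) + 1) with ht
  have htpos : ∀ n, 0 < t n := fun n => by rw [ht]; positivity
  choose c hcG hclim hceq using fun k =>
    exists_cayley (hX k) (t := t) tendsto_one_div_add_atTop_nhds_zero_nat
  set U : Ultrafilter ℕ := hyperfilter ℕ
  have hU : (U : Filter ℕ) ≤ atTop := Nat.hyperfilter_le_atTop
  have hlim : ∀ k, Tendsto (fun n => c k n * g k) U (𝓝 (g k)) := by
    intro k
    have h := ((hclim k).mono_left hU).mul (tendsto_const_nhds (x := g k))
    rwa [Matrix.one_mul] at h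
  obtain ⟨Vn, v, u, hiso, hvmem, hvspan, hvlim, huon, huspan⟩ := hm.perturb hpq hx hun U
    (γ := fun n k => c k n * g k) (fun n k => formGroup_mul (hcG k n) (hm.mem k)) hlim
  set S := pos (p + q) (colFlag (g 0)) V with hS
  have hVspan : V = Submodule.span ℂ (u 0 '' S) := by
    have h := huspan 0 (p + q) le_rfl
    rwa [(hm.isFlag 0).top, inf_top_eq, filter_true_of_mem] at h
    intro i hi
    exact mem_range.1 (pos_subset_range _ _ hi)
  set P := projMat S (u 0) with hP
  have hPP : P * P = P := (huon 0).projMat_mul_self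
  have hPV : ∀ y ∈ V, P *ᵥ y = y := fun y hy =>
    (huon 0).projMat_mulVec_eq (by rw [← hS, ← hVspan]; exact hy)
  have hPmem : ∀ y, P *ᵥ y ∈ V := fun y => by
    have h := projMat_mulVec_mem S (u 0) y
    rwa [← hVspan] at h
  have hPorth : ∀ y, (1 - P) *ᵥ y ∈ orth V := fun y => by
    have h := sub_projMat_mulVec_mem_orth (huon 0) y
    rwa [← hS, ← hVspan] at h
  have hVperp : V ≤ perp p q V := hm.hn.isotropic hpq hx hm.mem
  have hPn : Tendsto (fun n => projMat S (v n 0)) U (𝓝 P) :=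
    tendsto_projMat S fun a _ => hvlim 0 a
  set B : ℕ → Matrix (Fin (p + q)) (Fin (p + q)) ℂ := fun n =>
    P * projMat S (v n 0) + (1 - P) * (1 - projMat S (v n 0)) with hB
  have hBlim : Tendsto B U (𝓝 1) := by
    have h := ((tendsto_const_nhds (x := P)).mul hPn).add ((tendsto_const_nhds (x := 1 - P)).mul
      ((tendsto_const_nhds (x := (1 : Matrix (Fin (p + q)) (Fin (p + q)) ℂ))).sub hPn))
    have e : P * P + (1 - P) * (1 - P) = 1 := by
      rw [Matrix.mul_sub, Matrix.sub_mul, Matrix.sub_mul, hPP]; simp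
    rwa [e] at h
  obtain ⟨hBinv, hBunit⟩ := tendsto_matrix_inv hBlim
  set φ : ℕ → Matrix (Fin (p + q)) (Fin (p + q)) ℂ := fun n => (1 - P) * (B n)⁻¹ * P with hφdef
  have hφlim : Tendsto φ U (𝓝 0) := by
    have h := ((tendsto_const_nhds (x := 1 - P)).mul hBinv).mul (tendsto_const_nhds (x := P))
    have e : (1 - P) * 1 * P = 0 := by rw [Matrix.mul_one, Matrix.sub_mul, hPP]; simp
    rwa [e] at h
  have hgraph : ∀ᶠ n in U, ∀ y ∈ Vn n, y = P *ᵥ y + φ n *ᵥ (P *ᵥ y) := by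
    filter_upwards [hBunit, hvspan] with n hn hs y hy
    rw [hs.1] at hy
    have h1 : B n *ᵥ y = P *ᵥ y := by
      have h := hs.2.projMat_mulVec_eq hy
      rw [hB]
      simp only [add_mulVec, ← mulVec_mulVec, sub_mulVec, one_mulVec, h, sub_self, mulVec_zero,
        add_zero]
    have h2 : (B n)⁻¹ *ᵥ (P *ᵥ y) = y := by
      rw [← h1, mulVec_mulVec, nonsing_inv_mul _ hn, one_mulVec]
    rw [hφdef]
    simp only [← mulVec_mulVec]
    rw [hPV _ (hPmem y), h2, sub_mulVec, one_mulVec, add_sub_cancel]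
  obtain ⟨e, φ', τ, hφ', hτ, hne⟩ := exists_normalized_limit U φ htpos
  have hφ'P : φ' * P = φ' := by
    have h := hφ'.mul (tendsto_const_nhds (x := P))
    refine tendsto_nhds_unique h (hφ'.congr fun n => ?_)
    rw [hφdef]
    simp only [Matrix.smul_mul, Matrix.mul_assoc, hPP]
  have hPφ' : (1 - P) * φ' = φ' := by
    have h := (tendsto_const_nhds (x := 1 - P)).mul hφ'
    refine tendsto_nhds_unique h (hφ'.congr fun n => ?_)
    have e : (1 - P) * (1 - P) = 1 - P := by
      rw [Matrix.mul_sub, Matrix.mul_one, Matrix.sub_mul, hPP, Matrix.one_mul, sub_self, sub_zero]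
    rw [hφdef]
    simp only [Matrix.mul_smul, ← Matrix.mul_assoc, e]
  have horth : ∀ y, φ' *ᵥ y ∈ orth V := fun y => by
    rw [← hPφ', ← mulVec_mulVec]; exact hPorth _
  have hisoφ : ∀ y ∈ V, ∀ y' ∈ V,
      star (φ' *ᵥ y) ⬝ᵥ (J0 p q *ᵥ y') + star y ⬝ᵥ (J0 p q *ᵥ (φ' *ᵥ y')) = 0 := by
    have hconv : ∀ y ∈ V, Tendsto (fun n => P *ᵥ (projMat S (v n 0) *ᵥ y)) U (𝓝 y) := by
      intro y hy
      have h := tendsto_mulVec (tendsto_const_nhds (x := P))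
        (tendsto_mulVec hPn (tendsto_const_nhds (x := y)))
      rwa [hPV y hy, hPV y hy] at h
    intro y hy y' hy'
    refine isotropic_limit hVperp hφlim hφ' (hconv y hy) (hconv y' hy') (fun n => hPmem _)
      (fun n => hPmem _) ?_
    filter_upwards [hgraph, hvspan] with n hn hs
    have h1 : projMat S (v n 0) *ᵥ y ∈ Vn n := by rw [hs.1]; exact projMat_mulVec_mem _ _ _
    have h2 : projMat S (v n 0) *ᵥ y' ∈ Vn n := by rw [hs.1]; exact projMat_mulVec_mem _ _ _
    rw [← hn _ h1, ← hn _ h2]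
    exact hiso n h2 _ h1
  have hfilt : ∀ k, ∀ a ∈ pos (p + q) (colFlag (g k)) V,
      (φ' - ((2 * τ : ℝ) : ℂ) • X k) *ᵥ u k a ∈ V ⊔ colFlag (g k) (a + 1) := by
    intro k a ha
    have huV : u k a ∈ V := by
      have h := huspan k (p + q) le_rfl
      rw [(hm.isFlag k).top, inf_top_eq, filter_true_of_mem] at h
      · rw [h]; exact Submodule.subset_span ⟨a, ha, rfl⟩
      · intro i hi
        exact mem_range.1 (pos_subset_range _ _ hi)
    set z : ℕ → Fin (p + q) → ℂ := fun n => (J0 p q * (c k n)ᴴ * J0 p q) *ᵥ v n k a with hz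
    have hzlim : Tendsto z U (𝓝 (u k a)) := by
      have h1 : Tendsto (fun n => J0 p q * (c k n)ᴴ * J0 p q) U (𝓝 (J0 p q * 1 * J0 p q)) := by
        have h0 : Tendsto (fun n => (c k n)ᴴ) U (𝓝 1ᴴ) :=
          ((Continuous.matrix_conjTranspose continuous_id).tendsto _).comp
            ((hclim k).mono_left hU)
        rw [conjTranspose_one] at h0
        exact (tendsto_const_nhds.mul h0).mul tendsto_const_nhds
      rw [Matrix.mul_one, J0_mul_self] at h1
      have h := tendsto_mulVec h1 (hvlim k a)
      rwa [one_mulVec] at h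
    have h1 := tendsto_mulVec hφ' (tendsto_mulVec (tendsto_const_nhds (x := P)) (hvlim k a))
    have h2 := ((Complex.continuous_ofReal.tendsto _).comp hτ).smul
      (tendsto_mulVec (tendsto_const_nhds (x := X k)) ((hvlim k a).add hzlim))
    have h3 := h1.sub h2
    have h4 : φ' *ᵥ (P *ᵥ u k a) - (τ : ℂ) • X k *ᵥ (u k a + u k a) ∈ V ⊔ colFlag (g k) (a + 1) := by
      refine (Submodule.closed_of_finiteDimensional
        (V ⊔ colFlag (g k) (a + 1))).mem_of_tendsto h3 ?_
      filter_upwards [hgraph, hvmem, hU (hceq k)] with n hn hv hc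
      obtain ⟨hv1, hv2⟩ := hv k a ha
      have hzv : c k n *ᵥ z n = v n k a := by
        rw [hz]
        simp only [mulVec_mulVec]
        rw [mul_eq_one_comm.1 (formGroup_inv_mul (hcG k n)), one_mulVec]
      have hzF : z n ∈ colFlag (g k) (a + 1) := by
        change v n k a ∈ colFlag (c k n * g k) (a + 1) at hv2
        rw [colFlag_mul] at hv2
        obtain ⟨y, hy, hyv⟩ := hv2
        have : z n = y := by
          rw [hz]
          simp only [← hyv]
          rw [mulVecLin_apply, mulVec_mulVec, formGroup_inv_mul (hcG k n), one_mulVec]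
        rw [this]; exact hy
      have h5 := congrArg (fun A => A *ᵥ z n) hc
      simp only [← mulVec_mulVec, hzv] at h5
      simp only [sub_mulVec, add_mulVec, one_mulVec, smul_mulVec] at h5
      have h6 : ((e n : ℂ) • φ n) *ᵥ (P *ᵥ v n k a) -
          ((fun x : ℝ => (x : ℂ)) ∘ fun m => e m * t m) n • X k *ᵥ (v n k a + z n) =
          (e n : ℂ) • (z n - P *ᵥ v n k a) := by
        have h7 : φ n *ᵥ (P *ᵥ v n k a) = v n k a - P *ᵥ v n k a := 
          eq_sub_of_add_eq ((add_comm _ _).trans (hn _ hv1).symm)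
        have h8 : v n k a = z n + (t n : ℂ) • X k *ᵥ z n + (t n : ℂ) • X k *ᵥ v n k a := by
          rw [← h5]; abel
        simp only [Function.comp, Complex.ofReal_mul]
        rw [smul_mulVec, h7, mul_smul, ← smul_sub, mulVec_add, smul_add]
        congr 1
        nth_rewrite 1 [h8]
        abel
      change ((e n : ℂ) • φ n) *ᵥ (P *ᵥ v n k a) -
          ((fun x : ℝ => (x : ℂ)) ∘ fun m => e m * t m) n • X k *ᵥ (v n k a + z n) ∈ _
      rw [h6]
      exact Submodule.smul_mem _ _ (Submodule.sub_mem _ (Submodule.mem_sup_right hzF)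
        (Submodule.mem_sup_left (hPmem _)))
    rw [hPV _ huV, ← two_smul ℂ (u k a), mulVec_smul, smul_smul, mul_comm (τ : ℂ)] at h4
    rw [sub_mulVec, smul_mulVec]
    push_cast
    exact h4
  have hfilt' : ∀ k, ∀ i ≤ p + q, ∀ y ∈ V ⊓ colFlag (g k) i,
      (φ' - ((2 * τ : ℝ) : ℂ) • X k) *ᵥ y ∈ V ⊔ colFlag (g k) i := by
    intro k i hi y hy
    rw [huspan k i hi] at hy
    have hle : Submodule.span ℂ (u k '' ((pos (p + q) (colFlag (g k)) V).filter (· < i))) ≤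
        (V ⊔ colFlag (g k) i).comap (φ' - ((2 * τ : ℝ) : ℂ) • X k).mulVecLin := by
      rw [Submodule.span_le]
      rintro _ ⟨a, ha, rfl⟩
      rw [Finset.mem_coe, Finset.mem_filter] at ha
      exact sup_le_sup le_rfl ((hm.isFlag k).mono ha.2) (hfilt k a ha.1)
    exact hle hy
  have hτ0 : τ ≠ 0 := by
    intro h0
    apply hne h0
    have h1 : V.map φ'.mulVecLin ≤ V := by
      refine hm.hn.map_le hm.isFlag (fun k => xhat_antitone (hx k)) fun k i hi => ?_
      rintro _ ⟨y, hy, rfl⟩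
      have h := hfilt' k i hi y hy
      rw [h0] at h
      simpa using h
    rw [← hφ'P]
    apply ext_of_mulVec_single
    intro j
    rw [← mulVec_mulVec, zero_mulVec]
    have h2 : φ' *ᵥ (P *ᵥ Pi.single j 1) ∈ V ⊓ orth V :=
      ⟨h1 ⟨_, hPmem _, rfl⟩, horth _⟩
    rw [inf_orth] at h2
    exact (Submodule.mem_bot ℂ).1 h2
  have h2τ : ((2 * τ : ℝ) : ℂ) ≠ 0 := Complex.ofReal_ne_zero.2 (mul_ne_zero two_ne_zero hτ0)
  refine ⟨(((2 * τ)⁻¹ : ℝ) : ℂ) • φ', fun y _ => ?_, fun y hy y' hy' => ?_, fun k i hi y hy => ?_⟩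
  · rw [smul_mulVec]; exact Submodule.smul_mem _ _ (horth y)
  · rw [smul_mulVec, smul_mulVec, star_smul, mulVec_smul, Complex.star_def, Complex.conj_ofReal,
      smul_dotProduct, dotProduct_smul, ← smul_add, hisoφ y hy y' hy', smul_zero]
  · have h1 : (((2 * τ)⁻¹ : ℝ) : ℂ) • φ' - X k =
        (((2 * τ)⁻¹ : ℝ) : ℂ) • (φ' - ((2 * τ : ℝ) : ℂ) • X k) := by
      rw [smul_sub, smul_smul, Complex.ofReal_inv, inv_mul_cancel₀ h2τ, one_smul]
    rw [h1, smul_mulVec]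
    exact Submodule.smul_mem _ _ (hfilt' k i hi y hy)

end SingHorn

namespace SingHorn

open scoped ComplexOrder
open Module Finset

variable {p q : ℕ}

/-- Infinitesimal motions of an isotropic subspace. -/
def tangent (p q : ℕ) (V : Submodule ℂ (Fin (p + q) → ℂ)) :
    Submodule ℝ (V →ₗ[ℂ] (Fin (p + q) → ℂ)) where
  carrier := {ψ | (∀ v, ψ v ∈ orth V) ∧ ∀ v v' : V, star (ψ v) ⬝ᵥ (J0 p q *ᵥ v') +
    star (v : Fin (p + q) → ℂ) ⬝ᵥ (J0 p q *ᵥ (ψ v')) = 0}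
  zero_mem' := ⟨fun v => Submodule.zero_mem _, fun v v' => by simp⟩
  add_mem' := fun {ψ ψ'} h h' => ⟨fun v => Submodule.add_mem _ (h.1 v) (h'.1 v), fun v v' => by
    have e := h.2 v v'
    have e' := h'.2 v v'
    simp only [LinearMap.add_apply, star_add, add_dotProduct, mulVec_add, dotProduct_add]
    linear_combination e + e'⟩
  smul_mem' := fun c ψ h => by
    have e1 : ∀ v, (c • ψ) v = (c : ℂ) • (ψ v) := fun v => rfl
    refine ⟨fun v => Submodule.smul_mem _ (c : ℂ) (h.1 v), fun v v' => ?_⟩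
    have e := h.2 v v'
    rw [e1, e1, star_smul, Complex.star_def, Complex.conj_ofReal, smul_dotProduct, mulVec_smul,
      dotProduct_smul, ← smul_add, e, smul_zero]

/-- Maps from a subspace which are filtered modulo this subspace. -/
def filtMaps {n : ℕ} (F : ℕ → Submodule ℂ (Fin n → ℂ)) (V : Submodule ℂ (Fin n → ℂ)) :
    Submodule ℝ (V →ₗ[ℂ] (Fin n → ℂ)) where
  carrier := {ψ | ∀ i ≤ n, ∀ v : V, (v : Fin n → ℂ) ∈ F i → ψ v ∈ V ⊔ F i}
  zero_mem' := fun _ _ _ _ => Submodule.zero_mem _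
  add_mem' := fun h h' i hi v hv => Submodule.add_mem _ (h i hi v hv) (h' i hi v hv)
  smul_mem' := fun c _ h i hi v hv => Submodule.smul_mem _ (c : ℂ) (h i hi v hv)

theorem exists_projector {n : ℕ} (V : Submodule ℂ (Fin n → ℂ)) :
    ∃ P : Matrix (Fin n) (Fin n) ℂ, Pᴴ = P ∧ (∀ v, P *ᵥ v ∈ V) ∧ ∀ v ∈ V, P *ᵥ v = v := by
  have hF : IsFlag n (colFlag (1 : Matrix (Fin n) (Fin n) ℂ)) := isFlag_colFlag isUnit_one
  obtain ⟨v, hv⟩ := IsONAdapted.exists hF V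
  have hon : ONOn (pos n (colFlag 1) V) v := fun a ha b hb => hv.orthonormal hF ha hb
  have hspan := hon.span_eq (W := V) (fun a ha => (hv a ha).1.1) (by rw [← hF.card_pos])
  refine ⟨projMat (pos n (colFlag 1) V) v, projMat_conjTranspose _ _, fun y => ?_, fun y hy => ?_⟩
  · have h := projMat_mulVec_mem (pos n (colFlag 1) V) v y
    rwa [← hspan] at h
  · exact hon.projMat_mulVec_eq (by rw [← hspan]; exact hy)

/-- Infinitesimal motions of an isotropic subspace are induced by the Lie algebra of the form. -/
theorem exists_lie_of_tangent {V : Submodule ℂ (Fin (p + q) → ℂ)} {ψ : V →ₗ[ℂ] (Fin (p + q) → ℂ)}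
    (hψ : ψ ∈ tangent p q V) : ∃ X : Matrix (Fin (p + q)) (Fin (p + q)) ℂ,
      Xᴴ * J0 p q = -(J0 p q * X) ∧ ∀ v : V, X *ᵥ v = ψ v := by
  obtain ⟨P, hPH, hPV, hP⟩ := exists_projector V
  let f : (Fin (p + q) → ℂ) →ₗ[ℂ] (Fin (p + q) → ℂ) :=
    ψ ∘ₗ (P.mulVecLin.codRestrict V hPV)
  set D := LinearMap.toMatrix' f with hD
  have hDv : ∀ y, D *ᵥ y = ψ ⟨P *ᵥ y, hPV y⟩ := fun y => by
    rw [hD, LinearMap.toMatrix'_mulVec]; rfl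
  set B := J0 p q * D with hB
  set K := P * B with hK
  have hBH : Bᴴ = Dᴴ * J0 p q := by rw [hB, conjTranspose_mul, J0_conjTranspose]
  have hzero : ∀ u y, y ∈ V → star u ⬝ᵥ ((Bᴴ + K) *ᵥ y) = 0 := by
    intro u y hy
    have h := hψ.2 ⟨P *ᵥ u, hPV u⟩ ⟨y, hy⟩
    have hPu : star u ᵥ* P = star (P *ᵥ u) := by rw [star_mulVec, hPH]
    have h1 : (⟨P *ᵥ y, hPV y⟩ : V) = ⟨y, hy⟩ := Subtype.ext (hP y hy)
    rw [← hDv u, ← h1, ← hDv y] at h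
    rw [add_mulVec, dotProduct_add, hBH, hK, hB, ← mulVec_mulVec, ← mulVec_mulVec, ← mulVec_mulVec,
      dotProduct_mulVec, ← star_mulVec, dotProduct_mulVec _ P, hPu]
    simpa [hP y hy] using h
  have hzero' : ∀ y ∈ V, (Bᴴ + K) *ᵥ y = 0 := by
    intro y hy
    have h := hzero ((Bᴴ + K) *ᵥ y) y hy
    exact dotProduct_star_self_eq_zero.1 h
  have hKH : Kᴴ = -K := by
    have h : (Bᴴ + K) * P = 0 := by
      apply ext_of_mulVec_single
      intro i
      rw [← mulVec_mulVec, zero_mulVec, hzero' _ (hPV _)]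
    have hDP : D * P = D := by
      apply ext_of_mulVec_single
      intro i
      rw [← mulVec_mulVec, hDv, hDv]
      exact congrArg ψ (Subtype.ext (hP _ (hPV _)))
    have hKP : K * P = K := by rw [hK, hB, Matrix.mul_assoc, Matrix.mul_assoc, hDP]
    have h1 : Kᴴ = Bᴴ * P := by rw [hK, conjTranspose_mul, hPH]
    rw [Matrix.add_mul, ← h1, hKP] at h
    exact eq_neg_of_add_eq_zero_left h
  refine ⟨J0 p q * (B - Bᴴ - K), ?_, fun v => ?_⟩
  · rw [conjTranspose_mul, J0_conjTranspose, Matrix.mul_assoc, J0_mul_self, Matrix.mul_one,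
      ← Matrix.mul_assoc, J0_mul_self, Matrix.one_mul, conjTranspose_sub, conjTranspose_sub,
      conjTranspose_conjTranspose, hKH]
    abel
  · rw [sub_sub, ← mulVec_mulVec, sub_mulVec, hzero' _ v.2, sub_zero, mulVec_mulVec, hB,
      ← Matrix.mul_assoc, J0_mul_self, Matrix.one_mul, hDv]
    exact congrArg ψ (Subtype.ext (hP _ v.2))

/-- If every triple in `T` can be corrected by a common element of `T` into the triple of
subspaces `H`, then `H` is large. -/
theorem two_mul_finrank_le_of_correction {L : Type*} [AddCommGroup L] [Module ℝ L]
    [Module.Finite ℝ L] (T : Submodule ℝ L) (H : Fin 3 → Submodule ℝ L)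
    (h : ∀ η : Fin 3 → L, (∀ k, η k ∈ T) → ∃ ψ ∈ T, ∀ k, ψ - η k ∈ H k) :
    2 * finrank ℝ T ≤ ∑ k, finrank ℝ ↥(T ⊓ H k) := by
  let Φ : (T × ∀ k, ↥(T ⊓ H k)) →ₗ[ℝ] (Fin 3 → T) :=
    LinearMap.pi fun k => LinearMap.fst ℝ T (∀ k, ↥(T ⊓ H k)) -
      (Submodule.inclusion inf_le_left) ∘ₗ (LinearMap.proj k) ∘ₗ LinearMap.snd ℝ T _
  have hsurj : Function.Surjective Φ := by
    intro η
    obtain ⟨ψ, hψ, h⟩ := h (fun k => η k) fun k => (η k).2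
    refine ⟨(⟨ψ, hψ⟩, fun k => ⟨ψ - η k, T.sub_mem hψ (η k).2, h k⟩), ?_⟩
    funext k
    apply Subtype.ext
    change ψ - (ψ - (η k : L)) = η k
    abel
  have h := LinearMap.finrank_le_finrank_of_surjective hsurj
  rw [finrank_prod, finrank_pi_fintype, finrank_pi_fintype, sum_const, card_univ,
    Fintype.card_fin, smul_eq_mul] at h
  omega

theorem MinHN.two_mul_finrank_le (hpq : q ≤ p) {x : Fin 3 → Fin q → ℝ}
    (hx : ∀ k, DecrNonneg (x k))
    (hun : ∀ g : Fin 3 → Matrix (Fin (p + q)) (Fin (p + q)) ℂ, (∀ k, g k ∈ formGroup p q) →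
      ∃ V μ, HNData p q x g V μ)
    {g : Fin 3 → Matrix (Fin (p + q)) (Fin (p + q)) ℂ} {V : Submodule ℂ (Fin (p + q) → ℂ)}
    {μ : ℝ} (hm : MinHN p q x g V μ) :
    2 * finrank ℝ (tangent p q V) ≤
      ∑ k, finrank ℝ ↥(tangent p q V ⊓ filtMaps (colFlag (g k)) V) := by
  refine two_mul_finrank_le_of_correction (tangent p q V)
    (fun k => filtMaps (colFlag (g k)) V) fun η hη => ?_
  choose X hX hXη using fun k => exists_lie_of_tangent (hη k)
  obtain ⟨ψ, h1, h2, h3⟩ := hm.first_order hpq hx hun hX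
  refine ⟨ψ.mulVecLin ∘ₗ V.subtype, ⟨fun v => h1 v v.2,
    fun v v' => h2 v v.2 v' v'.2⟩, fun k i hi v hv => ?_⟩
  have h := h3 k i hi v ⟨v.2, hv⟩
  rw [sub_mulVec, hXη] at h
  exact h

end SingHorn

namespace SingHorn

open scoped ComplexOrder
open Module Finset

variable {p q : ℕ}

theorem IsFlag.exists_frame {n : ℕ} {F : ℕ → Submodule ℂ (Fin n → ℂ)} (hF : IsFlag n F)
    (V : Submodule ℂ (Fin n → ℂ)) : ∃ u : ℕ → V, (∀ a ∈ pos n F V, (u a : Fin n → ℂ) ∈ F (a + 1)) ∧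
      Submodule.span ℂ (u '' (pos n F V)) = ⊤ := by
  classical
  obtain ⟨v, hv⟩ := IsAdapted.exists hF V
  let u : ℕ → V := fun a => if h : v a ∈ V then ⟨v a, h⟩ else 0
  have hu : ∀ a ∈ pos n F V, (u a : Fin n → ℂ) = v a := fun a ha => by
    have h : v a ∈ V := (hv a ha).1.1
    simp [u, h]
  refine ⟨u, fun a ha => by rw [hu a ha]; exact (hv a ha).1.2, ?_⟩
  apply Submodule.map_injective_of_injective V.injective_subtype
  rw [Submodule.map_subtype_top, Submodule.map_span, ← Set.image_comp]
  conv_rhs => rw [hv.span_top hF]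
  congr 1
  exact Set.image_congr fun a ha => hu a ha

/-- Matrix coefficients of linear maps, as real linear forms. -/
def coeffForm {n : ℕ} {V : Submodule ℂ (Fin n → ℂ)} (M : Matrix (Fin n) (Fin n) ℂ) (w : Fin n → ℂ)
    (u : V) : (V →ₗ[ℂ] (Fin n → ℂ)) →ₗ[ℝ] ℂ where
  toFun ψ := star w ⬝ᵥ (M *ᵥ ψ u)
  map_add' ψ ψ' := by rw [LinearMap.add_apply, mulVec_add, dotProduct_add]
  map_smul' c ψ := by
    have e1 : (c • ψ) u = (c : ℂ) • (ψ u) := rfl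
    rw [e1, mulVec_smul, dotProduct_smul]; simp

/-- The real or imaginary part, as a complex-valued map. -/
noncomputable def partMap (b : Prop) [Decidable b] : ℂ →ₗ[ℝ] ℂ :=
  Complex.ofRealAm.toLinearMap ∘ₗ (if b then Complex.reLm else Complex.imLm)

theorem partMap_pos {b : Prop} [Decidable b] (hb : b) (z : ℂ) : partMap b z = z.re := by
  simp [partMap, hb]

theorem partMap_neg {b : Prop} [Decidable b] (hb : ¬b) (z : ℂ) : partMap b z = z.im := by
  simp [partMap, hb]

theorem finrank_range_partMap_comp {L : Type*} [AddCommMonoid L] [Module ℝ L] (b : Prop)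
    [Decidable b] (f : L →ₗ[ℝ] ℂ) : finrank ℝ (LinearMap.range (partMap b ∘ₗ f)) ≤ 1 := by
  rw [partMap, LinearMap.comp_assoc]
  calc _ ≤ finrank ℝ (LinearMap.range Complex.ofRealAm.toLinearMap) :=
        Submodule.finrank_mono (LinearMap.range_comp_le_range _ _)
    _ ≤ finrank ℝ ℝ := LinearMap.finrank_range_le _
    _ = 1 := finrank_self ℝ

theorem finrank_le_of_forms {L ι : Type*} [AddCommGroup L] [Module ℝ L] [Module.Finite ℝ L]
    (s t : Finset ι) (f g : ι → L →ₗ[ℝ] ℂ) (b : ι → Prop) [DecidablePred b] (M : Submodule ℝ L)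
    (h : ∀ ψ, (∀ j ∈ s, f j ψ = 0) → (∀ j ∈ t, partMap (b j) (g j ψ) = 0) → ψ ∈ M) :
    finrank ℝ L ≤ 2 * s.card + t.card + finrank ℝ M := by
  classical
  have key := finrank_le_sum_of_ker (K := ℝ) (s.disjSum t)
    (Sum.elim f fun j => partMap (b j) ∘ₗ g j) (Sum.elim (fun _ => 2) fun _ => 1) (fun j _ => by
      rcases j with j | j
      · exact (Submodule.finrank_le _).trans Complex.finrank_real_complex.le
      · exact finrank_range_partMap_comp _ _) M (fun ψ hψ => h ψ
        (fun j hj => hψ (Sum.inl j) (inl_mem_disjSum.2 hj))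
        (fun j hj => hψ (Sum.inr j) (inr_mem_disjSum.2 hj)))
  rw [sum_disjSum] at key
  simp only [Sum.elim_inl, Sum.elim_inr, sum_const, smul_eq_mul] at key
  omega

theorem finrank_real_homs {n : ℕ} (V : Submodule ℂ (Fin n → ℂ)) :
    finrank ℝ (V →ₗ[ℂ] (Fin n → ℂ)) = 2 * (finrank ℂ V * n) := by
  rw [← Module.finrank_mul_finrank ℝ ℂ (V →ₗ[ℂ] (Fin n → ℂ)), Complex.finrank_real_complex,
    Module.finrank_linearMap, finrank_fin_fun]

theorem eq_zero_of_span_frame {n : ℕ} {V : Submodule ℂ (Fin n → ℂ)} {s : Finset ℕ} {u : ℕ → V}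
    (hu : Submodule.span ℂ (u '' s) = ⊤) (M : Matrix (Fin n) (Fin n) ℂ) {w : Fin n → ℂ}
    (h : ∀ a ∈ s, star (u a : Fin n → ℂ) ⬝ᵥ (M *ᵥ w) = 0) (v : V) :
    star (v : Fin n → ℂ) ⬝ᵥ (M *ᵥ w) = 0 := by
  have hv : v ∈ Submodule.span ℂ (u '' s) := by rw [hu]; trivial
  induction hv using Submodule.span_induction with
  | mem x hx => obtain ⟨a, ha, rfl⟩ := hx; exact h a ha
  | zero => simp
  | add x y _ _ hx hy => rw [Submodule.coe_add, star_add, add_dotProduct, hx, hy, add_zero]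
  | smul c x _ hx => rw [Submodule.coe_smul, star_smul, smul_dotProduct, hx, smul_zero]

theorem le_finrank_tangent (V : Submodule ℂ (Fin (p + q) → ℂ)) :
    2 * (finrank ℂ V * (p + q)) ≤ 3 * finrank ℂ V ^ 2 + finrank ℝ (tangent p q V) := by
  classical
  have hF : IsFlag (p + q) (colFlag (1 : Matrix (Fin (p + q)) (Fin (p + q)) ℂ)) :=
    isFlag_colFlag isUnit_one
  obtain ⟨u, -, hu⟩ := hF.exists_frame V
  have hcard := hF.card_pos (W := V)
  set S := pos (p + q) (colFlag 1) V
  let C : ℕ → ℕ → (V →ₗ[ℂ] (Fin (p + q) → ℂ)) →ₗ[ℝ] ℂ := fun a b => coeffForm (J0 p q) (u b) (u a)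
  have key := finrank_le_of_forms (L := V →ₗ[ℂ] (Fin (p + q) → ℂ)) (S ×ˢ S) (S ×ˢ S)
    (fun j => coeffForm 1 (u j.2) (u j.1))
    (fun j => Complex.conjAe.toLinearMap ∘ₗ C j.1 j.2 + C j.2 j.1) (fun j => j.1 ≤ j.2)
    (tangent p q V) (fun ψ hψ hψ' => by
      have h1 : ∀ a ∈ S, ∀ b ∈ S, star (u b : Fin (p + q) → ℂ) ⬝ᵥ ψ (u a) = 0 := by
        intro a ha b hb
        have h := hψ (a, b) (mem_product.2 ⟨ha, hb⟩)
        simpa [coeffForm] using h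
      have h2 : ∀ a ∈ S, ∀ b ∈ S, partMap (a ≤ b) (star (C a b ψ) + C b a ψ) = 0 := by
        intro a ha b hb
        exact hψ' (a, b) (mem_product.2 ⟨ha, hb⟩)
      have h3 : ∀ a ∈ S, ∀ b ∈ S, star (C a b ψ) + C b a ψ = 0 := by
        have aux : ∀ a ∈ S, ∀ b ∈ S, a ≤ b → star (C a b ψ) + C b a ψ = 0 := by
          intro a ha b hb hab
          have e1 := h2 a ha b hb
          rw [partMap_pos hab, Complex.ofReal_eq_zero] at e1
          apply Complex.ext e1
          rcases hab.eq_or_lt with rfl | hlt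
          · simp
          · have e2 := h2 b hb a ha
            rw [partMap_neg (not_le.2 hlt), Complex.ofReal_eq_zero] at e2
            simp at e2 ⊢
            linarith
        intro a ha b hb
        rcases le_total a b with hab | hab
        · exact aux a ha b hb hab
        · have h := congrArg star (aux b hb a ha hab)
          rw [star_add, star_star, star_zero, add_comm] at h
          exact h
      refine ⟨fun v => ?_, fun v v' => ?_⟩
      · have hv : v ∈ Submodule.span ℂ (u '' S) := by rw [hu]; trivial
        induction hv using Submodule.span_induction with
        | mem x hx =>
          obtain ⟨a, ha, rfl⟩ := hx
          intro w hw
          have h := eq_zero_of_span_frame hu 1 (w := ψ (u a)) (fun b hb => by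
            rw [one_mulVec]; exact h1 a ha b hb) ⟨w, hw⟩
          rwa [one_mulVec] at h
        | zero => rw [map_zero]; exact Submodule.zero_mem _
        | add x y _ _ hx hy => rw [map_add]; exact Submodule.add_mem _ hx hy
        | smul c x _ hx => rw [map_smul]; exact Submodule.smul_mem _ _ hx
      · have aux : ∀ x : V, (∀ b ∈ S, star (ψ (u b)) ⬝ᵥ (J0 p q *ᵥ x) +
            star (u b : Fin (p + q) → ℂ) ⬝ᵥ (J0 p q *ᵥ ψ x) = 0) → ∀ v : V,
            star (ψ v) ⬝ᵥ (J0 p q *ᵥ x) + star (v : Fin (p + q) → ℂ) ⬝ᵥ (J0 p q *ᵥ ψ x) = 0 := by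
          intro x hx v
          have hv : v ∈ Submodule.span ℂ (u '' S) := by rw [hu]; trivial
          induction hv using Submodule.span_induction with
          | mem x hx' => obtain ⟨a, ha, rfl⟩ := hx'; exact hx a ha
          | zero => simp
          | add y z _ _ hy hz =>
            rw [map_add, star_add, Submodule.coe_add, star_add, add_dotProduct, add_dotProduct]
            linear_combination hy + hz
          | smul c y _ hy =>
            rw [map_smul, star_smul, Submodule.coe_smul, star_smul, smul_dotProduct,
              smul_dotProduct, ← smul_add, hy, smul_zero]
        apply aux v'
        intro b hb
        have h := aux (u b) (fun a ha => by
          have e := h3 a ha b hb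
          simp only [C, coeffForm, LinearMap.coe_mk, AddHom.coe_mk] at e
          rwa [← J0_form_symm] at e) v'
        have h' := congrArg star h
        rw [star_add, ← J0_form_symm, ← J0_form_symm, star_zero, add_comm] at h'
        exact h')
  rw [finrank_real_homs, card_product, hcard] at key
  rw [sq]
  omega

end SingHorn

namespace SingHorn

open scoped ComplexOrder
open Module Finset

variable {p q : ℕ}

theorem finrank_restrictScalars_real {n : ℕ} (R : Submodule ℂ (Fin n → ℂ)) :
    finrank ℝ ↥(R.restrictScalars ℝ) = 2 * finrank ℂ R := by
  have h := Module.finrank_mul_finrank ℝ ℂ R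
  rw [Complex.finrank_real_complex] at h
  exact h.symm

/-- Evaluation at a vector, as a real linear map. -/
def evalReal {n : ℕ} {V : Submodule ℂ (Fin n → ℂ)} (u : V) :
    (V →ₗ[ℂ] (Fin n → ℂ)) →ₗ[ℝ] (Fin n → ℂ) where
  toFun ψ := ψ u
  map_add' _ _ := rfl
  map_smul' _ _ := rfl

/-- Maps with values in a given subspace. -/
def mapsInto {n : ℕ} (V R : Submodule ℂ (Fin n → ℂ)) :
    Submodule ℝ (V →ₗ[ℂ] (Fin n → ℂ)) where
  carrier := {ψ | ∀ v, ψ v ∈ R}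
  zero_mem' := fun _ => R.zero_mem
  add_mem' := fun h h' v => R.add_mem (h v) (h' v)
  smul_mem' := fun c _ h v => R.smul_mem (c : ℂ) (h v)

theorem finrank_orth_inf_sup {n : ℕ} {V T F : Submodule ℂ (Fin n → ℂ)} (hVT : V ≤ T) :
    finrank ℂ ↥(orth V ⊓ (T ⊓ (V ⊔ F))) ≤ finrank ℂ ↥(T ⊓ F) - finrank ℂ ↥(V ⊓ F) := by
  have h0 : T ⊓ (V ⊔ F) = V ⊔ (T ⊓ F) := by
    rw [inf_comm, sup_inf_assoc_of_le F hVT, inf_comm F]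
  have h1 := Submodule.finrank_sup_add_finrank_inf_eq (orth V ⊓ (T ⊓ (V ⊔ F))) V
  have h2 : orth V ⊓ (T ⊓ (V ⊔ F)) ⊓ V = ⊥ := by
    rw [eq_bot_iff, ← inf_orth V]
    exact le_inf inf_le_right (inf_le_left.trans inf_le_left)
  have h3 : finrank ℂ ↥(orth V ⊓ (T ⊓ (V ⊔ F)) ⊔ V) ≤ finrank ℂ ↥(V ⊔ (T ⊓ F)) := by
    apply Submodule.finrank_mono
    rw [← h0]
    exact sup_le inf_le_right (le_inf hVT le_sup_left)
  have h4 := Submodule.finrank_sup_add_finrank_inf_eq V (T ⊓ F)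
  rw [← inf_assoc, inf_eq_left.2 hVT] at h4
  rw [h2, finrank_bot] at h1
  omega

theorem finrank_tangent_inf_mapsInto_le {F : ℕ → Submodule ℂ (Fin (p + q) → ℂ)}
    (hF : IsFlag (p + q) F) {V : Submodule ℂ (Fin (p + q) → ℂ)} (hV : V ≤ perp p q V) :
    finrank ℝ ↥(tangent p q V ⊓ filtMaps F V ⊓ mapsInto V (perp p q V)) ≤
      ∑ a ∈ pos (p + q) F V, 2 * (capDim F (perp p q V) (a + 1) - capDim F V (a + 1)) := by
  obtain ⟨u, hu, hspan⟩ := hF.exists_frame V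
  set X := tangent p q V ⊓ filtMaps F V ⊓ mapsInto V (perp p q V) with hX
  have key := finrank_le_sum_of_ker (K := ℝ) (L := X) (pos (p + q) F V)
    (fun a => evalReal (u a) ∘ₗ X.subtype)
    (fun a => 2 * (capDim F (perp p q V) (a + 1) - capDim F V (a + 1))) (fun a ha => by
      refine le_trans ?_ (Nat.mul_le_mul_left 2 (finrank_orth_inf_sup (F := F (a + 1)) hV))
      rw [← finrank_restrictScalars_real]
      apply Submodule.finrank_mono
      rintro _ ⟨ψ, rfl⟩
      have haN : a + 1 ≤ p + q := mem_range.1 (pos_subset_range _ _ ha)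
      exact ⟨ψ.2.1.1.1 _, ψ.2.2 _, ψ.2.1.2 _ haN _ (hu a ha)⟩) ⊥ (fun ψ hψ => by
      rw [Submodule.mem_bot]
      apply Subtype.ext
      apply LinearMap.ext_on hspan
      rintro _ ⟨a, ha, rfl⟩
      exact hψ a ha)
  rwa [finrank_bot, add_zero] at key

theorem finrank_tangent_inf_filtMaps_le {g : Matrix (Fin (p + q)) (Fin (p + q)) ℂ}
    (hg : g ∈ formGroup p q) {V : Submodule ℂ (Fin (p + q) → ℂ)} (hV : V ≤ perp p q V) :
    finrank ℝ ↥(tangent p q V ⊓ filtMaps (colFlag g) V) ≤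
      ((pos (p + q) (colFlag g) V ×ˢ pos (p + q) (colFlag g) V).filter
        fun ab => p + q ≤ ab.1 + ab.2 + 1).card +
      ∑ a ∈ pos (p + q) (colFlag g) V,
        2 * (capDim (colFlag g) (perp p q V) (a + 1) - capDim (colFlag g) V (a + 1)) := by
  classical
  have hF := isFlag_colFlag (isUnit_formGroup hg)
  refine le_trans ?_ (Nat.add_le_add_left (finrank_tangent_inf_mapsInto_le hF hV) _)
  obtain ⟨u, hu, hspan⟩ := hF.exists_frame V
  set X := tangent p q V ⊓ filtMaps (colFlag g) V with hX
  set S := pos (p + q) (colFlag g) V with hS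
  let C : ℕ → ℕ → (V →ₗ[ℂ] (Fin (p + q) → ℂ)) →ₗ[ℝ] ℂ :=
    fun a b => coeffForm (J0 p q) (u b) (u a)
  have hM : finrank ℝ ↥((mapsInto V (perp p q V)).comap X.subtype) =
      finrank ℝ ↥(X ⊓ mapsInto V (perp p q V)) := by
    have h := (Submodule.comapSubtypeEquivOfLe
      (inf_le_left : X ⊓ mapsInto V (perp p q V) ≤ X)).finrank_eq
    rw [← h]
    congr 1
    all_goals rw [Submodule.comap_inf, Submodule.comap_subtype_self, top_inf_eq]
  have key := finrank_le_of_forms (L := X) ∅ ((S ×ˢ S).filter fun ab => p + q ≤ ab.1 + ab.2 + 1)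
    (fun _ => 0) (fun j => C j.1 j.2 ∘ₗ X.subtype) (fun j => ¬ j.1 ≤ j.2)
    ((mapsInto V (perp p q V)).comap X.subtype) (fun ψ _ hψ v => by
      have hskew : ∀ a b, star (C a b ψ) + C b a ψ = 0 := fun a b => by
        have h := ψ.2.1.2 (u a) (u b)
        rw [J0_form_symm] at h
        exact h
      have hzero : ∀ a ∈ S, ∀ b ∈ S, C a b ψ = 0 := by
        have aux : ∀ a ∈ S, ∀ b ∈ S, a ≤ b → C a b ψ = 0 := by
          intro a ha b hb hab
          by_cases hN : p + q ≤ a + b + 1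
          · have e1 : partMap (¬ a ≤ b) (C a b ψ) = 0 :=
              hψ (a, b) (mem_filter.2 ⟨mem_product.2 ⟨ha, hb⟩, hN⟩)
            have e2 : partMap (¬ b ≤ a) (C b a ψ) = 0 :=
              hψ (b, a) (mem_filter.2 ⟨mem_product.2 ⟨hb, ha⟩, by
                change p + q ≤ b + a + 1; omega⟩)
            have e3 := hskew a b
            rw [partMap_neg (not_not.2 hab), Complex.ofReal_eq_zero] at e1
            refine Complex.ext ?_ e1
            have e4 := congrArg Complex.re e3
            rcases hab.eq_or_lt with rfl | hlt
            · simp at e4 ⊢; linarith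
            · rw [partMap_pos (not_le.2 hlt), Complex.ofReal_eq_zero] at e2
              simp [e2] at e4 ⊢
              exact e4
          · have haN : a < p + q := mem_range.1 (pos_subset_range _ _ ha)
            have hbN : b < p + q := mem_range.1 (pos_subset_range _ _ hb)
            have hb' : b + 1 ≤ q ∨ p ≤ b + 1 := by
              by_contra hcon
              push Not at hcon
              exact pos_isotropic_mid hg hV (by omega) (by omega) hb
            have h1 : colFlag g (a + 1) ≤ perp p q (V ⊓ colFlag g (b + 1)) := by
              refine le_trans ?_ (perp_anti inf_le_right)
              rw [perp_colFlag hg hb' hbN]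
              exact hF.mono (by omega)
            have h2 : V ≤ perp p q (V ⊓ colFlag g (b + 1)) := hV.trans (perp_anti inf_le_left)
            exact (sup_le h2 h1) (ψ.2.2 (a + 1) haN (u a) (hu a ha)) (u b) ⟨(u b).2, hu b hb⟩
        intro a ha b hb
        rcases le_total a b with hab | hab
        · exact aux a ha b hb hab
        · have h := hskew b a
          rw [aux b hb a ha hab, star_zero, zero_add] at h
          exact h
      have hv : v ∈ Submodule.span ℂ (u '' S) := by rw [hspan]; trivial
      change (ψ : V →ₗ[ℂ] (Fin (p + q) → ℂ)) v ∈ perp p q V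
      induction hv using Submodule.span_induction with
      | mem x hx =>
        obtain ⟨a, ha, rfl⟩ := hx
        intro w hw
        exact eq_zero_of_span_frame hspan (J0 p q) (fun b hb => hzero a ha b hb) ⟨w, hw⟩
      | zero => rw [map_zero]; exact Submodule.zero_mem _
      | add x y _ _ hx hy => rw [map_add]; exact Submodule.add_mem _ hx hy
      | smul c x _ hx => rw [map_smul]; exact Submodule.smul_mem _ _ hx)
  rw [hM, card_empty] at key
  omega

end SingHorn

namespace SingHorn

open scoped ComplexOrder
open Module Finset

section horn

variable {E : Type*} [AddCommGroup E] [Module ℂ E] [FiniteDimensional ℂ E]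

/-- The number of elements of a set above a given number. -/
def above (A : Finset ℕ) (i : ℕ) : ℕ := (A.filter (i < ·)).card

theorem above_antitone (A : Finset ℕ) : Antitone (above A) := fun _ _ h =>
  card_le_card fun u hu => by
    rw [mem_filter] at hu ⊢
    exact ⟨hu.1, h.trans_lt hu.2⟩

theorem above_sdiff {A B : Finset ℕ} (h : B ⊆ A) (i : ℕ) :
    above (A \ B) i + above B i = above A i := by
  unfold above
  have h1 : (A \ B).filter (i < ·) = A.filter (i < ·) \ B.filter (i < ·) := by
    ext u; simp only [mem_filter, mem_sdiff]; tauto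
  rw [h1, card_sdiff_add_card_eq_card (filter_subset_filter _ h)]

theorem IsFlag.capDim_add_above {N : ℕ} {F : ℕ → Submodule ℂ E} (hF : IsFlag N F)
    (V : Submodule ℂ E) {a : ℕ} (ha : a < N) :
    capDim F V (a + 1) + above (pos N F V) a = finrank ℂ V := by
  rw [hF.capDim_eq_card ha, ← hF.card_pos, above,
    ← card_filter_add_card_filter_not (s := pos N F V) (· < a + 1)]
  have h : (pos N F V).filter (a < ·) = (pos N F V).filter (fun u => ¬ u < a + 1) :=
    filter_congr fun u _ => by rw [not_lt, Nat.succ_le_iff]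
  rw [h]

theorem IsFlag.above_sdiff_eq {N : ℕ} {F : ℕ → Submodule ℂ E} (hF : IsFlag N F)
    {V T : Submodule ℂ E} (h : V ≤ T) {a : ℕ} (ha : a < N) :
    above (pos N F T \ pos N F V) a + capDim F T (a + 1) + finrank ℂ V =
      finrank ℂ T + capDim F V (a + 1) := by
  have h1 := hF.capDim_add_above V ha
  have h2 := hF.capDim_add_above T ha
  have h3 := above_sdiff (hF.pos_mono h) a
  omega

theorem hom_count_above {N : ℕ} {F : Fin 3 → ℕ → Submodule ℂ E}
    (hF : ∀ k, IsFlag N (F k)) {W V T : Submodule ℂ E} (hW : W ≤ V) (hVT : V ≤ T)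
    (H : ∀ φ : E →ₗ[ℂ] E, V.map φ ≤ T → (∀ k, ∀ i ≤ N, (V ⊓ F k i).map φ ≤ V ⊔ (T ⊓ F k i)) →
      V.map φ ≤ V) :
    (finrank ℂ V - finrank ℂ W) * (finrank ℂ T - finrank ℂ V) +
      ∑ k, ∑ a ∈ pos N (F k) W, above (pos N (F k) T \ pos N (F k) V) a ≤
      ∑ k, ∑ a ∈ pos N (F k) V, above (pos N (F k) T \ pos N (F k) V) a := by
  classical
  have h := hom_count hF hW hVT H
  have h1 : ∑ k, ∑ a ∈ pos N (F k) V, above (pos N (F k) T \ pos N (F k) V) a =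
      ∑ k, ∑ a ∈ pos N (F k) V \ pos N (F k) W, above (pos N (F k) T \ pos N (F k) V) a +
        ∑ k, ∑ a ∈ pos N (F k) W, above (pos N (F k) T \ pos N (F k) V) a := by
    rw [← sum_add_distrib]
    exact sum_congr rfl fun k _ => (sum_sdiff ((hF k).pos_mono hW)).symm
  rw [h1]
  refine Nat.add_le_add_right (h.trans (sum_le_sum fun k _ => sum_le_sum fun a ha => ?_)) _
  have haN : a < N := mem_range.1 (pos_subset_range _ _ (mem_sdiff.1 ha).1)
  have h2 := (hF k).above_sdiff_eq hVT haN
  omega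

theorem mul_le_sum_above {N : ℕ} {F : Fin 3 → ℕ → Submodule ℂ E}
    (hF : ∀ k, IsFlag N (F k)) {V T : Submodule ℂ E} (hVT : V ≤ T)
    (H : ∀ φ : E →ₗ[ℂ] E, V.map φ ≤ T → (∀ k, ∀ i ≤ N, (V ⊓ F k i).map φ ≤ V ⊔ (T ⊓ F k i)) →
      V.map φ ≤ V) :
    finrank ℂ V * (finrank ℂ T - finrank ℂ V) ≤
      ∑ k, ∑ a ∈ pos N (F k) V, above (pos N (F k) T \ pos N (F k) V) a := by
  have h := hom_count_above hF bot_le hVT H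
  rw [finrank_bot, Nat.sub_zero] at h
  exact (Nat.le_add_right _ _).trans h

theorem horn_of_hom_eq {N r : ℕ} (hr : 0 < r) {F : Fin 3 → ℕ → Submodule ℂ E}
    (hF : ∀ k, IsFlag N (F k)) {V T : Submodule ℂ E} (hV : finrank ℂ V = r) (hVT : V ≤ T)
    (H : ∀ φ : E →ₗ[ℂ] E, V.map φ ≤ T → (∀ k, ∀ i ≤ N, (V ⊓ F k i).map φ ≤ V ⊔ (T ⊓ F k i)) →
      V.map φ ≤ V)
    (hsum : ∑ k, ∑ a ∈ pos N (F k) V, above (pos N (F k) T \ pos N (F k) V) a ≤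
      r * (finrank ℂ T - r))
    {e : Fin 3 → ℕ → ℕ} (he : ∀ k, StrictMono (e k))
    (hp : ∀ k, pos N (F k) V = (range r).image (e k)) :
    ((fun a : Fin r => (above (pos N (F 0) T \ pos N (F 0) V) (e 0 a) : ℝ),
      fun a : Fin r => (above (pos N (F 1) T \ pos N (F 1) V) (e 1 a) : ℝ),
      fun a : Fin r => (above (pos N (F 2) T \ pos N (F 2) V) (e 2 a) : ℝ) -
        ((finrank ℂ T : ℝ) - r)) :
      (Fin r → ℝ) × (Fin r → ℝ) × (Fin r → ℝ)) ∈ Horn r := by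
  classical
  set t := finrank ℂ T
  have htr : r ≤ t := by rw [← hV]; exact Submodule.finrank_mono hVT
  let lam : Fin 3 → ℕ → ℕ := fun k => above (pos N (F k) T \ pos N (F k) V)
  let w : Fin 3 → ℕ → ℝ := fun k i => (lam k i : ℝ) - (if k = 2 then (t : ℝ) - r else 0)
  have hw : ∀ k, Antitone (w k) := fun k i j h => by
    have : lam k j ≤ lam k i := above_antitone _ h
    have h' : (lam k j : ℝ) ≤ lam k i := by exact_mod_cast this
    simp only [w]; linarith
  have hw2 : ∀ W ≤ V, ∑ k, wsum N (w k) (F k) W =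
      ((∑ k, ∑ a ∈ pos N (F k) W, lam k a : ℕ) : ℝ) - finrank ℂ W * (t - r) := by
    intro W _
    simp only [(hF _).wsum_eq, w, sum_sub_distrib, sum_const, (hF _).card_pos]
    push_cast
    congr 1
    simp
  have hcount : ∀ W ≤ V, (r - finrank ℂ W) * (t - r) + ∑ k, ∑ a ∈ pos N (F k) W, lam k a ≤
      ∑ k, ∑ a ∈ pos N (F k) V, lam k a := by
    intro W hW
    have h := hom_count_above hF hW hVT H
    rwa [hV] at h
  have hVsum : ∑ k, ∑ a ∈ pos N (F k) V, lam k a = r * (t - r) := by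
    apply le_antisymm hsum
    have h := mul_le_sum_above hF hVT H
    rwa [hV] at h
  have hcast : ((t - r : ℕ) : ℝ) = (t : ℝ) - r := by push_cast [htr]; ring
  have key := horn_of_semistable hr hF hV hw (fun W hW => by
    rw [hw2 W hW]
    have hd : finrank ℂ W ≤ r := by rw [← hV]; exact Submodule.finrank_mono hW
    have h := hcount W hW
    rw [hVsum] at h
    have h' : (((r - finrank ℂ W) * (t - r) + ∑ k, ∑ a ∈ pos N (F k) W, lam k a : ℕ) : ℝ) ≤
      ((r * (t - r) : ℕ) : ℝ) := Nat.cast_le.2 h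
    rw [Nat.cast_add, Nat.cast_mul, Nat.cast_mul, hcast, Nat.cast_sub hd] at h'
    linarith) (by
    rw [hw2 V le_rfl, hVsum, hV, Nat.cast_mul, hcast, sub_self]) he hp
  simpa [w, lam] using key

end horn

/-- Counting the difference of the two codimension vectors. -/
theorem above_compl_eq {N : ℕ} {S : Finset ℕ} (hS : S ⊆ range N)
    (hrev : ∀ i ∈ S, N - 1 - i ∉ S) (a : ℕ) :
    above (range N \ S) a = above ((range N).filter (fun i => N - 1 - i ∉ S) \ S) a +
      (S.filter fun b => ¬ N ≤ a + b + 1).card := by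
  classical
  have h1 : (S.filter fun b => ¬ N ≤ a + b + 1).card =
      ((range N \ S).filter fun u => a < u ∧ N - 1 - u ∈ S).card := by
    apply card_bij (fun b _ => N - 1 - b)
    · intro b hb
      rw [mem_filter] at hb
      have hbN := mem_range.1 (hS hb.1)
      rw [mem_filter, mem_sdiff, mem_range]
      have e : N - 1 - (N - 1 - b) = b := by omega
      rw [e]
      exact ⟨⟨by omega, hrev b hb.1⟩, by omega, hb.1⟩
    · intro b hb c hc h
      rw [mem_filter] at hb hc
      have hbN := mem_range.1 (hS hb.1)
      have hcN := mem_range.1 (hS hc.1)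
      omega
    · intro u hu
      rw [mem_filter, mem_sdiff, mem_range] at hu
      refine ⟨N - 1 - u, ?_, by omega⟩
      rw [mem_filter]
      exact ⟨hu.2.2, by omega⟩
  rw [h1]
  unfold above
  rw [← card_filter_add_card_filter_not (s := (range N \ S).filter (a < ·))
    (fun u => N - 1 - u ∉ S), filter_filter, filter_filter]
  congr 2
  · ext u; simp only [mem_filter, mem_sdiff, mem_range]; tauto
  · ext u; simp only [mem_filter, mem_sdiff, mem_range]; tauto

variable {p q : ℕ}

theorem MinHN.sum_above_le (hpq : q ≤ p) {x : Fin 3 → Fin q → ℝ}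
    (hx : ∀ k, DecrNonneg (x k))
    (hun : ∀ g : Fin 3 → Matrix (Fin (p + q)) (Fin (p + q)) ℂ, (∀ k, g k ∈ formGroup p q) →
      ∃ V μ, HNData p q x g V μ)
    {g : Fin 3 → Matrix (Fin (p + q)) (Fin (p + q)) ℂ} {V : Submodule ℂ (Fin (p + q) → ℂ)}
    {μ : ℝ} (hm : MinHN p q x g V μ) (hV : V ≤ perp p q V) :
    ∑ k, ∑ a ∈ pos (p + q) (colFlag (g k)) V,
        above (range (p + q) \ pos (p + q) (colFlag (g k)) V) a +
      ∑ k, ∑ a ∈ pos (p + q) (colFlag (g k)) V,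
        above (pos (p + q) (colFlag (g k)) (perp p q V) \ pos (p + q) (colFlag (g k)) V) a ≤
      finrank ℂ V * (p + q - finrank ℂ V) + finrank ℂ V * (p + q - 2 * finrank ℂ V) := by
  classical
  set r := finrank ℂ V with hr
  have hF := fun k => isFlag_colFlag (isUnit_formGroup (hm.mem k))
  have hperp := finrank_perp V
  have hr2 : r ≤ finrank ℂ (perp p q V) := Submodule.finrank_mono hV
  have h1 := hm.two_mul_finrank_le hpq hx hun
  have h2 := le_finrank_tangent V
  have h3 := fun k => finrank_tangent_inf_filtMaps_le (hm.mem k) hV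
  set S := fun k => pos (p + q) (colFlag (g k)) V with hS
  set lam := fun k => above (range (p + q) \ S k) with hlam
  set lam' := fun k => above (pos (p + q) (colFlag (g k)) (perp p q V) \ S k) with hlam'
  have hcard : ∀ k, (S k).card = r := fun k => (hF k).card_pos
  have h4 : ∀ k, ∑ a ∈ S k, 2 * (capDim (colFlag (g k)) (perp p q V) (a + 1) -
      capDim (colFlag (g k)) V (a + 1)) + 2 * ∑ a ∈ S k, lam' k a = 2 * (r * (p + q - 2 * r)) := by
    intro k
    rw [mul_sum, ← sum_add_distrib, ← hcard k, ← smul_eq_mul (a := (S k).card),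
      ← sum_const, mul_sum, hcard k]
    refine sum_congr rfl fun a ha => ?_
    have haN : a < p + q := mem_range.1 (pos_subset_range _ _ ha)
    have e : lam' k a + capDim (colFlag (g k)) (perp p q V) (a + 1) + r =
        finrank ℂ (perp p q V) + capDim (colFlag (g k)) V (a + 1) :=
      (hF k).above_sdiff_eq hV haN
    have e' : capDim (colFlag (g k)) V (a + 1) ≤ capDim (colFlag (g k)) (perp p q V) (a + 1) :=
      capDim_mono_right hV _
    clear_value lam' r
    omega
  have h5 : ∀ k, ∑ a ∈ S k, lam k a + ((S k ×ˢ S k).filter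
      fun ab => p + q ≤ ab.1 + ab.2 + 1).card = ∑ a ∈ S k, lam' k a + r ^ 2 := by
    intro k
    have e1 : ((S k ×ˢ S k).filter fun ab => p + q ≤ ab.1 + ab.2 + 1).card =
        ∑ a ∈ S k, ((S k).filter fun b => p + q ≤ a + b + 1).card := by
      rw [card_filter, sum_product]
      exact sum_congr rfl fun a _ => (card_filter _ _).symm
    have e2 : r ^ 2 = ∑ a ∈ S k, r := by rw [sum_const, hcard, smul_eq_mul, sq]
    rw [e1, e2, ← sum_add_distrib, ← sum_add_distrib]
    refine sum_congr rfl fun a _ => ?_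
    have e3 := above_compl_eq (S := S k) (pos_subset_range _ _)
      (fun i hi => pos_isotropic_rev (hm.mem k) hV hi) a
    rw [← pos_perp_eq (hm.mem k) hV] at e3
    have e4 := card_filter_add_card_filter_not (s := S k) (fun b => p + q ≤ a + b + 1)
    rw [hcard] at e4
    change above _ a + _ = above _ a + _
    omega
  obtain ⟨s, hs⟩ : ∃ s, p + q = 2 * r + s := ⟨p + q - 2 * r, by omega⟩
  have m1 : r * (p + q) = 2 * r ^ 2 + r * s := by
    have := congrArg (r * ·) hs
    rw [this]; ring
  have m2 : r * (p + q - r) = r ^ 2 + r * s := by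
    have e1 : p + q - r = r + s := by omega
    have := congrArg (r * ·) e1
    rw [this]; ring
  have m3 : r * (p + q - 2 * r) = r * s := by
    have e1 : p + q - 2 * r = s := by omega
    exact congrArg (r * ·) e1
  have h4' : ∀ k, ∑ a ∈ S k, 2 * (capDim (colFlag (g k)) (perp p q V) (a + 1) -
      capDim (colFlag (g k)) V (a + 1)) + 2 * ∑ a ∈ S k, lam' k a = 2 * (r * s) := fun k =>
    (h4 k).trans (congrArg (2 * ·) m3)
  rw [m2, m3]
  simp only [Fin.sum_univ_three] at h1 ⊢
  have a0 := h3 0; have a1 := h3 1; have a2 := h3 2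
  have b0 := h4' 0; have b1 := h4' 1; have b2 := h4' 2
  have c0 := h5 0; have c1 := h5 1; have c2 := h5 2
  have d2 := h2
  clear h2 h3 h4 h5 h4'
  change (∑ a ∈ S 0, lam 0 a + ∑ a ∈ S 1, lam 1 a + ∑ a ∈ S 2, lam 2 a) +
    (∑ a ∈ S 0, lam' 0 a + ∑ a ∈ S 1, lam' 1 a + ∑ a ∈ S 2, lam' 2 a) ≤ _
  have d3 : 2 * (r * (p + q)) ≤ 3 * r ^ 2 + finrank ℝ (tangent p q V) := d2
  rw [m1] at d3
  linarith

end SingHorn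

namespace SingHorn

open scoped ComplexOrder
open Module Finset

variable {p q : ℕ}

theorem card_le_of_isotropic {S : Finset ℕ} (hS : S ⊆ range (p + q))
    (hmid : ∀ i ∈ S, i < q ∨ p ≤ i) (hrev : ∀ i ∈ S, p + q - 1 - i ∉ S) : S.card ≤ q := by
  rw [← card_range q]
  apply card_le_card_of_injOn (fun i => if i < q then i else p + q - 1 - i)
  · intro i hi
    have h1 := mem_range.1 (hS hi)
    have h2 := hmid i hi
    rw [coe_range, Set.mem_Iio]
    dsimp only
    split_ifs <;> omega
  · intro i hi j hj h
    have h1 := mem_range.1 (hS hi)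
    have h2 := mem_range.1 (hS hj)
    dsimp only at h
    have h3 : p + q - 1 - i ≠ j := fun e => hrev i hi (e ▸ hj)
    split_ifs at h <;> omega

theorem exists_of_notMem_singularCone (hq : 1 ≤ q) (hpq : q ≤ p) {x : Fin 3 → Fin q → ℝ}
    (hx : ∀ k, DecrNonneg (x k)) (hns : (x 0, x 1, x 2) ∉ SingularCone p q) :
    ∃ (r : ℕ) (S : Fin 3 → Finset ℕ), 0 < r ∧ r ≤ q ∧ (∀ k, S k ⊆ range (p + q)) ∧
      (∀ k, (S k).card = r) ∧ (∀ k, ∀ i ∈ S k, i < q ∨ p ≤ i) ∧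
      (∀ k, ∀ i ∈ S k, p + q - 1 - i ∉ S k) ∧
      (∀ e : Fin 3 → ℕ → ℕ, (∀ k, StrictMono (e k)) → (∀ k, S k = (range r).image (e k)) →
        ((fun a : Fin r => (above (range (p + q) \ S 0) (e 0 a) : ℝ),
          fun a : Fin r => (above (range (p + q) \ S 1) (e 1 a) : ℝ),
          fun a : Fin r => (above (range (p + q) \ S 2) (e 2 a) : ℝ) - ((p : ℝ) + q - r)) :
          (Fin r → ℝ) × (Fin r → ℝ) × (Fin r → ℝ)) ∈ Horn r ∧
        ((fun a : Fin r =>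
            (above ((range (p + q)).filter (fun i => p + q - 1 - i ∉ S 0) \ S 0) (e 0 a) : ℝ),
          fun a : Fin r =>
            (above ((range (p + q)).filter (fun i => p + q - 1 - i ∉ S 1) \ S 1) (e 1 a) : ℝ),
          fun a : Fin r =>
            (above ((range (p + q)).filter (fun i => p + q - 1 - i ∉ S 2) \ S 2) (e 2 a) : ℝ) -
              ((p : ℝ) + q - 2 * r)) :
          (Fin r → ℝ) × (Fin r → ℝ) × (Fin r → ℝ)) ∈ Horn r) ∧
      0 < ∑ k, ∑ i ∈ S k, xhat p q (x k) i := by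
  have hun : ∀ g : Fin 3 → Matrix (Fin (p + q)) (Fin (p + q)) ℂ, (∀ k, g k ∈ formGroup p q) →
      ∃ V μ, HNData p q x g V μ := by
    intro g hg
    have hF := fun k => isFlag_colFlag (isUnit_formGroup (hg k))
    by_contra hcon
    refine hns (singular_of_semistable hq hpq hx hg fun W => ?_)
    by_contra hW
    obtain ⟨V, μ, h⟩ := exists_isHN hF (fun k => xhat_antitone (hx k)) ⟨W, not_le.1 hW⟩
    exact hcon ⟨V, μ, hg, h⟩
  obtain ⟨V₀, μ₀, h₀⟩ := hun (fun _ => 1) fun _ => formGroup_one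
  obtain ⟨g, V, μ, hm⟩ := exists_minHN ⟨_, V₀, μ₀, h₀⟩
  have hg := hm.mem
  have hF := fun k => isFlag_colFlag (isUnit_formGroup (hg k))
  have hV : V ≤ perp p q V := hm.hn.isotropic hpq hx hg
  have hsub : ∀ k, pos (p + q) (colFlag (g k)) V ⊆ range (p + q) := fun k => pos_subset_range _ _
  have hmid : ∀ k, ∀ i ∈ pos (p + q) (colFlag (g k)) V, i < q ∨ p ≤ i := fun k i hi => by
    by_contra h
    push Not at h
    exact pos_isotropic_mid (hg k) hV h.1 h.2 hi
  have hrev : ∀ k, ∀ i ∈ pos (p + q) (colFlag (g k)) V,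
      p + q - 1 - i ∉ pos (p + q) (colFlag (g k)) V := fun k i hi => pos_isotropic_rev (hg k) hV hi
  have hcard : ∀ k, (pos (p + q) (colFlag (g k)) V).card = finrank ℂ V := fun k => (hF k).card_pos
  have hr : 0 < finrank ℂ V := by
    rw [finrank_pos_iff]
    exact Submodule.nontrivial_iff_ne_bot.2 hm.hn.ne_bot
  have hperp := finrank_perp V
  have H1 : ∀ φ : (Fin (p + q) → ℂ) →ₗ[ℂ] (Fin (p + q) → ℂ), V.map φ ≤ ⊤ →
      (∀ k, ∀ i ≤ p + q, (V ⊓ colFlag (g k) i).map φ ≤ V ⊔ (⊤ ⊓ colFlag (g k) i)) →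
      V.map φ ≤ V := fun φ _ h =>
    hm.hn.map_le hF (fun k => xhat_antitone (hx k)) fun k i hi => (h k i hi).trans (by
      rw [top_inf_eq])
  have H2 : ∀ φ : (Fin (p + q) → ℂ) →ₗ[ℂ] (Fin (p + q) → ℂ), V.map φ ≤ perp p q V →
      (∀ k, ∀ i ≤ p + q, (V ⊓ colFlag (g k) i).map φ ≤ V ⊔ (perp p q V ⊓ colFlag (g k) i)) →
      V.map φ ≤ V := fun φ _ h =>
    hm.hn.map_le hF (fun k => xhat_antitone (hx k)) fun k i hi =>
      (h k i hi).trans (sup_le_sup le_rfl inf_le_right)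
  have hpt : ∀ k, pos (p + q) (colFlag (g k)) ⊤ = range (p + q) := fun k => (hF k).pos_top
  have hft : finrank ℂ (⊤ : Submodule ℂ (Fin (p + q) → ℂ)) = p + q := by simp
  have hle := hm.sum_above_le hpq hx hun hV
  have l1 := mul_le_sum_above hF le_top H1
  have l2 := mul_le_sum_above hF hV H2
  have hfp : finrank ℂ (perp p q V) - finrank ℂ V = p + q - 2 * finrank ℂ V := by omega
  rw [hft] at l1
  rw [hfp] at l2
  simp only [hpt] at l1
  have u1 : ∑ k, ∑ a ∈ pos (p + q) (colFlag (g k)) V,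
      above (pos (p + q) (colFlag (g k)) ⊤ \ pos (p + q) (colFlag (g k)) V) a ≤
      finrank ℂ V * (finrank ℂ (⊤ : Submodule ℂ (Fin (p + q) → ℂ)) - finrank ℂ V) := by
    rw [hft]
    simp only [hpt]
    omega
  have u2 : ∑ k, ∑ a ∈ pos (p + q) (colFlag (g k)) V,
      above (pos (p + q) (colFlag (g k)) (perp p q V) \ pos (p + q) (colFlag (g k)) V) a ≤
      finrank ℂ V * (finrank ℂ (perp p q V) - finrank ℂ V) := by
    rw [hfp]
    omega
  refine ⟨finrank ℂ V, fun k => pos (p + q) (colFlag (g k)) V, hr, ?_, hsub, hcard, hmid, hrev,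
    ?_, ?_⟩
  · rw [← hcard 0]
    exact card_le_of_isotropic (hsub 0) (hmid 0) (hrev 0)
  · intro e he hp
    have k1 := horn_of_hom_eq hr hF rfl le_top H1 u1 he hp
    have k2 := horn_of_hom_eq hr hF rfl hV H2 u2 he hp
    rw [hft] at k1
    have hfp' : (finrank ℂ (perp p q V) : ℝ) - finrank ℂ V = (p : ℝ) + q - 2 * finrank ℂ V := by
      have : (finrank ℂ (perp p q V) : ℝ) + finrank ℂ V = p + q := by exact_mod_cast hperp
      linarith
    rw [hfp'] at k2
    simp only [hpt, Nat.cast_add] at k1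
    simp only [pos_perp_eq (hg _) hV] at k2
    exact ⟨k1, k2⟩
  · have h1 := hm.hn.eq
    rw [tot_eq_pos hF] at h1
    rw [h1]
    exact mul_pos hm.hn.slope_pos (by exact_mod_cast hr)

end SingHorn

namespace SingHorn

open scoped ComplexOrder
open Module Finset

theorem getD_sort_eq {S : Finset ℕ} {r : ℕ} (h : S.card = r) (a : Fin r) :
    (S.sort (· ≤ ·)).getD a 0 = S.orderEmbOfFin h a := by
  rw [orderEmbOfFin_apply, List.getD_eq_getElem]
  rfl

theorem card_filter_lt_orderEmb {S : Finset ℕ} {r : ℕ} (h : S.card = r) (a : Fin r) :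
    (S.filter (· < S.orderEmbOfFin h a)).card = a := by
  have : S.filter (· < S.orderEmbOfFin h a) = (Iio a).map (S.orderEmbOfFin h).toEmbedding := by
    ext u
    rw [mem_filter, mem_map]
    constructor
    · rintro ⟨hu, hlt⟩
      rw [← image_orderEmbOfFin_univ S h] at hu
      obtain ⟨b, -, rfl⟩ := mem_image.1 hu
      exact ⟨b, mem_Iio.2 ((S.orderEmbOfFin h).lt_iff_lt.1 hlt), rfl⟩
    · rintro ⟨b, hb, rfl⟩
      exact ⟨orderEmbOfFin_mem _ _ _, (S.orderEmbOfFin h).lt_iff_lt.2 (mem_Iio.1 hb)⟩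
  rw [this, card_map, Fin.card_Iio]

theorem above_orderEmb {S : Finset ℕ} {r : ℕ} (h : S.card = r) (a : Fin r) :
    above S (S.orderEmbOfFin h a) + a + 1 = r := by
  have : S.filter (S.orderEmbOfFin h a < ·) = (Ioi a).map (S.orderEmbOfFin h).toEmbedding := by
    ext u
    rw [mem_filter, mem_map]
    constructor
    · rintro ⟨hu, hlt⟩
      rw [← image_orderEmbOfFin_univ S h] at hu
      obtain ⟨b, -, rfl⟩ := mem_image.1 hu
      exact ⟨b, mem_Ioi.2 ((S.orderEmbOfFin h).lt_iff_lt.1 hlt), rfl⟩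
    · rintro ⟨b, hb, rfl⟩
      exact ⟨orderEmbOfFin_mem _ _ _, (S.orderEmbOfFin h).lt_iff_lt.2 (mem_Ioi.1 hb)⟩
  rw [above, this, card_map, Fin.card_Ioi]
  omega

theorem orderEmb_image {S : Finset ℕ} {r : ℕ} (h : S.card = r) {f : ℕ → ℕ}
    (hf : StrictMonoOn f S) (h' : (S.image f).card = r) (a : Fin r) :
    (S.image f).orderEmbOfFin h' a = f (S.orderEmbOfFin h a) := by
  have := orderEmbOfFin_unique h' (f := fun a => f (S.orderEmbOfFin h a))
    (fun b => mem_image_of_mem _ (orderEmbOfFin_mem _ _ _))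
    (fun b c hbc => hf (orderEmbOfFin_mem _ _ _) (orderEmbOfFin_mem _ _ _)
      ((S.orderEmbOfFin h).strictMono hbc))
  exact (congrFun this a).symm

theorem card_image_of_strictMonoOn {S : Finset ℕ} {f : ℕ → ℕ} (hf : StrictMonoOn f S) :
    (S.image f).card = S.card := card_image_of_injOn hf.injOn

/-- A strictly monotone extension of the enumeration of a finite set. -/
theorem exists_enum {S : Finset ℕ} {r : ℕ} (h : S.card = r) :
    ∃ e : ℕ → ℕ, StrictMono e ∧ S = (range r).image e ∧ ∀ a : Fin r, e a = S.orderEmbOfFin h a := by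
  have hb : ∀ u ∈ S, u ≤ S.sup id := fun u hu => le_sup (f := id) hu
  let e : ℕ → ℕ := fun a => if h' : a < r then S.orderEmbOfFin h ⟨a, h'⟩ else S.sup id + 1 + a
  have he : ∀ a : Fin r, e a = S.orderEmbOfFin h a := fun a => by simp [e]
  refine ⟨e, strictMono_nat_of_lt_succ fun a => ?_, ?_, he⟩
  · by_cases h1 : a + 1 < r
    · have h2 : a < r := by omega
      simp only [e, h1, h2, dif_pos]
      exact (S.orderEmbOfFin h).strictMono (Fin.mk_lt_mk.2 (Nat.lt_add_one a))
    · by_cases h2 : a < r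
      · simp only [e, h1, h2, dif_pos, dif_neg, not_false_iff]
        have := hb _ (orderEmbOfFin_mem S h ⟨a, h2⟩)
        omega
      · simp only [e, h1, h2, dif_neg, not_false_iff]
        omega
  · ext u
    conv_lhs => rw [← image_orderEmbOfFin_univ S h]
    simp only [mem_image, mem_univ, true_and, mem_range]
    constructor
    · rintro ⟨a, rfl⟩; exact ⟨a, a.2, he a⟩
    · rintro ⟨a, ha, rfl⟩; exact ⟨⟨a, ha⟩, (he ⟨a, ha⟩).symm⟩

theorem lambdaOf_image_succ {N r : ℕ} {S : Finset ℕ} (hS : S ⊆ range N) (h : S.card = r)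
    (a : Fin r) :
    lambdaOf N r (S.image (· + 1)) a = above (range N \ S) (S.orderEmbOfFin h a) := by
  have hf : StrictMonoOn (· + 1) (S : Set ℕ) := fun u _ v _ h => Nat.add_lt_add_right h 1
  have hc := (card_image_of_strictMonoOn hf).trans h
  rw [lambdaOf, getD_sort_eq hc, orderEmb_image h hf hc]
  have h1 := above_sdiff hS (S.orderEmbOfFin h a)
  have h2 := above_orderEmb h a
  have hlt := mem_range.1 (hS (orderEmbOfFin_mem S h a))
  have h3 : above (range N) (S.orderEmbOfFin h a) + S.orderEmbOfFin h a + 1 = N := by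
    have : (range N).filter (S.orderEmbOfFin h a < ·) = Ioo (S.orderEmbOfFin h a) N := by
      ext u; simp only [mem_filter, mem_range, mem_Ioo]; tauto
    rw [above, this, Nat.card_Ioo]
    omega
  have h4 : above (range N \ S) (S.orderEmbOfFin h a) + (S.orderEmbOfFin h a + 1) + r =
      N + (a + 1) := by omega
  have h5 : (above (range N \ S) (S.orderEmbOfFin h a) : ℝ) + (S.orderEmbOfFin h a + 1 : ℕ) + r =
      N + (a + 1) := by exact_mod_cast h4
  linarith

theorem Icc_sdiff_image_succ {N : ℕ} {S : Finset ℕ} :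
    Icc 1 N \ S.image (· + 1) = (range N \ S).image (· + 1) := by
  ext u
  simp only [mem_sdiff, mem_Icc, mem_image, mem_range]
  constructor
  · rintro ⟨⟨h1, h2⟩, h3⟩
    exact ⟨u - 1, ⟨by omega, fun h => h3 ⟨u - 1, h, by omega⟩⟩, by omega⟩
  · rintro ⟨v, ⟨h1, h2⟩, rfl⟩
    refine ⟨⟨by omega, by omega⟩, ?_⟩
    rintro ⟨w, hw, e⟩
    exact h2 (by rwa [← Nat.succ_injective e])

theorem tildeSet_image_succ {p q r : ℕ} {S : Finset ℕ} (hS : S ⊆ range (p + q)) (h : S.card = r)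
    (hrev : ∀ i ∈ S, p + q - 1 - i ∉ S) :
    tildeSet p q r (S.image (· + 1)) =
      S.image fun s => above (range (p + q) \ S) (p + q - 1 - s) + 1 := by
  set N := p + q with hN
  have hC : (range N \ S).card = N - r := by rw [card_sdiff_of_subset hS, card_range, h]
  have hf : StrictMonoOn (· + 1) ((range N \ S : Finset ℕ) : Set ℕ) :=
    fun u _ v _ h => Nat.add_lt_add_right h 1
  have hcC := (card_image_of_strictMonoOn hf).trans hC
  have hu : ∀ j : Fin (N - r), ((Icc 1 N \ S.image (· + 1)).sort (· ≤ ·)).getD j 0 =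
      (range N \ S).orderEmbOfFin hC j + 1 := by
    intro j
    rw [Icc_sdiff_image_succ, getD_sort_eq hcC, orderEmb_image hC hf hcC]
  have hmem : ∀ i, i ∈ primeSet p q r (S.image (· + 1)) ↔
      ∃ j : Fin (N - r), i = j + 1 ∧ ∃ s ∈ S, (range N \ S).orderEmbOfFin hC j = N - 1 - s := by
    intro i
    rw [primeSet, mem_filter, mem_Icc, image_image, mem_image]
    constructor
    · rintro ⟨⟨h1, h2⟩, s, hs, e⟩
      have h3 : i - 1 < N - r := by omega
      rw [hu ⟨i - 1, h3⟩] at e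
      have := mem_range.1 (hS hs)
      simp only [Function.comp] at e
      exact ⟨⟨i - 1, h3⟩, by simp only; omega, s, hs, by omega⟩
    · rintro ⟨j, rfl, s, hs, e⟩
      refine ⟨⟨by omega, by omega⟩, s, hs, ?_⟩
      have := mem_range.1 (hS hs)
      rw [Nat.add_sub_cancel, hu, e]
      simp only [Function.comp]
      omega
  ext k
  rw [tildeSet, mem_filter, mem_Icc, hmem, mem_image]
  constructor
  · rintro ⟨⟨h1, h2⟩, j, hj, s, hs, e⟩
    refine ⟨s, hs, ?_⟩
    rw [← e]
    have := above_orderEmb hC j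
    omega
  · rintro ⟨s, hs, rfl⟩
    have hsN := mem_range.1 (hS hs)
    have hm : N - 1 - s ∈ range N \ S := mem_sdiff.2 ⟨mem_range.2 (by omega), hrev s hs⟩
    rw [← image_orderEmbOfFin_univ _ hC] at hm
    obtain ⟨j, -, hj⟩ := mem_image.1 hm
    have := above_orderEmb hC j
    rw [← hj]
    exact ⟨⟨by omega, by omega⟩, j, by omega, s, hs, hj⟩

theorem card_filter_rev {N r : ℕ} {S : Finset ℕ} (hS : S ⊆ range N) (h : S.card = r)
    (hrev : ∀ i ∈ S, N - 1 - i ∉ S) :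
    (((range N).filter fun i => N - 1 - i ∉ S) \ S).card + 2 * r = N := by
  classical
  have h1 : S.image (fun i => N - 1 - i) = (range N).filter fun i => N - 1 - i ∈ S := by
    ext u
    rw [mem_image, mem_filter, mem_range]
    constructor
    · rintro ⟨s, hs, rfl⟩
      have := mem_range.1 (hS hs)
      refine ⟨by omega, ?_⟩
      rwa [show N - 1 - (N - 1 - s) = s by omega]
    · rintro ⟨h1, h2⟩; exact ⟨_, h2, by omega⟩
  have h2 : ((range N).filter fun i => N - 1 - i ∈ S).card = r := by
    rw [← h1, card_image_of_injOn, h]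
    intro u hu v hv huv
    have := mem_range.1 (hS hu); have := mem_range.1 (hS hv)
    dsimp only at huv
    omega
  have h3 := card_filter_add_card_filter_not (s := range N) (fun i => N - 1 - i ∈ S)
  rw [card_range, h2] at h3
  have h4 : S ⊆ (range N).filter fun i => N - 1 - i ∉ S := fun i hi =>
    mem_filter.2 ⟨hS hi, hrev i hi⟩
  have h5 := card_sdiff_add_card_eq_card h4
  omega

theorem lambdaOf_tildeSet {p q r : ℕ} {S : Finset ℕ} (hS : S ⊆ range (p + q)) (h : S.card = r)
    (hrev : ∀ i ∈ S, p + q - 1 - i ∉ S) (a : Fin r) :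
    lambdaOf (p + q - r) r (tildeSet p q r (S.image (· + 1))) a =
      above ((range (p + q)).filter (fun i => p + q - 1 - i ∉ S) \ S) (S.orderEmbOfFin h a) := by
  classical
  rw [tildeSet_image_succ hS h hrev]
  have hrN : r + r ≤ p + q := by
    have := card_filter_rev hS h hrev
    omega
  set N := p + q with hN
  have hf : StrictMonoOn (fun s => above (range N \ S) (N - 1 - s) + 1) (S : Set ℕ) := by
    intro s hs t ht hst
    have hsN := mem_range.1 (hS hs)
    have htN := mem_range.1 (hS ht)
    refine Nat.add_lt_add_right (card_lt_card ?_) 1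
    refine (ssubset_iff_of_subset fun u hu => ?_).2 ⟨N - 1 - s, ?_, ?_⟩
    · rw [mem_filter] at hu ⊢
      exact ⟨hu.1, by omega⟩
    · rw [mem_filter, mem_sdiff, mem_range]
      exact ⟨⟨by omega, hrev s hs⟩, by omega⟩
    · rw [mem_filter]
      exact fun h => lt_irrefl _ h.2
  have hc := (card_image_of_strictMonoOn hf).trans h
  rw [lambdaOf, getD_sort_eq hc, orderEmb_image h hf hc]
  set s := S.orderEmbOfFin h a with hs
  have hsS : s ∈ S := orderEmbOfFin_mem S h a
  have hsN := mem_range.1 (hS hsS)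
  set M := (range N).filter (fun i => N - 1 - i ∉ S) \ S with hM
  have hMc : M.card + 2 * r = N := card_filter_rev hS h hrev
  have hMmem : ∀ u, u ∈ M ↔ u < N ∧ N - 1 - u ∉ S ∧ u ∉ S := fun u => by
    rw [hM, mem_sdiff, mem_filter, mem_range, and_assoc]
  have e1 := above_compl_eq hS hrev (N - 1 - s)
  have e2 : above M (N - 1 - s) = (M.filter (· < s)).card := by
    apply card_bij (fun u _ => N - 1 - u)
    · intro u hu
      rw [mem_filter, hMmem] at hu ⊢
      rw [show N - 1 - (N - 1 - u) = u by omega]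
      exact ⟨⟨by omega, hu.1.2.2, hu.1.2.1⟩, by omega⟩
    · intro u hu v hv huv
      rw [mem_filter, hMmem] at hu hv
      omega
    · intro u hu
      rw [mem_filter, hMmem] at hu
      refine ⟨N - 1 - u, ?_, by omega⟩
      rw [mem_filter, hMmem, show N - 1 - (N - 1 - u) = u by omega]
      exact ⟨⟨by omega, hu.1.2.2, hu.1.2.1⟩, by omega⟩
  have e3 : (S.filter fun b => ¬ N ≤ N - 1 - s + b + 1).card = a := by
    rw [← card_filter_lt_orderEmb h a]
    congr 1
    exact filter_congr fun u _ => by omega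
  have e4 : (M.filter (· < s)).card + above M s = M.card := by
    rw [above, ← card_filter_add_card_filter_not (s := M) (· < s)]
    congr 2
    refine filter_congr fun u hu => ?_
    have : u ≠ s := by rintro rfl; exact ((hMmem _).1 hu).2.2 hsS
    omega
  rw [← hM, e2, e3] at e1
  have e5 : above M s + (above (range N \ S) (N - 1 - s) + 1) + 2 * r = N + (a + 1) := by omega
  have e6 : (above M s : ℝ) + (above (range N \ S) (N - 1 - s) + 1 : ℕ) + 2 * r =
      N + (a + 1) := by exact_mod_cast e5
  have e7 : ((N - r : ℕ) : ℝ) = N - r := Nat.cast_sub (by omega)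
  rw [e7]
  linarith

/-- Splitting an isotropic set of positions into a polarized set. -/
theorem exists_polarized {p q r : ℕ} {S : Finset ℕ} (hS : S ⊆ range (p + q))
    (h : S.card = r) (hmid : ∀ i ∈ S, i < q ∨ p ≤ i) (hrev : ∀ i ∈ S, p + q - 1 - i ∉ S) :
    ∃ Xp Xm : Finset ℕ, Xp ⊆ Icc 1 q ∧ Xm ⊆ Icc 1 q ∧ Disjoint Xp Xm ∧ Xp.card + Xm.card = r ∧
      polToSet p q Xp Xm = S.image (· + 1) := by
  classical
  have hcard : ((S.filter (· < q)).image (· + 1)).card +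
      ((S.filter fun i => ¬ i < q).image (fun i => p + q - i)).card = r := by
    rw [card_image_of_injective _ (fun a b h => by simpa using h), card_image_of_injOn,
      card_filter_add_card_filter_not, h]
    intro u hu v hv huv
    have := mem_range.1 (hS (mem_filter.1 hu).1); have := mem_range.1 (hS (mem_filter.1 hv).1)
    dsimp only at huv
    omega
  refine ⟨(S.filter (· < q)).image (· + 1), (S.filter fun i => ¬ i < q).image (fun i => p + q - i),
    ?_, ?_, ?_, hcard, ?_⟩
  · intro u hu
    obtain ⟨i, hi, rfl⟩ := mem_image.1 hu
    rw [mem_filter] at hi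
    rw [mem_Icc]; omega
  · intro u hu
    obtain ⟨i, hi, rfl⟩ := mem_image.1 hu
    rw [mem_filter] at hi
    have := mem_range.1 (hS hi.1)
    have := hmid i hi.1
    rw [mem_Icc]; omega
  · rw [disjoint_left]
    intro u hu hu'
    obtain ⟨i, hi, rfl⟩ := mem_image.1 hu
    obtain ⟨j, hj, e⟩ := mem_image.1 hu'
    rw [mem_filter] at hi hj
    have := mem_range.1 (hS hj.1)
    apply hrev i hi.1
    rw [show p + q - 1 - i = j by omega]
    exact hj.1
  · rw [polToSet, image_image]
    conv_rhs => rw [← filter_union_filter_not_eq (· < q) S, image_union]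
    congr 1
    apply image_congr
    intro i hi
    have := mem_range.1 (hS (mem_filter.1 hi).1)
    simp only [Function.comp]
    omega

end SingHorn

namespace SingHorn

open scoped ComplexOrder
open Module Finset

variable {p q : ℕ}

theorem sum_xhat_polToSet (hpq : q ≤ p) (x : Fin q → ℝ) {Xp Xm : Finset ℕ} (hp : Xp ⊆ Icc 1 q)
    (hm : Xm ⊆ Icc 1 q) :
    ∑ i ∈ polToSet p q Xp Xm, xhat p q x (i - 1) =
      ∑ i ∈ Xp, valAt x i - ∑ i ∈ Xm, valAt x i := by
  classical
  have hd : Disjoint Xp (Xm.image fun a => p + q + 1 - a) := by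
    rw [disjoint_left]
    intro i hi hi'
    obtain ⟨j, hj, rfl⟩ := mem_image.1 hi'
    have h1 := mem_Icc.1 (hp hi)
    have h2 := mem_Icc.1 (hm hj)
    omega
  rw [polToSet, sum_union hd, sub_eq_add_neg, ← sum_neg_distrib, sum_image]
  · congr 1
    · refine sum_congr rfl fun i hi => ?_
      have h1 := mem_Icc.1 (hp hi)
      have h2 : i - 1 < q := by omega
      simp [xhat, valAt, h2]
    · refine sum_congr rfl fun i hi => ?_
      have h1 := mem_Icc.1 (hm hi)
      have h2 : i - 1 < q := by omega
      have h3 : p + q + 1 - i - 1 = p + q - i := by omega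
      have h4 : ¬ p + q - i < q := by omega
      have h5 : ¬ p + q - i < p := by omega
      have h6 : p + q - (p + q - i) = i := by omega
      simp only [xhat, h3, h4, h5, h6, if_false]
  · intro u hu v hv huv
    have h1 := mem_Icc.1 (hm hu)
    have h2 := mem_Icc.1 (hm hv)
    dsimp only at huv
    omega

theorem mem_singularCone_of_horn_conditions (hq : 1 ≤ q) (hpq : q ≤ p) {x : Fin 3 → Fin q → ℝ}
    (hx : ∀ k, DecrNonneg (x k))
    (h : ∀ (r : ℕ) (Xp Xm : Fin 3 → Finset ℕ), 1 ≤ r → r ≤ q → (∀ k, Xp k ⊆ Icc 1 q) →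
      (∀ k, Xm k ⊆ Icc 1 q) → (∀ k, Disjoint (Xp k) (Xm k)) →
      (∀ k, (Xp k).card + (Xm k).card = r) →
      (lambdaOf (p + q) r (polToSet p q (Xp 0) (Xm 0)),
        lambdaOf (p + q) r (polToSet p q (Xp 1) (Xm 1)),
        fun a => lambdaOf (p + q) r (polToSet p q (Xp 2) (Xm 2)) a - ((p : ℝ) + q - r))
          ∈ Horn r →
      (lambdaOf (p + q - r) r (tildeSet p q r (polToSet p q (Xp 0) (Xm 0))),
        lambdaOf (p + q - r) r (tildeSet p q r (polToSet p q (Xp 1) (Xm 1))),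
        fun a => lambdaOf (p + q - r) r (tildeSet p q r (polToSet p q (Xp 2) (Xm 2))) a
          - ((p : ℝ) + q - 2 * r)) ∈ Horn r →
      ∑ k, (∑ i ∈ Xp k, valAt (x k) i - ∑ i ∈ Xm k, valAt (x k) i) ≤ 0) :
    (x 0, x 1, x 2) ∈ SingularCone p q := by
  classical
  by_contra hns
  obtain ⟨r, S, hr, hrq, hS, hcard, hmid, hrev, hhorn, hpos⟩ :=
    exists_of_notMem_singularCone hq hpq hx hns
  choose Xp Xm hXp hXm hdis hXc hX using fun k =>
    exists_polarized (hS k) (hcard k) (hmid k) (hrev k)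
  choose e he hp hee using fun k => exists_enum (hcard k)
  obtain ⟨h1, h2⟩ := hhorn e he hp
  have e1 : ∀ k, lambdaOf (p + q) r (polToSet p q (Xp k) (Xm k)) =
      fun a : Fin r => (above (range (p + q) \ S k) (e k a) : ℝ) := fun k => funext fun a => by
    rw [hX, lambdaOf_image_succ (hS k) (hcard k), hee]
  have e2 : ∀ k, lambdaOf (p + q - r) r (tildeSet p q r (polToSet p q (Xp k) (Xm k))) =
      fun a : Fin r => (above ((range (p + q)).filter (fun i => p + q - 1 - i ∉ S k) \ S k) (e k a) : ℝ) :=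
    fun k => funext fun a => by
      rw [hX, lambdaOf_tildeSet (hS k) (hcard k) (hrev k), hee]
  have h3 := h r Xp Xm hr hrq hXp hXm hdis hXc (by rw [e1, e1, e1]; exact h1)
    (by rw [e2, e2, e2]; exact h2)
  refine absurd h3 (not_le.2 ?_)
  refine hpos.trans_eq (sum_congr rfl fun k _ => ?_)
  rw [← sum_xhat_polToSet hpq (x k) (hXp k) (hXm k), hX,
    sum_image (fun a _ b _ h => Nat.succ_injective h)]
  simp

end SingHorn

namespace SingHorn

open scoped ComplexOrder
open Module Finset

section Pencil

variable {V W U : Type*} [AddCommGroup V] [Module ℂ V] [AddCommGroup W] [Module ℂ W]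
  [FiniteDimensional ℂ V] [FiniteDimensional ℂ W]

theorem finite_not_injective_one_add_smul (M : V →ₗ[ℂ] V) :
    {t : ℂ | ¬ Function.Injective (LinearMap.id + t • M : V →ₗ[ℂ] V)}.Finite := by
  have hfin : {μ : ℂ | Module.End.HasEigenvalue M μ}.Finite :=
    Module.End.finite_hasEigenvalue M
  refine (hfin.image fun μ => -μ⁻¹).subset ?_
  intro t ht
  have h2 : LinearMap.ker (LinearMap.id + t • M : V →ₗ[ℂ] V) ≠ ⊥ := fun h =>
    ht (LinearMap.ker_eq_bot.1 h)
  obtain ⟨v, hv, hv0⟩ := Submodule.exists_mem_ne_zero_of_ne_bot h2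
  have hv' : v + t • M v = 0 := hv
  have ht0 : t ≠ 0 := by
    rintro rfl
    exact hv0 (by simpa using hv')
  refine ⟨-t⁻¹, ?_, by simp⟩
  refine Module.End.hasEigenvalue_of_hasEigenvector (x := v)
    ⟨Module.End.mem_eigenspace_iff.2 ?_, hv0⟩
  have h3 : t • M v = -v := (neg_eq_of_add_eq_zero_right hv').symm
  calc M v = t⁻¹ • (t • M v) := by rw [smul_smul, inv_mul_cancel₀ ht0, one_smul]
    _ = (-t⁻¹) • v := by rw [h3, smul_neg, neg_smul]

theorem finite_finrank_range_lt (A B : V →ₗ[ℂ] W) :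
    {t : ℂ | finrank ℂ (LinearMap.range (A + t • B)) < finrank ℂ (LinearMap.range A)}.Finite := by
  obtain ⟨E, hE⟩ := A.rangeRestrict.exists_rightInverse_of_surjective A.range_rangeRestrict
  obtain ⟨P, hP⟩ := (LinearMap.range A).subtype.exists_leftInverse_of_injective
    (Submodule.ker_subtype _)
  have hA : ∀ u, P (A (E u)) = u := by
    intro u
    have h1 : A (E u) = (LinearMap.range A).subtype u := by
      have := congrArg (fun g => (LinearMap.range A).subtype (g u)) hE
      simpa using this
    rw [h1]
    exact congrArg (fun g => g u) hP
  refine (finite_not_injective_one_add_smul (P ∘ₗ B ∘ₗ E)).subset ?_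
  intro t ht hinj
  rw [Set.mem_ofPred_eq] at ht
  refine absurd ht (not_lt.2 ?_)
  have hi : Function.Injective ((A + t • B) ∘ₗ E) := by
    refine Function.Injective.of_comp (f := P) ?_
    have : (P ∘ ((A + t • B) ∘ₗ E) : _ → _) =
        (LinearMap.id + t • (P ∘ₗ B ∘ₗ E) : LinearMap.range A →ₗ[ℂ] LinearMap.range A) := by
      funext u
      simp [hA]
    rw [this]
    exact hinj
  rw [← LinearMap.finrank_range_of_inj hi]
  exact Submodule.finrank_mono (LinearMap.range_comp_le_range _ _)

/-- If the rank of the pencil `A + t B` is never larger than that of `A`, then `B` maps the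
kernel of `A` into the range of `A`. -/
theorem mem_range_of_pencil {A B : V →ₗ[ℂ] W}
    (h : ∀ t : ℂ, finrank ℂ (LinearMap.range (A + t • B)) ≤ finrank ℂ (LinearMap.range A))
    {v : V} (hv : A v = 0) : B v ∈ LinearMap.range A := by
  by_contra hB
  let A' : V × ℂ →ₗ[ℂ] W := A.coprod (LinearMap.toSpanSingleton ℂ W (B v))
  let B' : V × ℂ →ₗ[ℂ] W := B.coprod 0
  have hlt : finrank ℂ (LinearMap.range A) < finrank ℂ (LinearMap.range A') := by
    refine Submodule.finrank_lt_finrank_of_lt (lt_of_le_of_ne ?_ ?_)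
    · rintro _ ⟨x, rfl⟩
      exact ⟨(x, 0), by simp [A']⟩
    · intro he
      exact hB (he ▸ ⟨(0, 1), by simp [A']⟩)
  have hfin := (finite_finrank_range_lt A' B').union (Set.finite_singleton (0 : ℂ))
  obtain ⟨t, ht⟩ := hfin.exists_notMem
  have ht1 : t ≠ 0 := fun h => ht (Or.inr h)
  have ht2 : finrank ℂ (LinearMap.range A') ≤ finrank ℂ (LinearMap.range (A' + t • B')) :=
    not_lt.1 fun h => ht (Or.inl h)
  refine absurd ((hlt.trans_le ht2).trans_le (Submodule.finrank_mono ?_)) (not_lt.2 (h t))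
  rintro _ ⟨⟨x, c⟩, rfl⟩
  refine ⟨x + (c * t⁻¹) • v, ?_⟩
  simp only [A', B', LinearMap.add_apply, LinearMap.smul_apply, LinearMap.coprod_apply, map_add,
    map_smul, hv, smul_zero, add_zero, LinearMap.toSpanSingleton_apply, LinearMap.zero_apply,
    smul_add, smul_smul]
  rw [show c * t⁻¹ * t = c by field_simp]
  abel

theorem finite_not_surjective {A : V →ₗ[ℂ] W} (hA : Function.Surjective A) (B : V →ₗ[ℂ] W) :
    {t : ℂ | ¬ Function.Surjective (A + t • B)}.Finite := by
  refine (finite_finrank_range_lt A B).subset fun t ht => ?_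
  have h1 : LinearMap.range (A + t • B) < ⊤ := lt_top_iff_ne_top.2 fun h =>
    ht (LinearMap.range_eq_top.1 h)
  rw [Set.mem_ofPred_eq, LinearMap.range_eq_top.2 hA]
  exact Submodule.finrank_lt_finrank_of_lt h1

theorem finite_not_isUnit {d : ℕ} {f : Matrix (Fin d) (Fin d) ℂ} (hf : IsUnit f)
    (g : Matrix (Fin d) (Fin d) ℂ) : {t : ℂ | ¬ IsUnit (f + t • g)}.Finite := by
  have h1 : Function.Surjective f.mulVecLin := Matrix.mulVec_surjective_iff_isUnit.2 hf
  refine (finite_not_surjective h1 g.mulVecLin).subset fun t ht h => ht ?_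
  refine Matrix.mulVec_surjective_iff_isUnit.1 ?_
  have : (f.mulVecLin + t • g.mulVecLin) = (f + t • g).mulVecLin := by
    ext; simp [Matrix.mulVecLin]
  rw [this] at h
  exact h

end Pencil
section LineOpen

variable {V : Type*} [AddCommGroup V] [Module ℂ V]

/-- A set meeting every complex line through one of its points in a cofinite set. -/
def LineOpen (O : Set V) : Prop := ∀ x ∈ O, ∀ v, {t : ℂ | x + t • v ∉ O}.Finite

theorem LineOpen.inter {O P : Set V} (hO : LineOpen O) (hP : LineOpen P) : LineOpen (O ∩ P) := by
  intro x hx v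
  refine ((hO x hx.1 v).union (hP x hx.2 v)).subset fun t ht => ?_
  by_contra h
  simp only [Set.mem_union, not_or] at h
  exact ht ⟨not_not.1 h.1, not_not.1 h.2⟩

theorem LineOpen.nonempty_inter {O P : Set V} (hO : LineOpen O) (hP : LineOpen P)
    (hO' : O.Nonempty) (hP' : P.Nonempty) : (O ∩ P).Nonempty := by
  obtain ⟨x, hx⟩ := hO'
  obtain ⟨y, hy⟩ := hP'
  obtain ⟨t, ht⟩ := ((hO x hx (y - x)).union
    ((hP y hy (x - y)).image fun s => 1 - s)).exists_notMem
  simp only [Set.mem_union, not_or] at ht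
  refine ⟨x + t • (y - x), not_not.1 ht.1, ?_⟩
  by_contra h
  refine ht.2 ⟨1 - t, ?_, by simp⟩
  rw [Set.mem_ofPred_eq, show y + (1 - t) • (x - y) = x + t • (y - x) by module]
  exact h

theorem LineOpen.exists_mem {ι : Type*} (s : Finset ι) {O : ι → Set V}
    (h : ∀ i, LineOpen (O i)) (h' : ∀ i, (O i).Nonempty) : ∃ x, ∀ i ∈ s, x ∈ O i := by
  classical
  have key : LineOpen (⋂ i ∈ s, O i) ∧ (⋂ i ∈ s, O i).Nonempty := by
    induction s using Finset.induction with
    | empty => exact ⟨fun x _ v => by simp, by simp⟩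
    | insert a s _ ih =>
      rw [Finset.set_biInter_insert]
      exact ⟨(h a).inter ih.1, (h a).nonempty_inter ih.1 (h' a) ih.2⟩
  obtain ⟨x, hx⟩ := key.2
  exact ⟨x, by simpa using hx⟩

end LineOpen

section Masked

/-- Keep the entries `(b, a)` with `m a ≤ b`. -/
def mask {n d : ℕ} (m : ℕ → ℕ) (Y : Matrix (Fin n) (Fin d) ℂ) : Matrix (Fin n) (Fin d) ℂ :=
  fun b a => if m a ≤ b then Y b a else 0

/-- The linear map `φ ↦ (γ_k φ f_k)_k`, truncated below the staircases `m_k`. -/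
def maskMap {n d : ℕ} (m : Fin 3 → ℕ → ℕ) (f : Fin 3 → Matrix (Fin d) (Fin d) ℂ)
    (γ : Fin 3 → Matrix (Fin n) (Fin n) ℂ) :
    Matrix (Fin n) (Fin d) ℂ →ₗ[ℂ] Fin 3 → Matrix (Fin n) (Fin d) ℂ where
  toFun φ k := mask (m k) (γ k * φ * f k)
  map_add' φ ψ := by
    funext k; ext b a
    simp only [mask, Matrix.mul_add, Matrix.add_mul, Matrix.add_apply, Pi.add_apply]
    split_ifs <;> simp
  map_smul' c φ := by
    funext k; ext b a
    simp only [mask, Matrix.mul_smul, Matrix.smul_mul, Matrix.smul_apply, Pi.smul_apply,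
      RingHom.id_apply]
    split_ifs <;> simp

variable {n d : ℕ} {m : Fin 3 → ℕ → ℕ}

theorem maskMap_add_smul_left (f g : Fin 3 → Matrix (Fin d) (Fin d) ℂ)
    (γ : Fin 3 → Matrix (Fin n) (Fin n) ℂ) (t : ℂ) :
    maskMap m (f + t • g) γ = maskMap m f γ + t • maskMap m g γ := by
  ext φ k b a
  simp only [maskMap, mask, LinearMap.coe_mk, AddHom.coe_mk, LinearMap.add_apply,
    LinearMap.smul_apply, Pi.add_apply, Pi.smul_apply, Matrix.mul_add, Matrix.mul_smul,
    Matrix.add_apply, Matrix.smul_apply]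
  split_ifs <;> simp

theorem maskMap_add_smul_right (f : Fin 3 → Matrix (Fin d) (Fin d) ℂ)
    (γ δ : Fin 3 → Matrix (Fin n) (Fin n) ℂ) (t : ℂ) :
    maskMap m f (γ + t • δ) = maskMap m f γ + t • maskMap m f δ := by
  ext φ k b a
  simp only [maskMap, mask, LinearMap.coe_mk, AddHom.coe_mk, LinearMap.add_apply,
    LinearMap.smul_apply, Pi.add_apply, Pi.smul_apply, Matrix.add_mul, Matrix.smul_mul,
    Matrix.add_apply, Matrix.smul_apply]
  split_ifs <;> simp

theorem maskMap_congr {m' : Fin 3 → ℕ → ℕ} (h : ∀ k, ∀ a < d, m k a = m' k a)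
    (f : Fin 3 → Matrix (Fin d) (Fin d) ℂ) (γ : Fin 3 → Matrix (Fin n) (Fin n) ℂ) :
    maskMap m f γ = maskMap m' f γ := by
  ext φ k b a
  simp only [maskMap, mask, LinearMap.coe_mk, AddHom.coe_mk, h k a a.2]

/-- The rank of the truncated map. -/
noncomputable def maskRank {n d : ℕ} (m : Fin 3 → ℕ → ℕ) (f : Fin 3 → Matrix (Fin d) (Fin d) ℂ)
    (γ : Fin 3 → Matrix (Fin n) (Fin n) ℂ) : ℕ := finrank ℂ (LinearMap.range (maskMap m f γ))

/-- `γ` realizes the largest rank for all staircases of width at most `r`. -/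
def IsGeneric (r : ℕ) (γ : Fin 3 → Matrix (Fin n) (Fin n) ℂ) : Prop :=
  ∀ d ≤ r, ∀ m : Fin 3 → ℕ → ℕ, (∀ k, ∀ a < d, m k a ≤ n) → ∃ f : Fin 3 → Matrix (Fin d) (Fin d) ℂ,
    ∀ f' γ', maskRank (n := n) (d := d) m f' γ' ≤ maskRank m f γ

theorem lineOpen_isUnit : LineOpen {γ : Fin 3 → Matrix (Fin n) (Fin n) ℂ | ∀ k, IsUnit (γ k)} := by
  intro γ hγ δ
  refine (Set.finite_iUnion fun k => finite_not_isUnit (hγ k) (δ k)).subset fun t ht => ?_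
  by_contra h
  simp only [Set.mem_iUnion, Set.mem_ofPred_eq, not_exists, not_not] at h
  exact ht h

theorem exists_isGeneric (n r : ℕ) :
    ∃ γ : Fin 3 → Matrix (Fin n) (Fin n) ℂ, (∀ k, IsUnit (γ k)) ∧ IsGeneric r γ := by
  classical
  let ι := Option ((d : Fin (r + 1)) × (Fin 3 → Fin r → Fin (n + 1)))
  let ex : (Fin 3 → Fin r → Fin (n + 1)) → Fin 3 → ℕ → ℕ := fun m k a =>
    if h : a < r then (m k ⟨a, h⟩ : ℕ) else 0
  let O : ι → Set (Fin 3 → Matrix (Fin n) (Fin n) ℂ) := fun i => match i with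
    | none => {γ | ∀ k, IsUnit (γ k)}
    | some x => {γ | ∃ f : Fin 3 → Matrix (Fin x.1) (Fin x.1) ℂ,
        ∀ f' γ', maskRank (n := n) (d := x.1) (ex x.2) f' γ' ≤ maskRank (ex x.2) f γ}
  have h1 : ∀ i, LineOpen (O i) := by
    rintro (_ | x)
    · exact lineOpen_isUnit
    · rintro γ ⟨f, hf⟩ δ
      refine (finite_finrank_range_lt (maskMap (ex x.2) f γ) (maskMap (ex x.2) f δ)).subset
        fun t ht => ?_
      by_contra h
      rw [Set.mem_ofPred_eq, not_lt, ← maskMap_add_smul_right] at h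
      exact ht ⟨f, fun f' γ' => (hf f' γ').trans h⟩
  have h2 : ∀ i, (O i).Nonempty := by
    rintro (_ | x)
    · exact ⟨fun _ => 1, fun _ => isUnit_one⟩
    · let S : Set ℕ := Set.range fun y : (Fin 3 → Matrix (Fin x.1) (Fin x.1) ℂ) ×
        (Fin 3 → Matrix (Fin n) (Fin n) ℂ) => maskRank (ex x.2) y.1 y.2
      have hb : BddAbove S := by
        refine ⟨finrank ℂ (Fin 3 → Matrix (Fin n) (Fin x.1) ℂ), ?_⟩
        rintro _ ⟨y, rfl⟩
        exact Submodule.finrank_le _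
      obtain ⟨y, hy⟩ := Nat.sSup_mem (Set.range_nonempty _ : S.Nonempty) hb
      refine ⟨y.2, y.1, fun f' γ' => ?_⟩
      change _ ≤ (fun y : (Fin 3 → Matrix (Fin x.1) (Fin x.1) ℂ) ×
        (Fin 3 → Matrix (Fin n) (Fin n) ℂ) => maskRank (ex x.2) y.1 y.2) y
      rw [hy]
      exact le_csSup hb ⟨(f', γ'), rfl⟩
  obtain ⟨γ, hγ⟩ := LineOpen.exists_mem univ h1 h2
  refine ⟨γ, hγ none (mem_univ _), fun d hd m hm => ?_⟩
  obtain ⟨f, hf⟩ := hγ (some ⟨⟨d, by omega⟩, fun k a =>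
    ⟨min (m k a) n, by omega⟩⟩) (mem_univ _)
  have hc : ∀ k, ∀ a < d, ex (fun k a => ⟨min (m k a) n, by omega⟩) k a = m k a := by
    intro k a ha
    simp only [ex]
    rw [dif_pos (by omega)]
    exact min_eq_left (hm k a ha)
  refine ⟨f, fun f' γ' => ?_⟩
  have := hf f' γ'
  simp only [maskRank] at this ⊢
  rwa [maskMap_congr hc, maskMap_congr hc] at this

end Masked
end SingHorn

namespace SingHorn

open scoped ComplexOrder
open Module Finset Filter Topology

section TraceInequality

variable {n : ℕ}

theorem projMat_eq_of_span_eq {s s' : Finset ℕ} {v v' : ℕ → Fin n → ℂ} (h : ONOn s v)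
    (h' : ONOn s' v') (hs : Submodule.span ℂ (v '' s) = Submodule.span ℂ (v' '' s')) :
    projMat s v = projMat s' v' := by
  have h1 : projMat s' v' * projMat s v = projMat s v := by
    apply ext_of_mulVec_single
    intro i
    rw [← mulVec_mulVec, h'.projMat_mulVec_eq (hs ▸ projMat_mulVec_mem s v _)]
  have h2 : projMat s v * projMat s' v' = projMat s' v' := by
    apply ext_of_mulVec_single
    intro i
    rw [← mulVec_mulVec, h.projMat_mulVec_eq (hs ▸ projMat_mulVec_mem s' v' _)]
  have h3 := congrArg conjTranspose h1
  rw [conjTranspose_mul, projMat_conjTranspose, projMat_conjTranspose, h2] at h3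
  exact h3.symm

theorem wsum_le_trace {U : Matrix (Fin n) (Fin n) ℂ} (hU : Uᴴ * U = 1) {w : ℕ → ℝ}
    (hw : Antitone w) {s : Finset ℕ} {v : ℕ → Fin n → ℂ} (hv : ONOn s v) :
    wsum n w (colFlag U) (Submodule.span ℂ (v '' s)) ≤ (diagConj U w * projMat s v).trace.re := by
  set W := Submodule.span ℂ (v '' s) with hW
  have hUu : IsUnit U := IsUnit.of_mul_eq_one _ (mul_eq_one_comm.1 hU)
  have hF := isFlag_colFlag hUu
  obtain ⟨u, hu⟩ := IsONAdapted.exists hF W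
  have hon : ONOn (pos n (colFlag U) W) u := fun a ha b hb => hu.orthonormal hF ha hb
  have hspan : W = Submodule.span ℂ (u '' pos n (colFlag U) W) :=
    hon.span_eq (fun a ha => (hu a ha).1.1) (by rw [hF.card_pos])
  rw [projMat_eq_of_span_eq hv hon (hW ▸ hspan)]
  set P := pos n (colFlag U) W with hP
  let c : ℕ → ℕ → ℝ := fun a i => if h : i < n then ‖(Uᴴ *ᵥ u a) ⟨i, h⟩‖ ^ 2 else 0
  have hc0 : ∀ a i, 0 ≤ c a i := fun a i => by
    simp only [c]; split_ifs <;> positivity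
  have hsumc : ∀ a ∈ P, ∑ i ∈ range n, c a i = 1 := by
    intro a ha
    have h1 : star (Uᴴ *ᵥ u a) ⬝ᵥ (Uᴴ *ᵥ u a) = 1 := by
      rw [star_mulVec, conjTranspose_conjTranspose, ← dotProduct_mulVec, mulVec_mulVec,
        mul_eq_one_comm.1 hU, one_mulVec]
      simpa using hon a ha a ha
    have h2 : ((∑ i : Fin n, ‖(Uᴴ *ᵥ u a) i‖ ^ 2 : ℝ) : ℂ) = 1 := by
      rw [← h1, Complex.ofReal_sum]
      refine sum_congr rfl fun i _ => ?_
      rw [Pi.star_apply, Complex.star_def, Complex.conj_mul']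
      simp
    rw [Finset.sum_range]
    rw [← Complex.ofReal_inj, Complex.ofReal_one, ← h2]
    congr 1
    exact sum_congr rfl fun i _ => by simp [c]
  have hpart : ∀ a ∈ P, ∀ j ≤ n, a < j → ∑ i ∈ range j, c a i = 1 := by
    intro a ha j hj haj
    rw [← hsumc a ha]
    refine sum_subset (range_subset_range.2 hj) fun i hi hij => ?_
    rw [mem_range] at hi hij
    obtain ⟨y, hy, hye⟩ := hF.mono haj (hu a ha).1.2
    rw [mulVecLin_apply] at hye
    have hy0 : Uᴴ *ᵥ u a = y := by rw [← hye, mulVec_mulVec, hU, one_mulVec]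
    simp only [c, dif_pos hi]
    rw [hy0, hy ⟨i, hi⟩ (by simpa using hij)]
    simp
  have htr : (diagConj U w * projMat P u).trace.re =
      ∑ i ∈ range n, w i * (∑ l ∈ range (i + 1), ∑ a ∈ P, c a l - ∑ l ∈ range i, ∑ a ∈ P, c a l) := by
    have h1 : ∀ i ∈ range n, w i * (∑ l ∈ range (i + 1), ∑ a ∈ P, c a l -
        ∑ l ∈ range i, ∑ a ∈ P, c a l) = w i * ∑ a ∈ P, c a i := fun i _ => by
      rw [sum_range_succ]; ring
    have h2 : (diagConj U w * projMat P u).trace =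
        ∑ a ∈ P, star (Uᴴ *ᵥ u a) ⬝ᵥ (diagonal (fun j : Fin n => (w j : ℂ)) *ᵥ (Uᴴ *ᵥ u a)) := by
      rw [projMat, mul_sum, trace_sum]
      refine sum_congr rfl fun a _ => ?_
      rw [mul_vecMulVec, trace_vecMulVec, dotProduct_comm, star_mulVec, conjTranspose_conjTranspose,
        ← dotProduct_mulVec, mulVec_mulVec, mulVec_mulVec, diagConj, Matrix.mul_assoc]
    rw [sum_congr rfl h1, h2, Complex.re_sum]
    simp_rw [mul_sum]
    rw [sum_comm]
    refine sum_congr rfl fun a _ => ?_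
    rw [dotProduct, Complex.re_sum, Finset.sum_range]
    refine sum_congr rfl fun i _ => ?_
    simp only [c, i.2, dif_pos, mulVec_diagonal, Pi.star_apply, Complex.star_def, Fin.eta]
    rw [mul_left_comm, Complex.conj_mul']
    norm_cast
  rw [htr]
  refine abel_le (D := fun i => (capDim (colFlag U) W i : ℝ))
    (D' := fun i => ∑ l ∈ range i, ∑ a ∈ P, c a l) hw ?_ ?_ fun i hi => ?_
  · simp [hF.capDim_zero]
  · rw [sum_comm, sum_congr rfl hsumc, hF.capDim_top, ← hF.card_pos]
    simp [hP]
  · rw [sum_comm, hF.capDim_eq_card hi, ← hP]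
    calc ((P.filter (· < i)).card : ℝ) = ∑ a ∈ P.filter (· < i), ∑ l ∈ range i, c a l := by
          rw [sum_congr rfl fun a ha => hpart a (mem_filter.1 ha).1 i hi (mem_filter.1 ha).2]
          simp
      _ ≤ _ := sum_le_sum_of_subset_of_nonneg (filter_subset _ _)
          fun a _ _ => sum_nonneg fun l _ => hc0 a l

theorem sum_wsum_nonpos {U : Fin 3 → Matrix (Fin n) (Fin n) ℂ} (hU : ∀ k, (U k)ᴴ * U k = 1)
    {w : Fin 3 → ℕ → ℝ} (hw : ∀ k, Antitone (w k)) (hsum : ∑ k, diagConj (U k) (w k) = 0)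
    (W : Submodule ℂ (Fin n → ℂ)) : ∑ k, wsum n (w k) (colFlag (U k)) W ≤ 0 := by
  have hF : IsFlag n (colFlag (U 0)) :=
    isFlag_colFlag (IsUnit.of_mul_eq_one _ (mul_eq_one_comm.1 (hU 0)))
  obtain ⟨u, hu⟩ := IsONAdapted.exists hF W
  have hon : ONOn (pos n (colFlag (U 0)) W) u := fun a ha b hb => hu.orthonormal hF ha hb
  rw [hon.span_eq (fun a ha => (hu a ha).1.1) (by rw [hF.card_pos])]
  refine (sum_le_sum fun k _ => wsum_le_trace (hU k) (hw k) hon).trans ?_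
  rw [← Complex.re_sum, ← trace_sum, ← sum_mul, hsum]
  simp

end TraceInequality

section Limits

variable {n : ℕ}

theorem mem_colFlag_iff_adjugate {g : Matrix (Fin n) (Fin n) ℂ} (hg : IsUnit g) {i : ℕ}
    {v : Fin n → ℂ} : v ∈ colFlag g i ↔ g.adjugate *ᵥ v ∈ coord n i := by
  have hd : g.det ≠ 0 := ((isUnit_iff_isUnit_det g).1 hg).ne_zero
  constructor
  · rintro ⟨c, hc, rfl⟩
    rw [mulVecLin_apply, mulVec_mulVec, adjugate_mul, smul_mulVec, one_mulVec]
    exact Submodule.smul_mem _ _ hc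
  · intro hv
    refine ⟨g.det⁻¹ • (g.adjugate *ᵥ v), Submodule.smul_mem _ _ hv, ?_⟩
    rw [map_smul, mulVecLin_apply, mulVec_mulVec, mul_adjugate, smul_mulVec, one_mulVec,
      smul_smul, inv_mul_cancel₀ hd, one_smul]

theorem mem_colFlag_of_tendsto' {U : Filter ℕ} [U.NeBot] {γ : ℕ → Matrix (Fin n) (Fin n) ℂ}
    {g : Matrix (Fin n) (Fin n) ℂ} (hγ : ∀ n, IsUnit (γ n)) (hg : IsUnit g)
    (hlim : Tendsto γ U (𝓝 g)) {v : ℕ → Fin n → ℂ} {u : Fin n → ℂ} (hv : Tendsto v U (𝓝 u))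
    {i : ℕ} (h : ∀ᶠ n in U, v n ∈ colFlag (γ n) i) : u ∈ colFlag g i := by
  rw [mem_colFlag_iff_adjugate hg]
  have hc : Continuous fun x : Matrix (Fin n) (Fin n) ℂ × (Fin n → ℂ) => x.1.adjugate *ᵥ x.2 := by
    fun_prop
  have h1 := (hc.tendsto (g, u)).comp (hlim.prodMk_nhds hv)
  intro a ha
  refine tendsto_nhds_unique (((continuous_apply a).tendsto _).comp h1)
    (tendsto_const_nhds.congr' ?_)
  filter_upwards [h] with l hl
  rw [mem_colFlag_iff_adjugate (hγ l)] at hl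
  exact (hl a ha).symm

/-- Subspaces in general position with respect to converging flags accumulate at a subspace in
at least as special a position with respect to the limit flags. -/
theorem exists_limit_subspace {γ : ℕ → Fin 3 → Matrix (Fin n) (Fin n) ℂ}
    {g : Fin 3 → Matrix (Fin n) (Fin n) ℂ} (hγ : ∀ l k, IsUnit (γ l k)) (hg : ∀ k, IsUnit (g k))
    (hlim : Tendsto γ atTop (𝓝 g)) (W : ℕ → Submodule ℂ (Fin n → ℂ)) :
    ∃ (V : Submodule ℂ (Fin n → ℂ)) (l : ℕ), finrank ℂ V = finrank ℂ (W l) ∧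
      ∀ k, ∀ i ≤ n, capDim (colFlag (γ l k)) (W l) i ≤ capDim (colFlag (g k)) V i := by
  classical
  set U : Ultrafilter ℕ := hyperfilter ℕ
  replace hlim : Tendsto γ U (𝓝 g) := hlim.mono_left Nat.hyperfilter_le_atTop
  have hFn : ∀ l k, IsFlag n (colFlag (γ l k)) := fun l k => isFlag_colFlag (hγ l k)
  have hF : ∀ k, IsFlag n (colFlag (g k)) := fun k => isFlag_colFlag (hg k)
  choose v₀ hv₀ using fun l k => IsONAdapted.exists (hFn l k) (W l)
  let P : ℕ → Fin 3 → Finset ℕ := fun l k => pos n (colFlag (γ l k)) (W l)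
  obtain ⟨P', -, hP'⟩ := eventually_eq_of_finite (finite_pos_range n) U (f := P)
    (fun l k => pos_subset_range _ _)
  let v : ℕ → Fin 3 → ℕ → Fin n → ℂ := fun l k a => if a ∈ P l k then v₀ l k a else 0
  have hvball : ∀ l k a, v l k a ∈ Metric.closedBall (0 : Fin n → ℂ) 1 := by
    intro l k a
    by_cases ha : a ∈ P l k
    · simp only [v, ha, if_true]
      exact norm_le_one_of_unit (hv₀ l k a ha).2.1
    · simp only [v, ha, if_false]
      exact Metric.mem_closedBall_self zero_le_one
  choose u _ hu using fun k a =>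
    tendsto_of_ultrafilter (isCompact_closedBall (0 : Fin n → ℂ) 1) U (fun l => hvball l k a)
  have hmem : ∀ l k, ∀ a ∈ P l k, v l k a ∈ W l ⊓ colFlag (γ l k) (a + 1) := by
    intro l k a ha
    simp only [v, ha, if_true]
    exact (hv₀ l k a ha).1
  have hon : ∀ l k, ONOn (P l k) (v l k) := by
    intro l k a ha b hb
    simp only [v, ha, hb, if_true]
    exact (hv₀ l k).orthonormal (hFn l k) ha hb
  have hon' : ∀ k, ONOn (P' k) (u k) := by
    intro k a ha b hb
    refine tendsto_nhds_unique (tendsto_star_dotProduct (hu k a) (hu k b))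
      (tendsto_const_nhds.congr' ?_)
    filter_upwards [hP'] with l hl
    rw [hon l k a (by rw [hl]; exact ha) b (by rw [hl]; exact hb)]
  set V := Submodule.span ℂ (u 0 '' P' 0) with hV
  have huV : ∀ k, ∀ a ∈ P' k, u k a ∈ V := by
    intro k a ha
    have h1 := tendsto_projMat (l := (U : Filter ℕ)) (P' 0) fun b _ => hu 0 b
    have h2 : u k a = projMat (P' 0) (u 0) *ᵥ u k a := by
      have h3 : Continuous fun x : Matrix (Fin n) (Fin n) ℂ × (Fin n → ℂ) => x.1 *ᵥ x.2 := by
        fun_prop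
      refine tendsto_nhds_unique (hu k a)
        (((h3.tendsto (_, u k a)).comp (h1.prodMk_nhds (hu k a))).congr' ?_)
      filter_upwards [hP'] with l hl
      change projMat (P' 0) (v l 0) *ᵥ v l k a = v l k a
      rw [← hl]
      refine (hon l 0).projMat_mulVec_eq ?_
      rw [← (hon l 0).span_eq (fun a ha => (hmem l 0 a ha).1) (by rw [← (hFn l 0).card_pos])]
      exact (hmem l k a (by rw [hl]; exact ha)).1
    rw [h2]
    exact projMat_mulVec_mem _ _ _
  have huF : ∀ k, ∀ a ∈ P' k, u k a ∈ colFlag (g k) (a + 1) := by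
    intro k a ha
    refine mem_colFlag_of_tendsto' (fun l => hγ l k) (hg k) (tendsto_pi_nhds.1 hlim k) (hu k a) ?_
    filter_upwards [hP'] with l hl
    exact (hmem l k a (by rw [hl]; exact ha)).2
  obtain ⟨l, hl⟩ := hP'.exists
  refine ⟨V, l, ?_, fun k i hi => ?_⟩
  · have h1 := finrank_span_eq_card (hon' 0).linearIndependent
    have h2 : Set.range (fun i : P' 0 => u 0 i) = u 0 '' P' 0 := by ext x; simp
    rw [h2, Fintype.card_coe] at h1
    rw [hV, h1, ← hl]
    exact (hFn l 0).card_pos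
  · rw [(hFn l k).capDim_eq_card hi, capDim]
    change ((P l k).filter (· < i)).card ≤ _
    rw [hl]
    refine ((hon' k).mono (filter_subset _ _)).card_le fun a ha => ?_
    rw [mem_filter] at ha
    exact ⟨huV k a ha.1, (hF k).mono ha.2 (huF k a ha.1)⟩

end Limits
end SingHorn

namespace SingHorn

open scoped ComplexOrder
open Module Finset Filter Topology

section Good

variable {n d : ℕ}

/-- The dimension estimates necessary for the surjectivity of the truncated map. -/
def IsGood (n d : ℕ) (m : Fin 3 → ℕ → ℕ) (f : Fin 3 → Matrix (Fin d) (Fin d) ℂ) : Prop :=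
  ∀ W : Submodule ℂ (Fin d → ℂ),
    ∑ k, wsum d (fun i => (n : ℝ) - m k i) (colFlag (f k)) W ≤ n * finrank ℂ W

theorem antitone_sub_cast {m : ℕ → ℕ} (hm : Monotone m) (c : ℝ) :
    Antitone fun i => c - (m i : ℝ) := fun i j h => by
  have : (m i : ℝ) ≤ m j := by exact_mod_cast hm h
  change c - (m j : ℝ) ≤ c - m i
  linarith

theorem exists_isGood {m : Fin 3 → ℕ → ℕ} (hm : ∀ k, Monotone (m k))
    (h : (((fun a => (n : ℝ) - m 0 a), (fun a => (n : ℝ) - m 1 a),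
      fun a => (n : ℝ) - m 2 a - n) : (Fin d → ℝ) × (Fin d → ℝ) × (Fin d → ℝ)) ∈ Horn d) :
    ∃ f : Fin 3 → Matrix (Fin d) (Fin d) ℂ, (∀ k, IsUnit (f k)) ∧ IsGood n d m f := by
  obtain ⟨A, B, C, hA, hB, hC, hsum, eA, eB, eC⟩ := h
  obtain ⟨U, hU, rA⟩ := spectral_desc hA
  obtain ⟨V, hV, rB⟩ := spectral_desc hB
  obtain ⟨T, hT, rC⟩ := spectral_desc hC
  rw [eA] at rA
  rw [eB] at rB
  rw [eC] at rC
  let f : Fin 3 → Matrix (Fin d) (Fin d) ℂ := ![U, V, T]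
  have hf : ∀ k, (f k)ᴴ * f k = 1 := fun k => by fin_cases k <;> assumption
  let w : Fin 3 → ℕ → ℝ := fun k i => (n : ℝ) - m k i - if k = 2 then (n : ℝ) else 0
  have hw : ∀ k, Antitone (w k) := fun k i j hij => by
    have := antitone_sub_cast (hm k) n hij
    simp only [w]
    linarith
  refine ⟨f, fun k => IsUnit.of_mul_eq_one _ (mul_eq_one_comm.1 (hf k)), fun W => ?_⟩
  have hs : ∑ k, diagConj (f k) (w k) = 0 := by
    rw [Fin.sum_univ_three, ← hsum, rA, rB, rC]
    have e0 : w 0 = fun i => (n : ℝ) - m 0 i := by funext i; simp [w]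
    have e1 : w 1 = fun i => (n : ℝ) - m 1 i := by funext i; simp [w]
    have e2 : w 2 = fun i => (n : ℝ) - m 2 i - n := by funext i; simp [w]
    rw [e0, e1, e2]
    rfl
  have h1 := sum_wsum_nonpos hf hw hs W
  have hF := isFlag_colFlag (IsUnit.of_mul_eq_one _ (mul_eq_one_comm.1 (hf 2)))
  have h2 : ∑ k, wsum d (fun i => (n : ℝ) - m k i) (colFlag (f k)) W =
      ∑ k, wsum d (w k) (colFlag (f k)) W + n * finrank ℂ W := by
    have h3 : wsum d (fun i => (n : ℝ) - m 2 i) (colFlag (f 2)) W =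
        wsum d (w 2) (colFlag (f 2)) W + n * finrank ℂ W := by
      rw [hF.wsum_eq, hF.wsum_eq, ← hF.card_pos, ← nsmul_eq_mul', ← sum_const, ← sum_add_distrib]
      exact sum_congr rfl fun i _ => by simp only [w, if_true]; ring
    have e0 : w 0 = fun i => (n : ℝ) - m 0 i := by funext i; simp [w]
    have e1 : w 1 = fun i => (n : ℝ) - m 1 i := by funext i; simp [w]
    rw [Fin.sum_univ_three, Fin.sum_univ_three, h3, e0, e1]
    ring
  rw [h2]
  linarith

theorem IsGood.exists_line {m : Fin 3 → ℕ → ℕ} (hm : ∀ k, Monotone (m k))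
    {f : Fin 3 → Matrix (Fin d) (Fin d) ℂ} (hf : ∀ k, IsUnit (f k)) (hg : IsGood n d m f)
    (g : Fin 3 → Matrix (Fin d) (Fin d) ℂ) {S : Set ℂ} (hS : S.Finite) :
    ∃ t ∉ S, (∀ k, IsUnit (f k + t • g k)) ∧ IsGood n d m (f + t • g) := by
  let τ : ℕ → ℂ := fun l => ((l : ℂ) + 1)⁻¹
  have hτi : Function.Injective τ := fun a b h => by
    have := inv_injective h
    exact_mod_cast add_right_cancel this
  have hτ : Tendsto τ atTop (𝓝 0) := by
    have := tendsto_one_div_add_atTop_nhds_zero_nat (𝕜 := ℂ)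
    simpa [τ] using this
  have hS' := hS.union (Set.finite_iUnion fun k => finite_not_isUnit (hf k) (g k))
  have hev : ∀ᶠ l in atTop, τ l ∉ S ∪ ⋃ k, {t : ℂ | ¬ IsUnit (f k + t • g k)} := by
    have := (hS'.preimage hτi.injOn).compl_mem_cofinite
    rw [Nat.cofinite_eq_atTop] at this
    exact this
  by_contra hcon
  push Not at hcon
  have hbad : ∀ᶠ l in atTop, (∀ k, IsUnit (f k + τ l • g k)) ∧ ¬ IsGood n d m (f + τ l • g) := by
    filter_upwards [hev] with l hl
    simp only [Set.mem_union, Set.mem_iUnion, Set.mem_ofPred_eq, not_or, not_exists, not_not] at hl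
    exact ⟨hl.2, hcon _ hl.1 hl.2⟩
  obtain ⟨L, hL⟩ := eventually_atTop.1 hbad
  have hW : ∀ l, ∃ W : Submodule ℂ (Fin d → ℂ), (n : ℝ) * finrank ℂ W <
      ∑ k, wsum d (fun i => (n : ℝ) - m k i) (colFlag ((f + τ (l + L) • g) k)) W := by
    intro l
    have := (hL (l + L) (by omega)).2
    simp only [IsGood] at this
    push Not at this
    exact this
  choose W hW using hW
  have hu : ∀ l k, IsUnit ((f + τ (l + L) • g) k) := fun l => (hL (l + L) (by omega)).1
  have hlim : Tendsto (fun l => f + τ (l + L) • g) atTop (𝓝 f) := by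
    have h1 : Tendsto (fun l => τ (l + L)) atTop (𝓝 0) := (tendsto_add_atTop_iff_nat L).2 hτ
    have h2 := (tendsto_const_nhds (x := f)).add (h1.smul_const g)
    simpa using h2
  obtain ⟨V, l, hV, hc⟩ := exists_limit_subspace hu hf hlim W
  refine absurd (hg V) (not_le.2 ?_)
  rw [hV]
  refine (hW l).trans_le (sum_le_sum fun k _ => ?_)
  exact wsum_le_of_capDim_le (isFlag_colFlag (hu l k)) (isFlag_colFlag (hf k))
    (antitone_sub_cast (hm k) n) hV.symm (hc k)

/-- The truncated map is onto. -/
def IsSurj (m : Fin 3 → ℕ → ℕ) (f : Fin 3 → Matrix (Fin d) (Fin d) ℂ)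
    (γ : Fin 3 → Matrix (Fin n) (Fin n) ℂ) : Prop :=
  ∀ Y : Fin 3 → Matrix (Fin n) (Fin d) ℂ, ∃ φ : Matrix (Fin n) (Fin d) ℂ,
    ∀ (k : Fin 3) (b : Fin n) (a : Fin d), m k a ≤ b → (γ k * φ * f k) b a = Y k b a

/-- The entries of the truncated map. -/
def stairMap (m : Fin 3 → ℕ → ℕ) (f : Fin 3 → Matrix (Fin d) (Fin d) ℂ)
    (γ : Fin 3 → Matrix (Fin n) (Fin n) ℂ) : Matrix (Fin n) (Fin d) ℂ →ₗ[ℂ]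
      ({x : Fin 3 × Fin d × Fin n // m x.1 x.2.1 ≤ x.2.2} → ℂ) where
  toFun φ x := maskMap m f γ φ x.1.1 x.1.2.2 x.1.2.1
  map_add' φ ψ := by rw [map_add]; rfl
  map_smul' c φ := by rw [map_smul]; rfl

variable {m : Fin 3 → ℕ → ℕ} {f : Fin 3 → Matrix (Fin d) (Fin d) ℂ}
  {γ : Fin 3 → Matrix (Fin n) (Fin n) ℂ}

theorem isSurj_iff : IsSurj m f γ ↔ Function.Surjective (stairMap m f γ) := by
  constructor
  · intro h y
    obtain ⟨φ, hφ⟩ := h fun k (b : Fin n) (a : Fin d) => if hx : m k a ≤ b then y ⟨(k, a, b), hx⟩ else 0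
    refine ⟨φ, funext fun ⟨⟨k, a, b⟩, hx⟩ => ?_⟩
    change mask (m k) _ b a = _
    rw [mask, if_pos hx, hφ k b a hx, dif_pos hx]
  · intro h Y
    obtain ⟨φ, hφ⟩ := h fun x => Y x.1.1 x.1.2.2 x.1.2.1
    refine ⟨φ, fun k b a hx => ?_⟩
    have : mask (m k) (γ k * φ * f k) b a = Y k b a := congrFun hφ ⟨(k, a, b), hx⟩
    rwa [mask, if_pos hx] at this

theorem IsSurj.finite (h : IsSurj m f γ) (g : Fin 3 → Matrix (Fin d) (Fin d) ℂ) :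
    {t : ℂ | ¬ IsSurj m (f + t • g) γ}.Finite := by
  refine (finite_not_surjective (isSurj_iff.1 h) (stairMap m g γ)).subset fun t ht h' => ht ?_
  rw [isSurj_iff]
  have : stairMap m (f + t • g) γ = stairMap m f γ + t • stairMap m g γ := by
    refine LinearMap.ext fun φ => funext fun x => ?_
    change maskMap m (f + t • g) γ φ _ _ _ = _
    rw [maskMap_add_smul_left]
    rfl
  rwa [this]

theorem IsGood.isSurj (hf : ∀ k, IsUnit (f k)) (hg : IsGood n d m f)
    (hmn : ∀ k, ∀ a < d, m k a ≤ n) (hker : ∀ φ, maskMap m f γ φ = 0 → φ = 0) :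
    IsSurj m f γ := by
  rw [isSurj_iff]
  have hinj : Function.Injective (stairMap m f γ) := by
    refine (injective_iff_map_eq_zero _).2 fun φ hφ => hker φ ?_
    funext k; ext (b : Fin n) (a : Fin d)
    by_cases hx : m k a ≤ b
    · exact congrFun hφ ⟨(k, a, b), hx⟩
    · change mask (m k) _ b a = 0
      rw [mask, if_neg hx]
  have hcard : Fintype.card {x : Fin 3 × Fin d × Fin n // m x.1 x.2.1 ≤ x.2.2} =
      ∑ k, ∑ a ∈ range d, (n - m k a) := by
    rw [Fintype.card_subtype, card_filter, Fintype.sum_prod_type]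
    refine sum_congr rfl fun k _ => ?_
    rw [Fintype.sum_prod_type, Finset.sum_range]
    refine sum_congr rfl fun a _ => ?_
    rw [Fin.sum_univ_eq_sum_range (fun b => if m k a ≤ b then 1 else 0), ← card_filter,
      ← Nat.card_Ico]
    congr 1
    ext b
    simp only [mem_filter, Finset.mem_range, mem_Ico]
    omega
  have hle : ∑ k, ∑ a ∈ range d, (n - m k a) ≤ n * d := by
    have h1 := hg ⊤
    rw [finrank_top, finrank_fin_fun] at h1
    have h2 : ((∑ k, ∑ a ∈ range d, (n - m k a) : ℕ) : ℝ) ≤ n * d := by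
      refine le_trans (le_of_eq ?_) h1
      push_cast
      refine sum_congr rfl fun k _ => ?_
      rw [(isFlag_colFlag (hf k)).wsum_top]
      exact sum_congr rfl fun a ha => by rw [Nat.cast_sub (hmn k a (mem_range.1 ha))]
    exact_mod_cast h2
  have h3 := LinearMap.finrank_le_finrank_of_injective hinj
  have h4 : finrank ℂ (Matrix (Fin n) (Fin d) ℂ) = n * d := by
    rw [finrank_matrix]; simp
  refine (LinearMap.injective_iff_surjective_of_finrank_eq_finrank ?_).1 hinj
  rw [h4, finrank_fintype_fun_eq_card, hcard] at h3
  rw [h4, finrank_fintype_fun_eq_card, hcard]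
  omega

end Good
end SingHorn

namespace SingHorn

open scoped ComplexOrder
open Module Finset

section Induct

variable {n d d' : ℕ} {m : Fin 3 → ℕ → ℕ}

theorem wsum_congr_flag {E : Type*} [AddCommGroup E] [Module ℂ E]
    {F G : ℕ → Submodule ℂ E} (h : ∀ i ≤ d, F i = G i) (w : ℕ → ℝ)
    (W : Submodule ℂ E) : wsum d w F W = wsum d w G W := by
  refine sum_congr rfl fun i hi => ?_
  have := mem_range.1 hi
  rw [capDim, capDim, capDim, capDim, h i (by omega), h (i + 1) (by omega)]

theorem exists_mul_eq {a b c : ℕ} {A : Matrix (Fin a) (Fin b) ℂ} {R : Matrix (Fin c) (Fin b) ℂ}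
    (h : ∀ v, A *ᵥ v = 0 → R *ᵥ v = 0) : ∃ Z : Matrix (Fin c) (Fin a) ℂ, Z * A = R := by
  obtain ⟨g, hg⟩ := LinearMap.exists_extend
    ((LinearMap.ker A.mulVecLin).liftQ R.mulVecLin (fun v hv => h v hv) ∘ₗ
      A.mulVecLin.quotKerEquivRange.symm.toLinearMap)
  refine ⟨LinearMap.toMatrix' g, ?_⟩
  refine Matrix.ext_of_mulVec_single fun i => ?_
  rw [← Matrix.mulVec_mulVec, ← Matrix.toLin'_apply, Matrix.toLin'_toMatrix']
  have := congrArg (fun f => f ⟨A *ᵥ Pi.single i 1, ⟨_, rfl⟩⟩) hg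
  refine Eq.trans this ?_
  have h2 : A.mulVecLin.quotKerEquivRange.symm ⟨A *ᵥ Pi.single i 1, ⟨_, rfl⟩⟩ =
      (LinearMap.ker A.mulVecLin).mkQ (Pi.single i 1) := by
    rw [LinearEquiv.symm_apply_eq]
    rfl
  rw [LinearMap.comp_apply, LinearEquiv.coe_coe, h2]
  rfl

theorem maskMap_eq_zero_iff (hm : ∀ k, Monotone (m k)) {f : Fin 3 → Matrix (Fin d) (Fin d) ℂ}
    {γ : Fin 3 → Matrix (Fin n) (Fin n) ℂ} {φ : Matrix (Fin n) (Fin d) ℂ} :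
    maskMap m f γ φ = 0 ↔ ∀ k (a : Fin d), ∀ v ∈ colFlag (f k) (a + 1), ∀ b : Fin n, m k a ≤ b →
      ((γ k * φ) *ᵥ v) b = 0 := by
  constructor
  · rintro h k a _ ⟨c, hc, rfl⟩ b hb
    rw [mulVecLin_apply, mulVec_mulVec, mulVec, dotProduct]
    refine sum_eq_zero fun a' _ => ?_
    by_cases haa : (a : ℕ) + 1 ≤ a'
    · rw [hc a' haa, mul_zero]
    · have h1 : mask (m k) (γ k * φ * f k) b a' = 0 := congrFun (congrFun (congrFun h k) b) a'
      rw [mask, if_pos ((hm k (by omega)).trans hb)] at h1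
      rw [h1, zero_mul]
  · intro h
    funext k; ext (b : Fin n) (a : Fin d)
    change mask (m k) (γ k * φ * f k) b a = 0
    rw [mask]
    split_ifs with hb
    · have h1 := h k a (f k *ᵥ Pi.single a 1) ⟨Pi.single a 1, fun a' ha' => ?_, rfl⟩ b hb
      · rwa [mulVec_mulVec, mulVec_single_one] at h1
      · rw [Pi.single_eq_of_ne]
        rintro rfl
        omega
    · rfl

theorem maskRank_congr_flag (hm : ∀ k, Monotone (m k)) {f g : Fin 3 → Matrix (Fin d) (Fin d) ℂ}
    (h : ∀ k, ∀ i ≤ d, colFlag (f k) i = colFlag (g k) i) (γ : Fin 3 → Matrix (Fin n) (Fin n) ℂ) :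
    maskRank m f γ = maskRank m g γ := by
  have hk : LinearMap.ker (maskMap m f γ) = LinearMap.ker (maskMap m g γ) := by
    ext φ
    rw [LinearMap.mem_ker, LinearMap.mem_ker, maskMap_eq_zero_iff hm, maskMap_eq_zero_iff hm]
    refine forall_congr' fun k => forall_congr' fun a => ?_
    rw [h k (a + 1) (by omega)]
  have h1 := (maskMap m f γ).finrank_range_add_finrank_ker
  have h2 := (maskMap m g γ).finrank_range_add_finrank_ker
  rw [hk] at h1
  rw [maskRank, maskRank]
  omega

theorem isUnit_of_mulVec {U : Matrix (Fin d) (Fin d) ℂ} (h : ∀ v, U *ᵥ v = 0 → v = 0) :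
    IsUnit U := by
  rw [← Matrix.mulVec_injective_iff_isUnit]
  exact (injective_iff_map_eq_zero U.mulVecLin).2 h

/-- A basis adapted both to a flag and to a subspace. -/
theorem exists_adapted_matrix {F : ℕ → Submodule ℂ (Fin d → ℂ)} (hF : IsFlag d F)
    (S : Submodule ℂ (Fin d → ℂ)) : ∃ U : Matrix (Fin d) (Fin d) ℂ, IsUnit U ∧
      (∀ i ≤ d, colFlag U i = F i) ∧ (∀ a : Fin d, Uᵀ a ∈ F (a + 1)) ∧
      (∀ a : Fin d, (a : ℕ) ∈ pos d F S → Uᵀ a ∈ S) ∧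
      ∀ c, U *ᵥ c ∈ S → ∀ a : Fin d, (a : ℕ) ∉ pos d F S → c a = 0 := by
  classical
  obtain ⟨u, hu⟩ := IsAdapted.exists hF S
  obtain ⟨v, hv⟩ := IsAdapted.exists hF ⊤
  let w : ℕ → Fin d → ℂ := fun i => if i ∈ pos d F S then u i else v i
  have hwS : IsAdapted d F S w := fun i hi => by
    simp only [w, if_pos hi]
    exact hu i hi
  have hwT : IsAdapted d F ⊤ w := fun i hi => by
    by_cases h : i ∈ pos d F S
    · exact ⟨⟨trivial, (hwS i h).1.2⟩, (hwS i h).2⟩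
    · simp only [w, if_neg h]
      exact hv i hi
  let U : Matrix (Fin d) (Fin d) ℂ := Matrix.of fun i a => w a i
  have hUa : ∀ a : Fin d, Uᵀ a = w a := fun a => rfl
  have hp : ∀ a : Fin d, (a : ℕ) ∈ pos d F ⊤ := fun a => by rw [hF.pos_top]; simp
  have hli : LinearIndependent ℂ fun a : Fin d => w a :=
    (hwT.linearIndependent hF).comp (fun a : Fin d => (⟨a, hp a⟩ : pos d F ⊤)) fun a b hab => by
      have : (a : ℕ) = b := congrArg Subtype.val hab
      exact Fin.ext this
  have hUm : ∀ c, U *ᵥ c = ∑ a, c a • w a := fun c => by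
    rw [Matrix.mulVec_eq_sum]
    exact sum_congr rfl fun a _ => by rw [op_smul_eq_smul, hUa]
  have hU0 : ∀ c, U *ᵥ c = 0 → c = 0 := fun c hc => by
    rw [hUm] at hc
    exact funext (Fintype.linearIndependent_iff.1 hli c hc)
  have hUu := isUnit_of_mulVec hU0
  have hmem : ∀ a : Fin d, Uᵀ a ∈ F (a + 1) := fun a => (hwT a (hp a)).1.2
  refine ⟨U, hUu, fun i hi => colFlag_eq_of_mem hF hUu hmem hi, hmem,
    fun a ha => (hwS a ha).1.1, fun c hc a ha => ?_⟩
  have hspan : U *ᵥ c ∈ Submodule.span ℂ (w '' (pos d F S)) := by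
    rw [← hwS.span_top hF]
    exact hc
  obtain ⟨t', ht'⟩ := (Submodule.mem_span_image_finset_iff_exists_fun ℂ).1 hspan
  let t : ℕ → ℂ := fun i => if h : i ∈ pos d F S then t' ⟨i, h⟩ else 0
  have ht : ∑ i ∈ pos d F S, t i • w i = U *ᵥ c := by
    rw [← ht', ← Finset.sum_coe_sort]
    exact sum_congr rfl fun i _ => by simp only [t, dif_pos i.2]
  let c' : Fin d → ℂ := fun a => if (a : ℕ) ∈ pos d F S then t a else 0
  have h1 : U *ᵥ c' = U *ᵥ c := by
    rw [← ht, hUm]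
    have hsub : pos d F S ⊆ range d := filter_subset _ _
    have h2 : ∑ i ∈ pos d F S, t i • w i =
        ∑ i ∈ range d, (if i ∈ pos d F S then t i else 0) • w i := by
      rw [← sum_subset hsub]
      · exact sum_congr rfl fun i hi => by rw [if_pos hi]
      · intro i _ hi
        rw [if_neg hi, zero_smul]
    rw [h2, Finset.sum_range]
  have h3 : c = c' := by
    rw [← sub_eq_zero]
    refine hU0 _ ?_
    rw [mulVec_sub, h1, sub_self]
  rw [h3]
  exact if_neg ha

theorem isSurj_of_restrict {h ft : Fin 3 → Matrix (Fin d) (Fin d) ℂ}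
    {γ : Fin 3 → Matrix (Fin n) (Fin n) ℂ} {φ : Matrix (Fin n) (Fin d) ℂ}
    {s : Matrix (Fin d) (Fin d') ℂ} {l : Matrix (Fin d') (Fin d) ℂ} (hl : l * s = 1)
    {hS : Fin 3 → Matrix (Fin d') (Fin d') ℂ} {ε : Fin 3 → Fin d' → Fin d}
    {m' : Fin 3 → ℕ → ℕ} (hm' : ∀ k (a : Fin d'), m' k a = m k (ε k a))
    (hφ : ∀ k, φ * h k = φ * ft k)
    (hker : ∀ k c, (φ * ft k) *ᵥ c = 0 → ∀ a, a ∉ Set.range (ε k) → c a = 0)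
    (hcol : ∀ k i a, h k i (ε k a) = (s * hS k) i a)
    (hsurj : IsSurj m' hS γ)
    (hZ : ∀ Z, ∃ ψ, maskMap m h γ ψ = maskMap m h Z φ) : IsSurj m h γ := by
  classical
  intro Y
  obtain ⟨φ', hφ'⟩ := hsurj fun k => (Y k).submatrix id (ε k)
  have h1 : ∀ k (b : Fin n) (a : Fin d'), m k (ε k a) ≤ b →
      (γ k * (φ' * l) * h k) b (ε k a) = Y k b (ε k a) := by
    intro k b a hb
    have h2 : (γ k * (φ' * l) * h k) b (ε k a) = (γ k * (φ' * l) * (s * hS k)) b a := by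
      rw [mul_apply, mul_apply]
      exact sum_congr rfl fun i _ => by rw [hcol]
    have h3 : γ k * (φ' * l) * (s * hS k) = γ k * φ' * hS k := by
      calc γ k * (φ' * l) * (s * hS k) = γ k * φ' * (l * s) * hS k := by
            simp only [Matrix.mul_assoc]
        _ = _ := by rw [hl, Matrix.mul_one]
    rw [h2, h3, hφ' k b a (by rw [hm']; exact hb)]
    rfl
  let R : Fin 3 → Matrix (Fin n) (Fin d) ℂ := fun k b a =>
    if a ∈ Set.range (ε k) then 0 else Y k b a - (γ k * (φ' * l) * h k) b a
  have hR : ∀ k, ∃ Z : Matrix (Fin n) (Fin n) ℂ, Z * (φ * ft k) = R k := fun k => by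
    refine exists_mul_eq fun c hc => ?_
    funext b
    rw [mulVec, dotProduct]
    refine sum_eq_zero fun a _ => ?_
    by_cases ha : a ∈ Set.range (ε k)
    · simp only [R, if_pos ha, zero_mul]
    · rw [hker k c hc a ha, mul_zero]
  choose Z hZR using hR
  obtain ⟨ψ, hψ⟩ := hZ Z
  refine ⟨φ' * l + ψ, fun (k : Fin 3) (b : Fin n) (a : Fin d) hb => ?_⟩
  have h4 : (γ k * ψ * h k) b a = R k b a := by
    have h5 : mask (m k) (γ k * ψ * h k) b a = mask (m k) (Z k * φ * h k) b a :=
      congrFun (congrFun (congrFun hψ k) b) a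
    rwa [mask, mask, if_pos hb, if_pos hb, Matrix.mul_assoc (Z k), hφ, hZR] at h5
  rw [Matrix.mul_add, Matrix.add_mul, Matrix.add_apply, h4]
  by_cases ha : a ∈ Set.range (ε k)
  · simp only [R, if_pos ha, add_zero]
    obtain ⟨a', rfl⟩ := ha
    exact h1 k b a' hb
  · simp only [R, if_neg ha]
    ring

end Induct
end SingHorn

namespace SingHorn

open scoped ComplexOrder
open Module Finset

section Induct

variable {n : ℕ}

theorem exists_coordinates {d d' : ℕ} (S : Submodule ℂ (Fin d → ℂ)) (h : finrank ℂ S = d') :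
    ∃ (s : Matrix (Fin d) (Fin d') ℂ) (l : Matrix (Fin d') (Fin d) ℂ), l * s = 1 ∧
      LinearMap.range s.mulVecLin = S ∧ ∀ v ∈ S, s *ᵥ (l *ᵥ v) = v := by
  let e : (Fin d' → ℂ) ≃ₗ[ℂ] S := LinearEquiv.ofFinrankEq _ _ (by rw [h, finrank_fin_fun])
  obtain ⟨P, hP⟩ := S.subtype.exists_leftInverse_of_injective (Submodule.ker_subtype _)
  let s := LinearMap.toMatrix' (S.subtype ∘ₗ e.toLinearMap)
  let l := LinearMap.toMatrix' (e.symm.toLinearMap ∘ₗ P)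
  have hs : ∀ v, s *ᵥ v = (e v : Fin d → ℂ) := fun v => by
    rw [← Matrix.toLin'_apply, Matrix.toLin'_toMatrix']; rfl
  have hl : ∀ v, l *ᵥ v = e.symm (P v) := fun v => by
    rw [← Matrix.toLin'_apply, Matrix.toLin'_toMatrix']; rfl
  have hPv : ∀ v : S, P v = v := fun v => congrArg (fun g => g v) hP
  refine ⟨s, l, ?_, ?_, fun v hv => ?_⟩
  · refine Matrix.ext_of_mulVec_single fun i => ?_
    rw [← mulVec_mulVec, hs, hl, hPv, LinearEquiv.symm_apply_apply, one_mulVec]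
  · ext v
    constructor
    · rintro ⟨c, rfl⟩
      rw [mulVecLin_apply, hs]
      exact (e c).2
    · intro hv
      refine ⟨e.symm ⟨v, hv⟩, ?_⟩
      rw [mulVecLin_apply, hs, LinearEquiv.apply_symm_apply]
  · rw [hs, hl, hPv ⟨v, hv⟩, LinearEquiv.apply_symm_apply]

theorem exists_isSurj_of_isGood {r : ℕ} {γ : Fin 3 → Matrix (Fin n) (Fin n) ℂ}
    (hγ : IsGeneric r γ) {d : ℕ} (hd : d ≤ r) {m : Fin 3 → ℕ → ℕ}
    (hm : ∀ k, Monotone (m k)) (hmn : ∀ k, ∀ a < d, m k a ≤ n)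
    {f : Fin 3 → Matrix (Fin d) (Fin d) ℂ} (hf : ∀ k, IsUnit (f k)) (hg : IsGood n d m f) :
    ∃ h : Fin 3 → Matrix (Fin d) (Fin d) ℂ, IsSurj m h γ := by
  classical
  induction d using Nat.strong_induction_on generalizing m with
  | _ d ih =>
  obtain ⟨fm, hfm⟩ := hγ d hd m hmn
  have hmax : ∃ f : Fin 3 → Matrix (Fin d) (Fin d) ℂ, (∀ k, IsUnit (f k)) ∧ IsGood n d m f ∧
      ∀ f' γ', maskRank (n := n) (d := d) m f' γ' ≤ maskRank m f γ := by
    obtain ⟨t, ht, hu, hg'⟩ := hg.exists_line hm hf (fm - f)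
      ((finite_finrank_range_lt (maskMap m fm γ) (maskMap m (f - fm) γ)).image fun t => 1 - t)
    refine ⟨f + t • (fm - f), hu, hg', fun f' γ' => (hfm f' γ').trans ?_⟩
    by_contra hlt
    refine ht ⟨1 - t, ?_, by simp⟩
    rw [Set.mem_ofPred_eq, ← maskMap_add_smul_left,
      show fm + (1 - t) • (f - fm) = f + t • (fm - f) by module]
    exact not_le.1 hlt
  clear hf hg f
  obtain ⟨f, hf, hg, hmx⟩ := hmax
  by_cases hker : ∀ φ, maskMap m f γ φ = 0 → φ = 0
  · exact ⟨f, hg.isSurj hf hmn hker⟩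
  push Not at hker
  obtain ⟨φ, hφ0, hφ⟩ := hker
  set S := LinearMap.ker φ.mulVecLin with hSdef
  set d' := finrank ℂ S with hd'
  have hlt : d' < d := by
    have h1 : finrank ℂ S < finrank ℂ (Fin d → ℂ) := by
      refine Submodule.finrank_lt (fun h => hφ ?_)
      refine Matrix.ext_of_mulVec_single fun i => ?_
      have : Pi.single i 1 ∈ S := h ▸ Submodule.mem_top
      rw [zero_mulVec]
      exact this
    rwa [finrank_fin_fun] at h1
  have hF := fun k => isFlag_colFlag (hf k)
  choose e he hJ _ using fun k => exists_enum ((hF k).card_pos (W := S))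
  obtain ⟨s, l, hl, hsr, hsl⟩ := exists_coordinates S hd'.symm
  have hsi : Function.Injective s.mulVecLin := fun u v huv => by
    have := congrArg (l *ᵥ ·) huv
    simpa [mulVec_mulVec, hl] using this
  choose ft hftu hftF hftm hftS hftc using fun k => exists_adapted_matrix (hF k) S
  have hed : ∀ k, ∀ a < d', e k a < d := fun k a ha => by
    have : e k a ∈ pos d (colFlag (f k)) S := by
      rw [hJ k]; exact mem_image_of_mem _ (mem_range.2 ha)
    exact ((hF k).mem_pos.1 this).1
  let ε : Fin 3 → Fin d' → Fin d := fun k a => ⟨e k a, hed k a a.2⟩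
  have hε : ∀ k (a : Fin d), (a : ℕ) ∈ pos d (colFlag (f k)) S ↔ a ∈ Set.range (ε k) := by
    intro k a
    rw [hJ k, mem_image]
    constructor
    · rintro ⟨b, hb, hab⟩
      exact ⟨⟨b, mem_range.1 hb⟩, Fin.ext hab⟩
    · rintro ⟨b, rfl⟩
      exact ⟨b, mem_range.2 b.2, rfl⟩
  have hεi : ∀ k, Function.Injective (ε k) := fun k a b hab =>
    Fin.ext ((he k).injective (congrArg Fin.val hab))
  let fS : Fin 3 → Matrix (Fin d') (Fin d') ℂ := fun k => l * (ft k).submatrix id (ε k)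
  have hfS : ∀ k, s * fS k = (ft k).submatrix id (ε k) := by
    intro k
    refine Matrix.ext_of_mulVec_single fun a => ?_
    have h1 : (ft k).submatrix id (ε k) *ᵥ Pi.single a 1 = (ft k)ᵀ (ε k a) := by
      rw [mulVec_single_one]; rfl
    rw [← mulVec_mulVec, ← mulVec_mulVec, h1]
    exact hsl _ (hftS k _ ((hε k _).2 ⟨a, rfl⟩))
  have hfSu : ∀ k, IsUnit (fS k) := by
    intro k
    refine isUnit_of_mulVec fun v hv => ?_
    have h1 : (ft k).submatrix id (ε k) *ᵥ v = 0 := by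
      rw [← hfS, ← mulVec_mulVec, hv, mulVec_zero]
    have h2 : ft k *ᵥ (fun a => ∑ b, if ε k b = a then v b else 0) = 0 := by
      rw [← h1]
      funext i
      simp only [mulVec, dotProduct, mul_sum, submatrix_apply, id]
      rw [sum_comm]
      refine sum_congr rfl fun b _ => ?_
      simp
    have h3 := Matrix.mulVec_injective_of_isUnit (hftu k) (h2.trans (mulVec_zero _).symm)
    funext b
    have h4 := congrFun h3 (ε k b)
    simpa [(hεi k).eq_iff] using h4
  have hfSF : ∀ k, ∀ i ≤ d', colFlag (fS k) i = restrictFlag s.mulVecLin (colFlag (f k)) (e k) i := by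
    intro k i hi
    refine colFlag_eq_of_mem (isFlag_restrictFlag (hF k) (he k) (hJ k) hsi hsr) (hfSu k)
      (fun a => ?_) hi
    have h1 : s *ᵥ (fS k)ᵀ a = (ft k)ᵀ (ε k a) := by
      have := congrArg (fun M => Mᵀ a) (hfS k)
      exact this
    change s *ᵥ (fS k)ᵀ a ∈ colFlag (f k) (e k a + 1)
    rw [h1]
    exact hftm k (ε k a)
  have hgS : IsGood n d' (fun k a => m k (e k a)) fS := by
    intro W
    rw [← finrank_map_of_injective hsi W]
    refine le_trans (le_of_eq ?_) (hg (W.map s.mulVecLin))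
    refine sum_congr rfl fun k _ => ?_
    rw [wsum_congr_flag (hfSF k)]
    exact wsum_restrictFlag (hF k) (he k) (hJ k) hsi hsr (fun i => (n : ℝ) - m k i) W
  obtain ⟨f', hf'⟩ := @ih d' hlt (by omega) (fun k a => m k (e k a))
    (fun k => (hm k).comp (he k).monotone) (fun k a ha => hmn k _ (hed k a ha)) fS hfSu hgS
  let g : Fin 3 → Matrix (Fin d) (Fin d) ℂ := fun k =>
    s * (f' k - fS k) * (1 : Matrix (Fin d) (Fin d) ℂ).submatrix (ε k) id
  have hgφ : ∀ k, φ * g k = 0 := by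
    intro k
    have h1 : φ * s = 0 := by
      refine Matrix.ext_of_mulVec_single fun a => ?_
      rw [← mulVec_mulVec, zero_mulVec]
      have h2 : s *ᵥ Pi.single a 1 ∈ S := by rw [← hsr]; exact ⟨_, rfl⟩
      exact h2
    simp only [g]
    rw [← Matrix.mul_assoc, ← Matrix.mul_assoc, h1, Matrix.zero_mul, Matrix.zero_mul]
  have hgc : ∀ k i a, g k i (ε k a) = (s * (f' k - fS k)) i a := by
    intro k i a
    simp only [g]
    rw [mul_apply, sum_eq_single a]
    · rw [submatrix_apply, id, one_apply_eq, mul_one]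
    · intro b _ hb
      rw [submatrix_apply, id, one_apply_ne fun h => hb (hεi k h), mul_zero]
    · simp
  have hfin := ((finite_finrank_range_lt (maskMap m ft γ) (maskMap m g γ))).union
    ((hf'.finite (fS - f')).image fun t => 1 - t)
  obtain ⟨t, ht⟩ := hfin.exists_notMem
  simp only [Set.mem_union, not_or] at ht
  have hrk : ∀ f' γ', maskRank (n := n) (d := d) m f' γ' ≤ maskRank m (ft + t • g) γ := by
    intro f'' γ'
    refine (hmx f'' γ').trans ?_
    rw [← maskRank_congr_flag hm hftF]
    have := ht.1
    rw [Set.mem_ofPred_eq, not_lt, ← maskMap_add_smul_left] at this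
    exact this
  have hsurj : IsSurj (fun k a => m k (e k a)) (fS + t • (f' - fS)) γ := by
    by_contra hns
    refine ht.2 ⟨1 - t, ?_, by simp⟩
    rw [Set.mem_ofPred_eq, show f' + (1 - t) • (fS - f') = fS + t • (f' - fS) by module]
    exact hns
  have hφh : ∀ k, φ * (ft + t • g) k = φ * ft k := fun k => by
    rw [Pi.add_apply, Pi.smul_apply, Matrix.mul_add, Matrix.mul_smul, hgφ, smul_zero, add_zero]
  refine ⟨ft + t • g, isSurj_of_restrict hl (ε := ε) (fun k a => rfl) hφh (fun k c hc a ha => ?_)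
    (fun k i a => ?_) hsurj fun Z => ?_⟩
  · refine hftc k c ?_ a fun h => ha ((hε k a).1 h)
    rw [← mulVec_mulVec] at hc
    exact hc
  · have h1 : (ft k) i (ε k a) = (s * fS k) i a := by rw [hfS]; rfl
    rw [Pi.add_apply, Pi.smul_apply, Matrix.add_apply, Matrix.smul_apply, hgc, h1, Pi.add_apply,
      Pi.smul_apply, Matrix.mul_add, Matrix.mul_smul]
    rfl
  · have hφ1 : maskMap m (ft + t • g) γ φ = 0 := by
      have h1 : maskMap m ft γ φ = 0 := by
        rw [maskMap_eq_zero_iff hm] at hφ0 ⊢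
        intro k a
        rw [hftF k (a + 1) (by omega)]
        exact hφ0 k a
      rw [← h1]
      funext k
      change mask _ _ = mask _ _
      rw [Matrix.mul_assoc, hφh, ← Matrix.mul_assoc]
    refine mem_range_of_pencil (A := maskMap m (ft + t • g) γ) (B := maskMap m (ft + t • g) Z)
      (fun u => ?_) hφ1
    rw [← maskMap_add_smul_right]
    exact hrk _ _

end Induct
end SingHorn

namespace SingHorn

open scoped ComplexOrder
open Module Finset Filter Topology

section Dominant
variable {σ τ : Type} [Finite σ] [Fintype τ] {P : τ → MvPolynomial σ ℂ}

open MvPolynomial in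
/-- By Chevalley's theorem and the Nullstellensatz, a dominant polynomial map hits every point
outside some hypersurface. -/
theorem exists_ne_zero_forall_mem_range (h : Function.Injective (aeval (R := ℂ) P)) :
    ∃ a : MvPolynomial τ ℂ, a ≠ 0 ∧ ∀ x, eval x a ≠ 0 → ∃ y, (fun t => eval y (P t)) = x := by
  set φ : MvPolynomial τ ℂ →+* MvPolynomial σ ℂ := (aeval P).toRingHom with hφ
  have hfp : φ.FinitePresentation := by
    refine RingHom.FinitePresentation.of_finiteType.1 ?_
    refine RingHom.FiniteType.of_comp_finiteType (f := C) ?_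
    have : φ.comp C = algebraMap ℂ (MvPolynomial σ ℂ) := by
      ext1 c; simp [hφ, MvPolynomial.algebraMap_eq]
    rw [this]
    exact RingHom.finiteType_algebraMap.2 inferInstance
  obtain ⟨D, hD⟩ := PrimeSpectrum.exists_constructibleSetData_iff.2
    (PrimeSpectrum.isConstructible_range_comap hfp)
  have h0 : PrimeSpectrum.comap φ ⊥ ∈ D.toSet := hD ▸ ⟨⊥, rfl⟩
  obtain ⟨c, hc, h0⟩ := Set.mem_iUnion₂.1 h0
  have hbot (p : MvPolynomial τ ℂ) : p ∈ (PrimeSpectrum.comap φ ⊥).asIdeal ↔ p = 0 := by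
    rw [PrimeSpectrum.comap_asIdeal, Ideal.mem_comap]
    exact (map_eq_zero_iff φ h)
  have hg (i) : c.g i = 0 := (hbot _).1 (h0.1 ⟨i, rfl⟩)
  refine ⟨c.f, fun hf => h0.2 ?_, fun x hx => ?_⟩
  · rw [PrimeSpectrum.mem_zeroLocus, Set.singleton_subset_iff]
    exact (hbot _).2 hf
  · have hm (p : MvPolynomial τ ℂ) : p ∈ vanishingIdeal ℂ {x} ↔ eval x p = 0 :=
      mem_vanishingIdeal_singleton_iff x p
    have hmem : (⟨vanishingIdeal ℂ {x}, inferInstance⟩ : PrimeSpectrum (MvPolynomial τ ℂ)) ∈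
        D.toSet := by
      refine Set.mem_iUnion₂.2 ⟨c, hc, ?_, fun hf => hx ?_⟩
      · rintro _ ⟨i, rfl⟩
        rw [hg]; exact zero_mem _
      · exact (hm _).1 (hf rfl)
    rw [hD] at hmem
    obtain ⟨Q, hQ⟩ := hmem
    obtain ⟨I, hI, hQI⟩ := Q.asIdeal.exists_le_maximal Q.isPrime.ne_top
    obtain ⟨y, rfl⟩ := eq_vanishingIdeal_singleton_of_isMaximal ℂ hI
    refine ⟨y, funext fun t => ?_⟩
    have h1 : X t - C (x t) ∈ Q.asIdeal.comap φ := by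
      rw [← PrimeSpectrum.comap_asIdeal, hQ]
      exact (hm _).2 (by simp)
    have h2 : eval y (φ (X t - C (x t))) = 0 :=
      (mem_vanishingIdeal_singleton_iff y _).1 (hQI h1)
    simpa [hφ, sub_eq_zero] using h2

open MvPolynomial in
theorem injective_aeval_of_range_mem_nhds {x₀ : τ → ℂ}
    (h : Set.range (fun (y : σ → ℂ) t => eval y (P t)) ∈ 𝓝 x₀) :
    Function.Injective (aeval (R := ℂ) P) := by
  rw [injective_iff_map_eq_zero]
  intro a ha
  obtain ⟨ε, hε, hb⟩ := Metric.nhds_basis_closedBall.mem_iff.1 h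
  refine funext_set (fun t => Metric.closedBall (x₀ t) ε) (fun t => ?_) fun x hx => ?_
  · exact infinite_of_mem_nhds _ (Metric.closedBall_mem_nhds _ hε)
  · rw [← closedBall_pi _ hε.le] at hx
    obtain ⟨y, rfl⟩ := hb hx
    have : eval y (aeval P a) = 0 := by rw [ha, map_zero]
    rw [map_zero, ← this, ← coe_aeval_eq_eval, ← coe_aeval_eq_eval]
    simp only [RingHom.coe_coe, ← AlgHom.comp_apply]
    congr 1
    ext t; simp

open MvPolynomial in
/-- A polynomial map whose differential at some point is onto hits every point outside some
hypersurface. -/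
theorem exists_ne_zero_of_hasDerivAt [Fintype σ] (y₀ : σ → ℂ)
    (h : ∀ z : τ → ℂ, ∃ v : σ → ℂ, ∀ t,
      HasDerivAt (fun s : ℂ => eval (y₀ + s • v) (P t)) (z t) 0) :
    ∃ a : MvPolynomial τ ℂ, a ≠ 0 ∧ ∀ x, eval x a ≠ 0 → ∃ y, (fun t => eval y (P t)) = x := by
  refine exists_ne_zero_forall_mem_range (injective_aeval_of_range_mem_nhds
    (x₀ := fun t => eval y₀ (P t)) ?_)
  set f : (σ → ℂ) → τ → ℂ := fun y t => eval y (P t)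
  have hf : AnalyticAt ℂ f y₀ := AnalyticAt.pi fun t =>
    AnalyticOnNhd.eval_mvPolynomial (P t) y₀ (Set.mem_univ _)
  have hs := hf.hasStrictFDerivAt
  have hsur : (fderiv ℂ f y₀).range = ⊤ := by
    rw [LinearMap.range_eq_top]
    intro z
    obtain ⟨v, hv⟩ := h z
    refine ⟨v, ?_⟩
    have h1 : HasDerivAt (fun s : ℂ => y₀ + s • v) v 0 := by
      simpa using ((hasDerivAt_id (0 : ℂ)).smul_const v).const_add y₀
    have h2 : HasDerivAt (fun s : ℂ => f (y₀ + s • v)) (fderiv ℂ f y₀ v) 0 :=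
      HasFDerivAt.comp_hasDerivAt (0 : ℂ) (l := f) (f := fun s : ℂ => y₀ + s • v)
        (by simpa using hs.hasFDerivAt) h1
    exact h2.unique (hasDerivAt_pi.2 hv)
  rw [show (fun t => eval y₀ (P t)) = f y₀ from rfl, ← hs.map_nhds_eq_of_surj hsur]
  exact range_mem_map

end Dominant
end SingHorn

namespace SingHorn

open scoped ComplexOrder
open Module Finset Filter Topology

section Dense
variable {r n N : ℕ} {ε : Fin 3 → Fin r ⊕ Fin n ≃ Fin N}

theorem exists_masked_solution {m : Fin 3 → ℕ → ℕ} {h : Fin 3 → Matrix (Fin r) (Fin r) ℂ}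
    {γ : Fin 3 → Matrix (Fin n) (Fin n) ℂ} (hγ : ∀ k, IsUnit (γ k)) (hs : IsSurj m h γ)
    (hε : ∀ k (a : Fin r) (b : Fin n), (b : ℕ) < m k a → ε k (.inr b) ≤ ε k (.inl a))
    (Z : Fin 3 → Matrix (Fin r ⊕ Fin n) (Fin r ⊕ Fin n) ℂ) :
    ∃ (w : Matrix (Fin r ⊕ Fin n) (Fin r ⊕ Fin n) ℂ)
      (c b : Fin 3 → Matrix (Fin r ⊕ Fin n) (Fin r ⊕ Fin n) ℂ),
      (∀ k i j, c k (.inr i) (.inl j) = 0) ∧ (∀ k i j, ¬ ε k i ≤ ε k j → b k i j = 0) ∧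
      ∀ k, w * fromBlocks (h k) 0 0 (γ k)⁻¹ + c k + fromBlocks (h k) 0 0 (γ k)⁻¹ * b k = Z k := by
  obtain ⟨φ, hφ⟩ := hs fun k => γ k * (Z k).toBlocks₂₁
  set β : Fin 3 → Matrix (Fin n) (Fin r) ℂ := fun k => γ k * (Z k).toBlocks₂₁ - γ k * φ * h k
  refine ⟨fromBlocks 0 0 φ 0,
    fun k => fromBlocks (Z k).toBlocks₁₁ (Z k).toBlocks₁₂ 0 (Z k).toBlocks₂₂,
    fun k => fromBlocks 0 0 (β k) 0, fun k i j => rfl, ?_, fun k => ?_⟩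
  · rintro k (i | i) (j | j) hij
    · rfl
    · rfl
    · have h1 := hφ k i j (not_lt.1 fun h => hij (hε k j i h))
      exact (Matrix.sub_apply _ _ i j).trans (sub_eq_zero.2 h1.symm)
    · rfl
  · have h1 : φ * h k + (γ k)⁻¹ * β k = (Z k).toBlocks₂₁ := by
      have hu := (isUnit_iff_isUnit_det _).1 (hγ k)
      rw [Matrix.mul_sub, Matrix.mul_assoc (γ k), nonsing_inv_mul_cancel_left _ _ hu,
        nonsing_inv_mul_cancel_left _ _ hu]
      abel
    conv_rhs => rw [← fromBlocks_toBlocks (Z k), ← h1]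
    simp [fromBlocks_multiply, fromBlocks_add]

/-- The matrix read off from the first group of variables. -/
def wPart {R K : Type*} [CommRing K] (y : (R × R) ⊕ (Fin 3 × R × R) ⊕ (Fin 3 × R × R) → K) :
    Matrix R R K :=
  of fun i j => y (.inl (i, j))

/-- The matrices with vanishing lower left block read off from the second group of variables. -/
def cPart {K : Type*} [CommRing K]
    (y : ((Fin r ⊕ Fin n) × (Fin r ⊕ Fin n)) ⊕ (Fin 3 × (Fin r ⊕ Fin n) × (Fin r ⊕ Fin n)) ⊕
      (Fin 3 × (Fin r ⊕ Fin n) × (Fin r ⊕ Fin n)) → K) (k : Fin 3) :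
    Matrix (Fin r ⊕ Fin n) (Fin r ⊕ Fin n) K :=
  of fun i j => if i.isRight ∧ j.isLeft then 0 else y (.inr (.inl (k, i, j)))

/-- The triangular matrices read off from the third group of variables. -/
def bPart (ε : Fin 3 → Fin r ⊕ Fin n ≃ Fin N) {K : Type*} [CommRing K]
    (y : ((Fin r ⊕ Fin n) × (Fin r ⊕ Fin n)) ⊕ (Fin 3 × (Fin r ⊕ Fin n) × (Fin r ⊕ Fin n)) ⊕
      (Fin 3 × (Fin r ⊕ Fin n) × (Fin r ⊕ Fin n)) → K) (k : Fin 3) :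
    Matrix (Fin r ⊕ Fin n) (Fin r ⊕ Fin n) K :=
  of fun i j => if ε k i ≤ ε k j then y (.inr (.inr (k, i, j))) else 0

theorem hasDerivAt_triple_mul {R : Type*} [Fintype R] (w w' c c' b b' : Matrix R R ℂ) (i j : R) :
    HasDerivAt (fun s : ℂ => ((w + s • w') * (c + s • c') * (b + s • b')) i j)
      ((w' * c * b + w * c' * b + w * c * b') i j) 0 := by
  have h : (fun s : ℂ => ((w + s • w') * (c + s • c') * (b + s • b')) i j) = fun s =>
      (w * c * b) i j + (w' * c * b + w * c' * b + w * c * b') i j * s +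
      ((w' * c' * b + w' * c * b' + w * c' * b') i j * s ^ 2 + (w' * c' * b') i j * s ^ 3) := by
    funext s
    simp only [Matrix.add_mul, Matrix.mul_add, Matrix.smul_mul, Matrix.mul_smul,
      Matrix.add_apply, Matrix.smul_apply, smul_eq_mul]
    ring
  rw [h]
  have := (((hasDerivAt_id (0 : ℂ)).const_mul
    ((w' * c * b + w * c' * b + w * c * b') i j)).const_add ((w * c * b) i j)).fun_add
    ((((hasDerivAt_id (0 : ℂ)).pow 2).const_mul ((w' * c' * b + w' * c * b' + w * c' * b') i j)).fun_add
    (((hasDerivAt_id (0 : ℂ)).pow 3).const_mul ((w' * c' * b') i j)))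
  simpa using this

theorem exists_ne_zero_factorization {m : Fin 3 → ℕ → ℕ} {h : Fin 3 → Matrix (Fin r) (Fin r) ℂ}
    {γ : Fin 3 → Matrix (Fin n) (Fin n) ℂ} (hγ : ∀ k, IsUnit (γ k)) (hs : IsSurj m h γ)
    (hε : ∀ k (a : Fin r) (b : Fin n), (b : ℕ) < m k a → ε k (.inr b) ≤ ε k (.inl a)) :
    ∃ A : MvPolynomial (Fin 3 × (Fin r ⊕ Fin n) × (Fin r ⊕ Fin n)) ℂ, A ≠ 0 ∧
      ∀ g : Fin 3 → Matrix (Fin r ⊕ Fin n) (Fin r ⊕ Fin n) ℂ,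
        MvPolynomial.eval (fun t => g t.1 t.2.1 t.2.2) A ≠ 0 →
        ∃ (w : Matrix (Fin r ⊕ Fin n) (Fin r ⊕ Fin n) ℂ)
          (c b : Fin 3 → Matrix (Fin r ⊕ Fin n) (Fin r ⊕ Fin n) ℂ),
          (∀ k i j, c k (.inr i) (.inl j) = 0) ∧ (∀ k i j, ¬ ε k i ≤ ε k j → b k i j = 0) ∧
          ∀ k, g k = w * c k * b k := by
  set Q : Fin 3 → Matrix (Fin r ⊕ Fin n) (Fin r ⊕ Fin n) (MvPolynomial _ ℂ) := fun k =>
    wPart MvPolynomial.X * cPart MvPolynomial.X k * bPart ε MvPolynomial.X k with hQ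
  set P : Fin 3 × (Fin r ⊕ Fin n) × (Fin r ⊕ Fin n) → MvPolynomial _ ℂ :=
    fun t => Q t.1 t.2.1 t.2.2 with hP
  have hev (y) (t) : MvPolynomial.eval y (P t) =
      (wPart y * cPart y t.1 * bPart ε y t.1) t.2.1 t.2.2 := by
    have h1 : (Q t.1).map (MvPolynomial.eval y) = wPart y * cPart y t.1 * bPart ε y t.1 := by
      rw [hQ, Matrix.map_mul, Matrix.map_mul]
      congr 1
      · congr 1
        · ext i j; simp [wPart]
        · ext i j
          simp only [cPart, map_apply, of_apply]
          split_ifs <;> simp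
      · ext i j
        simp only [bPart, map_apply, of_apply]
        split_ifs <;> simp
    rw [← h1]; rfl
  have hread (w : Matrix (Fin r ⊕ Fin n) (Fin r ⊕ Fin n) ℂ)
      (c b : Fin 3 → Matrix (Fin r ⊕ Fin n) (Fin r ⊕ Fin n) ℂ)
      (hc : ∀ k i j, c k (.inr i) (.inl j) = 0) (hb : ∀ k i j, ¬ ε k i ≤ ε k j → b k i j = 0) :
      ∃ y, wPart y = w ∧ cPart y = c ∧ bPart ε y = b := by
    refine ⟨Sum.elim (fun t => w t.1 t.2) (Sum.elim (fun t => c t.1 t.2.1 t.2.2)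
      fun t => b t.1 t.2.1 t.2.2), rfl, ?_, ?_⟩
    · funext k; ext i j
      rcases i with i | i <;> rcases j with j | j <;> simp [cPart, hc]
    · funext k; ext i j
      by_cases h : ε k i ≤ ε k j
      · simp [bPart, h]
      · simp [bPart, h, hb k i j h]
  obtain ⟨y₀, hw₀, hc₀, hb₀⟩ := hread 1 (fun k => fromBlocks (h k) 0 0 (γ k)⁻¹) 1
    (fun k i j => rfl) (fun k i j hij => one_apply_ne fun h => hij (h ▸ le_rfl))
  obtain ⟨A, hA, hA'⟩ := exists_ne_zero_of_hasDerivAt (P := P) y₀ fun z => by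
    obtain ⟨w, c, b, hc, hb, hZ⟩ := exists_masked_solution hγ hs hε fun k => of fun i j => z (k, i, j)
    obtain ⟨v, rfl, rfl, rfl⟩ := hread w c b hc hb
    refine ⟨v, fun t => ?_⟩
    have h1 := hasDerivAt_triple_mul (wPart y₀) (wPart v) (cPart y₀ t.1) (cPart v t.1)
      (bPart ε y₀ t.1) (bPart ε v t.1) t.2.1 t.2.2
    have h2 := congrFun (congrFun (hZ t.1) t.2.1) t.2.2
    rw [hw₀, hc₀, hb₀] at h1
    simp only [Pi.one_apply, Matrix.one_mul, Matrix.mul_one] at h1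
    refine (h1.congr_deriv h2).congr_of_eventuallyEq (.of_forall fun s => ?_)
    refine (hev (y₀ + s • v) t).trans ?_
    have e1 : wPart (y₀ + s • v) = 1 + s • wPart v := by rw [← hw₀]; rfl
    have e2 : cPart (y₀ + s • v) t.1 = fromBlocks (h t.1) 0 0 (γ t.1)⁻¹ + s • cPart v t.1 := by
      rw [← congrFun hc₀ t.1]; ext i j
      simp only [cPart, of_apply, Matrix.add_apply, Matrix.smul_apply, Pi.add_apply, Pi.smul_apply]
      split_ifs <;> simp
    have e3 : bPart ε (y₀ + s • v) t.1 = 1 + s • bPart ε v t.1 := by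
      rw [← Pi.one_apply (M := fun _ : Fin 3 => Matrix (Fin r ⊕ Fin n) (Fin r ⊕ Fin n) ℂ) t.1,
        ← hb₀]; ext i j
      simp only [bPart, of_apply, Matrix.add_apply, Matrix.smul_apply, Pi.add_apply, Pi.smul_apply]
      split_ifs <;> simp
    rw [e1, e2, e3]
  refine ⟨A, hA, fun g hg => ?_⟩
  obtain ⟨y, hy⟩ := hA' _ hg
  refine ⟨wPart y, cPart y, bPart ε y, fun k i j => ?_, fun k i j hij => ?_, fun k => ?_⟩
  · simp [cPart]
  · simp [bPart, hij]
  · ext i j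
    have := congrFun hy (k, i, j)
    rw [← hev y (k, i, j)]
    exact this.symm

end Dense
end SingHorn

namespace SingHorn

open scoped ComplexOrder
open Module Finset Filter Topology

section Limit
variable {N : ℕ}

theorem exists_subspace_of_line {U g : Fin 3 → Matrix (Fin N) (Fin N) ℂ} (hU : ∀ k, IsUnit (U k))
    {B : Set ℂ} (hB : B.Finite) {r : ℕ} {D : Fin 3 → ℕ → ℕ}
    (h : ∀ t ∉ B, (∀ k, IsUnit (U k + t • g k)) → ∃ W : Submodule ℂ (Fin N → ℂ),
      finrank ℂ W = r ∧ ∀ k, ∀ i ≤ N, D k i ≤ capDim (colFlag (U k + t • g k)) W i) :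
    ∃ V : Submodule ℂ (Fin N → ℂ), finrank ℂ V = r ∧
      ∀ k, ∀ i ≤ N, D k i ≤ capDim (colFlag (U k)) V i := by
  let τ : ℕ → ℂ := fun l => ((l : ℂ) + 1)⁻¹
  have hτi : Function.Injective τ := fun a b h => by
    have := inv_injective h
    exact_mod_cast add_right_cancel this
  have hτ : Tendsto τ atTop (𝓝 0) := by
    have := tendsto_one_div_add_atTop_nhds_zero_nat (𝕜 := ℂ)
    simpa [τ] using this
  have hev : ∀ᶠ l in atTop, τ l ∉ B ∪ ⋃ k, {t : ℂ | ¬ IsUnit (U k + t • g k)} := by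
    have := ((hB.union (Set.finite_iUnion fun k => finite_not_isUnit (hU k) (g k))).preimage
      hτi.injOn).compl_mem_cofinite
    rw [Nat.cofinite_eq_atTop] at this
    exact this
  obtain ⟨L, hL⟩ := eventually_atTop.1 hev
  have hL' (l) := hL (l + L) (by omega)
  simp only [Set.mem_union, Set.mem_iUnion, Set.mem_ofPred_eq, not_or, not_exists, not_not] at hL'
  choose W hr hW using fun l => h _ (hL' l).1 (hL' l).2
  have hlim : Tendsto (fun l => U + τ (l + L) • g) atTop (𝓝 U) := by
    have h1 : Tendsto (fun l => τ (l + L)) atTop (𝓝 0) := (tendsto_add_atTop_iff_nat L).2 hτ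
    have h2 := (tendsto_const_nhds (x := U)).add (h1.smul_const g)
    simpa using h2
  obtain ⟨V, l, hV, hc⟩ := exists_limit_subspace (fun l k => (hL' l).2 k) hU hlim W
  exact ⟨V, hV.trans (hr l), fun k i hi => (hW l k i hi).trans (hc k i hi)⟩

theorem card_le_capDim_mul {w c b : Matrix (Fin N) (Fin N) ℂ} (hu : IsUnit (w * c * b))
    (hb : ∀ i j, ¬ i ≤ j → b i j = 0) {T : Finset ℕ} (hT : T ⊆ range N)
    {L : Submodule ℂ (Fin N → ℂ)} (hc : ∀ j : Fin N, (j : ℕ) ∈ T → cᵀ j ∈ L) {i : ℕ} (hi : i ≤ N) :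
    (T.filter (· < i)).card ≤ capDim (colFlag (w * c * b)) (L.map w.mulVecLin) i := by
  have hub := isUnit_of_mul_isUnit_right hu
  have huw := isUnit_of_mul_isUnit_left (isUnit_of_mul_isUnit_left hu)
  have huc := isUnit_of_mul_isUnit_right (isUnit_of_mul_isUnit_left hu)
  have h1 : colFlag (w * c * b) i = colFlag (w * c) i := by
    rw [colFlag_mul, colFlag_eq_of_mem isFlag_coord hub _ hi]
    · rfl
    · intro a
      rw [mem_coord]
      intro j hj
      exact hb j a fun h => absurd (Fin.le_def.1 h) (by omega)
  have h2 : capDim (colFlag (w * c * b)) (L.map w.mulVecLin) i = capDim (colFlag c) L i := by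
    rw [← capDim_map huw c, capDim, capDim, h1]
  rw [h2, capDim]
  have hmem (j : T.filter (· < i)) : j.1 ∈ T ∧ j.1 < i := mem_filter.1 j.2
  let v : T.filter (· < i) → ↥(L ⊓ colFlag c i) := fun j =>
    ⟨cᵀ ⟨j, mem_range.1 (hT (hmem j).1)⟩, hc _ (hmem j).1,
      Pi.single ⟨j, mem_range.1 (hT (hmem j).1)⟩ 1, fun a ha => Pi.single_eq_of_ne
        (fun h => by have := (hmem j).2; rw [h] at ha; exact absurd ha (not_le.2 this)) _, by
      rw [mulVecLin_apply, mulVec_single_one]; rfl⟩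
  have hv : LinearIndependent ℂ v := by
    refine LinearIndependent.of_comp (Submodule.subtype _) ?_
    refine (Matrix.linearIndependent_cols_iff_isUnit.2 huc).comp
      (fun j : T.filter (· < i) => (⟨j, mem_range.1 (hT (hmem j).1)⟩ : Fin N)) fun a b h => ?_
    exact Subtype.ext (Fin.mk.inj h)
  simpa using hv.fintype_card_le_finrank

end Limit
end SingHorn

namespace SingHorn

open scoped ComplexOrder
open Module Finset

section Horn
variable {r n : ℕ}

theorem inr_le_inl {S : Finset ℕ} (hS : S ⊆ range (r + n)) (hr : S.card = r) :
    ∃ ε : Fin r ⊕ Fin n ≃ Fin (r + n), (∀ j, (ε j : ℕ) ∈ S ↔ j.isLeft) ∧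
      ∀ (a : Fin r) (b : Fin n),
        (b : ℕ) < ((range (r + n) \ S).filter (· < S.orderEmbOfFin hr a)).card →
        ε (.inr b) ≤ ε (.inl a) := by
  classical
  set T : Finset (Fin (r + n)) := univ.filter fun i => (i : ℕ) ∈ S with hTdef
  have hT : T.card = r := by
    refine ((card_map Fin.valEmbedding).symm.trans (congrArg card ?_)).trans hr
    ext i
    simp only [hTdef, mem_map, mem_filter, mem_univ, true_and, Fin.valEmbedding_apply]
    exact ⟨fun ⟨a, h, h'⟩ => h' ▸ h, fun h => ⟨⟨i, mem_range.1 (hS h)⟩, h, rfl⟩⟩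
  have hT' : Tᶜ.card = n := by rw [card_compl, hT]; simp
  have hl (a : Fin r) : ((T.orderEmbOfFin hT a : Fin (r + n)) : ℕ) = S.orderEmbOfFin hr a := by
    refine congrFun (orderEmbOfFin_unique hr (f := fun a => ((T.orderEmbOfFin hT a : Fin _) : ℕ))
      (fun a => (mem_filter.1 (orderEmbOfFin_mem T hT a)).2) fun a b h => ?_) a
    exact (T.orderEmbOfFin hT).strictMono h
  have hm (i : Fin (r + n)) : (i : ℕ) ∈ S ↔ i ∈ T := by simp [hTdef]
  refine ⟨finSumEquivOfFinset hT hT', ?_, fun a b hb => ?_⟩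
  · rintro (a | b)
    · simp [hm]
    · simp only [hm, finSumEquivOfFinset_inr, Sum.isLeft_inr, Bool.false_eq_true, iff_false]
      exact mem_compl.1 (orderEmbOfFin_mem Tᶜ hT' b)
  · rw [finSumEquivOfFinset_inl, finSumEquivOfFinset_inr]
    by_contra hlt
    rw [not_le] at hlt
    refine absurd hb (not_lt.2 ?_)
    have hsub : (range (r + n) \ S).filter (· < S.orderEmbOfFin hr a) ⊆
        (univ.filter (· < b)).image fun b' => ((Tᶜ.orderEmbOfFin hT' b' : Fin _) : ℕ) := by
      intro i hi
      rw [mem_filter, Finset.mem_sdiff, mem_range] at hi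
      have hi' : (⟨i, hi.1.1⟩ : Fin (r + n)) ∈ Set.range (Tᶜ.orderEmbOfFin hT') := by
        rw [range_orderEmbOfFin]
        exact mem_compl.2 fun h => hi.1.2 ((hm _).2 h)
      obtain ⟨b', hb'⟩ := hi'
      refine mem_image.2 ⟨b', mem_filter.2 ⟨mem_univ _, ?_⟩, by rw [hb']⟩
      rw [← (Tᶜ.orderEmbOfFin hT').lt_iff_lt, hb']
      refine lt_trans (Fin.lt_def.2 ?_) hlt
      rw [hl]; exact hi.2
    refine (card_le_card hsub).trans (card_image_le.trans ?_)
    rw [← Fin.card_Iio b]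
    exact card_le_card fun i hi => mem_Iio.2 (mem_filter.1 hi).2

theorem finite_eval_line_eq_zero {τ : Type} {A : MvPolynomial τ ℂ} {u v : τ → ℂ}
    (h : MvPolynomial.eval (u + v) A ≠ 0) :
    {t : ℂ | MvPolynomial.eval (u + t • v) A = 0}.Finite := by
  set P : Polynomial ℂ := MvPolynomial.aeval (fun s => Polynomial.C (u s) + Polynomial.X *
    Polynomial.C (v s)) A
  have hP (t : ℂ) : P.eval t = MvPolynomial.eval (u + t • v) A := by
    have := MvPolynomial.map_aeval (fun s => Polynomial.C (u s) + Polynomial.X *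
      Polynomial.C (v s)) (Polynomial.evalRingHom t) A
    rw [Polynomial.coe_evalRingHom] at this
    rw [this, MvPolynomial.eval, MvPolynomial.coe_eval₂Hom, MvPolynomial.coe_eval₂Hom]
    congr 1
    · ext c; simp
    · funext s; simp only [Polynomial.eval_add, Polynomial.eval_mul,
        Polynomial.eval_C, Polynomial.eval_X, Pi.add_apply, Pi.smul_apply, smul_eq_mul]
  have h0 : P ≠ 0 := fun h0 => h (by simpa [h0] using (hP 1).symm)
  refine (Polynomial.finite_setOfPred_isRoot h0).subset fun t ht => ?_
  exact (hP t).trans ht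

/-- If the partitions attached to three sets form a Horn triple, then any three flags have a
subspace in the corresponding Schubert positions. -/
theorem exists_subspace_of_horn {S : Fin 3 → Finset ℕ} (hS : ∀ k, S k ⊆ range (r + n))
    (hr : ∀ k, (S k).card = r)
    (hH : (lambdaOf (r + n) r ((S 0).image (· + 1)), lambdaOf (r + n) r ((S 1).image (· + 1)),
      fun a => lambdaOf (r + n) r ((S 2).image (· + 1)) a - (n : ℝ)) ∈ Horn r)
    {U : Fin 3 → Matrix (Fin (r + n)) (Fin (r + n)) ℂ} (hU : ∀ k, IsUnit (U k)) :
    ∃ V : Submodule ℂ (Fin (r + n) → ℂ), finrank ℂ V = r ∧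
      ∀ k, ∀ i ≤ r + n, ((S k).filter (· < i)).card ≤ capDim (colFlag (U k)) V i := by
  classical
  choose e he hp hee using fun k => exists_enum (hr k)
  have hcn (k) : (range (r + n) \ S k).card = n := by
    rw [card_sdiff_of_subset (hS k), card_range, hr k]; omega
  set m : Fin 3 → ℕ → ℕ := fun k a => ((range (r + n) \ S k).filter (· < e k a)).card with hm
  have hmono (k) : Monotone (m k) := fun a b hab => card_le_card fun i hi => by
    rw [mem_filter] at hi ⊢
    exact ⟨hi.1, hi.2.trans_le ((he k).monotone hab)⟩
  have hmn (k a) : m k a ≤ n := (card_le_card (filter_subset _ _)).trans (hcn k).le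
  have hlam (k) (a : Fin r) : lambdaOf (r + n) r ((S k).image (· + 1)) a = (n : ℝ) - m k a := by
    rw [lambdaOf_image_succ (hS k) (hr k), eq_sub_iff_add_eq, ← hee k a]
    norm_cast
    have hc := card_filter_add_card_filter_not (s := range (r + n) \ S k) (e k a < ·)
    rw [hcn k] at hc
    refine Eq.trans (congrArg₂ (· + ·) rfl (congrArg card (filter_congr fun i hi => ?_))) hc
    have : i ≠ e k a := fun h => (Finset.mem_sdiff.1 hi).2
      (h ▸ hee k a ▸ orderEmbOfFin_mem (S k) (hr k) a)
    omega
  obtain ⟨f, hf, hg⟩ := exists_isGood (n := n) (d := r) (m := m) hmono (by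
    have h0 := funext (hlam 0)
    have h1 := funext (hlam 1)
    simp only [hlam 2] at hH
    rw [h0, h1] at hH
    exact hH)
  obtain ⟨γ, hγ, hgen⟩ := exists_isGeneric n r
  obtain ⟨h, hs⟩ := exists_isSurj_of_isGood hgen le_rfl hmono (fun k a _ => hmn k a) hf hg
  choose ε hεS hε using fun k => inr_le_inl (hS k) (hr k)
  obtain ⟨A, hA, hfac⟩ := exists_ne_zero_factorization (ε := ε) hγ hs (fun k a b hb => hε k a b (by
    rw [← hee k a]; exact hb))
  obtain ⟨x, hx⟩ : ∃ x, MvPolynomial.eval x A ≠ 0 := by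
    by_contra hcon
    push Not at hcon
    exact hA (MvPolynomial.funext fun x => by rw [hcon x, map_zero])
  set ρ : Fin r ⊕ Fin n ≃ Fin (r + n) := finSumFinEquiv
  set u : Fin 3 × (Fin r ⊕ Fin n) × (Fin r ⊕ Fin n) → ℂ := fun t =>
    (U t.1).submatrix ρ (ε t.1) t.2.1 t.2.2 with hu
  have hfin := finite_eval_line_eq_zero (A := A) (u := u) (v := x - u) (by
    rwa [add_sub_cancel])
  refine exists_subspace_of_line (g := fun k => (of fun i j => (x - u) (k, i, j)).submatrix ρ.symm
    (ε k).symm) hU hfin fun t ht hunit => ?_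
  obtain ⟨w, c, b, hc, hb, hwcb⟩ := hfac (fun k => of fun i j => (u + t • (x - u)) (k, i, j)) ht
  have hG (k) : U k + t • (of fun i j => (x - u) (k, i, j)).submatrix ρ.symm (ε k).symm =
      w.submatrix ρ.symm ρ.symm * (c k).submatrix ρ.symm (ε k).symm *
        (b k).submatrix (ε k).symm (ε k).symm := by
    rw [submatrix_mul_equiv, submatrix_mul_equiv, ← hwcb k]
    ext i j
    simp [hu]
  simp only [hG] at hunit ⊢
  refine ⟨(coord (r + n) r).map (w.submatrix ρ.symm ρ.symm).mulVecLin, ?_, fun k i hi => ?_⟩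
  · rw [finrank_map_of_injective (mulVec_injective_of_isUnit' (isUnit_of_mul_isUnit_left
      (isUnit_of_mul_isUnit_left (hunit 0)))), finrank_coord (by omega)]
  · refine card_le_capDim_mul (hunit k) (fun i j hij => ?_) (hS k) (fun j hj => ?_) hi
    · exact hb k _ _ (by simpa using hij)
    · obtain ⟨j, rfl⟩ := (ε k).surjective j
      obtain ⟨a, rfl⟩ := Sum.isLeft_iff.1 ((hεS k j).1 hj)
      rw [mem_coord]
      intro i hi
      obtain ⟨i, rfl⟩ := ρ.surjective i
      rcases i with i | i
      · exact absurd hi (by simp [ρ])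
      · simp [hc]

end Horn
end SingHorn

namespace SingHorn

open scoped ComplexOrder
open Module Finset

theorem sum_nonpos_of_horn {N r n : ℕ} (hN : N = r + n) {S : Fin 3 → Finset ℕ} (hS : ∀ k, S k ⊆ range (N))
    (hr : ∀ k, (S k).card = r)
    (hH : (lambdaOf (N) r ((S 0).image (· + 1)), lambdaOf (N) r ((S 1).image (· + 1)),
      fun a => lambdaOf (N) r ((S 2).image (· + 1)) a - (n : ℝ)) ∈ Horn r)
    {U : Fin 3 → Matrix (Fin (N)) (Fin (N)) ℂ} (hU : ∀ k, (U k)ᴴ * U k = 1)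
    {w : Fin 3 → ℕ → ℝ} (hw : ∀ k, Antitone (w k)) (hsum : ∑ k, diagConj (U k) (w k) = 0) :
    ∑ k, ∑ i ∈ S k, w k i ≤ 0 := by
  subst hN
  have hu (k) : IsUnit (U k) := IsUnit.of_mul_eq_one _ (mul_eq_one_comm.1 (hU k))
  obtain ⟨V, hV, hc⟩ := exists_subspace_of_horn hS hr hH hu
  refine (sum_le_sum fun k _ => ?_).trans (sum_wsum_nonpos hU hw hsum V)
  have hF := isFlag_colFlag (hu k)
  have hfull : (S k).filter (· < r + n) = S k :=
    filter_true_of_mem fun i hi => mem_range.1 (hS k hi)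
  have hstep (i : ℕ) : (((S k).filter (· < i + 1)).card : ℝ) - ((S k).filter (· < i)).card =
      if i ∈ S k then 1 else 0 := by
    have h1 : (S k).filter (· < i + 1) = (S k).filter (· < i) ∪ (S k).filter (· = i) := by
      ext j; simp only [mem_filter, mem_union]; grind
    rw [h1, card_union_of_disjoint (disjoint_filter.2 fun j _ hj hj' => hj.ne hj'), filter_eq']
    split_ifs <;> simp
  have hle := abel_le (n := r + n) (D := fun i => (((S k).filter (· < i)).card : ℝ))
    (D' := fun i => (capDim (colFlag (U k)) V i : ℝ)) (hw k) (by simp [hF.capDim_zero])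
    (by simp only [hfull, hF.capDim_top, hV, hr k]) fun i hi => by exact_mod_cast hc k i hi
  refine Eq.trans_le ?_ hle
  simp only [hstep, mul_ite, mul_one, mul_zero]
  rw [← sum_filter, filter_mem_eq_inter, inter_eq_right.2 (hS k)]

theorem exists_diagConj_of_singularValues {p q : ℕ} (hpq : q ≤ p) {B : Matrix (Fin p) (Fin q) ℂ}
    {x : Fin q → ℝ} (hx : DecrNonneg x) (hB : singularValues B = x) :
    ∃ U : Matrix (Fin (p + q)) (Fin (p + q)) ℂ, Uᴴ * U = 1 ∧
      reindex finSumFinEquiv finSumFinEquiv (fromBlocks 0 B Bᴴ 0) = diagConj U (xhat p q x) := by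
  have hH : (reindex finSumFinEquiv finSumFinEquiv (fromBlocks 0 B Bᴴ 0) :
      Matrix (Fin (p + q)) (Fin (p + q)) ℂ).IsHermitian := by
    rw [reindex_apply]
    refine IsHermitian.submatrix ?_ _
    simp [IsHermitian, fromBlocks_conjTranspose]
  have he : eigsDesc hH = fun i : Fin (p + q) => xhat p q x i := by
    rw [eigsDesc_eq_iff hH fun i j h => xhat_antitone hx h, charpoly_reindex,
      (singularValues_eq_iff_block hpq B hx).1 hB]
    exact (Fin.prod_univ_eq_prod_range
      (fun i => (Polynomial.X - Polynomial.C (xhat p q x i : ℂ))) (p + q)).symm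
  obtain ⟨U, hU, h⟩ := spectral_desc hH
  refine ⟨U, hU, h.trans ?_⟩
  rw [diagConj, he]

theorem sum_nonpos_of_mem_singularCone {p q r : ℕ} (hpq : q ≤ p) (hrq : r ≤ q)
    {x : Fin 3 → Fin q → ℝ} (hx : ∀ k, DecrNonneg (x k))
    (hmem : (x 0, x 1, x 2) ∈ SingularCone p q) {Xp Xm : Fin 3 → Finset ℕ}
    (hXp : ∀ k, Xp k ⊆ Icc 1 q) (hXm : ∀ k, Xm k ⊆ Icc 1 q)
    (hc : ∀ k, (Xp k).card + (Xm k).card = r)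
    (hH : (lambdaOf (p + q) r (polToSet p q (Xp 0) (Xm 0)),
      lambdaOf (p + q) r (polToSet p q (Xp 1) (Xm 1)),
      fun a => lambdaOf (p + q) r (polToSet p q (Xp 2) (Xm 2)) a - ((p : ℝ) + q - r)) ∈ Horn r) :
    ∑ k, (∑ i ∈ Xp k, valAt (x k) i - ∑ i ∈ Xm k, valAt (x k) i) ≤ 0 := by
  classical
  obtain ⟨A, B, C, hABC, hA, hB, hC⟩ := hmem
  set M : Fin 3 → Matrix (Fin p) (Fin q) ℂ := ![A, B, C] with hM
  have hs (k) : singularValues (M k) = x k := by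
    fin_cases k
    exacts [hA, hB, hC]
  choose U hU hD using fun k => exists_diagConj_of_singularValues hpq (hx k) (hs k)
  have hsum : ∑ k, diagConj (U k) (xhat p q (x k)) = 0 := by
    rw [← sum_congr rfl fun k _ => hD k, Fin.sum_univ_three]
    have h' : Aᴴ + Bᴴ + Cᴴ = 0 := by
      rw [← conjTranspose_add, ← conjTranspose_add, hABC, conjTranspose_zero]
    have h0 : fromBlocks 0 A Aᴴ 0 + fromBlocks 0 B Bᴴ 0 + fromBlocks 0 C Cᴴ 0 = 0 := by
      rw [fromBlocks_add, fromBlocks_add, hABC, h']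
      simp
    exact (congrArg (reindex finSumFinEquiv finSumFinEquiv) h0).trans (by simp)
  have hrange (k) (i) (hi : i ∈ polToSet p q (Xp k) (Xm k)) : 1 ≤ i ∧ i ≤ p + q := by
    rcases mem_union.1 hi with h | h
    · have := mem_Icc.1 (hXp k h); omega
    · obtain ⟨j, hj, rfl⟩ := mem_image.1 h
      have := mem_Icc.1 (hXm k hj); omega
  have hinj (k) : Set.InjOn (· - 1) (polToSet p q (Xp k) (Xm k) : Set ℕ) := fun i hi j hj h => by
    have h1 := hrange k i hi
    have h2 := hrange k j hj
    dsimp only at h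
    omega
  have hcard (k) : (polToSet p q (Xp k) (Xm k)).card = r := by
    rw [polToSet, card_union_of_disjoint, card_image_of_injOn, hc k]
    · intro i hi j hj h
      have h1 := mem_Icc.1 (hXm k hi)
      have h2 := mem_Icc.1 (hXm k hj)
      dsimp only at h
      omega
    · rw [disjoint_left]
      intro i hi hi'
      obtain ⟨j, hj, rfl⟩ := mem_image.1 hi'
      have h1 := mem_Icc.1 (hXp k hi)
      have h2 := mem_Icc.1 (hXm k hj)
      omega
  have hback (k) : ((polToSet p q (Xp k) (Xm k)).image (· - 1)).image (· + 1) =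
      polToSet p q (Xp k) (Xm k) := by
    rw [image_image]
    refine (image_congr fun i hi => ?_).trans image_id
    have := hrange k i hi
    simp only [Function.comp, id]
    omega
  obtain ⟨n, hn⟩ : ∃ n, p + q = r + n := ⟨p + q - r, by omega⟩
  have hn' : (p : ℝ) + q - r = n := by
    have : ((p + q : ℕ) : ℝ) = (r + n : ℕ) := by rw [hn]
    push_cast at this
    linarith
  rw [hn', ← hback 0, ← hback 1, ← hback 2] at hH
  simp only [← sum_xhat_polToSet hpq _ (hXp _) (hXm _)]
  have hS (k) : (polToSet p q (Xp k) (Xm k)).image (· - 1) ⊆ range (p + q) := fun i hi => by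
    obtain ⟨j, hj, rfl⟩ := mem_image.1 hi
    have := hrange k j hj
    rw [mem_range]; omega
  have hcard' (k) : ((polToSet p q (Xp k) (Xm k)).image (· - 1)).card = r := by
    rw [card_image_of_injOn (hinj k), hcard k]
  have hsum' (k) : ∑ i ∈ (polToSet p q (Xp k) (Xm k)).image (· - 1), xhat p q (x k) i =
      ∑ i ∈ polToSet p q (Xp k) (Xm k), xhat p q (x k) (i - 1) := sum_image (hinj k)
  simp only [← hsum']
  exact sum_nonpos_of_horn hn hS hcard' hH hU (fun k => xhat_antitone (hx k)) hsum

end SingHorn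

/-- **Horn-type description of `Singular(p,q)`.**  For `p ≥ q ≥ 1`, an element
`(x,y,z) ∈ (ℝ^q_{++})^3` belongs to `Singular(p,q)` if and only if for every `r ∈ [q]` and
every triple `I_•, J_•, K_•` of polarized subsets of `[q]` of cardinal `r` satisfying
both `(λ(I^p_•), λ(J^p_•), λ(K^p_•) − (p+q−r)·1^r) ∈ Horn(r)` and
`(λ(Ĩ^p_•), λ(J̃^p_•), λ(K̃^p_•) − (p+q−2r)·1^r) ∈ Horn(r)`, the inequality
`|x|_{I_+} + |y|_{J_+} + |z|_{K_+} ≤ |x|_{I_−} + |y|_{J_−} + |z|_{K_−}` holds. -/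
theorem singular_iff_horn_conditions (p q : ℕ) (hq : 1 ≤ q) (hpq : q ≤ p)
    (x y z : Fin q → ℝ) (hx : DecrNonneg x) (hy : DecrNonneg y) (hz : DecrNonneg z) :
    (x, y, z) ∈ SingularCone p q ↔
      ∀ (r : ℕ) (Ip Im Jp Jm Kp Km : Finset ℕ),
        1 ≤ r → r ≤ q →
        Ip ⊆ Finset.Icc 1 q → Im ⊆ Finset.Icc 1 q → Disjoint Ip Im →
          Ip.card + Im.card = r →
        Jp ⊆ Finset.Icc 1 q → Jm ⊆ Finset.Icc 1 q → Disjoint Jp Jm →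
          Jp.card + Jm.card = r →
        Kp ⊆ Finset.Icc 1 q → Km ⊆ Finset.Icc 1 q → Disjoint Kp Km →
          Kp.card + Km.card = r →
        (lambdaOf (p + q) r (polToSet p q Ip Im),
          lambdaOf (p + q) r (polToSet p q Jp Jm),
          fun a => lambdaOf (p + q) r (polToSet p q Kp Km) a - ((p : ℝ) + q - r))
            ∈ Horn r →
        (lambdaOf (p + q - r) r (tildeSet p q r (polToSet p q Ip Im)),
          lambdaOf (p + q - r) r (tildeSet p q r (polToSet p q Jp Jm)),
          fun a => lambdaOf (p + q - r) r (tildeSet p q r (polToSet p q Kp Km)) a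
            - ((p : ℝ) + q - 2 * r)) ∈ Horn r →
        (∑ i ∈ Ip, valAt x i) + (∑ i ∈ Jp, valAt y i) + (∑ i ∈ Kp, valAt z i) ≤
          (∑ i ∈ Im, valAt x i) + (∑ i ∈ Jm, valAt y i) + (∑ i ∈ Km, valAt z i) := by
  constructor
  · intro hmem r Ip Im Jp Jm Kp Km _ hrq hIp hIm _ hIc hJp hJm _ hJc hKp hKm _ hKc hH _
    have h := SingHorn.sum_nonpos_of_mem_singularCone hpq hrq (x := ![x, y, z])
      (Xp := ![Ip, Jp, Kp]) (Xm := ![Im, Jm, Km]) (by simp [Fin.forall_fin_succ, hx, hy, hz]) hmem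
      (by simp [Fin.forall_fin_succ, hIp, hJp, hKp]) (by simp [Fin.forall_fin_succ, hIm, hJm, hKm])
      (by simp [Fin.forall_fin_succ, hIc, hJc, hKc]) hH
    rw [Fin.sum_univ_three] at h
    simp only [Matrix.cons_val] at h
    linarith
  · intro h
    refine SingHorn.mem_singularCone_of_horn_conditions hq hpq (x := ![x, y, z])
      (by simp [Fin.forall_fin_succ, hx, hy, hz]) fun r Xp Xm hr hrq hXp hXm hd hc h1 h2 => ?_
    have := h r (Xp 0) (Xm 0) (Xp 1) (Xm 1) (Xp 2) (Xm 2) hr hrq (hXp 0) (hXm 0) (hd 0) (hc 0)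
      (hXp 1) (hXm 1) (hd 1) (hc 1) (hXp 2) (hXm 2) (hd 2) (hc 2) h1 h2
    rw [Fin.sum_univ_three]
    simp only [Matrix.cons_val]
    linarith
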